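/- Main Theorem (local expansion / eigenvalue bound). There is an absolute constant C > 0 with the following property. Let N, H_0, H ≥ 1 with H_0 ≤ H, H ≥ 3, and log H_0 ≥ (log H)^{1/2} (log log H)^2. Let 𝐏 be a set of primes contained in the interval [H_0, H] such that 𝓛 = ∑_{p ∈ 𝐏} 1/p ≥ e and log H ≤ √((log N)/𝓛). Then for any real K with 1 ≤ K ≤ (log N)/(𝓛 (log H)^2), there is a subset 𝒳 ⊆ 𝐍 with |𝐍 ∖ 𝒳| ≤ C·(N·e^{−K𝓛·log K} + N/√H_0) such that every eigenvalue γ of the operator A|_𝒳 satisfies |γ| ≤ C·√(K𝓛). -/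

import Mathlib

open Finset Classical

/-- connectivity in functional form -/
def FConn {V : Type*} (adj : V → V → Prop) (I : Finset V) : Prop :=
  ∀ Φ : V → ℚ, (∀ x ∈ I, ∀ y ∈ I, adj x y → Φ x = Φ y) → ∀ x ∈ I, ∀ y ∈ I, Φ x = Φ y

noncomputable def gdeg {V : Type*} [Fintype V] (adj : V → V → Prop) (v : V) : ℕ :=
  (univ.filter (fun y => adj v y)).card

/-- explored set -/
noncomputable def gN {V : Type*} [Fintype V] (adj : V → V → Prop) (I : Finset V) : Finset V :=
  univ.filter (fun y => y ∉ I ∧ ∃ x ∈ I, adj x y)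

lemma FConn_insert {V : Type*} (adj : V → V → Prop)
    (I : Finset V) (hI : FConn adj I) (v : V) (x : V) (hx : x ∈ I) (hxv : adj x v) :
    FConn adj (insert v I) := by
  intro Φ hΦ
  have h1 := hI Φ (fun a ha b hb => hΦ a (mem_insert_of_mem ha) b (mem_insert_of_mem hb))
  have h2 : Φ x = Φ v := hΦ x (mem_insert_of_mem hx) v (mem_insert_self _ _) hxv
  have h3 : ∀ y ∈ insert v I, Φ y = Φ x := by
    intro y hy
    rcases mem_insert.1 hy with rfl | hy
    · exact h2.symm
    · exact h1 y hy x hx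
  intro a ha b hb
  rw [h3 a ha, h3 b hb]

lemma FConn_union {V : Type*} (adj : V → V → Prop)
    (I : Finset V) (hI : FConn adj I) (S : Finset V) (hS : ∀ v ∈ S, ∃ x ∈ I, adj x v) :
    FConn adj (I ∪ S) := by
  induction S using Finset.induction_on with
  | empty => simpa using hI
  | insert a s ha ih =>
    have := ih (fun v hv => hS v (mem_insert_of_mem hv))
    obtain ⟨x, hx, hxa⟩ := hS a (mem_insert_self _ _)
    rw [union_insert]
    exact FConn_insert adj _ this a x (mem_union_left _ hx) hxa

theorem greedy {V : Type*} [Fintype V] (adj : V → V → Prop) (hs : ∀ x y, adj x y → adj y x)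
    (hir : ∀ x, ¬ adj x x)
    (hc : FConn adj (univ : Finset V)) :
    ∀ k : ℕ, ∀ I : Finset V, I.Nonempty → FConn adj I →
      (univ \ (I ∪ gN adj I)).card ≤ k →
      ((I ∪ gN adj I).filter (fun v => 3 ≤ gdeg adj v)).card ≤ 3 * (gN adj I).card +
        ((gN adj I).filter (fun v => ∀ y, adj v y → y ∈ I ∪ gN adj I)).card + 1 →
      ∃ I' : Finset V, FConn adj I' ∧ I' ∪ gN adj I' = univ ∧
        (univ.filter (fun v => 3 ≤ gdeg adj v)).card ≤ 4 * (gN adj I').card + 1 := by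
  intro k
  induction k using Nat.strong_induction_on with
  | _ k ih =>
  intro I hne hI hk hinv
  set E := I ∪ gN adj I with hE
  by_cases hEu : E = univ
  · refine ⟨I, hI, hEu, ?_⟩
    rw [hEu] at hinv
    have := card_filter_le (gN adj I) (fun v => ∀ y, adj v y → y ∈ (univ : Finset V))
    omega
  -- helper facts
  have hIE : ∀ x ∈ I, ∀ y, adj x y → y ∈ E := by
    intro x hx y hxy
    by_cases hy : y ∈ I
    · exact mem_union_left _ hy
    · exact mem_union_right _ (by simp [gN, hy]; exact ⟨x, hx, hxy⟩)
  -- generic step: add v ∈ ∂, with unexplored neighbours Y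
  have hgN : ∀ v ∈ gN adj I, v ∉ I ∧ ∃ x ∈ I, adj x v := by
    intro v hv; simpa [gN] using hv
  -- unexplored nbrs
  let Y : V → Finset V := fun v => univ.filter (fun y => adj v y ∧ y ∉ E)
  have stepE : ∀ v ∈ gN adj I, gN adj (insert v I) = ((gN adj I).erase v) ∪ Y v := by
    intro v hv
    ext y
    simp only [gN, mem_filter, mem_univ, true_and, mem_insert, not_or, mem_union, mem_erase, Y]
    constructor
    · rintro ⟨⟨hyv, hyI⟩, x, hx | hx, hxy⟩
      · subst hx
        by_cases hyE : y ∈ E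
        · left
          refine ⟨hyv, hyI, ?_⟩
          have : y ∈ gN adj I := by
            rcases mem_union.1 hyE with h | h
            · exact absurd h hyI
            · exact h
          exact (hgN y this).2
        · right; exact ⟨hxy, hyE⟩
      · left; exact ⟨hyv, hyI, x, hx, hxy⟩
    · rintro (⟨h1, h2, x, hx, hxy⟩ | ⟨h1, h2⟩)
      · exact ⟨⟨h1, h2⟩, x, Or.inr hx, hxy⟩
      · refine ⟨⟨?_, ?_⟩, v, Or.inl rfl, h1⟩
        · rintro rfl; exact h2 (mem_union_right _ hv)
        · intro h; exact h2 (mem_union_left _ h)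
  have stepU : ∀ v ∈ gN adj I, insert v I ∪ gN adj (insert v I) = E ∪ Y v := by
    intro v hv
    rw [stepE v hv]
    ext y
    simp only [mem_union, mem_insert, mem_erase, hE]
    by_cases hyv : y = v
    · subst hyv; simp [hv]
    · simp [hyv]; tauto
  have hYd : ∀ v, Disjoint E (Y v) := by
    intro v
    rw [Finset.disjoint_left]
    intro a ha ha'
    simp only [Y, mem_filter] at ha'
    exact ha'.2.2 ha
  have stepC : ∀ v ∈ gN adj I, (gN adj (insert v I)).card + 1 = (gN adj I).card + (Y v).card := by
    intro v hv
    rw [stepE v hv, card_union_of_disjoint, card_erase_of_mem hv]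
    · have : 0 < (gN adj I).card := card_pos.2 ⟨v, hv⟩
      omega
    · exact Disjoint.mono_left (fun a ha => mem_union_right _ (mem_of_mem_erase ha)) (hYd v)
  have bd : ∀ (A B : Finset V), ((A ∪ B).filter (fun v => 3 ≤ gdeg adj v)).card ≤
      (A.filter (fun v => 3 ≤ gdeg adj v)).card + B.card := by
    intro A B
    rw [filter_union]
    exact (card_union_le _ _).trans (Nat.add_le_add_left (card_filter_le _ _) _)
  have kdec : ∀ v, 0 < (Y v).card → (univ \ (E ∪ Y v)).card < k := by
    intro v hv
    refine lt_of_lt_of_le (card_lt_card ?_) hk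
    obtain ⟨y, hy⟩ := card_pos.1 hv
    refine ⟨?_, ?_⟩
    · intro a; simp only [mem_sdiff, mem_univ, true_and, mem_union, not_or]; tauto
    · intro h
      have hyE : y ∉ E := by simp only [Y, mem_filter] at hy; exact hy.2.2
      have := h (show y ∈ univ \ E by simp [hyE])
      simp [hy] at this
  -- dead leaves
  set dead := (gN adj I).filter (fun v => ∀ y, adj v y → y ∈ E) with hdead
  by_cases c1 : ∃ v ∈ gN adj I, 2 ≤ (Y v).card
  · obtain ⟨v, hv, hv2⟩ := c1
    have hvc := stepC v hv
    refine ih _ (kdec v (by omega)) (insert v I) ⟨v, mem_insert_self _ _⟩ ?_ ?_ ?_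
    · obtain ⟨_, x, hx, hxv⟩ := hgN v hv
      exact FConn_insert adj I hI v x hx hxv
    · rw [stepU v hv]
    · rw [stepU v hv]
      have h1 := bd E (Y v)
      have h2 : dead.card ≤ ((gN adj (insert v I)).filter
          (fun w => ∀ y, adj w y → y ∈ E ∪ Y v)).card := by
        apply card_le_card
        intro w hw
        simp only [hdead, mem_filter] at hw
        simp only [mem_filter]
        refine ⟨?_, fun y hy => mem_union_left _ (hw.2 y hy)⟩
        rw [stepE v hv]
        refine mem_union_left _ (mem_erase.2 ⟨?_, hw.1⟩)
        rintro rfl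
        obtain ⟨y, hy⟩ := card_pos.1 (show 0 < (Y w).card by omega)
        simp only [Y, mem_filter] at hy
        exact hy.2.2 (hw.2 y hy.2.1)
      omega
  push Not at c1
  -- some leaf with an unexplored nbr
  have c2 : ∃ v ∈ gN adj I, (Y v).card = 1 := by
    by_contra hcon
    push Not at hcon
    have hY0 : ∀ v ∈ gN adj I, Y v = ∅ := by
      intro v hv
      have h1 := c1 v hv; have h2 := hcon v hv
      rw [← card_eq_zero]; omega
    apply hEu
    have := hc (fun x => if x ∈ E then 1 else 0) ?_
    · obtain ⟨x0, hx0⟩ := hne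
      ext y
      simp only [mem_univ, iff_true]
      by_contra hy
      have h := this x0 (mem_univ _) y (mem_univ _)
      have : x0 ∈ E := mem_union_left _ hx0
      simp [this, hy] at h
    · have key : ∀ x y, adj x y → x ∈ E → y ∈ E := by
        intro x y hxy hx
        rcases mem_union.1 hx with h | h
        · exact hIE x h y hxy
        · by_contra hy
          have : y ∈ Y x := by simp only [Y, mem_filter]; exact ⟨mem_univ _, hxy, hy⟩
          rw [hY0 x h] at this; simp at this
      intro x _ y _ hxy
      have : x ∈ E ↔ y ∈ E := ⟨key x y hxy, key y x (hs x y hxy)⟩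
      simp [this]
  obtain ⟨v, hv, hv1⟩ := c2
  obtain ⟨y, hy⟩ := card_eq_one.1 hv1
  have hyY : y ∈ Y v := by rw [hy]; simp
  have hyp : adj v y ∧ y ∉ E := by simpa [Y] using hyY
  have hvc := stepC v hv
  set I1 := insert v I with hI1
  have hU1 : I1 ∪ gN adj I1 = E ∪ {y} := by rw [stepU v hv, hy]
  have hI1c : FConn adj I1 := by
    obtain ⟨_, x, hx, hxv⟩ := hgN v hv
    exact FConn_insert adj I hI v x hx hxv
  have dead1 : dead ⊆ ((gN adj I1).filter
          (fun w => ∀ z, adj w z → z ∈ E ∪ {y})) := by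
    intro w hw
    simp only [hdead, mem_filter] at hw
    simp only [mem_filter]
    refine ⟨?_, fun y hy => mem_union_left _ (hw.2 y hy)⟩
    rw [stepE v hv]
    refine mem_union_left _ (mem_erase.2 ⟨?_, hw.1⟩)
    rintro rfl
    exact hyp.2 (hw.2 y hyp.1)
  by_cases c3 : 2 ≤ (univ.filter (fun z => adj y z ∧ z ∉ E ∪ {y})).card
  · set Z := univ.filter (fun z => adj y z ∧ z ∉ E ∪ {y}) with hZ
    have hyg : y ∈ gN adj I1 := by
      rw [stepE v hv]; exact mem_union_right _ hyY
    have hEq : gN adj (insert y I1) = ((gN adj I1).erase y) ∪ Z := by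
      ext w
      simp only [gN, mem_filter, mem_univ, true_and, mem_insert, not_or, mem_union, mem_erase]
      constructor
      · rintro ⟨⟨hyv, hyI⟩, x, hx | hx, hxy⟩
        · subst hx
          by_cases hyE : w ∈ E ∪ {x}
          · left
            refine ⟨hyv, hyI, ?_⟩
            rw [← hU1] at hyE
            rcases mem_union.1 hyE with h | h
            · exact absurd h hyI
            · simpa [gN, hyI] using h
          · right; simp only [hZ, mem_filter]; exact ⟨mem_univ _, hxy, hyE⟩
        · left; exact ⟨hyv, hyI, x, hx, hxy⟩
      · rintro (⟨h1, h2, x, hx, hxy⟩ | h1)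
        · exact ⟨⟨h1, h2⟩, x, Or.inr hx, hxy⟩
        · simp only [hZ, mem_filter, mem_univ, true_and] at h1
          rw [← hU1] at h1
          refine ⟨⟨?_, ?_⟩, y, Or.inl rfl, h1.1⟩
          · rintro rfl; exact h1.2 (mem_union_right _ hyg)
          · intro h; exact h1.2 (mem_union_left _ h)
    have hUq : insert y I1 ∪ gN adj (insert y I1) = (E ∪ {y}) ∪ Z := by
      rw [hEq, ← hU1]
      ext w
      simp only [mem_union, mem_insert, mem_erase]
      by_cases hyv : w = y
      · subst hyv; simp [hyg]
      · simp [hyv]; tauto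
    have hZd : Disjoint (E ∪ {y}) Z := by
      rw [Finset.disjoint_left]
      intro a ha ha'
      simp only [hZ, mem_filter] at ha'
      exact ha'.2.2 ha
    have hCq : (gN adj (insert y I1)).card + 1 = (gN adj I1).card + Z.card := by
      rw [hEq, card_union_of_disjoint, card_erase_of_mem hyg]
      · have : 0 < (gN adj I1).card := card_pos.2 ⟨y, hyg⟩
        omega
      · refine Disjoint.mono_left (fun a ha => ?_) hZd
        rw [← hU1]; exact mem_union_right _ (mem_of_mem_erase ha)
    refine ih (univ \ ((E ∪ {y}) ∪ Z)).card ?_ (insert y I1) ⟨y, mem_insert_self _ _⟩ ?_ ?_ ?_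
    · refine lt_of_le_of_lt (card_le_card ?_) (kdec v (by omega))
      rw [hy]
      exact sdiff_subset_sdiff (subset_refl _) subset_union_left
    · exact FConn_insert adj I1 hI1c y v (mem_insert_self _ _) hyp.1
    · rw [hUq]
    · rw [hUq]
      have h1 := bd (E ∪ {y}) Z
      have h2 := bd E {y}
      rw [card_singleton] at h2
      have h3 : dead.card ≤ ((gN adj (insert y I1)).filter
          (fun w => ∀ z, adj w z → z ∈ (E ∪ {y}) ∪ Z)).card := by
        apply card_le_card
        intro w hw
        have hw1 := dead1 hw
        simp only [mem_filter] at hw1 ⊢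
        refine ⟨?_, fun z hz => mem_union_left _ (hw1.2 z hz)⟩
        rw [hEq]
        refine mem_union_left _ (mem_erase.2 ⟨?_, hw1.1⟩)
        rintro rfl
        simp only [hdead, mem_filter] at hw
        exact hyp.2 (mem_union_right _ hw.1)
      omega
  · -- move 3
    refine ih (univ \ (E ∪ Y v)).card (kdec v (by omega)) I1 ⟨v, mem_insert_self _ _⟩ hI1c ?_ ?_
    · rw [stepU v hv]
    · rw [hU1]
      have h2 := bd E {y}
      rw [card_singleton] at h2
      by_cases hdy : 3 ≤ gdeg adj y
      · -- another leaf v' adjacent to y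
        have : ∃ v', v' ≠ v ∧ adj y v' ∧ v' ∈ E := by
          by_contra hcon
          push Not at hcon
          have hsub : univ.filter (fun z => adj y z) ⊆
              insert y (insert v (univ.filter (fun z => adj y z ∧ z ∉ E ∪ {y}))) := by
            intro z hz
            simp only [mem_filter, mem_univ, true_and] at hz
            simp only [mem_insert, mem_filter, mem_univ, true_and, mem_union, mem_singleton, not_or]
            by_cases h1 : z = y
            · exact Or.inl h1
            · by_cases h2 : z = v
              · exact Or.inr (Or.inl h2)
              · exact Or.inr (Or.inr ⟨hz, hcon z h2 hz, h1⟩)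
          have hvE : v ∈ E := mem_union_right _ hv
          have hle := card_le_card hsub
          have h3 := card_insert_le v (univ.filter (fun z => adj y z ∧ z ∉ E ∪ {y}))
          unfold gdeg at hdy
          have hsub' : univ.filter (fun z => adj y z) ⊆
              (insert v (univ.filter (fun z => adj y z ∧ z ∉ E ∪ {y}))) := by
            intro z hz
            have hz' := hz
            simp only [mem_filter, mem_univ, true_and] at hz'
            rcases mem_insert.1 (hsub hz) with rfl | h
            · exact absurd hz' (hir _)
            · exact h
          have hle := card_le_card hsub'
          omega
        obtain ⟨v', hv'v, hyv', hv'E⟩ := this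
        have hv'g : v' ∈ gN adj I := by
          rcases mem_union.1 hv'E with h | h
          · exact absurd (hIE v' h y (hs _ _ hyv')) hyp.2
          · exact h
        have hY' : Y v' = {y} := by
          have h1 := c1 v' hv'g
          have h2 : y ∈ Y v' := by
            simp only [Y, mem_filter]; exact ⟨mem_univ _, hs _ _ hyv', hyp.2⟩
          have h3 : (Y v').card = 1 := by
            have := card_pos.2 ⟨y, h2⟩; omega
          obtain ⟨w, hw⟩ := card_eq_one.1 h3
          rw [hw] at h2 ⊢
          rw [mem_singleton.1 h2]
        have h3 : (insert v' dead).card ≤ ((gN adj I1).filter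
          (fun w => ∀ z, adj w z → z ∈ E ∪ {y})).card := by
          apply card_le_card
          intro w hw
          rcases mem_insert.1 hw with rfl | hw
          · simp only [mem_filter]
            refine ⟨?_, ?_⟩
            · rw [stepE v hv]
              exact mem_union_left _ (mem_erase.2 ⟨hv'v, hv'g⟩)
            · intro z hz
              by_cases hzE : z ∈ E
              · exact mem_union_left _ hzE
              · have : z ∈ Y w := by simp only [Y, mem_filter]; exact ⟨mem_univ _, hz, hzE⟩
                rw [hY'] at this
                exact mem_union_right _ this
          · exact dead1 hw
        rw [card_insert_of_notMem] at h3
        · omega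
        · intro h
          simp only [hdead, mem_filter] at h
          exact hyp.2 (h.2 y (hs _ _ hyv'))
      · have h1 : ((E ∪ {y}).filter (fun v => 3 ≤ gdeg adj v)) ⊆
            (E.filter (fun v => 3 ≤ gdeg adj v)) := by
          intro w hw
          simp only [mem_filter, mem_union, mem_singleton] at hw ⊢
          rcases hw with ⟨h | rfl, h'⟩
          · exact ⟨h, h'⟩
          · exact absurd h' hdy
        have h1 := card_le_card h1
        have h3 := card_le_card dead1
        omega

theorem greedy_all {V : Type*} [Fintype V] [Nonempty V] (adj : V → V → Prop)
    (hs : ∀ x y, adj x y → adj y x) (hir : ∀ x, ¬ adj x x)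
    (hc : FConn adj (univ : Finset V)) :
      ∃ I' : Finset V, FConn adj I' ∧ I' ∪ gN adj I' = univ ∧
        (univ.filter (fun v => 3 ≤ gdeg adj v)).card ≤ 4 * (gN adj I').card + 1 := by
  obtain ⟨v0⟩ := ‹Nonempty V›
  refine greedy adj hs hir hc _ {v0} ⟨v0, mem_singleton_self _⟩ ?_ le_rfl ?_
  · intro Φ _ x hx y hy
    rw [mem_singleton.1 hx, mem_singleton.1 hy]
  · have h1 := card_filter_le ({v0} ∪ gN adj {v0}) (fun v => 3 ≤ gdeg adj v)
    have h2 := card_union_le {v0} (gN adj {v0})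
    rw [card_singleton] at h2
    omega

/-- sparse digraph (two out-neighbours) has a large independent set -/
theorem indep_set {V : Type*} (l r : V → V) :
    ∀ n : ℕ, ∀ S : Finset V, 5 * n ≤ S.card → (∀ v, l v ≠ v) → (∀ v, r v ≠ v) →
      ∃ T ⊆ S, T.card = n ∧ ∀ v ∈ T, l v ∉ T ∧ r v ∉ T := by
  intro n
  induction n with
  | zero => intro S _ _ _; exact ⟨∅, by simp, by simp, by simp⟩
  | succ n ih =>
    intro S hS hl hr
    -- a vertex with few in-neighbours
    have : ∃ v ∈ S, (S.filter (fun u => l u = v ∨ r u = v)).card ≤ 2 := by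
      by_contra hcon
      push Not at hcon
      have h1 : ∑ v ∈ S, 3 ≤ ∑ v ∈ S, (S.filter (fun u => l u = v ∨ r u = v)).card :=
        sum_le_sum (fun v hv => hcon v hv)
      have h2 : ∑ v ∈ S, (S.filter (fun u => l u = v ∨ r u = v)).card ≤ ∑ u ∈ S, 2 := by
        simp_rw [card_filter]
        rw [sum_comm]
        apply sum_le_sum
        intro u _
        rw [← card_filter]
        refine (card_le_card (show _ ⊆ ({l u, r u} : Finset V) from ?_)).trans card_le_two
        intro w hw
        simp only [mem_filter] at hw
        simp only [mem_insert, mem_singleton]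
        tauto
      simp only [sum_const, smul_eq_mul] at h1 h2
      omega
    obtain ⟨v, hv, hv2⟩ := this
    obtain ⟨T, hT, hTc, hTi⟩ := ih (S \ (insert v ({l v, r v} ∪ S.filter (fun u => l u = v ∨ r u = v)))) (by
      have h1 := le_card_sdiff (insert v ({l v, r v} ∪ S.filter (fun u => l u = v ∨ r u = v))) S
      have h2 := card_insert_le v ({l v, r v} ∪ S.filter (fun u => l u = v ∨ r u = v))
      have h3 := card_union_le ({l v, r v} : Finset V) (S.filter (fun u => l u = v ∨ r u = v))
      have h4 : ({l v, r v} : Finset V).card ≤ 2 := card_le_two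
      omega) hl hr
    have hvT : v ∉ T := by
      intro h; have := hT h; simp at this
    refine ⟨insert v T, ?_, ?_, ?_⟩
    · intro w hw
      rcases mem_insert.1 hw with rfl | hw
      · exact hv
      · exact (mem_sdiff.1 (hT hw)).1
    · rw [card_insert_of_notMem hvT, hTc]
    · intro w hw
      rcases mem_insert.1 hw with rfl | hw
      · refine ⟨?_, ?_⟩
        · intro h
          rcases mem_insert.1 h with h | h
          · exact hl _ h
          · have := (mem_sdiff.1 (hT h)).2; simp at this
        · intro h
          rcases mem_insert.1 h with h | h
          · exact hr _ h
          · have := (mem_sdiff.1 (hT h)).2; simp at this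
      · have h1 := mem_sdiff.1 (hT hw)
        simp only [mem_insert, mem_union, mem_singleton, mem_filter, not_or, not_and] at h1
        have h2 := h1.2.2.2 h1.1
        refine ⟨?_, ?_⟩
        · intro h
          rcases mem_insert.1 h with h | h
          · exact h2.1 h
          · exact (hTi w hw).1 h
        · intro h
          rcases mem_insert.1 h with h | h
          · exact h2.2 h
          · exact (hTi w hw).2 h

/-- adjacency of labels in a word of length m -/
def wadj {V : Type*} (lab : ℕ → V) (m : ℕ) (x y : V) : Prop :=
  x ≠ y ∧ ∃ t, t + 1 < m ∧ ((lab t = x ∧ lab (t+1) = y) ∨ (lab t = y ∧ lab (t+1) = x))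

/-- labels: many branch labels give a large set Λ with full column rank -/
theorem rank_lemma {V : Type*} [Fintype V] (lab : ℕ → V) (m l e d : ℕ)
    (hm : 0 < m) (hsurj : ∀ v, ∃ t < m, lab t = v)
    (hinj : ∀ t t', t < m → t' < m → t / l = t' / l → lab t = lab t' → t = t')
    (hend : (univ.filter (fun v => ∃ t < m, lab t = v ∧ (t = 0 ∨ t + 1 = m ∨ (t-1) / l ≠ t / l ∨ t / l ≠ (t+1) / l))).card ≤ e)
    (hβ : 4 * (5 * d + e) + 2 ≤ (univ.filter (fun v => 3 ≤ gdeg (wadj lab m) v)).card) :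
    ∃ Λ : Finset V, Λ.card = d ∧ ∀ φ : V → ℚ,
      (∀ i t, i < t → t < m → lab i = lab t → lab t ∉ Λ →
        ∑ u ∈ Finset.Ico i t, (if lab u ∈ Λ then (-1 : ℚ)^u * φ (lab u) else 0) = 0) →
      ∀ q ∈ Λ, φ q = 0 := by
  haveI : Nonempty V := ⟨lab 0⟩
  set adj := wadj lab m with hadj
  have hs : ∀ x y, adj x y → adj y x := by
    rintro x y ⟨h, t, ht, h'⟩; exact ⟨h.symm, t, ht, h'.symm⟩
  have hir : ∀ x, ¬ adj x x := fun x h => h.1 rfl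
  have hconn : FConn adj (univ : Finset V) := by
    intro Φ hΦ
    have h0 : ∀ t, t < m → Φ (lab t) = Φ (lab 0) := by
      intro t
      induction t with
      | zero => intro _; rfl
      | succ t ih =>
        intro ht
        rw [← ih (by omega)]
        by_cases h : lab t = lab (t+1)
        · rw [h]
        · exact hΦ _ (mem_univ _) _ (mem_univ _) ⟨fun h' => h h'.symm, t, ht, Or.inr ⟨rfl, rfl⟩⟩
    intro x _ y _
    obtain ⟨t, ht, rfl⟩ := hsurj x
    obtain ⟨t', ht', rfl⟩ := hsurj y
    rw [h0 t ht, h0 t' ht']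
  obtain ⟨I, hI, hIu, hIβ⟩ := greedy_all adj hs hir hconn
  set ends := univ.filter (fun v => ∃ t < m, lab t = v ∧ (t = 0 ∨ t + 1 = m ∨ (t-1) / l ≠ t / l ∨ t / l ≠ (t+1) / l)) with hends
  choose pos hpos hlab using hsurj
  have hS : 5 * d ≤ (gN adj I \ ends).card := by
    have := le_card_sdiff ends (gN adj I)
    omega
  by_cases hd : d = 0
  · subst hd; exact ⟨∅, by simp, by simp⟩
  -- neighbours, modified off S to be distinct from v
  have hne : ∀ v ∉ ends, 0 < pos v ∧ pos v + 1 < m ∧ (pos v - 1) / l = pos v / l ∧ pos v / l = (pos v + 1) / l := by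
    intro v hv
    simp only [hends, mem_filter, mem_univ, true_and, not_exists, not_and, not_or] at hv
    have h := hv (pos v) (hpos v) (hlab v)
    have := hpos v
    refine ⟨by omega, by omega, ?_, ?_⟩
    · by_contra h'; exact h.2.2.1 h'
    · by_contra h'; exact h.2.2.2 h'
  obtain ⟨w0, w1, hw⟩ : ∃ w0 w1 : V, w0 ≠ w1 := by
    have h1 : 0 < (gN adj I \ ends).card := by omega
    obtain ⟨v, hv⟩ := card_pos.1 h1
    have := hne v (mem_sdiff.1 hv).2
    refine ⟨lab (pos v - 1), lab (pos v), fun h => ?_⟩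
    have := hinj (pos v - 1) (pos v) (by omega) (hpos v) this.2.2.1 h
    omega
  have hoth : ∀ v : V, ∃ w, w ≠ v := by
    intro v
    by_cases h : w0 = v
    · exact ⟨w1, fun h' => hw (h.trans h'.symm)⟩
    · exact ⟨w0, h⟩
  choose oth hoth using hoth
  obtain ⟨Λ, hΛs, hΛc, hΛi⟩ := indep_set
    (fun v => if v ∈ ends then oth v else lab (pos v - 1))
    (fun v => if v ∈ ends then oth v else lab (pos v + 1)) d _ hS
    (by
      intro v
      by_cases h : v ∈ ends
      · simp [h, hoth]
      · simp only [h, if_false]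
        intro h'
        have h3 := hne v h
        have := hinj (pos v - 1) (pos v) (by omega) (hpos v) h3.2.2.1 (h'.trans (hlab v).symm)
        omega)
    (by
      intro v
      by_cases h : v ∈ ends
      · simp [h, hoth]
      · simp only [h, if_false]
        intro h'
        have h3 := hne v h
        have := hinj (pos v + 1) (pos v) (by omega) (hpos v) h3.2.2.2.symm (h'.trans (hlab v).symm)
        omega)
  refine ⟨Λ, hΛc, ?_⟩
  intro φ hφ q hq
  set Φ : ℕ → ℚ := fun t => ∑ u ∈ Finset.range t, (if lab u ∈ Λ then (-1 : ℚ)^u * φ (lab u) else 0) with hΦd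
  have hΦeq : ∀ i t, i < m → t < m → lab i = lab t → lab t ∉ Λ → Φ i = Φ t := by
    have key : ∀ i t, i < t → t < m → lab i = lab t → lab t ∉ Λ → Φ i = Φ t := by
      intro i t hit htm h1 h2
      have := hφ i t hit htm h1 h2
      rw [Finset.sum_Ico_eq_sub _ hit.le] at this
      simp only [hΦd]; linarith
    intro i t hi ht h1 h2
    rcases lt_trichotomy i t with h | h | h
    · exact key i t h ht h1 h2
    · rw [h]
    · exact (key t i h hi h1.symm (h1 ▸ h2)).symm
  -- potential on labels
  have hconst := FConn_union adj I hI (gN adj I \ Λ) (by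
    intro v hv
    have := (mem_sdiff.1 hv).1
    simp only [gN, mem_filter] at this
    exact this.2.2)
  have hmemU : ∀ v, v ∉ Λ → v ∈ I ∪ (gN adj I \ Λ) := by
    intro v hv
    have : v ∈ I ∪ gN adj I := by rw [hIu]; exact mem_univ _
    rcases mem_union.1 this with h | h
    · exact mem_union_left _ h
    · exact mem_union_right _ (mem_sdiff.2 ⟨h, hv⟩)
  have hnot : ∀ v ∈ I ∪ (gN adj I \ Λ), v ∉ Λ := by
    intro v hv h
    rcases mem_union.1 hv with h' | h'
    · have := hΛs h
      have := (mem_sdiff.1 this).1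
      simp only [gN, mem_filter] at this
      exact this.2.1 h'
    · exact (mem_sdiff.1 h').2 h
  have hc := hconst (fun v => Φ (pos v)) (by
    rintro x hx y hy ⟨hxy, t, ht, h | h⟩
    · have h1 := hΦeq (pos x) t (hpos x) (by omega) (by rw [hlab, h.1]) (by rw [h.1]; exact hnot x hx)
      have h2 := hΦeq (pos y) (t+1) (hpos y) (by omega) (by rw [hlab, h.2]) (by rw [h.2]; exact hnot y hy)
      simp only [h1, h2]
      simp only [hΦd, Finset.sum_range_succ, h.1, hnot x hx, if_false, add_zero]
    · have h1 := hΦeq (pos y) t (hpos y) (by omega) (by rw [hlab, h.1]) (by rw [h.1]; exact hnot y hy)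
      have h2 := hΦeq (pos x) (t+1) (hpos x) (by omega) (by rw [hlab, h.2]) (by rw [h.2]; exact hnot x hx)
      simp only [h1, h2]
      simp only [hΦd, Finset.sum_range_succ, h.1, hnot y hy, if_false, add_zero])
  have hqe : q ∉ ends := (mem_sdiff.1 (hΛs hq)).2
  have h3 := hne q hqe
  have h4 := hΛi q hq
  simp only [hqe, if_false] at h4
  have e1 := hΦeq (pos (lab (pos q - 1))) (pos q - 1) (hpos _) (by omega) (hlab _) h4.1
  have e2 := hΦeq (pos (lab (pos q + 1))) (pos q + 1) (hpos _) (by omega) (hlab _) h4.2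
  have e3 := hc _ (hmemU _ h4.1) _ (hmemU _ h4.2)
  simp only [e1, e2] at e3
  obtain ⟨a, ha⟩ : ∃ a, pos q = a + 1 := ⟨pos q - 1, by omega⟩
  have hlq : lab (a+1) = q := by rw [← ha]; exact hlab q
  rw [ha] at e3 h4
  simp only [hΦd, Nat.add_sub_cancel, Finset.sum_range_succ] at e3 h4
  rw [hlq] at e3
  simp only [h4.1, if_false, hq, if_true] at e3
  have : (-1 : ℚ)^(a+1) * φ q = 0 := by linarith
  rcases mul_eq_zero.1 this with h | h
  · exact absurd h (pow_ne_zero _ (by norm_num))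
  · exact h

def Canon {m : ℕ} (κ : Fin m → Fin m) : Prop := ∀ t, κ t ≤ t ∧ κ (κ t) = κ t

abbrev KRep {m : ℕ} (κ : Fin m → Fin m) := {t : Fin m // κ t = t}

def clip {m : ℕ} (hm : 0 < m) (t : ℕ) : Fin m := ⟨min t (m-1), by omega⟩

lemma clip_lt {m : ℕ} (hm : 0 < m) (t : ℕ) (ht : t < m) : clip hm t = ⟨t, ht⟩ := by
  apply Fin.ext; simp [clip]; omega

def rlab {m : ℕ} (hm : 0 < m) (κ : Fin m → Fin m) (hκ : Canon κ) (t : ℕ) : KRep κ :=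
  ⟨κ (clip hm t), (hκ _).2⟩

lemma rlab_eq {m : ℕ} (hm : 0 < m) (κ : Fin m → Fin m) (hκ : Canon κ) (t t' : ℕ)
    (ht : t < m) (ht' : t' < m) : rlab hm κ hκ t = rlab hm κ hκ t' ↔ κ ⟨t, ht⟩ = κ ⟨t', ht'⟩ := by
  simp [rlab, clip_lt hm t ht, clip_lt hm t' ht']

def BInj {m : ℕ} (l : ℕ) (κ : Fin m → Fin m) : Prop :=
  ∀ t t' : Fin m, t.1 / l = t'.1 / l → κ t = κ t' → t = t'

def isEnd (m l t : ℕ) : Prop := (t = 0 ∨ t + 1 = m ∨ (t-1) / l ≠ t / l ∨ t / l ≠ (t+1) / l)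

noncomputable def branch {m : ℕ} (hm : 0 < m) (κ : Fin m → Fin m) (hκ : Canon κ) : Finset (KRep κ) :=
  univ.filter (fun v => 3 ≤ gdeg (wadj (rlab hm κ hκ) m) v)

noncomputable def endlab {m : ℕ} (hm : 0 < m) (l : ℕ) (κ : Fin m → Fin m) (hκ : Canon κ) : Finset (KRep κ) :=
  univ.filter (fun v => ∃ t < m, rlab hm κ hκ t = v ∧ isEnd m l t)

/-- special positions -/
noncomputable def specPos {m : ℕ} (hm : 0 < m) (l : ℕ) (κ : Fin m → Fin m) (hκ : Canon κ) : Finset (Fin m) :=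
  univ.filter (fun t => rlab hm κ hκ t ∈ branch hm κ hκ ∪ endlab hm l κ hκ)

lemma endpos_card (nb l m : ℕ) (hmn : m = nb * l) :
    (univ.filter (fun t : Fin m => isEnd m l t.1)).card ≤ 2 * nb := by
  rcases Nat.eq_zero_or_pos l with rfl | hl
  · have : m = 0 := by simpa using hmn
    subst this; simp
  have : (univ.filter (fun t : Fin m => isEnd m l t.1)) ⊆
      (univ : Finset (Fin nb × Fin 2)).image (fun x => if h : x.1.1 * l + (if x.2 = 0 then 0 else l - 1) < m then (⟨_, h⟩ : Fin m) else ⟨x.1.1 * l, by rw [hmn]; exact Nat.mul_lt_mul_of_pos_right x.1.2 hl⟩) := by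
    intro t ht
    simp only [mem_filter, mem_univ, true_and] at ht
    have htm := t.2
    have h1 : t.1 / l < nb := by
      rw [Nat.div_lt_iff_lt_mul hl]; omega
    have hdm := Nat.div_add_mod t.1 l
    have hml := Nat.mod_lt t.1 hl
    have key : t.1 % l = 0 ∨ t.1 % l = l - 1 := by
      by_contra hcon
      push Not at hcon
      rcases ht with h | h | h | h
      · rw [h] at hcon; simp at hcon
      · have : (t.1 + 1) % l = 0 := by rw [h, hmn]; exact Nat.mul_mod_left _ _
        have h2 : (t.1 + 1) % l = t.1 % l + 1 := by
          have e : t.1 + 1 = l * (t.1 / l) + (t.1 % l + 1) := by omega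
          calc (t.1 + 1) % l = (l * (t.1 / l) + (t.1 % l + 1)) % l := congrArg (· % l) e
            _ = _ := by rw [Nat.mul_add_mod, Nat.mod_eq_of_lt (by omega)]
        omega
      · apply h
        have : t.1 - 1 = l * (t.1 / l) + (t.1 % l - 1) := by omega
        calc (t.1 - 1) / l = (l * (t.1 / l) + (t.1 % l - 1)) / l := congrArg (· / l) this
          _ = t.1 / l := by rw [Nat.mul_add_div hl, Nat.div_eq_of_lt (by omega : t.1 % l - 1 < l)]; rfl
      · apply h
        have : t.1 + 1 = l * (t.1 / l) + (t.1 % l + 1) := by omega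
        symm
        calc (t.1 + 1) / l = (l * (t.1 / l) + (t.1 % l + 1)) / l := congrArg (· / l) this
          _ = t.1 / l := by rw [Nat.mul_add_div hl, Nat.div_eq_of_lt (by omega : t.1 % l + 1 < l)]; rfl
    rw [mem_image]
    rcases key with h | h
    · refine ⟨(⟨t.1 / l, h1⟩, 0), mem_univ _, ?_⟩
      have e : t.1 / l * l = t.1 := by rw [mul_comm]; omega
      apply Fin.ext
      simp [e]
    · refine ⟨(⟨t.1 / l, h1⟩, 1), mem_univ _, ?_⟩
      have e : t.1 / l * l + (l - 1) = t.1 := by rw [mul_comm]; omega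
      apply Fin.ext
      simp [e]
  refine (card_le_card this).trans (card_image_le.trans ?_)
  simp [mul_comm]

lemma endlab_card {m : ℕ} (hm : 0 < m) (nb l : ℕ) (hmn : m = nb * l) (κ : Fin m → Fin m) (hκ : Canon κ) :
    (endlab hm l κ hκ).card ≤ 2 * nb := by
  refine le_trans ?_ (endpos_card nb l m hmn)
  have : endlab hm l κ hκ ⊆ (univ.filter (fun t : Fin m => isEnd m l t.1)).image (fun t => rlab hm κ hκ t.1) := by
    intro v hv
    simp only [endlab, mem_filter, mem_univ, true_and] at hv
    obtain ⟨t, ht, h1, h2⟩ := hv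
    rw [mem_image]
    exact ⟨⟨t, ht⟩, by simp [h2], h1⟩
  exact (card_le_card this).trans card_image_le

lemma specPos_card {m : ℕ} (hm : 0 < m) (nb l β : ℕ) (hmn : m = nb * l) (κ : Fin m → Fin m) (hκ : Canon κ)
    (hB : BInj l κ) (hβ : (branch hm κ hκ).card ≤ β) :
    (specPos hm l κ hκ).card ≤ nb * (β + 2 * nb) := by
  have hl : 0 < l := by
    rcases Nat.eq_zero_or_pos l with rfl | h
    · simp at hmn; omega
    · exact h
  have h1 : (branch hm κ hκ ∪ endlab hm l κ hκ).card ≤ β + 2 * nb :=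
    (card_union_le _ _).trans (add_le_add hβ (endlab_card hm nb l hmn κ hκ))
  have h2 : (specPos hm l κ hκ).card ≤ (range nb ×ˢ (branch hm κ hκ ∪ endlab hm l κ hκ)).card := by
    apply card_le_card_of_injOn (fun t => (t.1 / l, rlab hm κ hκ t.1))
    · intro t ht
      simp only [specPos, coe_filter, Set.mem_ofPred_eq, mem_univ, true_and] at ht
      simp only [coe_product, Set.mem_prod, mem_coe, mem_range]
      refine ⟨?_, ht⟩
      rw [Nat.div_lt_iff_lt_mul hl]; have := t.2; omega
    · intro t _ t' _ h
      simp only [Prod.mk.injEq] at h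
      exact hB t t' h.1 ((rlab_eq hm κ hκ t.1 t'.1 t.2 t'.2).1 h.2)
  rw [card_product, card_range] at h2
  exact h2.trans (Nat.mul_le_mul_left _ h1)

/-- the determined rule -/
noncomputable def rule {m : ℕ} (hm : 0 < m) (κ : Fin m → Fin m) (t : ℕ) : Fin m :=
  if κ (clip hm t) = clip hm t then clip hm (t+1) else
    if κ (clip hm (t-1)) = κ (clip hm ((κ (clip hm t)).1 - 1)) then κ (clip hm ((κ (clip hm t)).1 + 1))
    else κ (clip hm ((κ (clip hm t)).1 - 1))

lemma nbr_of_nonspec {m : ℕ} (hm : 0 < m) (l : ℕ) (κ : Fin m → Fin m) (hκ : Canon κ)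
    (hB : BInj l κ) (t : ℕ) (ht : t < m) (hs : (⟨t, ht⟩ : Fin m) ∉ specPos hm l κ hκ) :
    0 < t ∧ t + 1 < m ∧ (t-1)/l = t/l ∧ t/l = (t+1)/l ∧
    κ (clip hm (t-1)) ≠ κ (clip hm t) ∧ κ (clip hm (t+1)) ≠ κ (clip hm t) ∧
    κ (clip hm (t-1)) ≠ κ (clip hm (t+1)) ∧
    ∀ s, s + 1 < m → κ (clip hm s) ≠ κ (clip hm (s+1)) →
      ((κ (clip hm s) = κ (clip hm t) → κ (clip hm (s+1)) = κ (clip hm (t-1)) ∨ κ (clip hm (s+1)) = κ (clip hm (t+1))) ∧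
      (κ (clip hm (s+1)) = κ (clip hm t) → κ (clip hm s) = κ (clip hm (t-1)) ∨ κ (clip hm s) = κ (clip hm (t+1)))) := by
  simp only [specPos, mem_filter, mem_univ, true_and, mem_union, not_or] at hs
  obtain ⟨hb, he⟩ := hs
  simp only [endlab, mem_filter, mem_univ, true_and, not_exists, not_and] at he
  have he := he t ht rfl
  simp only [isEnd, not_or, not_not] at he
  obtain ⟨h0, h1, h2, h3⟩ := he
  have ht1 : t + 1 < m := by omega
  have c0 := clip_lt hm t ht
  have cm := clip_lt hm (t-1) (by omega)
  have cp := clip_lt hm (t+1) ht1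
  have n1 : κ (clip hm (t-1)) ≠ κ (clip hm t) := by
    intro h; rw [c0, cm] at h
    have := hB _ _ h2 h
    simp at this; omega
  have n2 : κ (clip hm (t+1)) ≠ κ (clip hm t) := by
    intro h; rw [c0, cp] at h
    have := hB _ _ h3.symm h
    simp at this
  have n3 : κ (clip hm (t-1)) ≠ κ (clip hm (t+1)) := by
    intro h; rw [cm, cp] at h
    have := hB _ _ (h2.trans h3) h
    simp at this <;> omega
  refine ⟨by omega, ht1, h2, h3, n1, n2, n3, ?_⟩
  -- neighbours have ≤ 2 elements
  have hb : ¬ (3 ≤ gdeg (wadj (rlab hm κ hκ) m) (rlab hm κ hκ t)) := fun h => hb (mem_filter.2 ⟨mem_univ _, h⟩)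
  rw [not_le, gdeg] at hb
  have hmem1 : wadj (rlab hm κ hκ) m (rlab hm κ hκ t) (rlab hm κ hκ (t-1)) := by
    refine ⟨?_, t-1, by omega, Or.inr ⟨rfl, ?_⟩⟩
    · intro h; rw [Subtype.ext_iff] at h; exact n1 h.symm
    · rw [show t - 1 + 1 = t by omega]
  have hmem2 : wadj (rlab hm κ hκ) m (rlab hm κ hκ t) (rlab hm κ hκ (t+1)) := by
    refine ⟨?_, t, by omega, Or.inl ⟨rfl, rfl⟩⟩
    intro h; rw [Subtype.ext_iff] at h; exact n2 h.symm
  have hall : ∀ v, wadj (rlab hm κ hκ) m (rlab hm κ hκ t) v → v = rlab hm κ hκ (t-1) ∨ v = rlab hm κ hκ (t+1) := by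
    intro v hv
    by_contra hcon
    push Not at hcon
    have hsub : ({v, rlab hm κ hκ (t-1), rlab hm κ hκ (t+1)} : Finset (KRep κ)) ⊆ univ.filter (fun y => wadj (rlab hm κ hκ) m (rlab hm κ hκ t) y) := by
      intro w hw
      simp only [mem_insert, mem_singleton] at hw
      simp only [mem_filter, mem_univ, true_and]
      rcases hw with rfl | rfl | rfl
      · exact hv
      · exact hmem1
      · exact hmem2
    have := card_le_card hsub
    rw [card_eq_three.2 ⟨_, _, _, hcon.1, hcon.2, ?_, rfl⟩] at this
    · refine absurd this (not_le.2 ?_)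
      convert hb
    · intro h; rw [Subtype.ext_iff] at h; exact n3 h
  intro s hs hne
  constructor
  · intro h
    have := hall (rlab hm κ hκ (s+1)) ⟨?_, s, hs, Or.inl ⟨Subtype.ext h, rfl⟩⟩
    · rcases this with h' | h'
      · left; exact congrArg Subtype.val h'
      · right; exact congrArg Subtype.val h'
    · intro h'; rw [Subtype.ext_iff] at h'; exact hne (h.trans h')
  · intro h
    have := hall (rlab hm κ hκ s) ⟨?_, s, hs, Or.inr ⟨rfl, Subtype.ext h⟩⟩
    · rcases this with h' | h'
      · left; exact congrArg Subtype.val h'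
      · right; exact congrArg Subtype.val h'
    · intro h'; rw [Subtype.ext_iff] at h'; exact hne ((h.trans h').symm)

lemma det_rule {m : ℕ} (hm : 0 < m) (l : ℕ) (κ : Fin m → Fin m) (hκ : Canon κ)
    (hB : BInj l κ) (t : ℕ) (ht : t + 1 < m) (hs : (⟨t, by omega⟩ : Fin m) ∉ specPos hm l κ hκ)
    (hs1 : (⟨t+1, ht⟩ : Fin m) ∉ specPos hm l κ hκ) :
    κ ⟨t+1, ht⟩ = rule hm κ t := by
  have A := nbr_of_nonspec hm l κ hκ hB t (by omega) hs
  have cp := clip_lt hm (t+1) ht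
  have c0 := clip_lt hm t (by omega)
  have cm := clip_lt hm (t-1) (by omega)
  rw [← cp]
  unfold rule
  by_cases hnew : κ (clip hm t) = clip hm t
  · rw [if_pos hnew]
    by_contra hold
    -- label at t+1 occurred before
    set r := κ (clip hm (t+1)) with hr
    have hrle : r.1 < t + 1 := by
      have h1 := (hκ (clip hm (t+1))).1
      rw [cp] at h1 hold
      have : r.1 ≤ t + 1 := by rw [hr, cp]; exact h1
      rcases Nat.lt_or_ge r.1 (t+1) with h | h
      · exact h
      · exact absurd (Fin.ext (by simp; omega)) hold
    have hrr : κ (clip hm r.1) = r := by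
      rw [clip_lt hm r.1 r.2]; exact (hκ _).2
    have hrs : (⟨r.1, r.2⟩ : Fin m) ∉ specPos hm l κ hκ := by
      intro h
      apply hs1
      simp only [specPos, mem_filter, mem_univ, true_and] at h ⊢
      have : rlab hm κ hκ r.1 = rlab hm κ hκ (t+1) := Subtype.ext hrr
      rw [← this]; exact h
    have B := nbr_of_nonspec hm l κ hκ hB r.1 r.2 hrs
    have := (B.2.2.2.2.2.2.2 t ht (by intro h; exact A.2.2.2.2.2.1 h.symm)).2 (by rw [hrr])
    rw [hnew] at this
    -- t = κ(r-1) ≤ r-1 or t = κ (r+1)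
    rcases this with h | h
    · have h1 := (hκ (clip hm (r.1-1))).1
      rw [← h, c0, clip_lt hm _ (by omega)] at h1
      simp [Fin.le_def] at h1; omega
    · have h1 := (hκ (clip hm (r.1+1))).1
      rw [← h, c0, clip_lt hm _ B.2.1] at h1
      simp only [Fin.mk_le_mk] at h1
      have h3 : r.1 = t ∨ r.1 = t - 1 := by omega
      rcases h3 with h3 | h3
      · have : κ (clip hm t) = r := by rw [← h3]; exact hrr
        exact A.2.2.2.2.2.1 this.symm
      · have : κ (clip hm (t-1)) = r := by rw [← h3]; exact hrr
        exact A.2.2.2.2.2.2.1 (by rw [this])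
  · rw [if_neg hnew]
    set r := κ (clip hm t) with hr
    have hrr : κ (clip hm r.1) = r := by
      rw [clip_lt hm r.1 r.2]; exact (hκ _).2
    have hrs : (⟨r.1, r.2⟩ : Fin m) ∉ specPos hm l κ hκ := by
      intro h
      apply hs
      simp only [specPos, mem_filter, mem_univ, true_and] at h ⊢
      have : rlab hm κ hκ r.1 = rlab hm κ hκ t := Subtype.ext hrr
      rw [← this]; exact h
    have B := nbr_of_nonspec hm l κ hκ hB r.1 r.2 hrs
    have h1 := (B.2.2.2.2.2.2.2 t ht (by intro h; exact A.2.2.2.2.2.1 h.symm)).1 (by rw [hrr])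
    have h2 := (B.2.2.2.2.2.2.2 (t-1) (by omega) (by rw [show t-1+1 = t by omega]; exact A.2.2.2.2.1)).2
      (by rw [hrr, show t-1+1 = t by omega])
    have h3 := A.2.2.2.2.2.2.1
    have h4 := B.2.2.2.2.2.2.1
    split_ifs with hc
    · rcases h1 with h | h
      · exact absurd (hc.trans h.symm) h3
      · exact h
    · rcases h2 with h | h
      · exact absurd h hc
      · rcases h1 with h' | h'
        · exact h'
        · exact absurd (h.trans h'.symm) h3

theorem pattern_count {m : ℕ} (hm : 0 < m) (nb l β : ℕ) (hmn : m = nb * l) :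
    (univ.filter (fun κ : Fin m → Fin m => ∃ hκ : Canon κ, BInj l κ ∧ (branch hm κ hκ).card ≤ β)).card
      ≤ 2 ^ m * m ^ (2 * (nb * (β + 2 * nb))) := by
  set K := univ.filter (fun κ : Fin m → Fin m => ∃ hκ : Canon κ, BInj l κ ∧ (branch hm κ hκ).card ≤ β) with hK
  set h := nb * (β + 2 * nb) with hh
  let sp : (Fin m → Fin m) → Finset (Fin m) := fun κ => if hκ : Canon κ then specPos hm l κ hκ else ∅
  let hard : Finset (Fin m) → Finset (Fin m) := fun S => S ∪ S.image (fun t => clip hm (t.1+1))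
  have hhard : ∀ S : Finset (Fin m), (hard S).card ≤ 2 * S.card := by
    intro S
    have := card_union_le S (S.image (fun t => clip hm (t.1+1)))
    have h2 : (S.image (fun t => clip hm (t.1+1))).card ≤ S.card := card_image_le
    simp only [hard]; omega
  have h1 : K.card ≤ ∑ S ∈ (univ : Finset (Finset (Fin m))), (K.filter (fun κ => sp κ = S)).card := by
    rw [← card_eq_sum_card_fiberwise (fun _ _ => by simp)]
  refine h1.trans ?_
  have h2 : ∀ S ∈ (univ : Finset (Finset (Fin m))), (K.filter (fun κ => sp κ = S)).card ≤ m ^ (2 * h) := by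
    intro S _
    by_cases hSc : S.card ≤ h
    swap
    · have : K.filter (fun κ => sp κ = S) = ∅ := by
        rw [filter_eq_empty_iff]
        intro κ hκ hS
        simp only [hK, mem_filter, mem_univ, true_and] at hκ
        obtain ⟨hC, hB, hb⟩ := hκ
        simp only [sp, hC, dif_pos] at hS
        have := specPos_card hm nb l β hmn κ hC hB hb
        rw [hS] at this; omega
      rw [this]; simp
    have hc : (K.filter (fun κ => sp κ = S)).card ≤
        (Fintype.piFinset (fun t : Fin m => if t ∈ hard S then (univ : Finset (Fin m)) else {⟨0, hm⟩})).card := by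
      apply card_le_card_of_injOn (fun κ t => if t ∈ hard S then κ t else ⟨0, hm⟩)
      · intro κ _
        simp only [mem_coe, Fintype.mem_piFinset]
        intro t
        by_cases ht : t ∈ hard S <;> simp [ht]
      · intro κ hκ κ' hκ' heq
        simp only [coe_filter, Set.mem_ofPred_eq, hK, mem_filter, mem_univ, true_and] at hκ hκ'
        obtain ⟨⟨hC, hB, hb⟩, hS⟩ := hκ
        obtain ⟨⟨hC', hB', hb'⟩, hS'⟩ := hκ'
        simp only [sp, hC, hC', dif_pos] at hS hS'
        have hag : ∀ t ∈ hard S, κ t = κ' t := by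
          intro t ht
          have := congrFun heq t
          simpa [ht] using this
        have key : ∀ n, ∀ t (ht : t < m), t ≤ n → κ ⟨t, ht⟩ = κ' ⟨t, ht⟩ := by
          intro n
          induction n with
          | zero =>
            intro t ht h0
            have : t = 0 := by omega
            subst this
            have a := (hC ⟨0, ht⟩).1
            have b := (hC' ⟨0, ht⟩).1
            apply Fin.ext
            simp only [Fin.le_def] at a b; omega
          | succ n ih =>
            intro t ht htn
            rcases Nat.lt_or_ge t (n+1) with h | h
            · exact ih t ht (by omega)
            have : t = n + 1 := by omega
            subst this
            by_cases hh1 : (⟨n+1, ht⟩ : Fin m) ∈ hard S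
            · exact hag _ hh1
            have g1 : (⟨n+1, ht⟩ : Fin m) ∉ S := fun h => hh1 (mem_union_left _ h)
            have g2 : (⟨n, by omega⟩ : Fin m) ∉ S := fun h => hh1 (mem_union_right _ (by
              rw [mem_image]; exact ⟨_, h, by simp [clip_lt hm (n+1) ht]⟩))
            rw [det_rule hm l κ hC hB n ht (by rw [hS]; exact g2) (by rw [hS]; exact g1),
              det_rule hm l κ' hC' hB' n ht (by rw [hS']; exact g2) (by rw [hS']; exact g1)]
            have ag : ∀ s, s ≤ n → κ (clip hm s) = κ' (clip hm s) := by
              intro s hs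
              rw [clip_lt hm s (by omega)]; exact ih s _ hs
            have hle := (hC (clip hm n)).1
            unfold rule
            have e1 := ag n le_rfl
            have e2 := ag (n-1) (by omega)
            rw [← e1, ← e2]
            have hle : (κ (clip hm n)).1 ≤ n := by
              have h3 := (hC (clip hm n)).1
              have h4 : ((clip hm n : Fin m) : ℕ) ≤ n := by simp [clip]
              exact le_trans h3 h4
            have e3 := ag ((κ (clip hm n)).1 - 1) (by omega)
            rw [← e3]
            by_cases hn : κ (clip hm n) = clip hm n
            · simp [hn]
            · have hlt : (κ (clip hm n)).1 < n := by
                rcases Nat.lt_or_ge (κ (clip hm n)).1 n with h | h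
                · exact h
                · exfalso; apply hn; apply Fin.ext
                  rw [clip_lt hm n (by omega)] at *
                  simp; omega
              have e4 := ag ((κ (clip hm n)).1 + 1) (by omega)
              rw [← e4]
        funext t
        exact key t.1 t.1 t.2 le_rfl
    refine hc.trans ?_
    rw [Fintype.card_piFinset]
    have : ∀ t : Fin m, (if t ∈ hard S then (univ : Finset (Fin m)) else {⟨0, hm⟩}).card = if t ∈ hard S then m else 1 := by
      intro t; split_ifs <;> simp
    simp_rw [this]
    rw [Finset.prod_ite]
    simp only [prod_const, one_pow, mul_one]
    apply Nat.pow_le_pow_right hm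
    have h3 := hhard S
    have h4 : (univ.filter (fun t => t ∈ hard S)).card = (hard S).card := by
      congr 1; ext; simp
    omega
  refine (sum_le_sum h2).trans ?_
  simp

lemma minor_exists {ι : Type*} [Fintype ι] {n : ℕ} (M : Matrix ι (Fin n) ℚ)
    (h : ∀ φ : Fin n → ℚ, M.mulVec φ = 0 → φ = 0) :
    ∃ s : Fin n → ι, (M.submatrix s id).det ≠ 0 := by
  have hinj : Function.Injective M.mulVecLin := by
    rw [← LinearMap.ker_eq_bot, LinearMap.ker_eq_bot']
    intro φ hφ; exact h φ hφ
  have hr : M.rank = n := by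
    rw [Matrix.rank, LinearMap.finrank_range_of_inj hinj]; simp
  rw [Matrix.rank_eq_finrank_span_row] at hr
  obtain ⟨κ, a, hai, hspan, hli⟩ := exists_linearIndependent' ℚ M.row
  have hfin : Finite κ := Finite.of_injective a hai
  have := Fintype.ofFinite κ
  have hc : Fintype.card κ = n := by
    rw [← hr, ← hspan, finrank_span_eq_card hli]
  let e : Fin n ≃ κ := (Fintype.equivFinOfCardEq hc).symm
  refine ⟨a ∘ e, ?_⟩
  have h2 : LinearIndependent ℚ (M.submatrix (a ∘ e) id).row := by
    have := hli.comp e e.injective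
    exact this
  have := Matrix.linearIndependent_rows_iff_isUnit.1 h2
  rw [Matrix.isUnit_iff_isUnit_det] at this
  exact this.ne_zero

lemma card_int_interval (S : Finset ℤ) (a B : ℝ) (hB : 0 ≤ B) (h : ∀ x ∈ S, |(x:ℝ) - a| ≤ B) :
    (S.card : ℝ) ≤ 2 * B + 1 := by
  have hs : S ⊆ Icc ⌈a - B⌉ ⌊a + B⌋ := by
    intro x hx
    have := abs_le.1 (h x hx)
    rw [mem_Icc]
    exact ⟨Int.ceil_le.2 (by linarith [this.1]), Int.le_floor.2 (by linarith [this.2])⟩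
  have h1 := card_le_card hs
  rw [Int.card_Icc] at h1
  have h2 : (S.card : ℝ) ≤ ((⌊a + B⌋ + 1 - ⌈a - B⌉).toNat : ℝ) := by exact_mod_cast h1
  refine h2.trans ?_
  rcases le_or_gt 0 (⌊a + B⌋ + 1 - ⌈a - B⌉) with hp | hp
  · have : ((⌊a + B⌋ + 1 - ⌈a - B⌉).toNat : ℝ) = ((⌊a + B⌋ + 1 - ⌈a - B⌉ : ℤ) : ℝ) := by
      exact_mod_cast congrArg (Int.cast : ℤ → ℝ) (Int.toNat_of_nonneg hp)
    rw [this]; push_cast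
    linarith [Int.floor_le (a + B), Int.le_ceil (a - B)]
  · rw [Int.toNat_of_nonpos hp.le]; simp; linarith

/-- tolerance lattice count: D a uniform bound for all determinants -/
lemma lattice_k (m : ℝ) (hm : 1 ≤ m) (n0 : ℕ) (D : ℝ) (hD1 : 1 ≤ D) (H0 : ℝ) (hH0 : 1 ≤ H0) (d : ℕ) :
    ∀ (hd : d ≤ n0) (hD : ∀ k ≤ n0, (k.factorial : ℝ) * m ^ k ≤ D)
      (A : Matrix (Fin d) (Fin d) ℤ) (hA : ∀ i j, |(A i j : ℝ)| ≤ m) (hdet : A.det ≠ 0)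
      (p b : Fin d → ℝ) (hp : ∀ e, H0 ≤ p e) (X : Fin d → ℝ) (hX : ∀ f, H0 ≤ X f) (Y : ℝ)
      (hY0 : 0 ≤ Y) (hY : ∀ f, Y ≤ 2 * m * ((n0 : ℝ) - d) * X f)
      (S : Finset (Fin d → ℤ))
      (hS : ∀ k ∈ S, ∃ q : Fin d → ℝ, (∀ f, X f ≤ q f ∧ q f ≤ 2 * X f) ∧
        ∀ e, |∑ f, (A e f : ℝ) * q f - b e - p e * k e| ≤ Y),
      (S.card : ℝ) ≤ ∏ f, (10 * m * (n0 + 1) ^ 2 * D * X f / H0) := by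
  induction d with
  | zero =>
    intro hd hD A hA hdet p b hp X hX Y hY0 hY S hS
    simp
    exact_mod_cast (card_le_univ S).trans (by simp)
  | succ d ih =>
    intro hd hD A hA hdet p b hp X hX Y hY0 hY S hS
    obtain ⟨f0, hf0⟩ := Finite.exists_min X
    -- row with nonzero cofactor
    have hadj : ∃ e, A.adjugate f0 e ≠ 0 := by
      by_contra hcon
      push Not at hcon
      have h1 := congrFun (congrFun (Matrix.adjugate_mul A) f0) f0
      rw [Matrix.mul_apply] at h1
      simp [hcon] at h1
      exact hdet h1.symm
    obtain ⟨e0, he0⟩ := hadj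
    set A' := A.submatrix e0.succAbove f0.succAbove with hA'
    have hdet' : A'.det ≠ 0 := by
      rw [Matrix.adjugate_fin_succ_eq_det_submatrix] at he0
      exact right_ne_zero_of_mul he0
    have hadjb : ∀ e, |(A.adjugate f0 e : ℝ)| ≤ D := by
      intro e
      rw [Matrix.adjugate_fin_succ_eq_det_submatrix, Int.cast_mul, Int.cast_pow, Int.cast_neg, Int.cast_one, abs_mul, abs_pow, abs_neg, abs_one, one_pow, one_mul]
      have h1 := Matrix.det_le (A := (A.submatrix e.succAbove f0.succAbove).map (Int.cast : ℤ → ℝ)) (abv := AbsoluteValue.abs) (x := m) (by intro i j; exact hA _ _)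
      have h2 : ((A.submatrix e.succAbove f0.succAbove).map (Int.cast : ℤ → ℝ)).det = (((A.submatrix e.succAbove f0.succAbove).det : ℤ) : ℝ) :=
        ((Int.castRingHom ℝ).map_det _).symm
      rw [h2] at h1
      simp only [AbsoluteValue.abs_apply, Fintype.card_fin, nsmul_eq_mul] at h1
      exact h1.trans (hD d (by omega))
    have hdetb : |(A.det : ℝ)| ≤ D := by
      have h1 := Matrix.det_le (A := A.map (Int.cast : ℤ → ℝ)) (abv := AbsoluteValue.abs) (x := m) (by intro i j; exact hA _ _)
      have h2 : (A.map (Int.cast : ℤ → ℝ)).det = ((A.det : ℤ) : ℝ) :=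
        ((Int.castRingHom ℝ).map_det _).symm
      rw [h2] at h1
      simp only [AbsoluteValue.abs_apply, Fintype.card_fin, nsmul_eq_mul] at h1
      exact h1.trans (hD (d+1) (by omega))
    have hX0 : ∀ f, 0 < X f := fun f => by linarith [hX f]
    set Xs := X f0 with hXs
    set Y' := Y + 2 * m * Xs with hY'
    let π : (Fin (d+1) → ℤ) → (Fin d → ℤ) := fun k e => k (e0.succAbove e)
    have ih' := ih (by omega) hD A' (fun i j => hA _ _) hdet' (fun e => p (e0.succAbove e)) (fun e => b (e0.succAbove e))
      (fun e => hp _) (fun f => X (f0.succAbove f)) (fun f => hX _) Y'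
      (by have := hX0 f0; positivity)
      (by
        intro f
        have h1 := hY f0
        have h2 := hf0 (f0.succAbove f)
        have h3 : (d:ℝ) + 1 ≤ n0 := by exact_mod_cast hd
        push_cast at h1
        calc Y' ≤ 2 * m * ((n0:ℝ) - d) * Xs := by rw [hY']; nlinarith
          _ ≤ _ := mul_le_mul_of_nonneg_left h2 (mul_nonneg (by linarith) (by linarith)))
      (S.image π)
      (by
        intro k' hk'
        obtain ⟨k, hk, rfl⟩ := mem_image.1 hk'
        obtain ⟨q, hq, hqe⟩ := hS k hk
        refine ⟨fun f => q (f0.succAbove f), fun f => hq _, fun e => ?_⟩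
        have h1 := hqe (e0.succAbove e)
        rw [Fin.sum_univ_succAbove _ f0] at h1
        have h2 : |(A (e0.succAbove e) f0 : ℝ) * q f0| ≤ m * (2 * Xs) := by
          rw [abs_mul]
          have := hX0 f0
          exact mul_le_mul (hA _ _) (by rw [abs_of_nonneg (by linarith [(hq f0).1])]; exact (hq f0).2) (abs_nonneg _) (by linarith)
        rw [abs_le] at h1 h2 ⊢
        simp only [hA', Matrix.submatrix_apply, π]
        constructor <;> linarith [h1.1, h1.2, h2.1, h2.2])
    have hfib : ∀ k' ∈ S.image π, ((S.filter (fun k => π k = k')).card : ℝ) ≤ 10 * m * (n0 + 1) ^ 2 * D * Xs / H0 := by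
      intro k' hk'
      -- k e0 in an interval
      set cst : ℝ := (∑ e, (A.adjugate f0 e : ℝ) * b e) + ∑ e : Fin d, (A.adjugate f0 (e0.succAbove e) : ℝ) * (p (e0.succAbove e) * k' e) with hcst
      set cf : ℝ := (A.adjugate f0 e0 : ℝ) with hcf
      have hcf1 : 1 ≤ |cf| := by
        rw [hcf]; exact_mod_cast Int.one_le_abs he0
      have hinj : Set.InjOn (fun k : Fin (d+1) → ℤ => k e0) (S.filter (fun k => π k = k')) := by
        intro k hk k2 hk2 h
        simp only [coe_filter, Set.mem_ofPred_eq] at hk hk2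
        funext e
        rcases Fin.eq_self_or_eq_succAbove e0 e with rfl | ⟨j, rfl⟩
        · exact h
        · exact congrFun (hk.2.trans hk2.2.symm) j
      rw [← card_image_of_injOn hinj]
      set B := (2 * D * Xs + (d+1) * D * Y) / H0 with hB
      have hXs0 : 0 < Xs := hX0 f0
      have hB0 : 0 ≤ B := by positivity
      have h1 := card_int_interval ((S.filter (fun k => π k = k')).image (fun k => k e0)) (- cst / (cf * p e0)) B hB0 (by
        intro x hx
        obtain ⟨k, hk, rfl⟩ := mem_image.1 hx
        obtain ⟨hkS, hkπ⟩ := mem_filter.1 hk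
        obtain ⟨q, hq, hqe⟩ := hS k hkS
        have hid : ∑ e, (A.adjugate f0 e : ℝ) * (∑ f, (A e f : ℝ) * q f) = A.det * q f0 := by
          simp_rw [mul_sum]
          rw [sum_comm]
          have : ∀ f, ∑ e, (A.adjugate f0 e : ℝ) * ((A e f : ℝ) * q f) = (if f0 = f then (A.det : ℝ) else 0) * q f := by
            intro f
            have h1 := congrFun (congrFun (Matrix.adjugate_mul A) f0) f
            rw [Matrix.mul_apply] at h1
            have h2 : (∑ e, (A.adjugate f0 e : ℝ) * (A e f : ℝ)) = if f0 = f then (A.det : ℝ) else 0 := by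
              have := congrArg (Int.cast : ℤ → ℝ) h1
              push_cast at this
              rw [this]
              simp [Matrix.smul_apply, Matrix.one_apply]
            rw [← h2, sum_mul]
            apply sum_congr rfl; intros; ring
          simp_rw [this]
          simp
        have hdev : |∑ e, (A.adjugate f0 e : ℝ) * (∑ f, (A e f : ℝ) * q f - b e - p e * k e)| ≤ (d+1) * D * Y := by
          refine (abs_sum_le_sum_abs _ _).trans ?_
          calc _ ≤ ∑ e : Fin (d+1), D * Y := by
                apply sum_le_sum; intro e _
                rw [abs_mul]
                exact mul_le_mul (hadjb e) (hqe e) (abs_nonneg _) (by linarith)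
            _ = _ := by simp; ring
        have hexp : ∑ e, (A.adjugate f0 e : ℝ) * (∑ f, (A e f : ℝ) * q f - b e - p e * k e) = A.det * q f0 - cst - cf * p e0 * k e0 := by
          have e1 : ∀ e, (A.adjugate f0 e : ℝ) * (∑ f, (A e f : ℝ) * q f - b e - p e * k e) =
            (A.adjugate f0 e : ℝ) * (∑ f, (A e f : ℝ) * q f) - (A.adjugate f0 e : ℝ) * b e - (A.adjugate f0 e : ℝ) * (p e * k e) := fun e => by ring
          simp_rw [e1, sum_sub_distrib]
          rw [hid, Fin.sum_univ_succAbove (fun e => (A.adjugate f0 e : ℝ) * (p e * k e)) e0, hcst]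
          have : ∀ e, (k (e0.succAbove e)) = k' e := fun e => congrFun hkπ e
          simp_rw [this]
          rw [hcf]; ring
        rw [hexp] at hdev
        have hq0 : |(A.det : ℝ) * q f0| ≤ D * (2 * Xs) := by
          rw [abs_mul]
          exact mul_le_mul hdetb (by rw [abs_of_nonneg (by linarith [(hq f0).1])]; exact (hq f0).2) (abs_nonneg _) (by linarith)
        have hpos : H0 ≤ |cf * p e0| := by
          rw [abs_mul, abs_of_nonneg (by linarith [hp e0] : (0:ℝ) ≤ p e0)]
          nlinarith [hp e0]
        have hne : cf * p e0 ≠ 0 := by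
          intro h; rw [h, abs_zero] at hpos; linarith
        have e2 : (k e0 : ℝ) - - cst / (cf * p e0) = (cf * p e0 * k e0 + cst) / (cf * p e0) := by
          rw [add_div, mul_div_cancel_left₀ _ hne]; ring
        rw [e2, abs_div, hB]
        have hnum : |cf * p e0 * k e0 + cst| ≤ 2 * D * Xs + (d+1) * D * Y := by
          rw [abs_le] at hdev hq0 ⊢
          constructor <;> linarith [hdev.1, hdev.2, hq0.1, hq0.2]
        have : 0 ≤ 2 * D * Xs + (d+1) * D * Y := by positivity
        apply div_le_div₀ this hnum (by linarith) hpos)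
      refine h1.trans ?_
      have hYs := hY f0
      have h3 : (d:ℝ) + 1 ≤ n0 := by exact_mod_cast hd
      have h4 : (1:ℝ) ≤ n0 := by linarith [(Nat.cast_nonneg d : (0:ℝ) ≤ d)]
      push_cast at hYs
      rw [hB]
      have hYb : Y ≤ 2 * m * n0 * Xs := hYs.trans (by
        apply mul_le_mul_of_nonneg_right _ hXs0.le
        apply mul_le_mul_of_nonneg_left _ (by linarith)
        linarith [(Nat.cast_nonneg d : (0:ℝ) ≤ d)])
      have h5 : ((d:ℝ)+1) * D * Y ≤ n0 * D * (2 * m * n0 * Xs) :=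
        mul_le_mul (mul_le_mul_of_nonneg_right h3 (by linarith)) hYb hY0 (by positivity)
      have h6 : (1:ℝ) ≤ Xs / H0 := by rw [le_div_iff₀ (by linarith)]; linarith [hX f0]
      have h7 : (2 * D * Xs + (d+1) * D * Y) / H0 ≤ (2 * D + 2 * n0 * n0 * m * D) * (Xs / H0) := by
        rw [← mul_div_assoc]
        apply div_le_div_of_nonneg_right _ (by linarith)
        nlinarith
      have h8 : 1 + 2 * (2 * D + 2 * n0 * n0 * m * D) ≤ 10 * m * (n0 + 1) ^ 2 * D := by
        have : D ≤ m * D := by nlinarith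
        have : 0 ≤ m * D * n0 := by positivity
        have : 0 ≤ m * D * n0 * n0 := by positivity
        nlinarith
      calc _ ≤ 2 * ((2 * D + 2 * n0 * n0 * m * D) * (Xs / H0)) + Xs / H0 := by linarith
        _ = (1 + 2 * (2 * D + 2 * n0 * n0 * m * D)) * (Xs / H0) := by ring
        _ ≤ (10 * m * (n0 + 1) ^ 2 * D) * (Xs / H0) := mul_le_mul_of_nonneg_right h8 (by linarith)
        _ = _ := by ring
    have hcard : (S.card : ℝ) = ∑ k' ∈ S.image π, ((S.filter (fun k => π k = k')).card : ℝ) := by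
      rw [← Nat.cast_sum, ← card_eq_sum_card_fiberwise (fun k hk => mem_coe.2 (mem_image_of_mem _ hk))]
    rw [hcard, Fin.prod_univ_succAbove _ f0]
    calc _ ≤ ∑ k' ∈ S.image π, 10 * m * (n0 + 1) ^ 2 * D * Xs / H0 := sum_le_sum hfib
      _ = ((S.image π).card : ℝ) * (10 * m * (n0 + 1) ^ 2 * D * Xs / H0) := by simp
      _ ≤ _ := by
        rw [mul_comm]
        apply mul_le_mul_of_nonneg_left ih'
        have := hX0 f0
        positivity

/-- weighted count -/
theorem lattice_weighted (m : ℝ) (hm : 1 ≤ m) (d : ℕ) (D : ℝ) (hD1 : 1 ≤ D) (H0 : ℝ) (hH0 : 1 ≤ H0)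
    (hD : ∀ k ≤ d, (k.factorial : ℝ) * m ^ k ≤ D) (r : ℕ) (P : Finset ℕ)
    (hP : ∀ x ∈ P, H0 ≤ (x:ℝ) ∧ (x:ℝ) < H0 * 2 ^ r)
    (A : Matrix (Fin d) (Fin d) ℤ) (hA : ∀ i j, |(A i j : ℝ)| ≤ m) (hdet : A.det ≠ 0)
    (p : Fin d → ℕ) (b : Fin d → ℤ) (hp : ∀ e, H0 ≤ p e) :
    ∑ q ∈ (Fintype.piFinset (fun _ : Fin d => P)).filter (fun q => ∀ e, (p e : ℤ) ∣ ∑ f, A e f * (q f : ℤ) - b e),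
      ∏ f, (1 : ℝ) / q f ≤ (r * (10 * m * (d + 1) ^ 2 * D / H0)) ^ d := by
  set T := (Fintype.piFinset (fun _ : Fin d => P)).filter (fun q => ∀ e, (p e : ℤ) ∣ ∑ f, A e f * (q f : ℤ) - b e) with hT
  have hH0' : (0:ℝ) < H0 := by linarith
  have hidx : ∀ x : ℕ, ∃ i : ℕ, x ∈ P → i < r ∧ H0 * 2 ^ i ≤ (x:ℝ) ∧ (x:ℝ) ≤ 2 * (H0 * 2 ^ i) := by
    intro x
    by_cases hx : x ∈ P
    swap
    · exact ⟨0, fun h => absurd h hx⟩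
    obtain ⟨h1, h2⟩ := hP x hx
    have hex : ∃ k : ℕ, (x:ℝ) < H0 * 2 ^ k := ⟨r, h2⟩
    have hk := Nat.find_spec hex
    have hkr := Nat.find_min' hex h2
    rcases hz : Nat.find hex with _ | i
    · rw [hz] at hk; simp at hk; linarith
    · rw [hz] at hk hkr
      refine ⟨i, fun _ => ⟨by omega, ?_, ?_⟩⟩
      · have := Nat.find_min hex (m := i) (by omega)
        linarith
      · rw [pow_succ] at hk; linarith
  choose idx hidx using hidx
  have hfw : ∀ I ∈ Fintype.piFinset (fun _ : Fin d => range r),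
      ∑ q ∈ T.filter (fun q => (fun f => idx (q f)) = I), ∏ f, (1 : ℝ) / q f ≤ (10 * m * (d + 1) ^ 2 * D / H0) ^ d := by
    intro I _
    set TI := T.filter (fun q => (fun f => idx (q f)) = I) with hTI
    set X : Fin d → ℝ := fun f => H0 * 2 ^ (I f) with hX
    have hX0 : ∀ f, 0 < X f := fun f => by positivity
    have hmem : ∀ q ∈ TI, ∀ f, X f ≤ (q f : ℝ) ∧ (q f : ℝ) ≤ 2 * X f := by
      intro q hq f
      obtain ⟨h1, h2⟩ := mem_filter.1 hq
      obtain ⟨h3, h4⟩ := mem_filter.1 h1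
      have := hidx (q f) (Fintype.mem_piFinset.1 h3 f)
      simp only [hX, ← h2]; exact this.2
    have hdiv : ∀ q : Fin d → ℕ, ∃ k : Fin d → ℤ, q ∈ TI → ∀ e, ∑ f, A e f * (q f : ℤ) - b e = p e * k e := by
      intro q
      by_cases hq : q ∈ TI
      · have := (mem_filter.1 (mem_filter.1 hq).1).2
        choose k hk using this
        exact ⟨k, fun _ => hk⟩
      · exact ⟨0, fun h => absurd h hq⟩
    choose kk hkk using hdiv
    have hinj : Set.InjOn kk TI := by
      intro q hq q' hq' h
      have h1 := hkk q hq
      have h2 := hkk q' hq'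
      have h3 : A.mulVec (fun f => (q f : ℤ)) = A.mulVec (fun f => (q' f : ℤ)) := by
        funext e
        simp only [Matrix.mulVec, dotProduct]
        have := h1 e; have := h2 e
        rw [h] at h1
        linarith [h1 e, h2 e]
      have h4 : A.mulVec ((fun f => (q f : ℤ)) - (fun f => (q' f : ℤ))) = 0 := by
        rw [Matrix.mulVec_sub, h3, sub_self]
      have h5 := Matrix.eq_zero_of_mulVec_eq_zero hdet h4
      funext f
      have := congrFun h5 f
      simp at this; omega
    have hc := lattice_k m hm d D hD1 H0 hH0 d le_rfl hD A hA hdet (fun e => p e) (fun e => b e) hp X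
      (fun f => by simp only [hX]; nlinarith [one_le_pow₀ (M₀ := ℝ) (one_le_two) (n := I f)]) 0 le_rfl (by intro f; simp)
      (TI.image kk) (by
        intro k hk
        obtain ⟨q, hq, rfl⟩ := mem_image.1 hk
        refine ⟨fun f => q f, hmem q hq, fun e => ?_⟩
        have := congrArg (Int.cast : ℤ → ℝ) (hkk q hq e)
        push_cast at this
        rw [this]; simp)
    rw [card_image_of_injOn hinj] at hc
    calc _ ≤ ∑ q ∈ TI, ∏ f, 1 / X f := by
          apply sum_le_sum; intro q hq
          apply prod_le_prod
          · intros; positivity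
          · intro f _; exact one_div_le_one_div_of_le (hX0 f) (hmem q hq f).1
      _ = TI.card * ∏ f, 1 / X f := by simp
      _ ≤ (∏ f, (10 * m * (d + 1) ^ 2 * D * X f / H0)) * ∏ f, 1 / X f := by
          apply mul_le_mul_of_nonneg_right hc
          apply prod_nonneg; intro f _; exact (one_div_pos.2 (hX0 f)).le
      _ = _ := by
          rw [← prod_mul_distrib]
          rw [prod_congr rfl (g := fun _ => 10 * m * (d + 1) ^ 2 * D / H0)]
          · simp [div_pow]
          · intro f _
            have := (hX0 f).ne'
            rw [div_mul_div_comm, mul_one, mul_div_mul_right _ _ this]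
  have hmaps : ∀ q ∈ T, (fun f => idx (q f)) ∈ Fintype.piFinset (fun _ : Fin d => range r) := by
    intro q hq
    rw [Fintype.mem_piFinset]
    intro f
    exact mem_range.2 (hidx (q f) (Fintype.mem_piFinset.1 (mem_filter.1 hq).1 f)).1
  rw [← sum_fiberwise_of_maps_to hmaps]
  calc _ ≤ ∑ I ∈ Fintype.piFinset (fun _ : Fin d => range r), (10 * m * (d + 1) ^ 2 * D / H0) ^ d := sum_le_sum hfw
    _ = _ := by simp [mul_pow]

/-- triangular sum -/
lemma tri_sum_aux {ι : Type*} [Fintype ι] [DecidableEq ι] (P : Finset ℕ) (ρ : ι → ℕ) (hρ : Function.Injective ρ)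
    (a : ι → (ι → ℕ) → ℝ) (ha : ∀ v g, 0 ≤ a v g) (c : ι → ℝ) (hc0 : ∀ v, 0 ≤ c v)
    (hdep : ∀ v g g', (∀ u, ρ u ≤ ρ v → g u = g' u) → a v g = a v g')
    (hc : ∀ v g, ∑ p ∈ P, a v (Function.update g v p) ≤ c v) (k : ℕ) (g0 : ι → ℕ) :
    ∑ g ∈ Fintype.piFinset (fun v => if ρ v < k then P else {g0 v}), ∏ v ∈ univ.filter (fun v => ρ v < k), a v g
      ≤ ∏ v ∈ univ.filter (fun v => ρ v < k), c v := by
  induction k with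
  | zero => simp
  | succ k ih =>
    by_cases hex : ∃ v, ρ v = k
    swap
    · have e : ∀ v, (ρ v < k + 1) = (ρ v < k) := by
        intro v; rw [Nat.lt_succ_iff_lt_or_eq]
        simp only [eq_iff_iff]
        exact ⟨fun h => h.resolve_right (fun h2 => hex ⟨v, h2⟩), Or.inl⟩
      simp only [e]; exact ih
    obtain ⟨v, hv⟩ := hex
    have hlt : ∀ u, u ≠ v → (ρ u < k + 1 ↔ ρ u < k) := by
      intro u hu
      have : ρ u ≠ k := fun h => hu (hρ (h.trans hv.symm))
      omega
    have hset : univ.filter (fun u => ρ u < k + 1) = insert v (univ.filter (fun u => ρ u < k)) := by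
      ext u
      simp only [mem_filter, mem_univ, true_and, mem_insert]
      by_cases hu : u = v
      · subst hu; simp; omega
      · simp [hlt u hu, hu]
    have hnv : v ∉ univ.filter (fun u => ρ u < k) := by simp; omega
    rw [hset, prod_insert hnv]
    have hbij : ∑ g ∈ Fintype.piFinset (fun v => if ρ v < k + 1 then P else {g0 v}), ∏ u ∈ insert v (univ.filter (fun u => ρ u < k)), a u g
        = ∑ x ∈ (Fintype.piFinset (fun v => if ρ v < k then P else {g0 v})) ×ˢ P,
            ∏ u ∈ insert v (univ.filter (fun u => ρ u < k)), a u (Function.update x.1 v x.2) := by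
      symm
      apply sum_nbij' (fun x => Function.update x.1 v x.2) (fun g => (Function.update g v (g0 v), g v))
      · intro x hx
        obtain ⟨h1, h2⟩ := mem_product.1 hx
        rw [Fintype.mem_piFinset] at h1 ⊢
        intro u
        by_cases hu : u = v
        · subst hu; simp [hv, h2]
        · rw [Function.update_of_ne hu]
          have := h1 u
          simpa only [hlt u hu] using this
      · intro g hg
        rw [Fintype.mem_piFinset] at hg
        refine mem_product.2 ⟨?_, ?_⟩
        · rw [Fintype.mem_piFinset]
          intro u
          by_cases hu : u = v
          · subst hu; simp [hv]
          · simp only [Function.update_of_ne hu]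
            have := hg u
            simpa only [hlt u hu] using this
        · have := hg v
          simpa [hv] using this
      · intro x hx
        obtain ⟨h1, h2⟩ := mem_product.1 hx
        rw [Fintype.mem_piFinset] at h1
        have h3 := h1 v
        simp [hv] at h3
        ext u
        · simp only [Function.update_idem]
          rw [← h3]; simp
        · simp
      · intro g hg; simp
      · intro x hx; rfl
    rw [hbij, sum_product]
    have hstep : ∀ h ∈ Fintype.piFinset (fun v => if ρ v < k then P else {g0 v}),
        ∑ p ∈ P, ∏ u ∈ insert v (univ.filter (fun u => ρ u < k)), a u (Function.update h v p) ≤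
          c v * ∏ u ∈ univ.filter (fun u => ρ u < k), a u h := by
      intro h _
      have : ∀ p, ∏ u ∈ insert v (univ.filter (fun u => ρ u < k)), a u (Function.update h v p) =
          a v (Function.update h v p) * ∏ u ∈ univ.filter (fun u => ρ u < k), a u h := by
        intro p
        rw [prod_insert hnv]
        congr 1
        apply prod_congr rfl
        intro u hu
        apply hdep
        intro w hw
        have : w ≠ v := by
          intro hwv; subst hwv
          simp at hu; omega
        rw [Function.update_of_ne this]
      simp_rw [this, ← sum_mul]
      exact mul_le_mul_of_nonneg_right (hc v h) (prod_nonneg fun u _ => ha u h)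
    refine (sum_le_sum hstep).trans ?_
    rw [← mul_sum]
    exact mul_le_mul_of_nonneg_left ih (hc0 v)

lemma tri_sum {ι : Type*} [Fintype ι] [DecidableEq ι] (P : Finset ℕ) (ρ : ι → ℕ) (hρ : Function.Injective ρ)
    (a : ι → (ι → ℕ) → ℝ) (ha : ∀ v g, 0 ≤ a v g) (c : ι → ℝ) (hc0 : ∀ v, 0 ≤ c v)
    (hdep : ∀ v g g', (∀ u, ρ u ≤ ρ v → g u = g' u) → a v g = a v g')
    (hc : ∀ v g, ∑ p ∈ P, a v (Function.update g v p) ≤ c v) :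
    ∑ g ∈ Fintype.piFinset (fun _ : ι => P), ∏ v, a v g ≤ ∏ v, c v := by
  have h := tri_sum_aux P ρ hρ a ha c hc0 hdep hc (univ.sup ρ + 1) (fun _ => 0)
  have e : ∀ v, (ρ v < univ.sup ρ + 1) = True := fun v => by
    simp only [eq_iff_iff, iff_true]
    exact Nat.lt_succ_of_le (Finset.le_sup (mem_univ v))
  simpa [e] using h

lemma primes_dvd_sum (P : Finset ℕ) (hP : ∀ p ∈ P, Nat.Prime p) (H0 : ℝ) (hH0 : 0 < H0)
    (hP2 : ∀ p ∈ P, H0 ≤ (p:ℝ)) (T : ℤ) (hT : T ≠ 0) (Q : ℕ) (hQ : |T| < 2 ^ Q) :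
    ∑ p ∈ P.filter (fun p : ℕ => (p:ℤ) ∣ T), (1:ℝ) / p ≤ Q / H0 := by
  set S := P.filter (fun p : ℕ => (p:ℤ) ∣ T) with hS
  have h1 : (∏ p ∈ S, p : ℕ) ∣ (T.natAbs : ℕ) := by
    apply Finset.prod_primes_dvd
    · intro p hp; exact (hP p (mem_filter.1 hp).1).prime
    · intro p hp
      exact Int.natCast_dvd.1 (mem_filter.1 hp).2
  have h2 : 2 ^ S.card ≤ ∏ p ∈ S, p := by
    rw [← prod_const]
    apply prod_le_prod'
    intro p hp; exact (hP p (mem_filter.1 hp).1).two_le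
  have h3 := Nat.le_of_dvd (Int.natAbs_pos.2 hT) h1
  have h4 : T.natAbs < 2 ^ Q := by
    have : ((T.natAbs : ℕ) : ℤ) < ((2 ^ Q : ℕ) : ℤ) := by rw [Int.natCast_natAbs]; exact_mod_cast hQ
    exact_mod_cast this
  have h5 : S.card ≤ Q := ((Nat.pow_lt_pow_iff_right (by norm_num : 1 < 2)).1 ((h2.trans h3).trans_lt h4)).le
  calc _ ≤ ∑ p ∈ S, 1 / H0 := by
        apply sum_le_sum; intro p hp
        exact one_div_le_one_div_of_le hH0 (hP2 p (mem_filter.1 hp).1)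
    _ = S.card / H0 := by simp [div_eq_mul_inv]
    _ ≤ _ := by gcongr

/-- alternating partial sums -/
def sg {m : ℕ} (z : Fin m → ℕ) (i : ℕ) : ℤ := ∑ u : Fin m, if u.1 < i then (-1) ^ u.1 * (z u : ℤ) else 0

lemma sg_sub {m : ℕ} (z : Fin m → ℕ) (i j : ℕ) (h : i ≤ j) :
    sg z j - sg z i = ∑ u : Fin m, if i ≤ u.1 ∧ u.1 < j then (-1) ^ u.1 * (z u : ℤ) else 0 := by
  unfold sg
  rw [← sum_sub_distrib]
  apply sum_congr rfl
  intro u _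
  by_cases h1 : u.1 < i
  · have : u.1 < j := by omega
    simp [h1, this]
  · by_cases h2 : u.1 < j <;> simp [h1, h2] <;> omega

lemma sg_abs {m : ℕ} (z : Fin m → ℕ) (i j : ℕ) (h : i ≤ j) (B : ℕ) (hB : ∀ u, z u ≤ B) :
    |sg z j - sg z i| ≤ m * B := by
  rw [sg_sub z i j h]
  refine (abs_sum_le_sum_abs _ _).trans ?_
  calc _ ≤ ∑ u : Fin m, (B:ℤ) := by
        apply sum_le_sum; intro u _
        split_ifs
        · rw [abs_mul, abs_pow, abs_neg, abs_one, one_pow, one_mul, Nat.abs_cast]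
          exact_mod_cast hB u
        · simp
    _ = _ := by simp

noncomputable def kz {m : ℕ} (U : Finset (Fin m)) (z : Fin m → ℕ) (t : Fin m) : Fin m :=
  if h : t ∈ U then (U.filter (fun t' => z t' = z t)).min' ⟨t, mem_filter.2 ⟨h, rfl⟩⟩ else t

lemma kz_not {m : ℕ} {U : Finset (Fin m)} {z : Fin m → ℕ} {t : Fin m} (h : t ∉ U) : kz U z t = t := by
  simp [kz, h]

lemma kz_mem {m : ℕ} {U : Finset (Fin m)} {z : Fin m → ℕ} {t : Fin m} (h : t ∈ U) :
    kz U z t ∈ U ∧ z (kz U z t) = z t := by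
  have := min'_mem (U.filter (fun t' => z t' = z t)) ⟨t, mem_filter.2 ⟨h, rfl⟩⟩
  rw [kz, dif_pos h]
  exact mem_filter.1 this

lemma kz_le {m : ℕ} (U : Finset (Fin m)) (z : Fin m → ℕ) (t : Fin m) : kz U z t ≤ t := by
  by_cases h : t ∈ U
  · rw [kz, dif_pos h]
    exact min'_le (U.filter (fun t' => z t' = z t)) t (mem_filter.2 ⟨h, rfl⟩)
  · rw [kz_not h]

lemma kz_val {m : ℕ} (U : Finset (Fin m)) (z : Fin m → ℕ) (t : Fin m) : z (kz U z t) = z t := by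
  by_cases h : t ∈ U
  · exact (kz_mem h).2
  · rw [kz_not h]

lemma kz_congr {m : ℕ} {U : Finset (Fin m)} {z : Fin m → ℕ} {t t' : Fin m} (h : t ∈ U) (h' : t' ∈ U)
    (hz : z t = z t') : kz U z t = kz U z t' := by
  simp [kz, h, h', hz]

lemma kz_canon {m : ℕ} (U : Finset (Fin m)) (z : Fin m → ℕ) : Canon (kz U z) := by
  intro t
  refine ⟨kz_le U z t, ?_⟩
  by_cases h : t ∈ U
  · exact kz_congr (kz_mem h).1 h (kz_mem h).2
  · rw [kz_not h, kz_not h]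

lemma kz_mem_iff {m : ℕ} (U : Finset (Fin m)) (z : Fin m → ℕ) (t : Fin m) : kz U z t ∈ U ↔ t ∈ U := by
  by_cases h : t ∈ U
  · simp [h, (kz_mem h).1]
  · rw [kz_not h]

def zBInj {m : ℕ} (l : ℕ) (z : Fin m → ℕ) : Prop :=
  ∀ t t' : Fin m, t.1 / l = t'.1 / l → z t = z t' → t = t'

lemma kz_BInj {m : ℕ} (l : ℕ) (U : Finset (Fin m)) (z : Fin m → ℕ) (h : zBInj l z) : BInj l (kz U z) := by
  intro t t' htt hk
  apply h t t' htt
  rw [← kz_val U z t, ← kz_val U z t', hk]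

def cong {m : ℕ} (U : Finset (Fin m)) (z : Fin m → ℕ) : Prop :=
  ∀ t ∈ U, ∀ t' ∈ U, z t = z t' → (z t : ℤ) ∣ sg z t'.1 - sg z t.1

/-- high branch case for a fixed pattern -/
theorem caseA {m : ℕ} (hm : 0 < m) (nb l d : ℕ) (hmn : m = nb * l) (P : Finset ℕ) (H0 : ℝ) (hH0 : 1 ≤ H0)
    (r : ℕ) (hP : ∀ x ∈ P, H0 ≤ (x:ℝ) ∧ (x:ℝ) < H0 * 2 ^ r) (L : ℝ) (hL : L = ∑ p ∈ P, (1:ℝ) / p) (hL1 : 1 ≤ L)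
    (D : ℝ) (hD1 : 1 ≤ D) (hD : ∀ k ≤ d, (k.factorial : ℝ) * (m:ℝ) ^ k ≤ D)
    (U : Finset (Fin m)) (κ : Fin m → Fin m) (hκ : Canon κ) (hB : BInj l κ)
    (hβ : 4 * (5 * d + 2 * nb) + 2 ≤ (branch hm κ hκ).card) :
    ∑ z ∈ (Fintype.piFinset (fun _ : Fin m => P)).filter (fun z => kz U z = κ ∧ cong U z),
      ∏ t ∈ univ.filter (fun t => κ t = t), (1:ℝ) / z t ≤ L ^ m * (r * (10 * m * (d + 1) ^ 2 * D / H0)) ^ d := by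
  set Z := (Fintype.piFinset (fun _ : Fin m => P)).filter (fun z => kz U z = κ ∧ cong U z) with hZ
  have hm1 : (1:ℝ) ≤ m := by exact_mod_cast hm
  have hH0' : (0:ℝ) < H0 := by linarith
  obtain ⟨Λ, hΛc, hΛ⟩ := rank_lemma (rlab hm κ hκ) m l (2 * nb) d hm
    (fun v => ⟨v.1.1, v.1.2, Subtype.ext (by simp only [rlab]; rw [clip_lt hm _ v.1.2]; exact v.2)⟩)
    (fun t t' ht ht' h1 h2 => by
      have := (rlab_eq hm κ hκ t t' ht ht').1 h2
      exact congrArg Fin.val (hB _ _ h1 this))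
    (by have := endlab_card hm nb l hmn κ hκ; refine le_trans (le_of_eq ?_) this; unfold endlab isEnd; congr) (by exact hβ)
  -- enumerate Λ
  let en : Fin d ≃ {x // x ∈ Λ} := (Λ.equivFinOfCardEq hΛc).symm
  -- rows
  let ι := {x : Fin m × Fin m // x.1 < x.2 ∧ κ x.1 = κ x.2 ∧ (⟨κ x.2, (hκ _).2⟩ : KRep κ) ∉ Λ}
  let Mx : ι → Fin d → ℤ := fun x f => ∑ u : Fin m, if x.1.1.1 ≤ u.1 ∧ u.1 < x.1.2.1 ∧ κ u = (en f).1.1 then (-1) ^ u.1 else 0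
  have hker : ∀ φ : Fin d → ℚ, (Matrix.of (fun x f => (Mx x f : ℚ))).mulVec φ = 0 → φ = 0 := by
    intro φ hφ
    let φ' : KRep κ → ℚ := fun v => if h : v ∈ Λ then φ (en.symm ⟨v, h⟩) else 0
    have h1 := hΛ φ' (by
      intro i t hit htm hlab hnot
      have him : i < m := by omega
      have hx : κ ⟨i, him⟩ = κ ⟨t, htm⟩ := (rlab_eq hm κ hκ i t him htm).1 hlab
      have hrl : ∀ (u : ℕ) (hu : u < m), rlab hm κ hκ u = ⟨κ ⟨u, hu⟩, (hκ _).2⟩ := by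
        intro u hu; apply Subtype.ext; simp only [rlab]; rw [clip_lt hm u hu]
      rw [hrl t htm] at hnot
      have h2 := congrFun hφ ⟨(⟨i, him⟩, ⟨t, htm⟩), hit, hx, hnot⟩
      simp only [Matrix.mulVec, dotProduct, Matrix.of_apply, Pi.zero_apply, Mx] at h2
      refine Eq.trans ?_ h2
      push_cast
      simp_rw [sum_mul]
      rw [sum_comm]
      have e1 : ∑ u ∈ Ico i t, (if rlab hm κ hκ u ∈ Λ then (-1:ℚ) ^ u * φ' (rlab hm κ hκ u) else 0)
          = ∑ u : Fin m, if i ≤ u.1 ∧ u.1 < t then (if rlab hm κ hκ u.1 ∈ Λ then (-1:ℚ) ^ u.1 * φ' (rlab hm κ hκ u.1) else 0) else 0 := by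
        rw [Fin.sum_univ_eq_sum_range (fun u => if i ≤ u ∧ u < t then (if rlab hm κ hκ u ∈ Λ then (-1:ℚ) ^ u * φ' (rlab hm κ hκ u) else 0) else 0) m]
        have hI : Ico i t = (range m).filter (fun u => i ≤ u ∧ u < t) := by
          ext u; simp only [mem_Ico, mem_filter, mem_range]; omega
        rw [hI, sum_filter]
      refine (Finset.sum_congr rfl fun u _ => by congr).trans (e1.trans ?_)
      apply sum_congr rfl
      intro u _
      by_cases hu : i ≤ u.1 ∧ u.1 < t
      swap
      · rw [if_neg hu]
        symm; apply sum_eq_zero; intro f _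
        rw [if_neg (by tauto)]; simp
      rw [if_pos hu]
      have hru := hrl u.1 u.2
      by_cases hul : rlab hm κ hκ u.1 ∈ Λ
      · rw [if_pos hul]
        rw [sum_eq_single (en.symm ⟨_, hul⟩)]
        · rw [if_pos ⟨hu.1, hu.2, by rw [Equiv.apply_symm_apply]; exact (congrArg Subtype.val hru).symm⟩]
          simp only [φ', hul, dif_pos]
        · intro f _ hf
          rw [if_neg]
          · simp
          · rintro ⟨_, _, h⟩
            apply hf
            rw [Equiv.eq_symm_apply]
            apply Subtype.ext; apply Subtype.ext
            exact (h.symm.trans (congrArg Subtype.val hru).symm)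
        · simp
      · rw [if_neg hul]
        symm; apply sum_eq_zero; intro f _
        rw [if_neg]
        · simp
        · rintro ⟨_, _, h⟩
          apply hul
          rw [hru]
          convert (en f).2
          )
    funext f
    have h2 := h1 (en f).1 (en f).2
    simpa [φ'] using h2
  obtain ⟨s, hs⟩ := minor_exists _ hker
  set A : Matrix (Fin d) (Fin d) ℤ := fun e f => Mx (s e) f with hAdef
  have hdet : A.det ≠ 0 := by
    intro h
    apply hs
    have : (Matrix.of (fun x f => (Mx x f : ℚ))).submatrix s id = A.map (Int.castRingHom ℚ) := by
      ext e f; rfl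
    rw [this, ← RingHom.mapMatrix_apply, ← RingHom.map_det, h]; simp
  have hAb : ∀ i j, |(A i j : ℝ)| ≤ m := by
    intro i j
    simp only [hAdef, Mx]
    push_cast
    refine (abs_sum_le_sum_abs _ _).trans ?_
    calc _ ≤ ∑ u : Fin m, (1:ℝ) := by
          apply sum_le_sum; intro u _
          split_ifs <;> simp
      _ = _ := by simp
  -- fibers
  let inL : Fin m → Prop := fun t => (⟨κ t, (hκ _).2⟩ : KRep κ) ∈ Λ
  let y : (Fin m → ℕ) → (Fin m → ℕ) := fun z t => if inL t then 0 else if κ t = t then z t else 0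
  let q : (Fin m → ℕ) → (Fin d → ℕ) := fun z f => z (en f).1.1
  -- weights
  let R1 := univ.filter (fun t : Fin m => κ t = t ∧ ¬ inL t)
  let R2 := univ.filter (fun t : Fin m => κ t = t ∧ inL t)
  have hw : ∀ z : Fin m → ℕ, ∏ t ∈ univ.filter (fun t => κ t = t), (1:ℝ) / z t = (∏ t ∈ R1, (1:ℝ) / y z t) * ∏ f, (1:ℝ) / q z f := by
    intro z
    rw [← prod_filter_mul_prod_filter_not (univ.filter (fun t => κ t = t)) (fun t => ¬ inL t)]
    rw [filter_filter, filter_filter]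
    congr 1
    · apply prod_congr rfl
      intro t ht
      simp only [mem_filter, mem_univ, true_and] at ht
      simp [y, ht.1, ht.2]
    · symm
      apply prod_nbij (fun f => (en f).1.1)
      · intro f _
        simp only [mem_filter, mem_univ, true_and, not_not, inL]
        refine ⟨(en f).1.2, ?_⟩
        convert (en f).2
        exact (en f).1.2
      · intro f _ f' _ h
        apply en.injective
        exact Subtype.ext (Subtype.ext h)
      · intro t ht
        simp only [coe_filter, mem_univ, true_and, Set.mem_ofPred_eq, not_not, inL] at ht
        refine ⟨en.symm ⟨_, ht.2⟩, by simp, ?_⟩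
        simp [ht.1]
      · intro f _; rfl
  have hfib : ∀ y0 ∈ Z.image y, ∑ z ∈ Z.filter (fun z => y z = y0), ∏ f, (1:ℝ) / q z f ≤ (r * (10 * m * (d + 1) ^ 2 * D / H0)) ^ d := by
    intro y0 hy0
    have hval : ∀ z ∈ Z, ∀ u, z u = z (κ u) := by
      intro z hz u
      have := (mem_filter.1 hz).2.1
      rw [← this]; exact (kz_val U z u).symm
    have hyv : ∀ z ∈ Z.filter (fun z => y z = y0), ∀ u, ¬ inL u → z u = y0 (κ u) := by
      intro z hz u hu
      obtain ⟨h1, h2⟩ := mem_filter.1 hz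
      rw [hval z h1 u, ← h2]
      have h3 : ¬ inL (κ u) := by
        simp only [inL] at hu ⊢
        convert hu using 3
        exact (hκ u).2
      simp only [y]
      rw [if_neg h3, if_pos (hκ u).2]
    have hlv : ∀ z ∈ Z, ∀ u (h : inL u), z u = q z (en.symm ⟨_, h⟩) := by
      intro z hz u h
      simp only [q, Equiv.apply_symm_apply]
      exact hval z hz u
    have hinj : Set.InjOn q (Z.filter (fun z => y z = y0)) := by
      intro z hz z' hz' h
      funext u
      by_cases hu : inL u
      · rw [hlv z (mem_filter.1 hz).1 u hu, hlv z' (mem_filter.1 hz').1 u hu, h]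
      · rw [hyv z hz u hu, hyv z' hz' u hu]
    rw [← sum_image (f := fun q : Fin d → ℕ => ∏ f, (1:ℝ) / q f) hinj]
    rcases (Z.filter (fun z => y z = y0)).eq_empty_or_nonempty with hemp | ⟨z1, hz1⟩
    · rw [hemp]; simp; positivity
    let b : Fin d → ℤ := fun e => - ∑ u : Fin m, if (s e).1.1.1 ≤ u.1 ∧ u.1 < (s e).1.2.1 ∧ ¬ inL u then (-1) ^ u.1 * (y0 (κ u) : ℤ) else 0
    have hlw := lattice_weighted m hm1 d D hD1 H0 hH0 hD r P hP A hAb hdet (fun e => y0 (κ (s e).1.2)) b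
      (by
        intro e
        have h1 := hyv z1 hz1 (s e).1.2 (s e).2.2.2
        show H0 ≤ ((y0 (κ (s e).1.2) : ℕ) : ℝ)
        rw [← h1]
        exact (hP _ (Fintype.mem_piFinset.1 (mem_filter.1 (mem_filter.1 hz1).1).1 _)).1)
    refine le_trans (sum_le_sum_of_subset_of_nonneg ?_ ?_) hlw
    · intro q0 hq0
      obtain ⟨z, hz, rfl⟩ := mem_image.1 hq0
      have hzZ := (mem_filter.1 hz).1
      rw [mem_filter]
      constructor
      · rw [Fintype.mem_piFinset]; intro f
        exact Fintype.mem_piFinset.1 (mem_filter.1 hzZ).1 _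
      · intro e
        show ((y0 (κ (s e).1.2) : ℕ) : ℤ) ∣ _
        have hlt := (s e).2.1
        rw [← hyv z hz (s e).1.2 (s e).2.2.2]
        obtain ⟨hkz, hcg⟩ := (mem_filter.1 hzZ).2
        -- positions in U
        have hU2 : (s e).1.2 ∈ U := by
          by_contra hU
          have h3 : κ (s e).1.2 = (s e).1.2 := (congrFun hkz _).symm.trans (kz_not hU)
          have h4 := (hκ (s e).1.1).1
          rw [(s e).2.2.1, h3] at h4
          exact absurd hlt (not_lt.2 h4)
        have hU1 : (s e).1.1 ∈ U := by
          have := (kz_mem_iff U z (s e).1.2).2 hU2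
          rw [hkz] at this
          rw [← kz_mem_iff U z, hkz, (s e).2.2.1]; exact this
        have hzz : z (s e).1.1 = z (s e).1.2 := by
          rw [hval z hzZ (s e).1.1, hval z hzZ (s e).1.2, (s e).2.2.1]
        have hdv := hcg _ hU1 _ hU2 hzz
        rw [hzz, sg_sub z _ _ (le_of_lt hlt)] at hdv
        convert hdv using 1
        simp only [hAdef, Mx, b]
        simp_rw [sum_mul]
        rw [sum_comm, sub_neg_eq_add, ← sum_add_distrib]
        apply sum_congr rfl
        intro u _
        by_cases hu : (s e).1.1.1 ≤ u.1 ∧ u.1 < (s e).1.2.1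
        swap
        · rw [if_neg hu, if_neg (by tauto)]
          rw [add_zero]
          apply sum_eq_zero; intro f _
          rw [if_neg (by tauto)]; simp
        rw [if_pos hu]
        by_cases hul : inL u
        · rw [if_neg (by tauto), add_zero, sum_eq_single (en.symm ⟨_, hul⟩)]
          · rw [if_pos ⟨hu.1, hu.2, by rw [Equiv.apply_symm_apply]⟩, hlv z hzZ u hul]
          · intro f _ hf
            rw [if_neg]
            · simp
            · rintro ⟨_, _, h⟩
              apply hf
              rw [Equiv.eq_symm_apply]
              apply Subtype.ext; apply Subtype.ext
              exact h.symm
          · simp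
        · rw [if_pos ⟨hu.1, hu.2, hul⟩, ← hyv z hz u hul, sum_eq_zero, zero_add]
          intro f _
          rw [if_neg]
          · simp
          · rintro ⟨_, _, h⟩
            apply hul
            simp only [inL]
            convert (en f).2
    · intros; positivity
  rw [← sum_fiberwise_of_maps_to (fun z hz => mem_image_of_mem y hz)]
  have hstep : ∀ y0 ∈ Z.image y, ∑ z ∈ Z.filter (fun z => y z = y0), ∏ t ∈ univ.filter (fun t => κ t = t), (1:ℝ) / z t
      ≤ (∏ t ∈ R1, (1:ℝ) / y0 t) * (r * (10 * m * (d + 1) ^ 2 * D / H0)) ^ d := by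
    intro y0 hy0
    have : ∀ z ∈ Z.filter (fun z => y z = y0), ∏ t ∈ univ.filter (fun t => κ t = t), (1:ℝ) / z t = (∏ t ∈ R1, (1:ℝ) / y0 t) * ∏ f, (1:ℝ) / q z f := by
      intro z hz
      rw [hw z, (mem_filter.1 hz).2]
    rw [sum_congr rfl this, ← mul_sum]
    exact mul_le_mul_of_nonneg_left (hfib y0 hy0) (prod_nonneg fun t _ => by positivity)
  refine (sum_le_sum hstep).trans ?_
  rw [← sum_mul]
  apply mul_le_mul_of_nonneg_right _ (by positivity)
  -- sum over y0
  have hsub : Z.image y ⊆ Fintype.piFinset (fun t => if t ∈ R1 then P else {0}) := by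
    intro y0 hy0
    obtain ⟨z, hz, rfl⟩ := mem_image.1 hy0
    rw [Fintype.mem_piFinset]
    intro t
    have hzt := Fintype.mem_piFinset.1 (mem_filter.1 hz).1 t
    by_cases h1 : inL t
    · simp [R1, y, h1]
    · by_cases h2 : κ t = t
      · simp [R1, y, h1, h2, hzt]
      · simp [R1, y, h1, h2]
  calc _ ≤ ∑ y0 ∈ Fintype.piFinset (fun t => if t ∈ R1 then P else {0}), ∏ t ∈ R1, (1:ℝ) / y0 t :=
        sum_le_sum_of_subset_of_nonneg hsub (fun _ _ _ => prod_nonneg fun t _ => by positivity)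
    _ = ∑ y0 ∈ Fintype.piFinset (fun t => if t ∈ R1 then P else {0}), ∏ t, (if t ∈ R1 then (1:ℝ) / y0 t else 1) := by
        apply sum_congr rfl; intro y0 _
        rw [prod_ite_mem, univ_inter]
    _ = ∏ t, ∑ p ∈ (if t ∈ R1 then P else {0}), (if t ∈ R1 then (1:ℝ) / p else 1) :=
        (prod_univ_sum (fun t => if t ∈ R1 then P else {0}) (fun t p => if t ∈ R1 then (1:ℝ) / p else 1)).symm
    _ ≤ ∏ t : Fin m, L := by
        apply prod_le_prod
        · intro t _; apply sum_nonneg; intro p _; split_ifs <;> positivity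
        · intro t _
          by_cases h : t ∈ R1
          · simp only [h, if_true]; rw [hL]
          · simp only [h, if_false]; simpa using hL1
    _ = L ^ m := by simp

lemma caseB_core {m : ℕ} (P : Finset ℕ) (hPp : ∀ p ∈ P, Nat.Prime p) (H0 : ℝ) (hH0 : 1 ≤ H0)
    (hP : ∀ p ∈ P, H0 ≤ (p:ℝ)) (L : ℝ) (hL : L = ∑ p ∈ P, (1:ℝ) / p) (hL1 : 1 ≤ L)
    (κ : Fin m → Fin m) (E M : Finset (Fin m)) (Q : ℕ) (hQ : ((m:ℝ)+1) * Q ≤ H0) (hmH : (m:ℝ) ≤ H0)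
    (T : Fin m → Fin (m+1) → (Fin m → ℕ) → ℤ) (σ : Fin m → ℕ) (hσ : Function.Injective σ) (hσm : ∀ t, σ t < m)
    (hT : ∀ t jj z z', (∀ u, (u ∉ M ∨ σ u < σ t) → z u = z' u) → T t jj z = T t jj z')
    (hκM : ∀ t, κ t ≠ t → t ∉ E ∧ t ∉ M ∧ κ t ∉ E ∧ κ t ∉ M ∧ κ (κ t) = κ t) (hME : ∀ t ∈ M, t ∉ E)
    (S : Finset (Fin m → ℕ)) (hSP : ∀ z ∈ S, ∀ t, z t ∈ P) (hSκ : ∀ z ∈ S, ∀ t, z (κ t) = z t)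
    (hSE : ∀ z ∈ S, ∀ t ∈ E, ∃ u, u ∉ E ∧ u ∉ M ∧ z u = z t)
    (hSM : ∀ z ∈ S, ∀ t ∈ M, ∃ jj, T t jj z ≠ 0 ∧ |T t jj z| < 2 ^ Q ∧ (z t : ℤ) ∣ T t jj z) :
    ∑ z ∈ S, ∏ t ∈ univ.filter (fun t => κ t = t), (1:ℝ) / z t ≤
      L ^ (univ.filter (fun t => κ t = t ∧ t ∉ E ∧ t ∉ M)).card := by
  let ind : Prop → ℝ := fun p => if p then 1 else 0
  have ind0 : ∀ p, 0 ≤ ind p := fun p => by simp only [ind]; split_ifs <;> norm_num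
  let a : Fin m → (Fin m → ℕ) → ℝ := fun t z =>
    if κ t = t then (1 / (z t:ℝ)) * (if t ∈ E then ind (∃ u, u ∉ E ∧ u ∉ M ∧ z u = z t) else
      if t ∈ M then ind (∃ jj, T t jj z ≠ 0 ∧ |T t jj z| < 2 ^ Q ∧ (z t : ℤ) ∣ T t jj z) else 1) else ind (z (κ t) = z t)
  let c : Fin m → ℝ := fun t => if κ t = t ∧ t ∉ E ∧ t ∉ M then L else 1
  let ρ : Fin m → ℕ := fun t => if t ∈ M then 3 * m + σ t else if t ∈ E then 2 * m + t.1 else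
    if κ t = t then t.1 else m + t.1
  have hρ : Function.Injective ρ := by
    intro t t' h
    have h1 := hσm t; have h2 := hσm t'; have h3 := t.2; have h4 := t'.2
    simp only [ρ] at h
    split_ifs at h <;> first | (apply hσ; omega) | (apply Fin.ext; omega)
  have h := tri_sum P ρ hρ a (fun t z => by
      simp only [a]; split_ifs <;> first | positivity | exact ind0 _ | exact mul_nonneg (by positivity) (ind0 _)) c
    (fun v => by simp only [c]; split_ifs <;> linarith)
    (by
      intro t z z' hzz
      have ht := hzz t le_rfl
      simp only [a]
      by_cases h1 : κ t = t
      · simp only [h1, if_true, ht]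
        congr 1
        by_cases h2 : t ∈ E
        · simp only [h2, if_true]
          have htM : t ∉ M := fun h => hME t h h2
          congr 1
          simp only [eq_iff_iff]
          apply exists_congr; intro u
          refine and_congr_right fun hu => and_congr_right fun hu2 => ?_
          rw [hzz u]
          simp only [ρ, hu, hu2, h2, htM, if_true, if_false]
          have := u.2
          split_ifs <;> omega
        · simp only [h2, if_false]
          by_cases h3 : t ∈ M
          · simp only [h3, if_true]
            congr 1
            simp only [eq_iff_iff]
            apply exists_congr; intro jj
            rw [hT t jj z z']
            intro u hu
            apply hzz
            simp only [ρ, h3, if_true]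
            have := u.2
            by_cases hu3 : u ∈ M
            · have := hu.resolve_left (fun h => h hu3)
              simp only [hu3, if_true]; omega
            · simp only [hu3, if_false]; split_ifs <;> omega
          · simp only [h3, if_false]
      · simp only [h1, if_false]
        obtain ⟨h2, h3, h4, h5, h6⟩ := hκM t h1
        rw [hzz (κ t), ht]
        simp only [ρ, h2, h3, h4, h5, h6, h1, if_true, if_false]
        have := (κ t).2
        omega)
    (by
      intro t g
      simp only [a, Function.update_self]
      by_cases h1 : κ t = t
      · simp only [h1, if_true]
        by_cases h2 : t ∈ E
        · simp only [h2, if_true, c]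
          simp only [not_true_eq_false, false_and, and_false, if_false]
          calc _ ≤ ∑ p ∈ P.filter (fun p => p ∈ univ.image g), 1 / H0 := by
                rw [sum_filter]
                apply sum_le_sum; intro p hp
                by_cases h5 : p ∈ univ.image g
                · rw [if_pos h5]
                  have := one_div_le_one_div_of_le (by linarith) (hP p hp)
                  refine le_trans ?_ this
                  refine mul_le_of_le_one_right (by positivity) ?_
                  simp only [ind]; split_ifs <;> norm_num
                · rw [if_neg h5]
                  simp only [ind]
                  rw [if_neg, mul_zero]
                  rintro ⟨u, hu1, hu2, hu3⟩
                  rw [Function.update_of_ne (by rintro rfl; exact hu1 h2)] at hu3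
                  exact h5 (mem_image.2 ⟨u, mem_univ _, hu3⟩)
            _ = (P.filter (fun p => p ∈ univ.image g)).card / H0 := by rw [sum_const, nsmul_eq_mul]; ring
            _ ≤ m / H0 := by
                gcongr
                have : P.filter (fun p => p ∈ univ.image g) ⊆ univ.image g := fun x hx => (mem_filter.1 hx).2
                refine (card_le_card this).trans (card_image_le.trans (by simp))
            _ ≤ 1 := by rw [div_le_one (by linarith)]; exact hmH
        · simp only [h2, if_false]
          by_cases h3 : t ∈ M
          · simp only [h3, if_true, c]
            simp only [not_true_eq_false, and_false, if_false]
            have e : ∀ jj p, T t jj (Function.update g t p) = T t jj g := by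
              intro jj p
              apply hT; intro u hu
              rw [Function.update_of_ne]
              rintro rfl
              rcases hu with hu | hu
              · exact hu h3
              · omega
            simp only [e]
            calc _ ≤ ∑ p ∈ P, ∑ jj : Fin (m+1), (if (T t jj g ≠ 0 ∧ |T t jj g| < 2 ^ Q) ∧ (p:ℤ) ∣ T t jj g then (1:ℝ)/p else 0) := by
                  apply sum_le_sum; intro p hp
                  simp only [ind]
                  by_cases h5 : ∃ jj, T t jj g ≠ 0 ∧ |T t jj g| < 2 ^ Q ∧ (p : ℤ) ∣ T t jj g
                  · rw [if_pos h5, mul_one]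
                    obtain ⟨jj, h6, h7, h8⟩ := h5
                    refine le_trans (le_of_eq ?_) (single_le_sum (f := fun jj : Fin (m+1) => (if (T t jj g ≠ 0 ∧ |T t jj g| < 2 ^ Q) ∧ (p:ℤ) ∣ T t jj g then (1:ℝ)/p else 0)) (fun _ _ => by positivity) (mem_univ jj))
                    rw [if_pos ⟨⟨h6, h7⟩, h8⟩]
                  · rw [if_neg h5, mul_zero]
                    exact sum_nonneg fun _ _ => by positivity
              _ = ∑ jj : Fin (m+1), ∑ p ∈ P, (if (T t jj g ≠ 0 ∧ |T t jj g| < 2 ^ Q) ∧ (p:ℤ) ∣ T t jj g then (1:ℝ)/p else 0) := sum_comm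
              _ ≤ ∑ jj : Fin (m+1), Q / H0 := by
                  apply sum_le_sum; intro jj _
                  by_cases h5 : T t jj g ≠ 0 ∧ |T t jj g| < 2 ^ Q
                  · simp only [h5, not_false_eq_true, ne_eq, true_and, and_self]
                    rw [← sum_filter]
                    exact primes_dvd_sum P hPp H0 (by linarith) hP _ h5.1 Q h5.2
                  · simp only [h5, false_and, if_false, sum_const_zero]
                    positivity
              _ = ((m:ℝ)+1) * Q / H0 := by simp; ring
              _ ≤ 1 := by rw [div_le_one (by linarith)]; exact hQ
          · simp only [h3, if_false, c, h1, h2, not_false_eq_true, and_self, if_true, mul_one]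
            rw [hL]
      · simp only [h1, if_false, c, false_and, Function.update_of_ne h1, ind]
        calc _ = ∑ x ∈ P, (if x = g (κ t) then (1:ℝ) else 0) := by
              apply sum_congr rfl; intro x _
              by_cases h : x = g (κ t)
              · rw [if_pos h, if_pos h.symm]
              · rw [if_neg h, if_neg (fun h' => h h'.symm)]
          _ ≤ 1 := by rw [sum_ite_eq']; split_ifs <;> norm_num)
  have hc : ∏ t, c t = L ^ (univ.filter (fun t => κ t = t ∧ t ∉ E ∧ t ∉ M)).card := by
    simp only [c]; rw [prod_ite]; simp
  rw [← hc]
  refine le_trans ?_ h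
  have hsub : S ⊆ Fintype.piFinset (fun _ => P) := fun z hz => Fintype.mem_piFinset.2 (hSP z hz)
  refine le_trans ?_ (sum_le_sum_of_subset_of_nonneg hsub (fun z _ _ => prod_nonneg fun t _ => ?_))
  · apply sum_le_sum
    intro z hz
    rw [prod_filter]
    apply le_of_eq
    apply prod_congr rfl
    intro t _
    simp only [a]
    by_cases h1 : κ t = t
    · simp only [h1, if_true]
      by_cases h2 : t ∈ E
      · simp only [h2, if_true, ind]
        rw [if_pos (hSE z hz t h2), mul_one]
      · by_cases h3 : t ∈ M
        · simp only [h2, h3, if_true, if_false, ind]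
          rw [if_pos (hSM z hz t h3), mul_one]
        · simp only [h2, h3, if_false, mul_one]
    · simp only [h1, if_false, ind]
      rw [if_pos (hSκ z hz t)]
  · simp only [a]; split_ifs <;> first | positivity | exact ind0 _ | exact mul_nonneg (by positivity) (ind0 _)

noncomputable def LoS {m : ℕ} (C : Finset (Fin m)) (z : Fin m → ℕ) : Finset (Fin m) :=
  C.filter (fun i => ∀ t ∈ C, z t = z i → t = i)
noncomputable def CoR {m : ℕ} (C : Finset (Fin m)) (z : Fin m → ℕ) : Finset (Fin m) :=
  (LoS C z).filter (fun i => ∃ jj : Fin (m+1), i.1 + 1 < jj.1 ∧ sg z jj ≠ sg z (i+1) ∧ (z i:ℤ) ∣ sg z jj - sg z (i+1))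
noncomputable def CoL {m : ℕ} (C : Finset (Fin m)) (z : Fin m → ℕ) : Finset (Fin m) :=
  (LoS C z).filter (fun i => ∃ jj : Fin (m+1), jj.1 < i.1 ∧ sg z jj ≠ sg z i ∧ (z i:ℤ) ∣ sg z i - sg z jj)
def goodE {m : ℕ} (C E : Finset (Fin m)) (z : Fin m → ℕ) : Prop := ∀ t ∈ E, ∃ u ∈ C \ E, z u = z t

lemma sg_congr {m : ℕ} (z z' : Fin m → ℕ) (i j : ℕ) (hij : i ≤ j)
    (h : ∀ u : Fin m, i ≤ u.1 → u.1 < j → z u = z' u) : sg z j - sg z i = sg z' j - sg z' i := by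
  rw [sg_sub _ _ _ hij, sg_sub _ _ _ hij]
  apply sum_congr rfl; intro u _
  by_cases h1 : i ≤ u.1 ∧ u.1 < j
  · rw [if_pos h1, if_pos h1, h u h1.1 h1.2]
  · rw [if_neg h1, if_neg h1]

lemma caseB {m : ℕ} (P : Finset ℕ) (hPp : ∀ p ∈ P, Nat.Prime p) (H0 : ℝ) (hH0 : 1 ≤ H0)
    (hP : ∀ p ∈ P, H0 ≤ (p:ℝ)) (L : ℝ) (hL : L = ∑ p ∈ P, (1:ℝ) / p) (s : ℝ) (hs : 1 ≤ s) (hsL : s ^ 2 = L)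
    (bs : ℝ) (hbs : s ≤ bs) (Q B : ℕ) (hB : ∀ p ∈ P, p ≤ B) (hQB : m * B < 2 ^ Q)
    (hQ : ((m:ℝ)+1) * Q ≤ H0) (hmH : (m:ℝ) ≤ H0)
    (C E Lo R0 L0 : Finset (Fin m)) (hEC : E ⊆ C) (κ : Fin m → Fin m) (hκ : Canon κ)
    (S : Finset (Fin m → ℕ)) (hS : ∀ z ∈ S, (∀ t, z t ∈ P) ∧ kz (C \ E) z = κ ∧ goodE C E z ∧ LoS C z = Lo ∧
      CoR C z = R0 ∧ CoL C z = L0) :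
    ∑ z ∈ S, (∏ t ∈ univ.filter (fun t => κ t = t), (1:ℝ) / z t) * (1 / bs) ^ (Lo \ (R0 ∪ L0)).card ≤
      s ^ (2 * Cᶜ.card + C.card) := by
  rcases S.eq_empty_or_nonempty with hSe | ⟨z0, hz0⟩
  · rw [hSe, sum_empty]; positivity
  have hL1 : 1 ≤ L := by rw [← hsL]; nlinarith
  have hs0 : 0 < s := by linarith
  have hbs0 : 0 < bs := by linarith
  obtain ⟨h0P, h0κ, h0g, h0L, h0R, h0L'⟩ := hS z0 hz0
  have hLoC : Lo ⊆ C := by rw [← h0L]; exact filter_subset _ _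
  have hRLo : R0 ⊆ Lo := by rw [← h0R, ← h0L]; exact filter_subset _ _
  have hLLo : L0 ⊆ Lo := by rw [← h0L', ← h0L]; exact filter_subset _ _
  -- lone characterization for any z ∈ S
  have hlone : ∀ z ∈ S, ∀ t ∈ C, ∀ u ∈ C, t ≠ u → z t = z u → t ∉ Lo := by
    intro z hz t ht u hu htu hzz h
    rw [← (hS z hz).2.2.2.1] at h
    exact htu ((mem_filter.1 h).2 u hu hzz.symm).symm
  have hLE : ∀ t ∈ Lo, t ∉ E := by
    intro t ht htE
    obtain ⟨u, hu, hzu⟩ := h0g t htE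
    have hu' := mem_sdiff.1 hu
    exact hlone z0 hz0 t (hEC htE) u hu'.1 (by rintro rfl; exact hu'.2 htE) hzu.symm ht
  have hnr : ∀ t, κ t ≠ t → t ∉ E ∧ t ∉ Lo ∧ κ t ∉ E ∧ κ t ∉ Lo ∧ κ (κ t) = κ t := by
    intro t ht
    have htU : t ∈ C \ E := by
      by_contra h; rw [← h0κ, kz_not h] at ht; exact ht rfl
    have hk := kz_mem (z := z0) htU
    rw [h0κ] at hk
    have h1 := mem_sdiff.1 htU; have h2 := mem_sdiff.1 hk.1
    exact ⟨h1.2, hlone z0 hz0 t h1.1 _ h2.1 (Ne.symm ht) hk.2.symm, h2.2, hlone z0 hz0 _ h2.1 _ h1.1 ht hk.2, (hκ t).2⟩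
  -- counting
  have hcount : ∀ M ⊆ Lo, (R0 ∪ L0).card ≤ 2 * M.card →
      2 * (univ.filter (fun t => κ t = t ∧ t ∉ E ∧ t ∉ M)).card ≤ 2 * Cᶜ.card + C.card + (Lo \ (R0 ∪ L0)).card := by
    intro M hM hMc
    set V := (C \ E).filter (fun t => κ t = t ∧ t ∉ Lo) with hV
    have h1 : univ.filter (fun t => κ t = t ∧ t ∉ E ∧ t ∉ M) ⊆ Cᶜ ∪ ((Lo \ M) ∪ V) := by
      intro t ht
      obtain ⟨-, h1, h2, h3⟩ := mem_filter.1 ht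
      by_cases hC : t ∈ C
      · by_cases hl : t ∈ Lo
        · simp [hl, h3]
        · simp [hV, hC, h1, h2, hl]
      · simp [hC]
    have h2 := card_le_card h1
    have h3 := card_union_le Cᶜ ((Lo \ M) ∪ V)
    have h4 := card_union_le (Lo \ M) V
    have h5 := card_sdiff_add_card_eq_card hM
    have h6 : V ⊆ C \ Lo := by
      intro t ht; obtain ⟨h1, h2⟩ := mem_filter.1 ht
      exact mem_sdiff.2 ⟨(mem_sdiff.1 h1).1, h2.2⟩
    have hVinj : ∀ t ∈ V, ∀ t' ∈ V, z0 t = z0 t' → t = t' := by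
      intro t ht t' ht' h
      obtain ⟨h1, h2⟩ := mem_filter.1 ht
      obtain ⟨h1', h2'⟩ := mem_filter.1 ht'
      rw [← h2.1, ← h2'.1, ← h0κ]
      exact kz_congr h1 h1' h
    have hex : ∀ t ∈ V, ∃ t' ∈ C, t' ≠ t ∧ z0 t' = z0 t := by
      intro t ht
      obtain ⟨h1, h2⟩ := mem_filter.1 ht
      by_contra! hcon
      apply h2.2
      rw [← h0L]
      refine mem_filter.2 ⟨(mem_sdiff.1 h1).1, fun u hu hzu => ?_⟩
      by_contra hne; exact hcon u hu hne hzu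
    have h7 : V.card ≤ ((C \ Lo) \ V).card := by
      have hex' : ∀ t : Fin m, ∃ t' : Fin m, t ∈ V → (t' ∈ C ∧ t' ≠ t ∧ z0 t' = z0 t) := by
        intro t
        by_cases ht : t ∈ V
        · obtain ⟨t', h⟩ := hex t ht; exact ⟨t', fun _ => h⟩
        · exact ⟨t, fun h => absurd h ht⟩
      choose g hg using hex'
      apply card_le_card_of_injOn g
      · intro t ht
        obtain ⟨h1, h2, h3⟩ := hg t ht
        have htC : t ∈ C := (mem_sdiff.1 (h6 ht)).1
        refine mem_sdiff.2 ⟨mem_sdiff.2 ⟨h1, hlone z0 hz0 _ h1 _ htC h2 h3⟩, fun h => h2 (hVinj _ h _ ht h3)⟩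
      · intro t ht t' ht' h
        exact hVinj t ht t' ht' (by rw [← (hg t ht).2.2, ← (hg t' ht').2.2, h])
    have h8 := card_sdiff_add_card_eq_card h6
    have h9 := card_sdiff_add_card_eq_card hLoC
    have h10 := card_sdiff_add_card_eq_card (union_subset hRLo hLLo)
    omega
  -- main
  have key : ∃ M ⊆ Lo, (R0 ∪ L0).card ≤ 2 * M.card ∧
      ∑ z ∈ S, ∏ t ∈ univ.filter (fun t => κ t = t), (1:ℝ) / z t ≤
      L ^ (univ.filter (fun t => κ t = t ∧ t ∉ E ∧ t ∉ M)).card := by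
    have hgE : ∀ M ⊆ Lo, ∀ z ∈ S, ∀ t ∈ E, ∃ u, u ∉ E ∧ u ∉ M ∧ z u = z t := by
      intro M hM z hz t htE
      obtain ⟨u, hu, hzu⟩ := (hS z hz).2.2.1 t htE
      have hu' := mem_sdiff.1 hu
      refine ⟨u, hu'.2, fun h => hlone z hz u hu'.1 t (hEC htE) (by rintro rfl; exact hu'.2 htE) hzu (hM h), hzu⟩
    have hκM : ∀ M ⊆ Lo, ∀ t, κ t ≠ t → t ∉ E ∧ t ∉ M ∧ κ t ∉ E ∧ κ t ∉ M ∧ κ (κ t) = κ t := by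
      intro M hM t ht
      obtain ⟨h1, h2, h3, h4, h5⟩ := hnr t ht
      exact ⟨h1, fun h => h2 (hM h), h3, fun h => h4 (hM h), h5⟩
    have hTb : ∀ z ∈ S, ∀ i j, i ≤ j → |sg z j - sg z i| < 2 ^ Q := by
      intro z hz i j hij
      have := sg_abs z i j hij B (fun u => hB _ ((hS z hz).1 u))
      refine this.trans_lt ?_
      exact_mod_cast hQB
    have hSκ : ∀ z ∈ S, ∀ t, z (κ t) = z t := by
      intro z hz t; rw [← (hS z hz).2.1]; exact kz_val _ _ _
    rcases le_total L0.card R0.card with hle | hle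
    · refine ⟨R0, hRLo, by have := card_union_le R0 L0; omega, ?_⟩
      refine caseB_core P hPp H0 hH0 hP L hL hL1 κ E R0 Q hQ hmH
        (fun t jj z => if t.1 + 1 < jj.1 then sg z jj - sg z (t+1) else 0) (fun t => m - 1 - t.1)
        (fun t t' h => by apply Fin.ext; have := t.2; have := t'.2; simp only at h; omega) (fun t => by have := t.2; omega)
        ?_ (hκM R0 hRLo) (fun t ht => hLE t (hRLo ht)) S (fun z hz => (hS z hz).1) hSκ (hgE R0 hRLo) ?_
      · intro t jj z z' h
        split_ifs with h1
        swap; rfl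
        apply sg_congr _ _ _ _ h1.le
        intro u hu1 hu2
        apply h; right
        have := u.2; omega
      · intro z hz t ht
        rw [← (hS z hz).2.2.2.2.1] at ht
        obtain ⟨jj, h1, h2, h3⟩ := (mem_filter.1 ht).2
        refine ⟨jj, ?_⟩
        simp only [h1, if_true]
        exact ⟨sub_ne_zero.2 h2, hTb z hz _ _ h1.le, h3⟩
    · refine ⟨L0, hLLo, by have := card_union_le R0 L0; omega, ?_⟩
      refine caseB_core P hPp H0 hH0 hP L hL hL1 κ E L0 Q hQ hmH
        (fun t jj z => if jj.1 < t.1 then sg z t - sg z jj else 0) (fun t => t.1)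
        (fun t t' h => Fin.ext h) (fun t => t.2)
        ?_ (hκM L0 hLLo) (fun t ht => hLE t (hLLo ht)) S (fun z hz => (hS z hz).1) hSκ (hgE L0 hLLo) ?_
      · intro t jj z z' h
        split_ifs with h1
        swap; rfl
        apply sg_congr _ _ _ _ h1.le
        intro u hu1 hu2
        apply h; right
        exact hu2
      · intro z hz t ht
        rw [← (hS z hz).2.2.2.2.2] at ht
        obtain ⟨jj, h1, h2, h3⟩ := (mem_filter.1 ht).2
        refine ⟨jj, ?_⟩
        simp only [h1, if_true]
        exact ⟨sub_ne_zero.2 (Ne.symm h2), hTb z hz _ _ h1.le, h3⟩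
  obtain ⟨M, hM, hMc, hMs⟩ := key
  have hcn := hcount M hM hMc
  rw [← sum_mul]
  set n0 := (univ.filter (fun t => κ t = t ∧ t ∉ E ∧ t ∉ M)).card
  set k := (Lo \ (R0 ∪ L0)).card
  calc _ ≤ L ^ n0 * (1 / s) ^ k := by
        apply mul_le_mul hMs _ (by positivity) (by positivity)
        exact pow_le_pow_left₀ (by positivity) (one_div_le_one_div_of_le (by linarith) hbs) _
    _ = s ^ (2 * n0) * (1 / s) ^ k := by rw [← hsL, ← pow_mul]
    _ ≤ s ^ (2 * Cᶜ.card + C.card + k) * (1 / s) ^ k := by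
        apply mul_le_mul_of_nonneg_right _ (by positivity)
        exact pow_le_pow_right₀ hs hcn
    _ = _ := by rw [pow_add _ _ k, mul_assoc, ← mul_pow, mul_one_div_cancel hs0.ne', one_pow, mul_one]

noncomputable def dTerm {m : ℕ} (C : Finset (Fin m)) (bs : ℝ) (z : Fin m → ℕ) (E : Finset (Fin m)) : ℝ :=
  (∏ t ∈ univ.filter (fun t => kz (C \ E) z t = t), (1:ℝ) / z t) * (1 / bs) ^ (LoS C z \ (CoR C z ∪ CoL C z)).card

theorem stepD {m : ℕ} (hm : 0 < m) (nb l d : ℕ) (hmn : m = nb * l) (P : Finset ℕ) (hPp : ∀ p ∈ P, Nat.Prime p)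
    (H0 : ℝ) (hH0 : 1 ≤ H0)
    (r : ℕ) (hP : ∀ x ∈ P, H0 ≤ (x:ℝ) ∧ (x:ℝ) < H0 * 2 ^ r) (L : ℝ) (hL : L = ∑ p ∈ P, (1:ℝ) / p)
    (s : ℝ) (hs : 1 ≤ s) (hsL : s ^ 2 = L)
    (bs : ℝ) (hbs : s ≤ bs) (Q B : ℕ) (hB : ∀ p ∈ P, p ≤ B) (hQB : m * B < 2 ^ Q)
    (hQ : ((m:ℝ)+1) * Q ≤ H0) (hmH : (m:ℝ) ≤ H0)
    (D : ℝ) (hD1 : 1 ≤ D) (hD : ∀ k ≤ d, (k.factorial : ℝ) * (m:ℝ) ^ k ≤ D)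
    (hbig : (m:ℝ) ^ m * (L ^ m * (r * (10 * m * (d + 1) ^ 2 * D / H0)) ^ d) ≤ 1) (C : Finset (Fin m)) :
    ∑ z ∈ (Fintype.piFinset (fun _ : Fin m => P)).filter (fun z => zBInj l z),
      ∑ E ∈ C.powerset.filter (fun E => goodE C E z ∧ cong (C \ E) z), dTerm C bs z E ≤
      16 ^ m * (1 + 2 ^ m * (m:ℝ) ^ (2 * (nb * (4 * (5 * d + 2 * nb) + 1 + 2 * nb))) * s ^ (2 * Cᶜ.card + C.card)) := by
  have hL1 : 1 ≤ L := by rw [← hsL]; nlinarith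
  have hs0 : 0 < s := by linarith
  have hbs0 : 0 < bs := by linarith
  set Kc := 2 ^ m * (m:ℝ) ^ (2 * (nb * (4 * (5 * d + 2 * nb) + 1 + 2 * nb))) with hKc
  set sF := s ^ (2 * Cᶜ.card + C.card) with hsF
  have hsF0 : 0 ≤ sF := by positivity
  have hf0 : ∀ z E, 0 ≤ dTerm C bs z E := fun z E => by unfold dTerm; positivity
  have hE : ∀ E ∈ C.powerset, ∑ z ∈ (Fintype.piFinset (fun _ : Fin m => P)).filter (fun z => zBInj l z ∧ goodE C E z ∧ cong (C \ E) z),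
      dTerm C bs z E ≤ 8 ^ m * (1 + Kc * sF) := by
    intro E hEC
    rw [mem_powerset] at hEC
    set Z := (Fintype.piFinset (fun _ : Fin m => P)).filter (fun z => zBInj l z ∧ goodE C E z ∧ cong (C \ E) z) with hZ
    let hi : (Fin m → Fin m) → Prop := fun κ => ∃ hκ : Canon κ, 4 * (5 * d + 2 * nb) + 2 ≤ (branch hm κ hκ).card
    rw [← sum_filter_add_sum_filter_not Z (fun z => hi (kz (C \ E) z))]
    have h1 : ∑ z ∈ Z.filter (fun z => hi (kz (C \ E) z)), dTerm C bs z E ≤ 1 := by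
      rw [← sum_fiberwise_of_maps_to (t := (univ : Finset (Fin m → Fin m))) (g := fun z => kz (C \ E) z) (fun _ _ => mem_univ _)]
      calc _ ≤ ∑ κ : Fin m → Fin m, (L ^ m * (r * (10 * m * (d + 1) ^ 2 * D / H0)) ^ d) := by
            apply sum_le_sum; intro κ _
            by_cases hk : ∃ z ∈ Z, hi κ ∧ kz (C \ E) z = κ
            · obtain ⟨z0, hz0, ⟨hκ, hbr⟩, hkz⟩ := hk
              have hBI : BInj l κ := by
                rw [← hkz]; exact kz_BInj l _ _ (mem_filter.1 hz0).2.1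
              refine le_trans ?_ (caseA hm nb l d hmn P H0 hH0 r hP L hL hL1 D hD1 hD (C \ E) κ hκ hBI hbr)
              refine le_trans ?_ (sum_le_sum_of_subset_of_nonneg (s := (Z.filter (fun z => hi (kz (C \ E) z))).filter (fun z => kz (C \ E) z = κ)) ?_ (fun _ _ _ => by positivity))
              · apply sum_le_sum; intro z hz
                have e := (mem_filter.1 hz).2
                unfold dTerm
                rw [e]
                apply mul_le_of_le_one_right (by positivity)
                exact pow_le_one₀ (by positivity) (by rw [div_le_one hbs0]; linarith)
              · intro z hz
                obtain ⟨hz1, hz2⟩ := mem_filter.1 hz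
                obtain ⟨hz3, hz4⟩ := mem_filter.1 (mem_filter.1 hz1).1
                exact mem_filter.2 ⟨hz3, hz2, hz4.2.2⟩
            · rw [filter_eq_empty_iff.2, sum_empty]
              · positivity
              · intro z hz hzk
                exact hk ⟨z, (mem_filter.1 hz).1, hzk ▸ (mem_filter.1 hz).2, hzk⟩
        _ = (m:ℝ) ^ m * (L ^ m * (r * (10 * m * (d + 1) ^ 2 * D / H0)) ^ d) := by
            rw [sum_const, nsmul_eq_mul]; simp
        _ ≤ 1 := hbig
    have h2 : ∑ z ∈ Z.filter (fun z => ¬ hi (kz (C \ E) z)), dTerm C bs z E ≤ Kc * 8 ^ m * sF := by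
      set Kl := univ.filter (fun κ : Fin m → Fin m => ∃ hκ : Canon κ, BInj l κ ∧ (branch hm κ hκ).card ≤ 4 * (5 * d + 2 * nb) + 1) with hKl
      rw [← sum_fiberwise_of_maps_to (t := Kl ×ˢ (univ : Finset (Finset (Fin m) × Finset (Fin m) × Finset (Fin m))))
        (g := fun z => (kz (C \ E) z, LoS C z, CoR C z, CoL C z))]
      · calc _ ≤ ∑ x ∈ Kl ×ˢ (univ : Finset (Finset (Fin m) × Finset (Fin m) × Finset (Fin m))), sF := by
              apply sum_le_sum; intro x hx
              obtain ⟨κ, Lo, R0, L0⟩ := x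
              have hκ := (mem_filter.1 (mem_product.1 hx).1).2
              obtain ⟨hκ, -⟩ := hκ
              refine le_trans (le_of_eq ?_) (caseB P hPp H0 hH0 (fun p hp => (hP p hp).1) L hL s hs hsL bs hbs Q B hB hQB hQ hmH C E Lo R0 L0 hEC κ hκ ((Z.filter (fun z => ¬ hi (kz (C \ E) z))).filter (fun z => (kz (C \ E) z, LoS C z, CoR C z, CoL C z) = (κ, Lo, R0, L0))) ?_)
              · apply sum_congr rfl; intro z hz
                have e := (mem_filter.1 hz).2
                simp only [Prod.mk.injEq] at e
                obtain ⟨e1, e2, e3, e4⟩ := e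
                unfold dTerm
                rw [e1, e2, e3, e4]
              · intro z hz
                obtain ⟨hz1, e⟩ := mem_filter.1 hz
                simp only [Prod.mk.injEq] at e
                obtain ⟨hz3, hz4⟩ := mem_filter.1 (mem_filter.1 hz1).1
                exact ⟨Fintype.mem_piFinset.1 hz3, e.1, hz4.2.1, e.2⟩
          _ = Kl.card * 8 ^ m * sF := by
              rw [sum_const, nsmul_eq_mul, card_product]
              congr 1
              simp only [card_univ, Fintype.card_prod, Fintype.card_finset, Fintype.card_fin]
              push_cast
              rw [← mul_pow, ← mul_pow]; norm_num
          _ ≤ _ := by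
              gcongr
              have := pattern_count hm nb l (4 * (5 * d + 2 * nb) + 1) hmn
              rw [hKc]
              exact_mod_cast this
      · intro z hz
        obtain ⟨hz1, hz2⟩ := mem_filter.1 hz
        refine mem_product.2 ⟨mem_filter.2 ⟨mem_univ _, kz_canon _ _, kz_BInj l _ _ (mem_filter.1 hz1).2.1, ?_⟩, mem_univ _⟩
        by_contra h
        exact hz2 ⟨kz_canon _ _, not_le.1 h⟩
    have h8 : (1:ℝ) ≤ 8 ^ m := one_le_pow₀ (by norm_num)
    nlinarith
  have hsw : ∑ z ∈ (Fintype.piFinset (fun _ : Fin m => P)).filter (fun z => zBInj l z),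
      ∑ E ∈ C.powerset.filter (fun E => goodE C E z ∧ cong (C \ E) z), dTerm C bs z E =
      ∑ E ∈ C.powerset, ∑ z ∈ (Fintype.piFinset (fun _ : Fin m => P)).filter (fun z => zBInj l z ∧ goodE C E z ∧ cong (C \ E) z),
      dTerm C bs z E := by
    apply sum_comm'
    intro z E
    simp only [mem_filter]
    tauto
  rw [hsw]
  refine (sum_le_sum hE).trans ?_
  rw [sum_const, nsmul_eq_mul, card_powerset]
  have hKc0 : 0 ≤ Kc := by positivity
  have : (2:ℝ) ^ C.card ≤ 2 ^ m := pow_le_pow_right₀ (by norm_num) (by simpa using card_le_univ C)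
  push_cast
  calc _ ≤ (2:ℝ) ^ m * (8 ^ m * (1 + Kc * sF)) := by gcongr
    _ = _ := by rw [← mul_assoc, ← mul_pow]; norm_num

abbrev RR := ℕ → Option ℤ
noncomputable def hit (r : RR) (p : ℕ) (x : ℤ) : ℝ :=
  match r p with
  | none => 0
  | some y => if (p:ℤ) ∣ y + x then 1 else 0
def cst (n : ℤ) : RR := fun _ => some n
noncomputable def Av (p : ℕ) (F : RR → ℝ) : RR → ℝ := fun r => (1/(p:ℝ)) * ∑ x ∈ range p, F (Function.update r p (some (x:ℤ)))
noncomputable def EE : List ℕ → (RR → ℝ) → RR → ℝ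
  | [], F => F
  | p :: l, F => Av p (EE l F)
def oeq (p : ℕ) (a b : Option ℤ) : Prop :=
  match a, b with
  | none, none => True
  | some x, some y => (p:ℤ) ∣ x - y
  | _, _ => False
def Loc (l : List ℕ) (F : RR → ℝ) : Prop := ∀ r r', (∀ p ∈ l, oeq p (r p) (r' p)) → F r = F r'

lemma oeq_refl (p : ℕ) (a : Option ℤ) : oeq p a a := by
  cases a <;> simp [oeq]

lemma hit_nonneg (r : RR) (p : ℕ) (x : ℤ) : 0 ≤ hit r p x := by
  unfold hit; split <;> [norm_num; (split_ifs <;> norm_num)]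
lemma hit_le_one (r : RR) (p : ℕ) (x : ℤ) : hit r p x ≤ 1 := by
  unfold hit; split <;> [norm_num; (split_ifs <;> norm_num)]
lemma hit_some (r : RR) (p : ℕ) (x y : ℤ) (h : r p = some y) : hit r p x = if (p:ℤ) ∣ y + x then 1 else 0 := by
  unfold hit; rw [h]
lemma hit_none (r : RR) (p : ℕ) (x : ℤ) (h : r p = none) : hit r p x = 0 := by
  unfold hit; rw [h]
lemma hit_eq (r r' : RR) (p : ℕ) (x : ℤ) (h : oeq p (r p) (r' p)) : hit r p x = hit r' p x := by
  unfold hit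
  cases h1 : r p <;> cases h2 : r' p <;> simp only [h1, h2, oeq] at h ⊢
  rename_i y y'
  have : (p:ℤ) ∣ y + x ↔ (p:ℤ) ∣ y' + x := by
    have e : y + x = (y - y') + (y' + x) := by ring
    rw [e]; exact (Int.dvd_add_right h)
  by_cases h3 : (p:ℤ) ∣ y' + x
  · rw [if_pos h3, if_pos (this.2 h3)]
  · rw [if_neg h3, if_neg (fun h => h3 (this.1 h))]
lemma hit_update_ne (r : RR) (p q : ℕ) (x : ℤ) (v : Option ℤ) (h : p ≠ q) : hit (Function.update r q v) p x = hit r p x := by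
  apply hit_eq; rw [Function.update_of_ne h]; exact oeq_refl _ _

lemma EE_update (l : List ℕ) (F : RR → ℝ) (p : ℕ) (v : Option ℤ) (hp : p ∉ l) (r : RR) :
    EE l F (Function.update r p v) = EE l (fun r => F (Function.update r p v)) r := by
  induction l generalizing r with
  | nil => rfl
  | cons q l ih =>
    simp only [List.mem_cons, not_or] at hp
    simp only [EE, Av]
    congr 1
    apply sum_congr rfl; intro x _
    rw [Function.update_comm (Ne.symm hp.1).symm, ih hp.2]

lemma EE_append (l l' : List ℕ) (F : RR → ℝ) : EE (l ++ l') F = EE l (EE l' F) := by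
  induction l with
  | nil => rfl
  | cons p l ih => simp only [List.cons_append, EE, ih]

lemma Av_mono (p : ℕ) (F G : RR → ℝ) (r : RR) (h : ∀ r, F r ≤ G r) : Av p F r ≤ Av p G r := by
  unfold Av
  gcongr
  exact h _

lemma EE_mono (l : List ℕ) (F G : RR → ℝ) (h : ∀ r, F r ≤ G r) (r : RR) : EE l F r ≤ EE l G r := by
  induction l generalizing r with
  | nil => exact h r
  | cons p l ih => exact Av_mono p _ _ r ih

lemma EE_add (l : List ℕ) (F G : RR → ℝ) (r : RR) : EE l (fun r => F r + G r) r = EE l F r + EE l G r := by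
  induction l generalizing r with
  | nil => rfl
  | cons p l ih => simp only [EE, Av]; simp_rw [ih]; rw [sum_add_distrib, mul_add]

lemma EE_smul (l : List ℕ) (c : ℝ) (F : RR → ℝ) (r : RR) : EE l (fun r => c * F r) r = c * EE l F r := by
  induction l generalizing r with
  | nil => rfl
  | cons p l ih => simp only [EE, Av]; simp_rw [ih]; rw [← mul_sum]; ring

lemma EE_sum {ι : Type*} (s : Finset ι) (l : List ℕ) (F : ι → RR → ℝ) (r : RR) :
    EE l (fun r => ∑ i ∈ s, F i r) r = ∑ i ∈ s, EE l (F i) r := by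
  induction l generalizing r with
  | nil => rfl
  | cons p l ih => simp only [EE, Av]; simp_rw [ih]; rw [sum_comm, mul_sum]

lemma EE_nonneg (l : List ℕ) (F : RR → ℝ) (h : ∀ r, 0 ≤ F r) (r : RR) : 0 ≤ EE l F r := by
  induction l generalizing r with
  | nil => exact h r
  | cons p l ih => simp only [EE, Av]; exact mul_nonneg (by positivity) (sum_nonneg fun _ _ => ih _)

lemma EE_abs (l : List ℕ) (F : RR → ℝ) (r : RR) : |EE l F r| ≤ EE l (fun r => |F r|) r := by
  rw [abs_le]
  constructor
  · have := EE_mono l (fun r => (-1) * |F r|) F (fun r => by linarith [neg_abs_le (F r)]) r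
    rw [EE_smul] at this; linarith
  · exact EE_mono l F _ (fun r => le_abs_self _) r

lemma EE_const (l : List ℕ) (hl : ∀ p ∈ l, 0 < p) (c : ℝ) (r : RR) : EE l (fun _ => c) r = c := by
  induction l generalizing r with
  | nil => rfl
  | cons p l ih =>
    have hp : (p:ℝ) ≠ 0 := by have := hl p (by simp); positivity
    simp only [EE, Av]
    simp_rw [ih (fun q hq => hl q (by simp [hq]))]
    rw [sum_const, card_range, nsmul_eq_mul]; field_simp

/-- pulling out a factor not depending on coordinates of l -/
lemma EE_pull (l : List ℕ) (f F : RR → ℝ) (hf : ∀ p ∈ l, ∀ r v, f (Function.update r p (some v)) = f r) (r : RR) :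
    EE l (fun r => f r * F r) r = f r * EE l F r := by
  induction l generalizing r with
  | nil => rfl
  | cons p l ih =>
    simp only [EE, Av]
    simp_rw [ih (fun q hq => hf q (by simp [hq])), hf p (by simp), ← mul_sum]
    ring

lemma EE_swap (p q : ℕ) (l : List ℕ) (F : RR → ℝ) (h : p ≠ q) : EE (p :: q :: l) F = EE (q :: p :: l) F := by
  funext r
  simp only [EE, Av, ← mul_sum]
  rw [sum_comm]
  rw [← mul_assoc, ← mul_assoc, mul_comm (1/(p:ℝ))]
  congr 1
  apply sum_congr rfl; intro x _
  apply sum_congr rfl; intro y _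
  rw [Function.update_comm h]

lemma EE_perm {l l' : List ℕ} (h : l.Perm l') (hl : l.Nodup) (F : RR → ℝ) : EE l F = EE l' F := by
  induction h with
  | nil => rfl
  | cons p _ ih => simp only [EE, ih (List.nodup_cons.1 hl).2]
  | swap p q l =>
    apply EE_swap
    rintro rfl; simp at hl
  | trans h1 h2 ih1 ih2 => rw [ih1 hl, ih2 (h1.nodup_iff.1 hl)]

lemma crt_sum (p q : ℕ) (hp : 0 < p) (hq : 0 < q) (hpq : Nat.Coprime p q) (a : ℤ) (g : ℤ → ℤ → ℝ) :
    ∑ n ∈ Ico a (a + p * q), g (n % p) (n % q) = ∑ x ∈ range p, ∑ y ∈ Ico (0:ℤ) (0 + q), g x y := by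
  have hp' : (0:ℤ) < p := by exact_mod_cast hp
  have hq' : (0:ℤ) < q := by exact_mod_cast hq
  have e1 : ∑ x ∈ range p, ∑ y ∈ Ico (0:ℤ) (0 + q), g x y = ∑ x ∈ Ico (0:ℤ) p, ∑ y ∈ Ico (0:ℤ) (0 + q), g x y := by
    apply sum_nbij (fun x : ℕ => (x:ℤ))
    · intro x hx; simp at hx ⊢; exact hx
    · intro x _ y _ h; simpa using h
    · intro x hx
      simp at hx
      exact ⟨x.toNat, by simp; omega, by simp [hx.1]⟩
    · intro x _; rfl
  rw [e1, ← sum_product']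
  have hinj : Set.InjOn (fun n : ℤ => ((n % p, n % q) : ℤ × ℤ)) (Ico a (a + p * q) : Finset ℤ) := by
    intro n hn n' hn' h
    simp only [Prod.mk.injEq] at h
    have h1 : (p:ℤ) ∣ n - n' := Int.ModEq.dvd (Eq.symm h.1)
    have h2 : (q:ℤ) ∣ n - n' := Int.ModEq.dvd (Eq.symm h.2)
    have h3 : (p:ℤ) * q ∣ n - n' := IsCoprime.mul_dvd (Nat.isCoprime_iff_coprime.2 hpq) h1 h2
    simp only [coe_Ico, Set.mem_Ico] at hn hn'
    have h4 : n - n' = 0 := Int.eq_zero_of_abs_lt_dvd h3 (by rw [abs_lt]; constructor <;> linarith)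
    linarith
  have himg : (Ico a (a + p * q)).image (fun n : ℤ => ((n % p, n % q) : ℤ × ℤ)) = Ico (0:ℤ) p ×ˢ Ico (0:ℤ) (0 + q) := by
    apply eq_of_subset_of_card_le
    · intro x hx
      obtain ⟨n, _, rfl⟩ := mem_image.1 hx
      simp only [mem_product, mem_Ico, zero_add]
      exact ⟨⟨Int.emod_nonneg _ hp'.ne', Int.emod_lt_of_pos _ hp'⟩, Int.emod_nonneg _ hq'.ne', Int.emod_lt_of_pos _ hq'⟩
    · rw [card_image_of_injOn hinj]
      simp only [card_product, Int.card_Ico, zero_add, sub_zero, Int.toNat_natCast, add_sub_cancel_left]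
      rw [show ((p:ℤ) * q) = ((p * q : ℕ) : ℤ) by push_cast; rfl, Int.toNat_natCast]
  rw [← himg, sum_image hinj]

lemma per_sum (l : List ℕ) (hl : ∀ p ∈ l, Nat.Prime p) (hnd : l.Nodup) (F : RR → ℝ) (hF : Loc l F) (r : RR) (a : ℤ) :
    ∑ n ∈ Ico a (a + (l.prod : ℕ)), F (cst n) = l.prod * EE l F r := by
  induction l generalizing F r a with
  | nil =>
    have : Ico a (a + ((([]:List ℕ).prod : ℕ) : ℤ)) = {a} := by ext; simp; omega
    rw [this, sum_singleton]
    simp only [List.prod_nil, Nat.cast_one, one_mul, EE]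
    exact hF _ _ (by simp)
  | cons p l ih =>
    have hp := hl p (by simp)
    have hl' : ∀ q ∈ l, Nat.Prime q := fun q hq => hl q (by simp [hq])
    obtain ⟨hpl, hnd'⟩ := List.nodup_cons.1 hnd
    have hcop : Nat.Coprime p l.prod := by
      apply Nat.coprime_list_prod_right_iff.2
      intro q hq
      exact (Nat.coprime_primes hp (hl' q hq)).2 (by rintro rfl; exact hpl hq)
    have hq0 : 0 < l.prod := List.prod_pos (fun q hq => (hl' q hq).pos)
    have h1 : ∀ n : ℤ, F (cst n) = F (Function.update (cst (n % (l.prod:ℕ))) p (some (n % p))) := by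
      intro n
      apply hF
      intro q hq
      by_cases hqp : q = p
      · subst hqp
        simp only [Function.update_self, cst, oeq]
        exact Int.dvd_self_sub_emod
      · rw [Function.update_of_ne hqp]
        simp only [cst, oeq]
        have : (q:ℤ) ∣ ((l.prod : ℕ) : ℤ) := by
          exact_mod_cast List.dvd_prod ((List.mem_cons.1 hq).resolve_left hqp)
        exact this.trans Int.dvd_self_sub_emod
    simp_rw [h1]
    rw [List.prod_cons, Nat.cast_mul]
    rw [crt_sum p l.prod hp.pos hq0 hcop a (fun x y => F (Function.update (cst y) p (some x)))]
    have h2 : ∀ x : ℕ, ∑ y ∈ Ico (0:ℤ) (0 + (l.prod:ℕ)), F (Function.update (cst y) p (some (x:ℤ))) =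
        l.prod * EE l F (Function.update r p (some (x:ℤ))) := by
      intro x
      rw [ih hl' hnd' (fun r => F (Function.update r p (some (x:ℤ)))) ?_ r 0, EE_update l F p _ hpl]
      intro r r' hrr
      apply hF
      intro q hq
      by_cases hqp : q = p
      · subst hqp; simp only [Function.update_self]; exact oeq_refl _ _
      · rw [Function.update_of_ne hqp, Function.update_of_ne hqp]
        exact hrr q ((List.mem_cons.1 hq).resolve_left hqp)
    simp_rw [h2]
    simp only [EE, Av]
    rw [← mul_sum]
    have : (p:ℝ) ≠ 0 := by have := hp.pos; positivity
    push_cast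
    field_simp

lemma per_mul (l : List ℕ) (hl : ∀ p ∈ l, Nat.Prime p) (hnd : l.Nodup) (F : RR → ℝ) (hF : Loc l F) (r : RR) (a : ℤ) (k : ℕ) :
    ∑ n ∈ Ico a (a + (l.prod : ℕ) * k), F (cst n) = l.prod * k * EE l F r := by
  induction k with
  | zero => simp
  | succ k ih =>
    have h1 := per_sum l hl hnd F hF r (a + (l.prod : ℕ) * k)
    have hle : (0:ℤ) ≤ (l.prod : ℕ) * k := by positivity
    have hdis : Disjoint (Ico a (a + (l.prod : ℕ) * k)) (Ico (a + (l.prod : ℕ) * k) (a + (l.prod : ℕ) * k + (l.prod : ℕ))) :=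
      Ico_disjoint_Ico_consecutive _ _ _
    rw [show a + (l.prod : ℕ) * ((k+1 : ℕ):ℤ) = a + (l.prod : ℕ) * k + (l.prod : ℕ) by push_cast; ring,
      ← Ico_union_Ico_eq_Ico (b := a + (l.prod : ℕ) * k) (by linarith) (by linarith [Int.natCast_nonneg l.prod]),
      sum_union hdis, ih, h1]
    push_cast; ring

lemma per_pos (l : List ℕ) (hl : ∀ p ∈ l, Nat.Prime p) (hnd : l.Nodup) (F : RR → ℝ) (hF : Loc l F) (hF0 : ∀ r, 0 ≤ F r)
    (r : RR) (a : ℤ) (N : ℕ) :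
    ∑ n ∈ Ico a (a + N), F (cst n) ≤ (N + l.prod) * EE l F r := by
  have hq0 : 0 < l.prod := List.prod_pos (fun q hq => (hl q hq).pos)
  set k := N / l.prod with hk
  have h1 : N < l.prod * (k + 1) := Nat.lt_mul_div_succ N hq0
  have h2 : l.prod * k ≤ N := Nat.mul_div_le N l.prod
  have hE := EE_nonneg l F hF0 r
  calc _ ≤ ∑ n ∈ Ico a (a + (l.prod : ℕ) * ((k+1 : ℕ):ℤ)), F (cst n) := by
        apply sum_le_sum_of_subset_of_nonneg _ (fun _ _ _ => hF0 _)
        apply Ico_subset_Ico le_rfl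
        have : (N:ℤ) ≤ (l.prod:ℕ) * ((k+1:ℕ):ℤ) := by exact_mod_cast h1.le
        linarith
    _ = l.prod * ((k+1 : ℕ):ℝ) * EE l F r := per_mul l hl hnd F hF r a (k+1)
    _ ≤ _ := by
        apply mul_le_mul_of_nonneg_right _ hE
        have : (l.prod:ℝ) * k ≤ N := by exact_mod_cast h2
        rw [Nat.cast_add, Nat.cast_one]; linarith

lemma per_close (l : List ℕ) (hl : ∀ p ∈ l, Nat.Prime p) (hnd : l.Nodup) (F : RR → ℝ) (hF : Loc l F) (B : ℝ)
    (hB : ∀ r, |F r| ≤ B) (r : RR) (a : ℤ) (N : ℕ) :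
    |∑ n ∈ Ico a (a + N), F (cst n) - N * EE l F r| ≤ 2 * B * l.prod := by
  have hq0 : 0 < l.prod := List.prod_pos (fun q hq => (hl q hq).pos)
  have hB0 : 0 ≤ B := (abs_nonneg _).trans (hB r)
  have h1 := per_pos l hl hnd (fun r => F r + B) (fun r r' h => by simp only [hF r r' h]) (fun r => by linarith [neg_le_of_abs_le (hB r)]) r a N
  have h2 := per_pos l hl hnd (fun r => (-1) * F r + B) (fun r r' h => by simp only [hF r r' h]) (fun r => by linarith [le_of_abs_le (hB r)]) r a N
  have hc := EE_const l (fun p hp => (hl p hp).pos) B r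
  rw [EE_add, hc, sum_add_distrib] at h1
  rw [EE_add, EE_smul, hc, sum_add_distrib, ← mul_sum] at h2
  simp only [sum_const, Int.card_Ico, add_sub_cancel_left, Int.toNat_natCast, nsmul_eq_mul] at h1 h2
  have hE : |EE l F r| ≤ B := by
    refine (EE_abs l F r).trans ?_
    rw [← hc]; exact EE_mono l _ _ hB r
  have hE' := abs_le.1 hE
  have hq : (0:ℝ) < l.prod := by exact_mod_cast hq0
  rw [abs_le]
  constructor <;> nlinarith

def nn (p : ℕ) (F : RR → ℝ) : RR → ℝ := fun r => F (Function.update r p none)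
def Tr : List ℕ → ℕ → (RR → ℝ) → RR → ℝ
  | _, 0, _ => fun _ => 0
  | [], _+1, F => F
  | p :: l, j+1, F => fun r => Tr l (j+1) (nn p F) r + Tr l j (fun r => F r - nn p F r) r
def es (h : ℕ → RR → ℝ) : List ℕ → ℕ → RR → ℝ
  | _, 0 => fun _ => 1
  | [], _+1 => fun _ => 0
  | p :: l, j+1 => fun r => es h l (j+1) r + h p r * es h l j r
def ec (a : ℕ → ℝ) : List ℕ → ℕ → ℝ
  | _, 0 => 1
  | [], _+1 => 0
  | p :: l, j+1 => ec a l (j+1) + a p * ec a l j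

lemma es_zero (h l) : es h l 0 = fun _ => 1 := by cases l <;> rfl
lemma ec_zero (h l) : ec h l 0 = 1 := by cases l <;> rfl
lemma Tr_zero (l F) : Tr l 0 F = fun _ => 0 := by cases l <;> rfl

lemma ec_nonneg (a : ℕ → ℝ) (l : List ℕ) (ha : ∀ p ∈ l, 0 ≤ a p) (j : ℕ) : 0 ≤ ec a l j := by
  induction l generalizing j with
  | nil => cases j <;> simp [ec]
  | cons p l ih =>
    cases j with
    | zero => simp [ec]
    | succ j =>
      simp only [ec]
      have := ha p (by simp)
      have h1 := ih (fun q hq => ha q (by simp [hq])) j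
      have h2 := ih (fun q hq => ha q (by simp [hq])) (j+1)
      positivity

lemma pow_aux (x S : ℝ) (hx : 0 ≤ x) (hS : 0 ≤ S) (j : ℕ) : S ^ (j+1) + (j+1) * (x * S ^ j) ≤ (x + S) ^ (j+1) := by
  induction j with
  | zero => simp; linarith
  | succ j ihj =>
    calc _ ≤ (S ^ (j+1) + (j+1) * (x * S ^ j)) * (x + S) := by
          have : 0 ≤ (j+1) * (x * S ^ j) * x := by positivity
          push_cast; ring_nf at this ⊢; nlinarith
      _ ≤ (x + S) ^ (j+1) * (x + S) := by gcongr
      _ = _ := by ring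

lemma ec_le (a : ℕ → ℝ) (l : List ℕ) (ha : ∀ p ∈ l, 0 ≤ a p) (j : ℕ) : ec a l j ≤ (l.map a).sum ^ j / j.factorial := by
  induction l generalizing j with
  | nil => cases j <;> simp [ec]
  | cons p l ih =>
    cases j with
    | zero => simp [ec]
    | succ j =>
      simp only [ec, List.map_cons, List.sum_cons]
      have hp := ha p (by simp)
      have ha' : ∀ q ∈ l, 0 ≤ a q := fun q hq => ha q (by simp [hq])
      have h1 := ih ha' j
      have h2 := ih ha' (j+1)
      set S := (l.map a).sum
      have hS : 0 ≤ S := List.sum_nonneg (by simpa using ha')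
      have h3 := pow_aux (a p) S hp hS j
      calc _ ≤ S ^ (j+1) / (j+1).factorial + a p * (S ^ j / j.factorial) := by gcongr
        _ = (S ^ (j+1) + (j+1) * (a p * S ^ j)) / (j+1).factorial := by
            rw [Nat.factorial_succ]; push_cast; field_simp
        _ ≤ _ := by gcongr

lemma es_nonneg (h : ℕ → RR → ℝ) (hh : ∀ p r, 0 ≤ h p r) (l : List ℕ) (j : ℕ) (r : RR) : 0 ≤ es h l j r := by
  induction l generalizing j with
  | nil => cases j <;> simp [es]
  | cons p l ih =>
    cases j with
    | zero => simp [es]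
    | succ j =>
      simp only [es]
      have := hh p r; have h1 := ih j; have h2 := ih (j+1)
      positivity

lemma Tr_err (h : ℕ → RR → ℝ) (hh : ∀ p r, h p r = 0 ∨ 1 ≤ h p r)
    (hloc : ∀ p q r, p ≠ q → h p (Function.update r q none) = h p r)
    (l : List ℕ) (hnd : l.Nodup) (j : ℕ) (F f : RR → ℝ) (hFf : ∀ r, |F r| ≤ f r)
    (hf : ∀ p ∈ l, ∀ r, f (Function.update r p none) = f r)
    (hF : ∀ p ∈ l, ∀ r, h p r = 0 → F (Function.update r p none) = F r) (r : RR) :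
    |F r - Tr l j F r| ≤ 2 ^ j * f r * es h l j r := by
  have hh0 : ∀ p r, 0 ≤ h p r := fun p r => by rcases hh p r with h | h <;> linarith
  induction l generalizing j F f r with
  | nil =>
    cases j with
    | zero => simpa [Tr, es] using hFf r
    | succ j => simp [Tr, es]
  | cons p l ih =>
    cases j with
    | zero => simpa [Tr, es] using hFf r
    | succ j =>
      obtain ⟨hpl, hnd'⟩ := List.nodup_cons.1 hnd
      have hne : ∀ q ∈ l, q ≠ p := by rintro q hq rfl; exact hpl hq
      have h1 := ih hnd' (j+1) (nn p F) f (fun r => by rw [nn, ← hf p (by simp) r]; exact hFf _)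
        (fun q hq => hf q (by simp [hq]))
        (fun q hq r hr => by
          simp only [nn]
          rw [Function.update_comm (hne q hq)]
          exact hF q (by simp [hq]) _ (by rw [hloc q p r (hne q hq)]; exact hr)) r
      have h2 := ih hnd' j (fun r => F r - nn p F r) (fun r => 2 * f r * h p r)
        (fun r => by
          rcases hh p r with h0 | h0
          · simp only [nn]
            rw [hF p (by simp) r h0, h0]; simp
          · have e1 := hFf r
            have e2 := hFf (Function.update r p none)
            rw [hf p (by simp) r] at e2
            have e3 := abs_sub (F r) (nn p F r)
            simp only [nn] at e3 ⊢
            have e0 : 0 ≤ f r := (abs_nonneg _).trans e1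
            nlinarith)
        (fun q hq r => by
          rw [hf q (by simp [hq]), hloc p q r (hne q hq).symm])
        (fun q hq r hr => by
          simp only [nn]
          rw [Function.update_comm (hne q hq), hF q (by simp [hq]) r hr,
            hF q (by simp [hq]) (Function.update r p none) (by rw [hloc q p r (hne q hq)]; exact hr)]) r
      simp only [Tr, es]
      calc _ = |(nn p F r - Tr l (j+1) (nn p F) r) + ((F r - nn p F r) - Tr l j (fun r => F r - nn p F r) r)| := by
            congr 1; ring
        _ ≤ _ := (abs_add_le _ _).trans (add_le_add h1 h2)
        _ = _ := by ring

lemma Loc_update (S : List ℕ) (f : RR → ℝ) (hf : Loc S f) (p : ℕ) (hp : p ∉ S) (v : Option ℤ) (r : RR) :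
    f (Function.update r p v) = f r := by
  apply hf
  intro q hq
  rw [Function.update_of_ne (by rintro rfl; exact hp hq)]; exact oeq_refl _ _

lemma Loc_mono {S T : List ℕ} (h : ∀ p ∈ S, p ∈ T) {f : RR → ℝ} (hf : Loc S f) : Loc T f :=
  fun r r' hr => hf r r' (fun p hp => hr p (h p hp))

lemma EE_indep (p : ℕ) (hp : 0 < p) (l : List ℕ) (F : RR → ℝ) (hF : ∀ r v, F (Function.update r p v) = F r) :
    EE (l ++ [p]) F = EE l F := by
  rw [EE_append]
  congr 1
  funext r
  simp only [EE, Av, hF, sum_const, card_range, nsmul_eq_mul]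
  have : (p:ℝ) ≠ 0 := by positivity
  field_simp

lemma Tr_indep (l : List ℕ) (p : ℕ) (hp : p ∉ l) (j : ℕ) (F : RR → ℝ) (hF : ∀ r v, F (Function.update r p v) = F r) (r : RR) (v : Option ℤ) :
    Tr l j F (Function.update r p v) = Tr l j F r := by
  induction l generalizing j F r with
  | nil => cases j <;> simp [Tr, hF]
  | cons q l ih =>
    simp only [List.mem_cons, not_or] at hp
    cases j with
    | zero => simp [Tr]
    | succ j =>
      have h1 : ∀ r v, nn q F (Function.update r p v) = nn q F r := fun r v => by
        simp only [nn]; rw [Function.update_comm hp.1, hF]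
      simp only [Tr]
      rw [ih hp.2 _ _ h1, ih hp.2 _ _ (fun r v => by simp only [h1, hF])]

lemma nn_loc (p : ℕ) (S : List ℕ) (F : RR → ℝ) (hF : Loc S F) (T : List ℕ) (hT : ∀ q ∈ S, q = p ∨ q ∈ T) : Loc T (nn p F) := by
  intro r r' h
  simp only [nn]
  apply hF
  intro q hq
  by_cases hqp : q = p
  · subst hqp; simp only [Function.update_self]; exact oeq_refl _ _
  · rw [Function.update_of_ne hqp, Function.update_of_ne hqp]
    exact h q ((hT q hq).resolve_left hqp)

lemma Tr_per (H : ℕ) (l S : List ℕ) (hl : ∀ p ∈ S ++ l, Nat.Prime p) (hnd : (S ++ l).Nodup) (hH : ∀ p ∈ l, p ≤ H)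
    (j : ℕ) (F : RR → ℝ) (hF : Loc (S ++ l) F) (B : ℝ) (hB : ∀ r, |F r| ≤ B) (r : RR) (a : ℤ) (N : ℕ) :
    |∑ n ∈ Ico a (a + N), Tr l j F (cst n) - N * EE (S ++ l) (Tr l j F) r| ≤
      2 * B * S.prod * (1 + 2 * H * l.length : ℝ) ^ j := by
  have hB0 : 0 ≤ B := (abs_nonneg _).trans (hB r)
  induction l generalizing S j F B with
  | nil =>
    cases j with
    | zero =>
      simp only [Tr, sum_const_zero, zero_sub]
      rw [EE_const _ (fun p hp => (hl p hp).pos), mul_zero, neg_zero, abs_zero]; positivity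
    | succ j =>
      simp only [Tr]
      rw [List.append_nil] at *
      have := per_close S hl hnd F hF B hB r a N
      simpa using this
  | cons p l ih =>
    cases j with
    | zero =>
      rw [Tr_zero]
      simp only [sum_const_zero, zero_sub]
      rw [EE_const _ (fun p hp => (hl p hp).pos), mul_zero, neg_zero, abs_zero]; positivity
    | succ j =>
      have hperm : (S ++ p :: l).Perm ((p :: S) ++ l) := List.perm_middle
      have hnd2 : ((p :: S) ++ l).Nodup := hperm.nodup_iff.1 hnd
      have hpn : p ∉ S ++ l := (List.nodup_cons.1 hnd2).1
      have hnd3 : (S ++ l).Nodup := (List.nodup_cons.1 hnd2).2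
      have hpP := hl p (by simp)
      have hl1 : ∀ q ∈ S ++ l, Nat.Prime q := fun q hq => hl q (by
        simp only [List.mem_append, List.mem_cons] at hq ⊢; tauto)
      have hl2 : ∀ q ∈ (p :: S) ++ l, Nat.Prime q := fun q hq => hl q (hperm.mem_iff.2 hq)
      have hH' : ∀ q ∈ l, q ≤ H := fun q hq => hH q (by simp [hq])
      have hB1 : ∀ r, |nn p F r| ≤ B := fun r => hB _
      have hnl : Loc (S ++ l) (nn p F) := nn_loc p _ F hF _ (fun q hq => by
        simp only [List.mem_append, List.mem_cons] at hq ⊢; tauto)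
      have h1 := ih S hl1 hnd3 hH' (j+1) (nn p F) hnl B hB1 hB0
      have h2 := ih (p :: S) hl2 hnd2 hH' j (fun r => F r - nn p F r)
        (fun r r' h => by
          simp only
          rw [hF r r' (fun q hq => h q (hperm.mem_iff.1 hq)),
            hnl r r' (fun q hq => h q (by simp only [List.cons_append, List.mem_cons]; tauto))]) (2 * B)
        (fun r => by
          have := abs_sub (F r) (nn p F r)
          have := hB r; have := hB1 r
          linarith) (by linarith)
      have e1 : EE (S ++ p :: l) (Tr (p :: l) (j+1) F) r = EE (S ++ l) (Tr l (j+1) (nn p F)) r +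
          EE ((p :: S) ++ l) (Tr l j (fun r => F r - nn p F r)) r := by
        simp only [Tr]
        rw [EE_add]
        congr 1
        · rw [EE_perm (l' := (S ++ l) ++ [p]) (hperm.trans (List.perm_append_singleton p (S ++ l)).symm) hnd]
          rw [EE_indep p hpP.pos]
          intro r v
          apply Tr_indep l p (fun h => hpn (by simp [h]))
          intro r v
          simp [nn]
        · rw [EE_perm hperm hnd]
      rw [e1]
      simp only [Tr]
      rw [sum_add_distrib]
      have hpH : (p:ℝ) ≤ H := by exact_mod_cast hH p (by simp)
      have hS0 : (0:ℝ) ≤ (S.prod:ℕ) := by positivity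
      set X : ℝ := 1 + 2 * H * l.length
      have hX : 1 ≤ X := by have : (0:ℝ) ≤ 2 * H * l.length := by positivity
                            simp only [X]; linarith
      calc _ = |(∑ n ∈ Ico a (a + N), Tr l (j+1) (nn p F) (cst n) - N * EE (S ++ l) (Tr l (j+1) (nn p F)) r) +
            (∑ n ∈ Ico a (a + N), Tr l j (fun r => F r - nn p F r) (cst n) - N * EE ((p :: S) ++ l) (Tr l j (fun r => F r - nn p F r)) r)| := by
            congr 1; ring
        _ ≤ _ := (abs_add_le _ _).trans (add_le_add h1 h2)
        _ = 2 * B * S.prod * (X ^ j * (X + 2 * p)) := by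
            rw [List.prod_cons, Nat.cast_mul]; ring
        _ ≤ 2 * B * S.prod * ((1 + 2 * H * (p :: l).length) ^ j * (1 + 2 * H * (p :: l).length)) := by
            have hX2 : X + 2 * p ≤ 1 + 2 * H * ((p :: l).length : ℝ) := by
              simp only [X, List.length_cons, Nat.cast_add, Nat.cast_one]; linarith
            have hX3 : X ≤ 1 + 2 * H * ((p :: l).length : ℝ) := by
              have : (0:ℝ) ≤ p := by positivity
              linarith
            gcongr
        _ = _ := by rw [pow_succ]

lemma es_real (H : ℕ) (h : ℕ → RR → ℝ) (hh : ∀ p r, 0 ≤ h p r) (hloc : ∀ p, Loc [p] (h p)) (av : ℕ → ℝ)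
    (l S : List ℕ) (hl : ∀ p ∈ S ++ l, Nat.Prime p) (hnd : (S ++ l).Nodup) (hH : ∀ p ∈ l, p ≤ H) (hH1 : 1 ≤ H)
    (hav : ∀ p ∈ l, ∀ r, Av p (h p) r ≤ av p) (hav0 : ∀ p ∈ l, 0 ≤ av p)
    (j : ℕ) (f : RR → ℝ) (hf : Loc S f) (hf0 : ∀ r, 0 ≤ f r) (r : RR) (a : ℤ) (N : ℕ) :
    ∑ n ∈ Ico a (a + N), f (cst n) * es h l j (cst n) ≤ (N + S.prod * (H:ℝ) ^ j) * EE S f r * ec av l j := by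
  have hH1' : (1:ℝ) ≤ H := by exact_mod_cast hH1
  induction l generalizing S j f with
  | nil =>
    rw [List.append_nil] at *
    cases j with
    | zero => simpa [es, ec] using per_pos S hl hnd f hf hf0 r a N
    | succ j => simp [es, ec]
  | cons p l ih =>
    have hperm : (S ++ p :: l).Perm ((p :: S) ++ l) := List.perm_middle
    have hnd2 : ((p :: S) ++ l).Nodup := hperm.nodup_iff.1 hnd
    have hpn : p ∉ S ++ l := (List.nodup_cons.1 hnd2).1
    have hpS : p ∉ S := fun h => hpn (by simp [h])
    have hnd3 : (S ++ l).Nodup := (List.nodup_cons.1 hnd2).2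
    have hl1 : ∀ q ∈ S ++ l, Nat.Prime q := fun q hq => hl q (by
      simp only [List.mem_append, List.mem_cons] at hq ⊢; tauto)
    have hl2 : ∀ q ∈ (p :: S) ++ l, Nat.Prime q := fun q hq => hl q (hperm.mem_iff.2 hq)
    have hH' : ∀ q ∈ l, q ≤ H := fun q hq => hH q (by simp [hq])
    have hav' := fun q hq => hav q (List.mem_cons_of_mem p hq)
    have hav0' := fun q hq => hav0 q (List.mem_cons_of_mem p hq)
    cases j with
    | zero =>
      rw [es_zero, ec_zero]
      simpa using per_pos S (fun q hq => hl1 q (by simp [hq])) (List.nodup_append.1 hnd3).1 f hf hf0 r a N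
    | succ j =>
      have h1 := ih S hl1 hnd3 hH' hav' hav0' (j+1) f hf hf0
      have h2 := ih (p :: S) hl2 hnd2 hH' hav' hav0' j (fun r => f r * h p r)
        (fun r r' hr => by
          simp only
          rw [hf r r' (fun q hq => hr q (by simp [hq])), hloc p r r' (fun q hq => hr q (by simp at hq; simp [hq]))])
        (fun r => mul_nonneg (hf0 r) (hh p r))
      have h3 : EE (p :: S) (fun r => f r * h p r) r ≤ av p * EE S f r := by
        have hndS : (p :: S).Nodup := List.nodup_cons.2 ⟨hpS, (List.nodup_append.1 hnd3).1⟩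
        rw [EE_perm (List.perm_append_singleton p S).symm hndS, EE_append, ← EE_smul]
        apply EE_mono
        intro r
        rw [EE_pull [p] f (h p) (fun q hq r v => by simp at hq; subst hq; exact Loc_update S f hf q hpS _ _)]
        have := mul_le_mul_of_nonneg_left (hav p (by simp) r) (hf0 r)
        simp only [EE]; linarith
      have hES := EE_nonneg S f hf0 r
      have hec1 := ec_nonneg av l hav0' j
      have hap := hav0 p (by simp)
      have hpH : (p:ℝ) ≤ H := by exact_mod_cast hH p (by simp)
      simp only [es, ec]
      calc _ = ∑ n ∈ Ico a (a + N), f (cst n) * es h l (j+1) (cst n) + ∑ n ∈ Ico a (a + N), f (cst n) * h p (cst n) * es h l j (cst n) := by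
            rw [← sum_add_distrib]; apply sum_congr rfl; intros; ring
        _ ≤ _ := add_le_add h1 h2
        _ ≤ (N + S.prod * (H:ℝ) ^ (j+1)) * EE S f r * ec av l (j+1) + (N + S.prod * (H:ℝ)^(j+1)) * (av p * EE S f r) * ec av l j := by
            have hS0 : (0:ℝ) ≤ (S.prod:ℕ) := by positivity
            have e : (N + (p :: S).prod * (H:ℝ) ^ j) ≤ (N + S.prod * (H:ℝ)^(j+1)) := by
              rw [List.prod_cons, Nat.cast_mul, pow_succ]
              have : (p:ℝ) * S.prod * (H:ℝ)^j ≤ H * S.prod * (H:ℝ)^j := by gcongr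
              linarith
            have e2 := EE_nonneg (p :: S) (fun r => f r * h p r) (fun r => mul_nonneg (hf0 r) (hh p r)) r
            gcongr
        _ = _ := by ring

lemma es_loc (h : ℕ → RR → ℝ) (hloc : ∀ p, Loc [p] (h p)) (l : List ℕ) (j : ℕ) : Loc l (es h l j) := by
  induction l generalizing j with
  | nil => intro r r' _; cases j <;> simp [es]
  | cons p l ih =>
    cases j with
    | zero => intro r r' _; simp [es]
    | succ j =>
      intro r r' hr
      simp only [es]
      have h0 : ∀ q ∈ l, oeq q (r q) (r' q) := fun q hq => hr q (by simp [hq])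
      rw [ih (j+1) r r' h0, ih j r r' h0, hloc p r r' (fun q hq => hr q (by simp at hq; simp [hq]))]

lemma es_model (h : ℕ → RR → ℝ) (hh : ∀ p r, 0 ≤ h p r) (hloc : ∀ p, Loc [p] (h p)) (av : ℕ → ℝ)
    (l : List ℕ) (hl : ∀ p ∈ l, Nat.Prime p) (hnd : l.Nodup)
    (hav : ∀ p ∈ l, ∀ r, Av p (h p) r ≤ av p) (hav0 : ∀ p ∈ l, 0 ≤ av p) (j : ℕ) (r : RR) :
    EE l (es h l j) r ≤ ec av l j := by
  induction l generalizing j r with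
  | nil => cases j <;> simp [EE, es, ec]
  | cons p l ih =>
    obtain ⟨hpl, hnd'⟩ := List.nodup_cons.1 hnd
    cases j with
    | zero => rw [es_zero, ec_zero, EE_const _ (fun p hp => (hl p hp).pos)]
    | succ j =>
      have hih := ih (fun q hq => hl q (by simp [hq])) hnd' (fun q hq => hav q (by simp [hq])) (fun q hq => hav0 q (by simp [hq]))
      have h0 : ec av l j ≥ 0 := ec_nonneg av l (fun q hq => hav0 q (by simp [hq])) j
      simp only [es, ec]
      rw [EE_add]
      apply add_le_add
      · calc _ ≤ Av p (fun _ => ec av l (j+1)) r := Av_mono p _ _ r (fun r => hih (j+1) r)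
          _ = _ := EE_const [p] (by simpa using (hl p (by simp)).pos) _ r
      · calc _ ≤ Av p (fun r => ec av l j * h p r) r := by
              apply Av_mono; intro r
              rw [EE_pull l (h p) _ (fun q hq r v => Loc_update [p] (h p) (hloc p) q (by simp; rintro rfl; exact hpl hq) _ _)]
              rw [mul_comm]; exact mul_le_mul_of_nonneg_right (hih j r) (hh p r)
          _ = ec av l j * Av p (h p) r := EE_smul [p] _ _ r
          _ ≤ ec av l j * av p := by have := hav p (by simp) r; gcongr
          _ = _ := by ring

theorem trunc (H : ℕ) (hH1 : 1 ≤ H) (h : ℕ → RR → ℝ) (hh : ∀ p r, h p r = 0 ∨ 1 ≤ h p r) (hloc : ∀ p, Loc [p] (h p)) (av : ℕ → ℝ)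
    (l S : List ℕ) (hl : ∀ p ∈ S ++ l, Nat.Prime p) (hnd : (S ++ l).Nodup) (hH : ∀ p ∈ l, p ≤ H)
    (hav : ∀ p ∈ l, ∀ r, Av p (h p) r ≤ av p) (hav0 : ∀ p ∈ l, 0 ≤ av p)
    (J : ℕ) (G f : RR → ℝ) (hf : Loc S f) (hG : Loc (S ++ l) G) (hGf : ∀ r, |G r| ≤ f r) (B : ℝ) (hB : ∀ r, f r ≤ B)
    (hGh : ∀ p ∈ l, ∀ r, h p r = 0 → G (Function.update r p none) = G r) (r : RR) (a : ℤ) (N : ℕ) :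
    |∑ n ∈ Ico a (a + N), G (cst n) - N * EE (S ++ l) G r| ≤
      2 * B * S.prod * (1 + 2 * H * l.length : ℝ) ^ J + 2 ^ J * ((2 * N + S.prod * (H:ℝ) ^ J) * EE S f r * ec av l J) := by
  have hh0 : ∀ p r, 0 ≤ h p r := fun p r => by rcases hh p r with h | h <;> linarith
  have hf0 : ∀ r, 0 ≤ f r := fun r => (abs_nonneg _).trans (hGf r)
  have hndl : l.Nodup := (List.nodup_append.1 hnd).2.1
  have hdis : ∀ p ∈ l, p ∉ S := fun p hp hS => (List.nodup_append.1 hnd).2.2 p hS p hp rfl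
  have herr := Tr_err h hh (fun p q r hpq => Loc_update [p] (h p) (hloc p) q (by simpa using hpq.symm) _ _) l hndl J G f hGf
    (fun p hp r => Loc_update S f hf p (hdis p hp) _ _) hGh
  have h1 := Tr_per H l S hl hnd hH J G hG B (fun r => (hGf r).trans (hB r)) r a N
  have h2 : |∑ n ∈ Ico a (a + N), G (cst n) - ∑ n ∈ Ico a (a + N), Tr l J G (cst n)| ≤
      2 ^ J * ((N + S.prod * (H:ℝ) ^ J) * EE S f r * ec av l J) := by
    rw [← sum_sub_distrib]
    calc _ ≤ ∑ n ∈ Ico a (a + N), 2 ^ J * (f (cst n) * es h l J (cst n)) :=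
          (abs_sum_le_sum_abs _ _).trans (sum_le_sum fun n _ => by rw [← mul_assoc]; exact herr _)
      _ ≤ _ := by
          rw [← mul_sum]
          exact mul_le_mul_of_nonneg_left (es_real H h hh0 hloc av l S hl hnd hH hH1 hav hav0 J f hf hf0 r a N) (by positivity)
  have h3 : |EE (S ++ l) G r - EE (S ++ l) (Tr l J G) r| ≤ 2 ^ J * (EE S f r * ec av l J) := by
    have e : EE (S ++ l) G r - EE (S ++ l) (Tr l J G) r = EE (S ++ l) (fun r => G r + (-1) * Tr l J G r) r := by
      rw [EE_add, EE_smul]; ring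
    rw [e]
    refine (EE_abs _ _ _).trans ?_
    calc _ ≤ EE (S ++ l) (fun r => 2 ^ J * (f r * es h l J r)) r := by
          apply EE_mono; intro r
          rw [show G r + -1 * Tr l J G r = G r - Tr l J G r by ring, ← mul_assoc]; exact herr _
      _ ≤ _ := by
          rw [EE_smul]
          apply mul_le_mul_of_nonneg_left _ (by positivity)
          rw [EE_append]
          calc _ ≤ EE S (fun r => ec av l J * f r) r := by
                apply EE_mono; intro r
                rw [EE_pull l f _ (fun q hq r v => Loc_update S f hf q (hdis q hq) _ _), mul_comm]
                exact mul_le_mul_of_nonneg_right (es_model h hh0 hloc av l (fun q hq => hl q (by simp [hq])) hndl hav hav0 J r) (hf0 r)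
            _ = _ := by rw [EE_smul, mul_comm]
  have h4 : |(N:ℝ) * (EE (S ++ l) (Tr l J G) r - EE (S ++ l) G r)| ≤ N * (2 ^ J * (EE S f r * ec av l J)) := by
    rw [abs_mul, abs_sub_comm, Nat.abs_cast]; gcongr
  calc _ = |(∑ n ∈ Ico a (a + N), G (cst n) - ∑ n ∈ Ico a (a + N), Tr l J G (cst n)) +
        (∑ n ∈ Ico a (a + N), Tr l J G (cst n) - N * EE (S ++ l) (Tr l J G) r) + N * (EE (S ++ l) (Tr l J G) r - EE (S ++ l) G r)| := by
        congr 1; ring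
    _ ≤ _ := (abs_add_le _ _).trans (add_le_add ((abs_add_le _ _).trans (add_le_add h2 h1)) h4)
    _ = _ := by ring

def Dth (θ : ℝ → ℝ) : ℕ → ℝ → ℝ
  | 0 => θ
  | k+1 => fun x => Dth θ k (x+1) - Dth θ k x

noncomputable def hz (q : ℕ) (ρ : ℤ) (x : ℤ) : ℝ := if (q:ℤ) ∣ ρ + x then 1 else 0

noncomputable def VV (D : Finset ℤ) (θ : ℝ → ℝ) : List (ℕ × ℤ × ℤ) → (ℤ → ℕ) → (ℤ → ℝ) → ℝ
  | [], e, c => ∏ x ∈ D, Dth θ (e x) (c x)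
  | (q, s, _) :: js, e, c => (1/(q:ℝ)) * ∑ ρ ∈ range q, (hz q ρ s - 1/q) * VV D θ js e (fun x => c x + hz q ρ x)

def i1 (y : ℤ) : ℤ → ℕ := fun x => if x = y then 1 else 0

lemma VV_congr (D θ js e) (c c' : ℤ → ℝ) (h : ∀ x ∈ D, c x = c' x) : VV D θ js e c = VV D θ js e c' := by
  induction js generalizing c c' with
  | nil => simp only [VV]; exact prod_congr rfl (fun x hx => by rw [h x hx])
  | cons a js ih =>
    obtain ⟨q, s, s'⟩ := a
    simp only [VV]
    congr 1
    apply sum_congr rfl; intro ρ _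
    congr 1
    exact ih _ _ (fun x hx => by rw [h x hx])

lemma VV_diff (D θ js e) (c : ℤ → ℝ) (y : ℤ) (hy : y ∈ D) :
    VV D θ js e (fun x => c x + i1 y x) - VV D θ js e c = VV D θ js (fun x => e x + i1 y x) c := by
  induction js generalizing c with
  | nil =>
    simp only [VV]
    rw [← mul_prod_erase D _ hy, ← mul_prod_erase D _ hy, ← mul_prod_erase D _ hy]
    have h1 : ∏ x ∈ D.erase y, Dth θ (e x) (c x + i1 y x) = ∏ x ∈ D.erase y, Dth θ (e x) (c x) :=
      prod_congr rfl (fun x hx => by simp [i1, (mem_erase.1 hx).1])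
    have h2 : ∏ x ∈ D.erase y, Dth θ (e x + i1 y x) (c x) = ∏ x ∈ D.erase y, Dth θ (e x) (c x) :=
      prod_congr rfl (fun x hx => by simp [i1, (mem_erase.1 hx).1])
    rw [h1, h2, ← sub_mul]
    simp [i1, Dth]
  | cons a js ih =>
    obtain ⟨q, s, s'⟩ := a
    simp only [VV]
    rw [← mul_sub, ← sum_sub_distrib]
    congr 1
    apply sum_congr rfl; intro ρ _
    rw [← ih, ← mul_sub]
    congr 2
    apply VV_congr
    intro x _; ring

lemma VV_bound (D : Finset ℤ) (θ : ℝ → ℝ) (β : ℝ) (hβ : 0 ≤ β) (hθ : ∀ k ≤ 2, ∀ x, |Dth θ k x| ≤ β ^ k)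
    (H0 : ℝ) (hH0 : 0 < H0)
    (js : List (ℕ × ℤ × ℤ)) (hjs : ∀ a ∈ js, 0 < a.1 ∧ H0 ≤ a.1 ∧ a.2.1 ≠ a.2.2 ∧ a.2.1 ∈ D ∧ a.2.2 ∈ D ∧
      (∀ x ∈ D, (a.1:ℤ) ∣ x - a.2.1 ↔ x = a.2.1 ∨ x = a.2.2))
    (e : ℤ → ℕ) (he : ∀ x, e x + (js.map (fun a => i1 a.2.1 x + i1 a.2.2 x)).sum ≤ 2) (c : ℤ → ℝ) :
    |VV D θ js e c| ≤ (js.map (fun a => (1/(a.1:ℝ)) * (2 * β + 2 * D.card / H0))).prod * ∏ x ∈ D, β ^ e x := by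
  induction js generalizing e c with
  | nil =>
    simp only [VV, List.map_nil, List.prod_nil, one_mul, abs_prod]
    apply prod_le_prod (fun _ _ => abs_nonneg _)
    intro x _
    exact hθ _ (by simpa using he x) _
  | cons a js ih =>
    obtain ⟨q, s, s'⟩ := a
    obtain ⟨hq0, hqH, hss, hsD, hsD', hdiv⟩ := hjs _ (List.mem_cons_self)
    simp only at hq0 hqH hss hsD hsD' hdiv
    have ih' := ih (fun a ha => hjs a (by simp [ha]))
    set W := VV D θ js with hW
    set Bd := (js.map (fun a => (1/(a.1:ℝ)) * (2 * β + 2 * D.card / H0))).prod with hBd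
    have hBd0 : 0 ≤ Bd := List.prod_nonneg (by
      intro x hx
      obtain ⟨a, _, rfl⟩ := List.mem_map.1 hx
      positivity)
    have hq : (0:ℝ) < q := by positivity
    have hPe : ∀ y ∈ D, ∏ x ∈ D, β ^ (e x + i1 y x) = β * ∏ x ∈ D, β ^ e x := by
      intro y hy
      rw [← mul_prod_erase D _ hy, ← mul_prod_erase D _ hy, ← mul_assoc]
      congr 1
      · simp [i1, pow_succ']
      · exact prod_congr rfl (fun x hx => by simp [i1, (mem_erase.1 hx).1])
    set Pe := ∏ x ∈ D, β ^ e x with hPee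
    have hPe0 : 0 ≤ Pe := prod_nonneg (fun _ _ => by positivity)
    simp only [List.map_cons, List.sum_cons] at he
    have hb0 : ∀ c, |W e c| ≤ Bd * Pe := fun c => ih' e (fun x => by have := he x; omega) c
    have hb1 : ∀ c, |W (fun x => e x + i1 s x) c| ≤ Bd * (β * Pe) := fun c => by
      rw [← hPe s hsD]
      exact ih' _ (fun x => by have := he x; omega) c
    have hb2 : ∀ c, |W (fun x => e x + i1 s' x) c| ≤ Bd * (β * Pe) := fun c => by
      rw [← hPe s' hsD']
      exact ih' _ (fun x => by have := he x; omega) c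
    set g : ℕ → ℝ := fun ρ => W e (fun x => c x + hz q ρ x) with hg
    -- the special residue
    obtain ⟨ρ0, hρ0, hρ0s⟩ : ∃ ρ0 ∈ range q, ∀ x : ℤ, (q:ℤ) ∣ (ρ0:ℕ) + x ↔ (q:ℤ) ∣ x - s := by
      have hq' : (0:ℤ) < q := by exact_mod_cast hq0
      refine ⟨((-s) % q).toNat, ?_, ?_⟩
      · rw [mem_range]
        have := Int.emod_lt_of_pos (-s) hq'
        have := Int.emod_nonneg (-s) hq'.ne'
        omega
      · intro x
        rw [Int.toNat_of_nonneg (Int.emod_nonneg (-s) hq'.ne')]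
        have h1 : (q:ℤ) ∣ (-s) - (-s) % q := Int.dvd_self_sub_emod
        rw [show x - s = ((-s) - (-s) % q) + ((-s) % q + x) by ring]
        exact (Int.dvd_add_right h1).symm
    have huniq : ∀ ρ ∈ range q, ∀ x : ℤ, ∀ ρ' ∈ range q, (q:ℤ) ∣ (ρ:ℕ) + x → (q:ℤ) ∣ (ρ':ℕ) + x → ρ = ρ' := by
      intro ρ hρ x ρ' hρ' h h'
      have h1 : (q:ℤ) ∣ (ρ:ℤ) - ρ' := by
        have := dvd_sub h h'
        rwa [show ((ρ:ℤ) + x) - (ρ' + x) = ρ - ρ' by ring] at this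
      rw [mem_range] at hρ hρ'
      have := Int.eq_zero_of_abs_lt_dvd h1 (by rw [abs_lt]; constructor <;> omega)
      omega
    have e1 : ∑ ρ ∈ range q, (hz q ρ s - 1/q) * g ρ = (g ρ0 - W e c) - (1/q) * ∑ ρ ∈ range q, (g ρ - W e c) := by
      simp only [sub_mul, sum_sub_distrib, sum_const, card_range, nsmul_eq_mul, ← mul_sum]
      have : ∑ ρ ∈ range q, hz q ρ s * g ρ = g ρ0 := by
        rw [sum_eq_single_of_mem ρ0 hρ0]
        · have : hz q (ρ0:ℕ) s = 1 := by rw [hz, if_pos ((hρ0s s).2 (by simp))]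
          rw [this, one_mul]
        · intro ρ hρ hne
          have : hz q (ρ:ℕ) s = 0 := by
            rw [hz, if_neg]
            intro h
            exact hne (huniq ρ hρ s ρ0 hρ0 h ((hρ0s s).2 (by simp)))
          rw [this, zero_mul]
      rw [this]
      field_simp
      ring
    have e2 : |g ρ0 - W e c| ≤ 2 * β * (Bd * Pe) := by
      have h1 : g ρ0 = W e (fun x => (c x + i1 s' x) + i1 s x) := by
        apply VV_congr
        intro x hx
        by_cases hd : x = s ∨ x = s'
        · have : hz q (ρ0:ℕ) x = 1 := by rw [hz, if_pos ((hρ0s x).2 ((hdiv x hx).2 hd))]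
          rw [this]
          rcases hd with rfl | rfl
          · simp [i1, hss]
          · simp [i1, hss.symm]
        · have : hz q (ρ0:ℕ) x = 0 := by rw [hz, if_neg (fun h => hd ((hdiv x hx).1 ((hρ0s x).1 h)))]
          rw [this]
          push_neg at hd
          simp [i1, hd.1, hd.2]
      have h2 := VV_diff D θ js e (fun x => c x + i1 s' x) s hsD
      have h3 := VV_diff D θ js e c s' hsD'
      rw [← hW] at h2 h3
      have h4 : g ρ0 - W e c = W (fun x => e x + i1 s x) (fun x => c x + i1 s' x) + W (fun x => e x + i1 s' x) c := by
        rw [h1, ← h2, ← h3]; ring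
      rw [h4]
      refine (abs_add_le _ _).trans ?_
      have := hb1 (fun x => c x + i1 s' x)
      have := hb2 c
      linarith
    have e3 : |∑ ρ ∈ range q, (g ρ - W e c)| ≤ 2 * D.card * (Bd * Pe) := by
      have h1 : ∑ ρ ∈ range q, (g ρ - W e c) = ∑ ρ ∈ (range q).filter (fun ρ => ∃ x ∈ D, (q:ℤ) ∣ (ρ:ℕ) + x), (g ρ - W e c) := by
        symm
        apply sum_subset (filter_subset _ _)
        intro ρ hρ hn
        simp only [mem_filter, hρ, true_and, not_exists, not_and] at hn
        have : g ρ = W e c := by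
          apply VV_congr; intro x hx
          rw [hz, if_neg (hn x hx), add_zero]
        rw [this, sub_self]
      have h2 : ((range q).filter (fun ρ => ∃ x ∈ D, (q:ℤ) ∣ (ρ:ℕ) + x)).card ≤ D.card := by
        have : ∀ ρ ∈ (range q).filter (fun ρ => ∃ x ∈ D, (q:ℤ) ∣ (ρ:ℕ) + x), ∃ x ∈ D, (q:ℤ) ∣ (ρ:ℕ) + x :=
          fun ρ hρ => (mem_filter.1 hρ).2
        choose! f hf using this
        apply card_le_card_of_injOn f (fun ρ hρ => (hf ρ hρ).1)
        intro ρ hρ ρ' hρ' h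
        refine huniq ρ (mem_filter.1 hρ).1 (f ρ) ρ' (mem_filter.1 hρ').1 (hf ρ hρ).2 ?_
        rw [h]; exact (hf ρ' hρ').2
      rw [h1]
      calc _ ≤ ∑ ρ ∈ (range q).filter (fun ρ => ∃ x ∈ D, (q:ℤ) ∣ (ρ:ℕ) + x), 2 * (Bd * Pe) := by
            refine (abs_sum_le_sum_abs _ _).trans (sum_le_sum fun ρ _ => ?_)
            have := abs_sub (g ρ) (W e c)
            have := hb0 c
            have := hb0 (fun x => c x + hz q ρ x)
            have e : |g ρ| ≤ Bd * Pe := this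
            linarith
        _ = ((range q).filter (fun ρ => ∃ x ∈ D, (q:ℤ) ∣ (ρ:ℕ) + x)).card * (2 * (Bd * Pe)) := by rw [sum_const, nsmul_eq_mul]
        _ ≤ D.card * (2 * (Bd * Pe)) := by gcongr
        _ = _ := by ring
    have e4 : VV D θ ((q, s, s') :: js) e c = (1/(q:ℝ)) * ((g ρ0 - W e c) - (1/q) * ∑ ρ ∈ range q, (g ρ - W e c)) := by
      rw [← e1]; simp only [VV]; rfl
    rw [e4, abs_mul, abs_of_nonneg (by positivity : 0 ≤ 1/(q:ℝ))]
    simp only [List.map_cons, List.prod_cons]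
    calc _ ≤ (1/(q:ℝ)) * (2 * β * (Bd * Pe) + (1/q) * (2 * D.card * (Bd * Pe))) := by
          apply mul_le_mul_of_nonneg_left _ (by positivity)
          refine (abs_sub _ _).trans (add_le_add e2 ?_)
          rw [abs_mul, abs_of_nonneg (by positivity : 0 ≤ 1/(q:ℝ))]
          gcongr
      _ ≤ (1/(q:ℝ)) * (2 * β * (Bd * Pe) + (1/H0) * (2 * D.card * (Bd * Pe))) := by gcongr
      _ = _ := by ring

lemma hit_cst (n : ℤ) (p : ℕ) (x : ℤ) : hit (cst n) p x = if (p:ℤ) ∣ n + x then 1 else 0 := hit_some _ _ _ _ rfl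

lemma Av_hit (p : ℕ) (hp : 0 < p) (x : ℤ) (r : RR) : Av p (fun r => hit r p x) r = 1/p := by
  simp only [Av]
  have hp' : (0:ℤ) < p := by exact_mod_cast hp
  rw [sum_eq_single_of_mem ((-x) % p).toNat]
  · rw [hit_some _ _ _ _ (Function.update_self _ _ _), if_pos, mul_one]
    rw [Int.toNat_of_nonneg (Int.emod_nonneg (-x) hp'.ne')]
    have : (-x) % p + x = -((-x) - (-x) % p) := by ring
    rw [this, dvd_neg]; exact Int.dvd_self_sub_emod
  · rw [mem_range]
    have := Int.emod_lt_of_pos (-x) hp'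
    have := Int.emod_nonneg (-x) hp'.ne'
    omega
  · intro ρ hρ hne
    rw [hit_some _ _ _ _ (Function.update_self _ _ _), if_neg]
    intro h
    apply hne
    rw [mem_range] at hρ
    have h1 : (ρ:ℤ) = (-x) % p := by
      have h2 : (ρ:ℤ) % p = (-x) % p := Int.emod_eq_emod_iff_emod_sub_eq_zero.2 (Int.emod_eq_zero_of_dvd (by simpa using h))
      rwa [Int.emod_eq_of_lt (by omega : (0:ℤ) ≤ ρ) (by omega : (ρ:ℤ) < p)] at h2
    omega

lemma EE_drop (A B : List ℕ) (g : RR → ℝ) (hB : ∀ p ∈ B, 0 < p) (hg : ∀ p ∈ B, ∀ r v, g (Function.update r p (some v)) = g r) (r : RR) :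
    EE (A ++ B) g r = EE A g r := by
  rw [EE_append]
  congr 1
  funext r
  have := EE_pull B g (fun _ => 1) hg r
  rw [EE_const B hB, mul_one] at this
  simpa using this

/-- pulling out local averages of distinct primes -/
lemma EE_pullout {ι : Type*} [DecidableEq ι] (z : ι → ℕ) (δ : ι → ℤ) (c : ι → ℝ) (A : Finset ι) (hinj : Set.InjOn z A) (S : List ℕ) (hS : S.Nodup)
    (hS0 : ∀ p ∈ S, 0 < p) (hA : ∀ i ∈ A, z i ∈ S) (g : RR → ℝ) (hg : ∀ i ∈ A, ∀ r v, g (Function.update r (z i) (some v)) = g r) (r : RR) :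
    EE S (fun r => (∏ i ∈ A, (hit r (z i) (δ i) + c i)) * g r) r = (∏ i ∈ A, (1/(z i:ℝ) + c i)) * EE S g r := by
  induction A using Finset.induction_on generalizing S with
  | empty => simp
  | @insert i A hi ih =>
    have hzi := hA i (by simp)
    have hne : ∀ j ∈ A, z j ≠ z i := fun j hj h => hi (by
      have := hinj (by simp [hj]) (by simp) h; rwa [← this])
    have hperm : S.Perm (S.erase (z i) ++ [z i]) := (List.perm_cons_erase hzi).trans (List.perm_append_singleton _ _).symm
    have hpos := hS0 _ hzi
    have hgi := hg i (by simp)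
    have e1 : ∀ r, EE [z i] (fun r => (∏ j ∈ insert i A, (hit r (z j) (δ j) + c j)) * g r) r =
        (1/(z i:ℝ) + c i) * ((∏ j ∈ A, (hit r (z j) (δ j) + c j)) * g r) := by
      intro r
      have : (fun r => (∏ j ∈ insert i A, (hit r (z j) (δ j) + c j)) * g r) =
          fun r => ((∏ j ∈ A, (hit r (z j) (δ j) + c j)) * g r) * (hit r (z i) (δ i) + c i) := by
        funext r; rw [prod_insert hi]; ring
      rw [this, EE_pull, EE_add, EE_const _ (by simpa using hpos)]
      · simp only [EE]; rw [Av_hit _ hpos]; ring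
      · intro p hp r v
        simp only [List.mem_singleton] at hp; subst hp
        rw [hgi]; congr 1
        apply prod_congr rfl; intro j hj
        rw [hit_update_ne _ _ _ _ _ (hne j hj)]
    have hS' : (S.erase (z i)).Nodup := hS.erase _
    have hg1 : EE S g r = EE (S.erase (z i)) g r := by
      rw [EE_perm hperm hS]
      exact EE_drop _ _ g (by simpa using hpos) (by simpa using hgi) r
    rw [hg1, EE_perm hperm hS, EE_append]
    simp_rw [show EE [z i] (fun r => (∏ j ∈ insert i A, (hit r (z j) (δ j) + c j)) * g r) =
      fun r => (1/(z i:ℝ) + c i) * ((∏ j ∈ A, (hit r (z j) (δ j) + c j)) * g r) from funext e1]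
    rw [EE_smul, ih (fun a ha b hb h => hinj (by simp at ha ⊢; simp [ha]) (by simp at hb ⊢; simp [hb]) h) _ hS'
      (fun p hp => hS0 p (List.mem_of_mem_erase hp))
      (fun j hj => (hS.mem_erase_iff).2 ⟨hne j hj, hA j (by simp [hj])⟩) (fun j hj => hg j (by simp [hj])), prod_insert hi]
    ring

lemma EE_V (D : Finset ℤ) (θ : ℝ → ℝ) (js : List (ℕ × ℤ × ℤ)) (hnd : (js.map (fun a => a.1)).Nodup) (e : ℤ → ℕ) (c0 : RR → ℤ → ℝ)
    (hc : ∀ p ∈ js.map (fun a => a.1), ∀ r v x, c0 (Function.update r p v) x = c0 r x) (r : RR) :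
    EE (js.map (fun a => a.1)) (fun r => (js.map (fun a => hit r a.1 a.2.1 - 1/(a.1:ℝ))).prod *
      ∏ x ∈ D, Dth θ (e x) (c0 r x + (js.map (fun a => hit r a.1 x)).sum)) r = VV D θ js e (c0 r) := by
  induction js generalizing c0 r with
  | nil => simp [EE, VV]
  | cons a js ih =>
    obtain ⟨q, s, s'⟩ := a
    simp only [List.map_cons] at hnd hc ⊢
    obtain ⟨hq, hnd'⟩ := List.nodup_cons.1 hnd
    simp only [EE, VV, Av]
    congr 1
    apply sum_congr rfl; intro ρ _
    have hu : ∀ p ∈ js.map (fun a => a.1), ∀ (r:RR) v x, hit (Function.update r p v) q x = hit r q x := fun p hp r v x =>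
      hit_update_ne _ _ _ _ _ (by rintro rfl; exact hq hp)
    have h1 := ih hnd' (fun r x => c0 r x + hit r q x) (fun p hp r v x => by
      rw [hc p (by simp [hp]), hu p hp]) (Function.update r q (some (ρ:ℤ)))
    have hh : ∀ x, hit (Function.update r q (some (ρ:ℤ))) q x = hz q ρ x := fun x =>
      hit_some _ _ _ _ (Function.update_self _ _ _)
    simp only [hh, hc q (by simp)] at h1
    rw [← h1, ← hh s]
    rw [← EE_pull _ (fun r => hit r q s - 1/(q:ℝ)) _ (fun p hp r v => by rw [hu p hp])]
    congr 1
    funext r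
    simp only [List.prod_cons, List.sum_cons, mul_assoc, add_assoc]

lemma kz_fix_iff {m : ℕ} (U : Finset (Fin m)) (z : Fin m → ℕ) (t : Fin m) :
    kz U z t = t ↔ (t ∈ U → ∀ u ∈ U, z u = z t → t ≤ u) := by
  constructor
  · intro h ht u hu hz
    have : kz U z u = kz U z t := kz_congr hu ht hz
    rw [← h, ← this]; exact kz_le U z u
  · intro h
    by_cases ht : t ∈ U
    · have h1 := kz_mem (z := z) ht
      exact le_antisymm (kz_le U z t) (h ht _ h1.1 h1.2)
    · exact kz_not ht

noncomputable def ptE {m : ℕ} (C : Finset (Fin m)) (z : Fin m → ℕ) (E : Finset (Fin m)) : ℝ :=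
  ∏ t ∈ univ.filter (fun t => kz (C \ E) z t = t), (1:ℝ) / z t

noncomputable def mfix {m : ℕ} (C : Finset (Fin m)) (z : Fin m → ℕ) (E : Finset (Fin m)) : Finset (Fin m) :=
  E.filter (fun t => (∃ u ∈ C \ E, z u = z t) ∨ ∃ u ∈ C, z u = z t ∧ u < t)

lemma mfix_mem {m : ℕ} (C : Finset (Fin m)) (z : Fin m → ℕ) (E : Finset (Fin m)) (t : Fin m) :
    t ∈ C \ mfix C z E ↔ t ∈ C \ E ∨ (t ∈ C ∧ t ∈ E ∧ (∀ u ∈ C \ E, z u ≠ z t) ∧ ∀ u ∈ C, z u = z t → t ≤ u) := by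
  unfold mfix
  simp only [mem_sdiff, mem_filter, not_and, not_or, not_exists, not_lt]
  by_cases h1 : t ∈ E <;> by_cases h2 : t ∈ C <;> simp [h1, h2]

lemma mfix_uniq {m : ℕ} (C : Finset (Fin m)) (z : Fin m → ℕ) (E : Finset (Fin m)) (t t' : Fin m)
    (h : t ∈ C \ mfix C z E) (h' : t' ∈ C \ mfix C z E) (hz : z t = z t') : t = t' ∨ (t ∈ C \ E ∧ t' ∈ C \ E) := by
  rw [mfix_mem] at h h'
  rcases h with h | ⟨h1, h2, h3, h4⟩
  · rcases h' with h' | ⟨h1', h2', h3', h4'⟩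
    · exact Or.inr ⟨h, h'⟩
    · exact absurd hz (h3' t h)
  · rcases h' with h' | ⟨h1', h2', h3', h4'⟩
    · exact absurd hz.symm (h3 t' h')
    · exact Or.inl (le_antisymm (h4 t' h1' hz.symm) (h4' t h1 hz))

lemma mfix_pt {m : ℕ} (C : Finset (Fin m)) (z : Fin m → ℕ) (E : Finset (Fin m)) : ptE C z (mfix C z E) = ptE C z E := by
  unfold ptE
  congr 1
  apply filter_congr
  intro t _
  rw [kz_fix_iff, kz_fix_iff]
  have hsub : ∀ u, u ∈ C \ E → u ∈ C \ mfix C z E := fun u hu => (mfix_mem C z E u).2 (Or.inl hu)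
  constructor
  · intro h ht u hu hz
    exact h (hsub t ht) u (hsub u hu) hz
  · intro h ht u hu hz
    rcases mfix_uniq C z E u t hu ht hz with rfl | ⟨h1, h2⟩
    · exact le_rfl
    · exact h h2 u h1 hz

lemma mfix_cong {m : ℕ} (C : Finset (Fin m)) (z : Fin m → ℕ) (E : Finset (Fin m)) (h : cong (C \ E) z) : cong (C \ mfix C z E) z := by
  intro t ht t' ht' hz
  rcases mfix_uniq C z E t t' ht ht' hz with rfl | ⟨h1, h2⟩
  · simp
  · exact h t h1 t' h2 hz

lemma mfix_good {m : ℕ} (C : Finset (Fin m)) (z : Fin m → ℕ) (E : Finset (Fin m)) (hE : E ⊆ C) : goodE C (mfix C z E) z := by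
  intro t ht
  have htE : t ∈ E := (mem_filter.1 ht).1
  by_cases hm : ∃ u ∈ C \ E, z u = z t
  · obtain ⟨u, hu, hz⟩ := hm
    exact ⟨u, (mfix_mem C z E u).2 (Or.inl hu), hz⟩
  · push_neg at hm
    have hmin := kz_mem (U := C) (z := z) (hE htE)
    refine ⟨kz C z t, (mfix_mem C z E _).2 (Or.inr ⟨hmin.1, ?_, ?_, ?_⟩), hmin.2⟩
    · by_contra hn
      exact hm _ (mem_sdiff.2 ⟨hmin.1, hn⟩) hmin.2
    · intro u hu; rw [hmin.2]; exact hm u hu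
    · intro u hu hz
      rw [hmin.2] at hz
      rw [← kz_congr hu (hE htE) hz]; exact kz_le _ _ _

lemma EE_hits {m : ℕ} (U : Finset (Fin m)) (z : Fin m → ℕ) (ε : ℤ) (hε : ε * ε = 1) (S : List ℕ) (hS : S.Nodup)
    (hS0 : ∀ p ∈ S, 0 < p) (hU : ∀ i ∈ U, z i ∈ S) (r : RR) :
    EE S (fun r => ∏ i ∈ U, hit r (z i) (ε * sg z i.1)) r ≤
      if cong U z then ∏ t ∈ U.filter (fun t => kz U z t = t), (1:ℝ) / z t else 0 := by
  split_ifs with hc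
  · have h1 : Set.InjOn z (U.filter (fun t => kz U z t = t)) := by
      intro t ht t' ht' hz
      simp only [coe_filter, Set.mem_setOf_eq] at ht ht'
      rw [← ht.2, ← ht'.2]; exact kz_congr ht.1 ht'.1 hz
    have h2 := EE_pullout z (fun i => ε * sg z i.1) (fun _ => 0) _ h1 S hS hS0 (fun i hi => hU i (mem_filter.1 hi).1)
      (fun _ => 1) (fun _ _ _ _ => rfl) r
    rw [EE_const S hS0] at h2
    simp only [add_zero, mul_one] at h2
    rw [← h2]
    apply EE_mono
    intro r
    exact prod_le_prod_of_subset_of_le_one (filter_subset _ _) (fun i _ => hit_nonneg _ _ _) (fun i _ _ => hit_le_one _ _ _)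
  · apply le_of_eq
    rw [← EE_const S hS0 0 r]
    congr 1
    funext r
    unfold cong at hc
    push_neg at hc
    obtain ⟨t, ht, t', ht', hz, hnd⟩ := hc
    by_cases h0 : hit r (z t) (ε * sg z t.1) = 0
    · exact prod_eq_zero ht h0
    · apply prod_eq_zero ht'
      rw [← hz]
      cases hr : r (z t) with
      | none => exact hit_none _ _ _ hr
      | some y =>
        rw [hit_some _ _ _ _ hr] at h0 ⊢
        rw [if_neg]
        intro hd
        have hd0 : (z t:ℤ) ∣ y + ε * sg z t.1 := by by_contra h; exact h0 (if_neg h)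
        apply hnd
        have := (dvd_sub hd hd0).mul_left ε
        rw [show ε * ((y + ε * sg z t'.1) - (y + ε * sg z t.1)) = (ε * ε) * (sg z t'.1 - sg z t.1) by ring, hε, one_mul] at this
        exact this

lemma PB_le {m : ℕ} (C : Finset (Fin m)) (z : Fin m → ℕ) (ε : ℤ) (hε : ε * ε = 1) (S : List ℕ) (hS : S.Nodup)
    (hS0 : ∀ p ∈ S, 0 < p) (hU : ∀ i ∈ C, z i ∈ S) (r : RR) :
    EE S (fun r => ∏ i ∈ C, (hit r (z i) (ε * sg z i.1) + 1/(z i:ℝ))) r * ∏ i ∈ Cᶜ, 1/(z i:ℝ) ≤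
      2 ^ m * ∑ E ∈ C.powerset.filter (fun E => goodE C E z ∧ cong (C \ E) z), ptE C z E := by
  have hpt0 : ∀ E, 0 ≤ ptE C z E := fun E => prod_nonneg (fun _ _ => by positivity)
  have e1 : (fun r : RR => ∏ i ∈ C, (hit r (z i) (ε * sg z i.1) + 1/(z i:ℝ))) =
      fun r => ∑ E ∈ C.powerset, (∏ i ∈ E, 1/(z i:ℝ)) * ∏ i ∈ C \ E, hit r (z i) (ε * sg z i.1) := by
    funext r
    rw [← prod_add]
    exact prod_congr rfl (fun _ _ => add_comm _ _)
  rw [e1, EE_sum, sum_mul]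
  have e2 : ∀ E ∈ C.powerset, EE S (fun r => (∏ i ∈ E, 1/(z i:ℝ)) * ∏ i ∈ C \ E, hit r (z i) (ε * sg z i.1)) r * ∏ i ∈ Cᶜ, 1/(z i:ℝ) ≤
      if cong (C \ E) z then ptE C z E else 0 := by
    intro E hE
    rw [mem_powerset] at hE
    rw [EE_smul]
    have h1 := EE_hits (C \ E) z ε hε S hS hS0 (fun i hi => hU i (mem_sdiff.1 hi).1) r
    have hp1 : 0 ≤ ∏ i ∈ E, 1/(z i:ℝ) := prod_nonneg (fun _ _ => by positivity)
    have hp2 : 0 ≤ ∏ i ∈ Cᶜ, 1/(z i:ℝ) := prod_nonneg (fun _ _ => by positivity)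
    refine (mul_le_mul_of_nonneg_right (mul_le_mul_of_nonneg_left h1 hp1) hp2).trans ?_
    split_ifs with hc
    · apply le_of_eq
      unfold ptE
      have hset : univ.filter (fun t => kz (C \ E) z t = t) = (E ∪ (C \ E).filter (fun t => kz (C \ E) z t = t)) ∪ Cᶜ := by
        ext t
        simp only [mem_filter, mem_univ, true_and, mem_union, mem_sdiff, mem_compl]
        constructor
        · intro h; tauto
        · rintro ((h | h) | h)
          · exact kz_not (by simp [h])
          · exact h.2
          · exact kz_not (by simp [h])
      rw [hset, prod_union, prod_union]
      · rw [disjoint_left]; intro t ht ht'; simp at ht'; exact ht'.1.2 ht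
      · rw [disjoint_left]; intro t ht ht'
        simp only [mem_union, mem_filter, mem_sdiff, mem_compl] at ht ht'
        rcases ht with h | h
        · exact ht' (hE h)
        · exact ht' h.1.1
    · simp
  refine (sum_le_sum e2).trans ?_
  calc _ ≤ ∑ E ∈ C.powerset, ∑ E ∈ C.powerset.filter (fun E => goodE C E z ∧ cong (C \ E) z), ptE C z E := by
        apply sum_le_sum
        intro E hE
        split_ifs with hc
        · rw [← mfix_pt]
          apply single_le_sum (f := fun E => ptE C z E) (fun E _ => hpt0 E)
          rw [mem_powerset] at hE
          exact mem_filter.2 ⟨mem_powerset.2 ((filter_subset _ _).trans hE), mfix_good C z E hE, mfix_cong C z E hc⟩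
        · exact sum_nonneg (fun E _ => hpt0 E)
    _ = 2 ^ C.card * ∑ E ∈ C.powerset.filter (fun E => goodE C E z ∧ cong (C \ E) z), ptE C z E := by
        rw [sum_const, card_powerset, nsmul_eq_mul]; push_cast; rfl
    _ ≤ _ := by
        apply mul_le_mul_of_nonneg_right _ (sum_nonneg (fun E _ => hpt0 E))
        exact pow_le_pow_right₀ (by norm_num) ((card_le_univ C).trans (by simp))

lemma sg_succ {m : ℕ} (z : Fin m → ℕ) (i : Fin m) : sg z (i.1+1) = sg z i.1 + (-1)^i.1 * (z i:ℤ) := by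
  have h := sg_sub z i.1 (i.1+1) (by omega)
  rw [sum_eq_single_of_mem i (mem_univ _), if_pos (by omega)] at h
  · linarith
  · intro u _ hu
    rw [if_neg]
    intro h; apply hu; ext; omega

noncomputable def Dz {m : ℕ} (ε : ℤ) (z : Fin m → ℕ) : Finset ℤ := (range (m+1)).image (fun i => ε * sg z i)

noncomputable def Gw {m : ℕ} (P : Finset ℕ) (C : Finset (Fin m)) (z : Fin m → ℕ) (ε a : ℤ) (θ : ℝ → ℝ) (r : RR) : ℝ :=
  hit r 2 a * (∏ i ∈ C, (hit r (z i) (ε * sg z i.1) - 1/(z i:ℝ))) * ∏ x ∈ Dz ε z, θ (∑ p ∈ P, hit r p x)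

noncomputable def NCs {m : ℕ} (C : Finset (Fin m)) (z : Fin m → ℕ) := LoS C z \ (CoR C z ∪ CoL C z)

lemma NCs_spec {m : ℕ} (C : Finset (Fin m)) (z : Fin m → ℕ) (i : Fin m) (hi : i ∈ NCs C z) :
    i ∈ C ∧ (∀ t ∈ C, z t = z i → t = i) ∧ (∀ jj ≤ m, i.1 + 1 < jj → (z i:ℤ) ∣ sg z jj - sg z (i.1+1) → sg z jj = sg z (i.1+1)) ∧
      (∀ jj < i.1, (z i:ℤ) ∣ sg z i.1 - sg z jj → sg z jj = sg z i.1) := by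
  unfold NCs at hi
  simp only [mem_sdiff, mem_union, not_or] at hi
  obtain ⟨h1, h2, h3⟩ := hi
  unfold CoR at h2
  unfold CoL at h3
  simp only [mem_filter, h1, true_and, not_exists, not_and] at h2 h3
  have h4 := mem_filter.1 h1
  refine ⟨h4.1, h4.2, ?_, ?_⟩
  · intro jj hjj hlt hd
    by_contra hne
    exact h2 ⟨jj, by omega⟩ hlt hne hd
  · intro jj hlt hd
    by_contra hne
    exact h3 ⟨jj, by omega⟩ hlt hne hd

lemma NCs_last {m : ℕ} (C : Finset (Fin m)) (z : Fin m → ℕ) (hz : ∀ i, 0 < z i) (i i' : Fin m) (hi : i ∈ NCs C z)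
    (h : sg z i.1 = sg z i'.1) : i'.1 ≤ i.1 := by
  obtain ⟨_, _, h1, _⟩ := NCs_spec C z i hi
  by_contra hlt
  push_neg at hlt
  have hs := sg_succ z i
  have hz' : (z i:ℤ) ≠ 0 := by have := hz i; omega
  have hne : sg z (i.1+1) ≠ sg z i.1 := by
    rw [hs]; intro h
    have : (-1:ℤ)^i.1 * z i = 0 := by linarith
    rcases mul_eq_zero.1 this with h | h
    · exact absurd h (pow_ne_zero _ (by norm_num))
    · exact hz' h
  rcases Nat.lt_or_ge (i.1+1) i'.1 with hlt' | hge
  · have := h1 i'.1 (by omega) hlt' (by rw [← h, hs]; exact ⟨-(-1)^i.1, by ring⟩)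
    exact hne (by rw [← this, h])
  · have : i'.1 = i.1 + 1 := by omega
    rw [this] at h; exact hne h.symm

lemma NCs_first {m : ℕ} (C : Finset (Fin m)) (z : Fin m → ℕ) (hz : ∀ i, 0 < z i) (i i' : Fin m) (hi : i ∈ NCs C z)
    (h : sg z (i.1+1) = sg z (i'.1+1)) : i.1 ≤ i'.1 := by
  obtain ⟨_, _, _, h1⟩ := NCs_spec C z i hi
  by_contra hlt
  push_neg at hlt
  have hs := sg_succ z i
  have hz' : (z i:ℤ) ≠ 0 := by have := hz i; omega
  have hne : sg z (i.1+1) ≠ sg z i.1 := by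
    rw [hs]; intro h
    have : (-1:ℤ)^i.1 * z i = 0 := by linarith
    rcases mul_eq_zero.1 this with h | h
    · exact absurd h (pow_ne_zero _ (by norm_num))
    · exact hz' h
  rcases Nat.lt_or_ge (i'.1+1) i.1 with hlt' | hge
  · have := h1 (i'.1+1) hlt' (by rw [← h, hs]; exact ⟨-(-1)^i.1, by ring⟩)
    exact hne (by rw [h, this])
  · have : i'.1 + 1 = i.1 := by omega
    rw [this] at h; exact hne h

lemma NCs_div {m : ℕ} (C : Finset (Fin m)) (z : Fin m → ℕ) (i : Fin m) (hi : i ∈ NCs C z) (jj : ℕ) (hjj : jj ≤ m)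
    (hd : (z i:ℤ) ∣ sg z jj - sg z i.1) : sg z jj = sg z i.1 ∨ sg z jj = sg z (i.1+1) := by
  obtain ⟨_, _, h1, h2⟩ := NCs_spec C z i hi
  have hs := sg_succ z i
  rcases Nat.lt_trichotomy jj i.1 with h | h | h
  · left; exact h2 jj h (by rw [← dvd_neg]; simpa using hd)
  · left; rw [h]
  · rcases Nat.lt_or_ge (i.1+1) jj with h' | h'
    · right; apply h1 jj hjj h'
      rw [hs, show sg z jj - (sg z i.1 + (-1)^i.1 * z i) = (sg z jj - sg z i.1) - (-1)^i.1 * z i by ring]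
      exact dvd_sub hd (Dvd.intro_left _ rfl)
    · right; rw [show jj = i.1+1 by omega]

lemma NCs_inj {m : ℕ} (C : Finset (Fin m)) (z : Fin m → ℕ) : Set.InjOn z (NCs C z) := by
  intro i hi j hj h
  exact (NCs_spec C z j hj).2.1 i (NCs_spec C z i hi).1 h

lemma toList_sum_map {ι : Type*} [DecidableEq ι] {M : Type*} [AddCommMonoid M] (s : Finset ι) (f : ι → M) : (s.toList.map f).sum = ∑ i ∈ s, f i := sum_map_toList s f
lemma toList_prod_map {ι : Type*} [DecidableEq ι] {M : Type*} [CommMonoid M] (s : Finset ι) (f : ι → M) : (s.toList.map f).prod = ∏ i ∈ s, f i := prod_map_toList s f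

lemma EEG_bound {m : ℕ} (P : Finset ℕ) (H0 : ℝ) (hH0 : 2 < H0) (hP : ∀ p ∈ P, Nat.Prime p ∧ H0 ≤ p) (C : Finset (Fin m)) (z : Fin m → ℕ)
    (hz : ∀ i, z i ∈ P) (ε a : ℤ) (hε : ε * ε = 1) (θ : ℝ → ℝ) (β : ℝ) (hβ : 0 ≤ β) (hθ : ∀ k ≤ 2, ∀ x, |Dth θ k x| ≤ β ^ k) (r : RR) :
    |EE ((2 :: (C.image z).toList) ++ (P \ C.image z).toList) (Gw P C z ε a θ) r| ≤
      (β + (m+1) / H0) ^ (NCs C z).card * EE (2 :: (C.image z).toList) (fun r => ∏ i ∈ C, (hit r (z i) (ε * sg z i.1) + 1/(z i:ℝ))) r := by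
  set δ : ℕ → ℤ := fun i => ε * sg z i with hδ
  have hε0 : ε ≠ 0 := by rintro rfl; simp at hε
  have h2P : ∀ p ∈ P, 2 < p := fun p hp => by have := (hP p hp).2; exact_mod_cast hH0.trans_le this
  have hz0 : ∀ i, 0 < z i := fun i => by have := h2P _ (hz i); omega
  have h2n : (2:ℕ) ∉ P := fun h => absurd (h2P 2 h) (by norm_num)
  set Q := C.image z with hQ
  have hQP : Q ⊆ P := by intro p hp; obtain ⟨i, _, rfl⟩ := mem_image.1 hp; exact hz i
  set NC := NCs C z with hNC
  have hNCC : NC ⊆ C := fun i hi => (NCs_spec C z i hi).1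
  set js : List (ℕ × ℤ × ℤ) := NC.toList.map (fun i => (z i, δ i.1, δ (i.1+1))) with hjs
  set T := js.map (fun a => a.1) with hT
  have hTe : T = NC.toList.map z := by rw [hT, hjs, List.map_map]; rfl
  have hTm : ∀ p, p ∈ T ↔ ∃ i ∈ NC, z i = p := by intro p; rw [hTe]; simp
  have hTnd : T.Nodup := by
    rw [hTe]
    apply List.Nodup.map_on _ (nodup_toList _)
    intro x hx y hy h
    exact NCs_inj C z (by simpa using hx) (by simpa using hy) h
  set rest := ((insert 2 P) \ NC.image z).toList with hrest
  have hSl_nd : ((2 :: Q.toList) ++ (P \ Q).toList).Nodup := by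
    rw [List.nodup_append]
    refine ⟨List.nodup_cons.2 ⟨by simpa using fun h => h2n (hQP h), nodup_toList _⟩, nodup_toList _, ?_⟩
    intro x hx y hy hxy
    subst hxy
    simp only [List.mem_cons, mem_toList, mem_sdiff] at hx hy
    rcases hx with rfl | hx
    · exact h2n hy.1
    · exact hy.2 hx
  have hrT_nd : (rest ++ T).Nodup := by
    rw [List.nodup_append]
    refine ⟨nodup_toList _, hTnd, ?_⟩
    intro x hx y hy hxy
    subst hxy
    rw [hTm] at hy
    simp only [hrest, mem_toList, mem_sdiff, mem_image] at hx
    exact hx.2 hy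
  have hperm : ((2 :: Q.toList) ++ (P \ Q).toList).Perm (rest ++ T) := by
    rw [List.perm_ext_iff_of_nodup hSl_nd hrT_nd]
    intro p
    simp only [List.mem_append, List.mem_cons, mem_toList, mem_sdiff, hTm, hrest, mem_insert, mem_image]
    constructor
    · rintro ((h | h) | h)
      · left; refine ⟨Or.inl h, ?_⟩
        rintro ⟨i, _, hi⟩
        exact h2n (by rw [← h, ← hi]; exact hz i)
      · by_cases hi : ∃ i ∈ NC, z i = p
        · exact Or.inr hi
        · exact Or.inl ⟨Or.inr (hQP h), hi⟩
      · by_cases hi : ∃ i ∈ NC, z i = p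
        · exact Or.inr hi
        · exact Or.inl ⟨Or.inr h.1, hi⟩
    · rintro (⟨h | h, _⟩ | ⟨i, hi, h⟩)
      · exact Or.inl (Or.inl h)
      · by_cases hq : p ∈ Q
        · exact Or.inl (Or.inr hq)
        · exact Or.inr ⟨h, hq⟩
      · exact Or.inl (Or.inr (by rw [← h]; exact mem_image_of_mem z (hNCC hi)))
  have hpos : ∀ p ∈ (2 :: Q.toList) ++ (P \ Q).toList, 0 < p := by
    intro p hp
    simp only [List.mem_append, List.mem_cons, mem_toList, mem_sdiff] at hp
    rcases hp with (h | h) | h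
    · omega
    · have := h2P p (hQP h); omega
    · have := h2P p h.1; omega
  set D := Dz ε z with hD
  have hDm : ∀ jj ≤ m, δ jj ∈ D := fun jj h => mem_image_of_mem _ (mem_range.2 (by omega))
  have hDc : (D.card : ℝ) ≤ m + 1 := by
    have : D.card ≤ m + 1 := card_image_le.trans (by simp)
    exact_mod_cast this
  set pre : RR → ℝ := fun r => hit r 2 a * ∏ i ∈ C \ NC, (hit r (z i) (δ i.1) - 1/(z i:ℝ)) with hpre
  set g : RR → ℝ := fun r => ∏ i ∈ C \ NC, (hit r (z i) (δ i.1) + 1/(z i:ℝ)) with hg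
  set c0 : RR → ℤ → ℝ := fun r x => ∑ p ∈ P \ NC.image z, hit r p x with hc0
  have hCne : ∀ i ∈ C \ NC, ∀ j ∈ NC, z i ≠ z j := by
    intro i hi j hj h
    have := (NCs_spec C z j hj).2.1 i (mem_sdiff.1 hi).1 h
    exact (mem_sdiff.1 hi).2 (this ▸ hj)
  have hpreT : ∀ p ∈ T, ∀ (r:RR) v, pre (Function.update r p (some v)) = pre r := by
    intro p hp r v
    obtain ⟨j, hj, rfl⟩ := (hTm p).1 hp
    simp only [hpre]
    rw [hit_update_ne _ _ _ _ _ (by intro h; exact h2n (by rw [h]; exact hz j))]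
    congr 1
    apply prod_congr rfl; intro i hi
    rw [hit_update_ne _ _ _ _ _ (hCne i hi j hj)]
  have hgT : ∀ j ∈ NC, ∀ (r:RR) v, g (Function.update r (z j) (some v)) = g r := by
    intro j hj r v
    simp only [hg]
    apply prod_congr rfl; intro i hi
    rw [hit_update_ne _ _ _ _ _ (hCne i hi j hj)]
  have hc0T : ∀ p ∈ T, ∀ (r:RR) v x, c0 (Function.update r p v) x = c0 r x := by
    intro p hp r v x
    obtain ⟨j, hj, rfl⟩ := (hTm p).1 hp
    simp only [hc0]
    apply sum_congr rfl; intro q hq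
    rw [hit_update_ne _ _ _ _ _ ?_]
    rintro rfl
    exact (mem_sdiff.1 hq).2 (mem_image_of_mem z hj)
  have hG : Gw P C z ε a θ = fun r => pre r * ((js.map (fun a => hit r a.1 a.2.1 - 1/(a.1:ℝ))).prod *
      ∏ x ∈ D, Dth θ ((fun _ => 0 : ℤ → ℕ) x) (c0 r x + (js.map (fun a => hit r a.1 x)).sum)) := by
    funext r
    have e1 : (js.map (fun a => hit r a.1 a.2.1 - 1/(a.1:ℝ))).prod = ∏ i ∈ NC, (hit r (z i) (δ i.1) - 1/(z i:ℝ)) := by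
      rw [hjs, List.map_map, ← toList_prod_map]; rfl
    have e2 : ∀ x, (js.map (fun a => hit r a.1 x)).sum = ∑ p ∈ NC.image z, hit r p x := by
      intro x
      rw [hjs, List.map_map, sum_image (NCs_inj C z), ← toList_sum_map]; rfl
    have e3 : ∀ x, c0 r x + (js.map (fun a => hit r a.1 x)).sum = ∑ p ∈ P, hit r p x := by
      intro x
      rw [e2]
      apply sum_sdiff
      intro p hp; obtain ⟨i, _, rfl⟩ := mem_image.1 hp; exact hz i
    simp only [e1, e3, Gw, hpre, Dth]
    rw [← prod_sdiff hNCC]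
    ring
  set X := (js.map (fun a => (1/(a.1:ℝ)) * (2 * β + 2 * D.card / H0))).prod with hX
  have hVV : ∀ r, |VV D θ js (fun _ => 0) (c0 r)| ≤ X := by
    intro r
    have := VV_bound D θ β hβ hθ H0 (by linarith) js ?_ (fun _ => 0) ?_ (c0 r)
    · rw [hX]; simp only [pow_zero, prod_const_one, mul_one] at this; exact this
    · intro b hb
      rw [hjs] at hb
      obtain ⟨i, hi, rfl⟩ := List.mem_map.1 hb
      have hi' : i ∈ NC := by simpa using hi
      refine ⟨hz0 i, (hP _ (hz i)).2, ?_, hDm _ (by omega), hDm _ (by omega), ?_⟩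
      · simp only [hδ]
        intro h
        have := mul_left_cancel₀ hε0 h
        rw [sg_succ] at this
        have h3 : (-1:ℤ)^i.1 * z i = 0 := by linarith
        rcases mul_eq_zero.1 h3 with h | h
        · exact absurd h (pow_ne_zero _ (by norm_num))
        · have := hz0 i; omega
      · intro x hx
        obtain ⟨jj, hjj, rfl⟩ := mem_image.1 hx
        rw [mem_range] at hjj
        simp only [hδ]
        rw [← mul_sub]
        constructor
        · intro h
          have h4 : (z i:ℤ) ∣ sg z jj - sg z i.1 := by
            have := h.mul_left ε
            rwa [← mul_assoc, hε, one_mul] at this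
          rcases NCs_div C z i hi' jj (by omega) h4 with h | h
          · left; rw [h]
          · right; rw [h]
        · rintro (h | h)
          · rw [mul_left_cancel₀ hε0 h]; simp
          · rw [mul_left_cancel₀ hε0 h, sg_succ]
            exact ⟨ε * (-1)^i.1, by ring⟩
    · intro x
      rw [hjs, List.map_map, zero_add]
      have : (NC.toList.map ((fun a : ℕ × ℤ × ℤ => i1 a.2.1 x + i1 a.2.2 x) ∘ fun i : Fin m => (z i, δ i.1, δ (i.1+1)))).sum =
          ∑ i ∈ NC, (i1 (δ i.1) x + i1 (δ (i.1+1)) x) := by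
        rw [← toList_sum_map]; rfl
      rw [this, sum_add_distrib]
      have h1 : ∑ i ∈ NC, i1 (δ i.1) x ≤ 1 := by
        simp only [i1]
        rw [← card_filter]
        apply card_le_one.2
        intro i hi j hj
        simp only [mem_filter] at hi hj
        have : sg z i.1 = sg z j.1 := mul_left_cancel₀ hε0 (hi.2.symm.trans hj.2)
        ext
        exact le_antisymm (NCs_last C z hz0 j i hj.1 this.symm) (NCs_last C z hz0 i j hi.1 this)
      have h2 : ∑ i ∈ NC, i1 (δ (i.1+1)) x ≤ 1 := by
        simp only [i1]
        rw [← card_filter]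
        apply card_le_one.2
        intro i hi j hj
        simp only [mem_filter] at hi hj
        have : sg z (i.1+1) = sg z (j.1+1) := mul_left_cancel₀ hε0 (hi.2.symm.trans hj.2)
        ext
        exact le_antisymm (NCs_first C z hz0 i j hi.1 this) (NCs_first C z hz0 j i hj.1 this.symm)
      omega
  have hXe : X ≤ (β + (m+1) / H0) ^ NC.card * ∏ i ∈ NC, (1/(z i:ℝ) + 1/(z i:ℝ)) := by
    have : X = ∏ i ∈ NC, (1/(z i:ℝ)) * (2 * β + 2 * D.card / H0) := by
      rw [hX, hjs, List.map_map, ← toList_prod_map]; rfl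
    rw [this, ← prod_const, ← prod_mul_distrib]
    apply prod_le_prod
    · intro i _; positivity
    · intro i _
      have : (D.card:ℝ) / H0 ≤ (m+1)/H0 := by gcongr
      have h3 : (0:ℝ) ≤ 1/(z i:ℝ) := by positivity
      calc _ = (β + D.card / H0) * (1/(z i:ℝ) + 1/(z i:ℝ)) := by ring
        _ ≤ _ := by gcongr
  have hX0 : 0 ≤ X := (abs_nonneg _).trans (hVV r)
  have hg0 : ∀ r, 0 ≤ g r := fun r => prod_nonneg (fun i _ => add_nonneg (hit_nonneg _ _ _) (by positivity))
  have hpreg : ∀ r, |pre r| ≤ g r := by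
    intro r
    simp only [hpre, hg, abs_mul, abs_prod]
    rw [abs_of_nonneg (hit_nonneg _ _ _)]
    calc _ ≤ 1 * ∏ i ∈ C \ NC, |hit r (z i) (δ i.1) - 1/(z i:ℝ)| :=
          mul_le_mul_of_nonneg_right (hit_le_one _ _ _) (prod_nonneg fun _ _ => abs_nonneg _)
      _ ≤ _ := by
          rw [one_mul]
          apply prod_le_prod (fun _ _ => abs_nonneg _)
          intro i _
          refine (abs_sub _ _).trans (le_of_eq ?_)
          rw [abs_of_nonneg (hit_nonneg _ _ _), abs_of_nonneg (by positivity : (0:ℝ) ≤ 1/(z i:ℝ))]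
  have hES : EE rest g r = EE (2 :: Q.toList) g r := by
    have h1 := EE_drop (2 :: Q.toList) (P \ Q).toList g (fun p hp => hpos p (by simp only [List.mem_append]; exact Or.inr hp))
      (fun p hp r v => by
        simp only [hg]
        apply prod_congr rfl; intro i hi
        rw [hit_update_ne _ _ _ _ _ ?_]
        rintro rfl
        rw [mem_toList, mem_sdiff] at hp
        exact hp.2 (mem_image_of_mem z (mem_sdiff.1 hi).1)) r
    rw [← h1, EE_perm hperm hSl_nd]
    symm
    apply EE_drop
    · intro p hp; exact hpos p (hperm.mem_iff.2 (by simp only [List.mem_append]; exact Or.inr hp))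
    · intro p hp r v
      obtain ⟨j, hj, rfl⟩ := (hTm p).1 hp
      exact hgT j hj r v
  have hESf : EE (2 :: Q.toList) (fun r => ∏ i ∈ C, (hit r (z i) (ε * sg z i.1) + 1/(z i:ℝ))) r =
      (∏ i ∈ NC, (1/(z i:ℝ) + 1/(z i:ℝ))) * EE (2 :: Q.toList) g r := by
    rw [← EE_pullout z (fun i => δ i.1) (fun i => 1/(z i:ℝ)) NC (NCs_inj C z) (2 :: Q.toList) (List.nodup_append.1 hSl_nd).1
      (fun p hp => hpos p (by simp only [List.mem_append]; exact Or.inl hp))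
      (fun i hi => by simp only [List.mem_cons, mem_toList]; exact Or.inr (mem_image_of_mem z (hNCC hi))) g hgT r]
    congr 1
    funext r
    rw [← prod_sdiff hNCC]
    ring
  rw [EE_perm hperm hSl_nd, EE_append]
  have e1 : EE T (Gw P C z ε a θ) = fun r => pre r * VV D θ js (fun _ => 0) (c0 r) := by
    funext r
    rw [hG, EE_pull T pre _ hpreT, hT, EE_V D θ js hTnd (fun _ => 0) c0 hc0T]
  rw [e1]
  calc _ ≤ EE rest (fun r => X * g r) r := by
        refine (EE_abs _ _ _).trans (EE_mono _ _ _ (fun r => ?_) _)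
        rw [abs_mul, mul_comm]
        exact mul_le_mul (hVV r) (hpreg r) (abs_nonneg _) hX0
    _ = X * EE (2 :: Q.toList) g r := by rw [EE_smul, hES]
    _ ≤ _ := by
        rw [hESf, ← mul_assoc]
        exact mul_le_mul_of_nonneg_right hXe (EE_nonneg _ _ hg0 _)

lemma hit_oeq (r r' : RR) (p : ℕ) (x : ℤ) (h : oeq p (r p) (r' p)) : hit r p x = hit r' p x := by
  unfold hit oeq at *
  cases h1 : r p with
  | none => cases h2 : r' p with
    | none => rfl
    | some y' => rw [h1, h2] at h; exact h.elim
  | some y => cases h2 : r' p with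
    | none => rw [h1, h2] at h; exact h.elim
    | some y' =>
      rw [h1, h2] at h
      simp only at h ⊢
      have : (p:ℤ) ∣ y + x ↔ (p:ℤ) ∣ y' + x := by
        have e : y + x = (y' + x) + (y - y') := by ring
        rw [e]; exact (Int.dvd_add_left h)
      simp only [this]

lemma hit_abs_sub (r : RR) (p : ℕ) (x : ℤ) : |hit r p x - 1/(p:ℝ)| ≤ hit r p x + 1/(p:ℝ) := by
  have h1 := hit_nonneg r p x
  have h2 : (0:ℝ) ≤ 1/(p:ℝ) := by positivity
  rw [abs_le]; constructor <;> linarith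

lemma perword0 {m : ℕ} (P : Finset ℕ) (H0 : ℝ) (hH0 : 2 < H0) (hP : ∀ p ∈ P, Nat.Prime p ∧ H0 ≤ p) (Hn : ℕ) (hHn : 1 ≤ Hn)
    (hPH : ∀ p ∈ P, p ≤ Hn) (L : ℝ) (hL : L = ∑ p ∈ P, (1:ℝ) / p) (C : Finset (Fin m)) (z : Fin m → ℕ)
    (hz : ∀ i, z i ∈ P) (ε a : ℤ) (hε : ε * ε = 1) (θ : ℝ → ℝ) (β : ℝ) (hβ : 0 ≤ β) (hθ : ∀ k ≤ 2, ∀ x, |Dth θ k x| ≤ β ^ k)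
    (J : ℕ) (a0 : ℤ) (N : ℕ) :
    |∑ n ∈ Ico a0 (a0 + N), Gw P C z ε a θ (cst n)| * ∏ i ∈ Cᶜ, 1/(z i:ℝ) ≤
      (N * (β + (m+1) / H0) ^ (NCs C z).card + 2 ^ J * (2 * N + 2 * (Hn:ℝ)^m * (Hn:ℝ)^J) * (((m+1) * L) ^ J / J.factorial)) *
        (2 ^ m * ∑ E ∈ C.powerset.filter (fun E => goodE C E z ∧ cong (C \ E) z), ptE C z E)
      + 2 * 2 ^ m * (2 * (Hn:ℝ)^m) * (1 + 2 * Hn * P.card : ℝ) ^ J := by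
  have hz0 : ∀ i, 0 < z i := fun i => (hP _ (hz i)).1.pos
  have hz1 : ∀ i, (1:ℝ)/(z i:ℝ) ≤ 1 := fun i => by
    rw [div_le_one (by exact_mod_cast hz0 i)]; exact_mod_cast hz0 i
  have hz1' : ∀ i, (0:ℝ) ≤ 1/(z i:ℝ) := fun i => by positivity
  set S := 2 :: (C.image z).toList with hS
  set l := (P \ C.image z).toList with hl
  have hsub : C.image z ⊆ P := by intro p hp; obtain ⟨i, _, rfl⟩ := mem_image.1 hp; exact hz i
  have h2P : ∀ p ∈ P, p ≠ 2 := by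
    rintro p hp rfl
    have := (hP _ hp).2; norm_num at this; linarith
  have hnd : (S ++ l).Nodup := by
    rw [hS, hl, List.cons_append, List.nodup_cons]
    constructor
    · intro h
      simp only [List.mem_append, mem_toList, mem_sdiff] at h
      rcases h with h | h
      · exact h2P 2 (hsub h) rfl
      · exact h2P 2 h.1 rfl
    · rw [List.nodup_append]
      refine ⟨nodup_toList _, nodup_toList _, ?_⟩
      intro x hx y hy h
      subst h
      rw [mem_toList] at hx hy
      exact (mem_sdiff.1 hy).2 hx
  have hpr : ∀ p ∈ S ++ l, Nat.Prime p := by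
    intro p hp
    simp only [hS, hl, List.cons_append, List.mem_cons, List.mem_append, mem_toList, mem_sdiff] at hp
    rcases hp with h | h | h
    · rw [h]; exact Nat.prime_two
    · exact (hP _ (hsub h)).1
    · exact (hP _ h.1).1
  have hlP : ∀ p ∈ l, p ∈ P ∧ p ∉ C.image z := fun p hp => by rw [hl, mem_toList, mem_sdiff] at hp; exact hp
  set f : RR → ℝ := fun r => ∏ i ∈ C, (hit r (z i) (ε * sg z i.1) + 1/(z i:ℝ)) with hf
  have hzS : ∀ i ∈ C, z i ∈ S := fun i hi => by
    rw [hS]; exact List.mem_cons_of_mem _ (mem_toList.2 (mem_image_of_mem z hi))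
  have hfL : Loc S f := by
    intro r r' h
    simp only [hf]
    apply prod_congr rfl
    intro i hi
    rw [hit_oeq r r' _ _ (h _ (hzS i hi))]
  have hf0 : ∀ r, 0 ≤ f r := fun r => prod_nonneg fun i _ => add_nonneg (hit_nonneg _ _ _) (hz1' i)
  have hfB : ∀ r, f r ≤ 2 ^ m := by
    intro r
    calc f r ≤ ∏ i ∈ C, (2:ℝ) := prod_le_prod (fun i _ => add_nonneg (hit_nonneg _ _ _) (hz1' i))
          (fun i _ => by linarith [hit_le_one r (z i) (ε * sg z i.1), hz1 i])
      _ = 2 ^ C.card := by rw [prod_const]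
      _ ≤ 2 ^ m := pow_le_pow_right₀ (by norm_num) ((card_le_univ C).trans (by simp))
  have hθ1 : ∀ x, |θ x| ≤ 1 := fun x => by simpa [Dth] using hθ 0 (by norm_num) x
  have hGf : ∀ r, |Gw P C z ε a θ r| ≤ f r := by
    intro r
    unfold Gw
    rw [abs_mul, abs_mul, abs_prod, abs_prod, abs_of_nonneg (hit_nonneg r 2 a)]
    have h1 : ∏ i ∈ C, |hit r (z i) (ε * sg z i.1) - 1/(z i:ℝ)| ≤ f r :=
      prod_le_prod (fun i _ => abs_nonneg _) (fun i _ => hit_abs_sub _ _ _)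
    have h2 : ∏ x ∈ Dz ε z, |θ (∑ p ∈ P, hit r p x)| ≤ 1 := prod_le_one (fun _ _ => abs_nonneg _) (fun _ _ => hθ1 _)
    have h3 : hit r 2 a * ∏ i ∈ C, |hit r (z i) (ε * sg z i.1) - 1/(z i:ℝ)| ≤ 1 * f r :=
      mul_le_mul (hit_le_one _ _ _) h1 (prod_nonneg fun _ _ => abs_nonneg _) (by norm_num)
    calc _ ≤ (1 * f r) * 1 := mul_le_mul h3 h2 (prod_nonneg fun _ _ => abs_nonneg _) (by rw [one_mul]; exact hf0 r)
      _ = f r := by ring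
  have hcov : ∀ p ∈ P, p ∈ S ++ l := by
    intro p hp
    rw [hS, hl]
    by_cases h : p ∈ C.image z
    · exact List.mem_append_left _ (List.mem_cons_of_mem _ (mem_toList.2 h))
    · exact List.mem_append_right _ (mem_toList.2 (mem_sdiff.2 ⟨hp, h⟩))
  have hGL : Loc (S ++ l) (Gw P C z ε a θ) := by
    intro r r' h
    unfold Gw
    rw [hit_oeq r r' 2 a (h 2 (by rw [hS]; simp))]
    congr 1
    · congr 1
      exact prod_congr rfl fun i hi => by rw [hit_oeq r r' _ _ (h _ (hcov _ (hz i)))]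
    · apply prod_congr rfl
      intro x _
      congr 1
      exact sum_congr rfl fun p hp => hit_oeq r r' _ _ (h _ (hcov _ hp))
  set h : ℕ → RR → ℝ := fun p r => ∑ x ∈ Dz ε z, hit r p x with hh
  have hDc : ((Dz ε z).card : ℝ) ≤ m + 1 := by
    have : (Dz ε z).card ≤ m + 1 := by unfold Dz; exact card_image_le.trans (by simp)
    exact_mod_cast this
  have hit01 : ∀ r p x, hit r p x = 0 ∨ hit r p x = 1 := by
    intro r p x
    unfold hit
    split
    · left; rfl
    · split_ifs
      · right; rfl
      · left; rfl
  have hh01 : ∀ p r, h p r = 0 ∨ 1 ≤ h p r := by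
    intro p r
    by_cases hx : ∃ x ∈ Dz ε z, hit r p x ≠ 0
    · obtain ⟨x, hx, hne⟩ := hx
      right
      have h1 := (hit01 r p x).resolve_left hne
      rw [← h1]
      exact single_le_sum (f := fun x => hit r p x) (fun x _ => hit_nonneg r p x) hx
    · push Not at hx
      left; exact sum_eq_zero hx
  have hhL : ∀ p, Loc [p] (h p) := by
    intro p r r' hr
    exact sum_congr rfl fun x _ => hit_oeq r r' _ _ (hr p (by simp))
  have hav : ∀ p ∈ l, ∀ r, Av p (h p) r ≤ (m+1)/(p:ℝ) := by
    intro p hp r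
    have hp0 := (hP _ (hlP p hp).1).1.pos
    have : Av p (h p) r = ∑ x ∈ Dz ε z, 1/(p:ℝ) := by
      have e : ∀ x ∈ Dz ε z, (1/(p:ℝ)) = Av p (fun r => hit r p x) r := fun x _ => (Av_hit p hp0 x r).symm
      rw [sum_congr rfl e]
      simp only [Av, hh]
      rw [sum_comm, mul_sum]
    rw [this, sum_const, nsmul_eq_mul, mul_one_div]
    gcongr
  have hGh : ∀ p ∈ l, ∀ r, h p r = 0 → Gw P C z ε a θ (Function.update r p none) = Gw P C z ε a θ r := by
    intro p hp r h0
    have hp1 := hlP p hp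
    have hne : ∀ q, q ≠ p → ∀ x, hit (Function.update r p none) q x = hit r q x := fun q hq x => hit_update_ne _ _ _ _ _ hq
    have hz' : ∀ x ∈ Dz ε z, hit r p x = 0 := (sum_eq_zero_iff_of_nonneg (fun x _ => hit_nonneg r p x)).1 h0
    unfold Gw
    rw [hne 2 (h2P p hp1.1).symm]
    congr 1
    · congr 1
      apply prod_congr rfl
      intro i hi
      rw [hne]
      rintro rfl; exact hp1.2 (mem_image_of_mem z hi)
    · apply prod_congr rfl
      intro x hx
      congr 1
      apply sum_congr rfl
      intro q _
      by_cases hq : q = p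
      · subst hq
        rw [hz' x hx, hit_none _ _ _ (Function.update_self _ _ _)]
      · exact hne q hq x
  have r : RR := fun _ => none
  have T := trunc Hn hHn h hh01 hhL (fun p => (m+1)/(p:ℝ)) l S hpr hnd (fun p hp => hPH p (hlP p hp).1) hav
    (fun p _ => by positivity) J (Gw P C z ε a θ) f hfL hGL hGf (2^m) hfB hGh r a0 N
  have E1 := EEG_bound P H0 hH0 hP C z hz ε a hε θ β hβ hθ r
  have hPB := PB_le C z ε hε S (List.Nodup.of_append_left hnd) (fun p hp => (hpr p (List.mem_append_left _ hp)).pos) hzS r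
  have hec := ec_le (fun p => (m+1)/(p:ℝ)) l (fun p _ => by positivity) J
  have hec0 := ec_nonneg (fun p => (m+1)/(p:ℝ)) l (fun p _ => by positivity) J
  have hsumav : (l.map (fun p : ℕ => ((m:ℝ)+1)/(p:ℝ))).sum ≤ (m+1) * L := by
    rw [hl, toList_sum_map, hL, mul_sum]
    calc ∑ i ∈ P \ image z C, ((m:ℝ) + 1) / i ≤ ∑ i ∈ P, ((m:ℝ) + 1) / i :=
          sum_le_sum_of_subset_of_nonneg sdiff_subset (fun _ _ _ => by positivity)
      _ = _ := sum_congr rfl fun p _ => by ring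
  have hsumav0 : 0 ≤ (l.map (fun p : ℕ => ((m:ℝ)+1)/(p:ℝ))).sum := by
    rw [hl, toList_sum_map]; exact sum_nonneg fun _ _ => by positivity
  have hec2 : ec (fun p : ℕ => ((m:ℝ)+1)/(p:ℝ)) l J ≤ ((m+1) * L) ^ J / J.factorial := by
    refine hec.trans ?_
    gcongr
  have hSp : (S.prod : ℝ) ≤ 2 * (Hn:ℝ)^m := by
    have : S.prod ≤ 2 * Hn ^ m := by
      rw [hS, List.prod_cons]
      apply Nat.mul_le_mul_left
      have e : (C.image z).toList.prod = ∏ p ∈ C.image z, p := by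
        have := toList_prod_map (C.image z) (fun p => p)
        simpa using this
      rw [e]
      calc ∏ p ∈ C.image z, p ≤ ∏ p ∈ C.image z, Hn := prod_le_prod' (fun p hp => hPH p (hsub hp))
        _ = Hn ^ (C.image z).card := prod_const _
        _ ≤ Hn ^ m := Nat.pow_le_pow_right hHn (card_image_le.trans ((card_le_univ C).trans (by simp)))
    exact_mod_cast this
  have hlc : (l.length : ℝ) ≤ P.card := by
    rw [hl, length_toList]; exact_mod_cast card_le_card sdiff_subset
  set F := EE S f r with hF
  have hF0 : 0 ≤ F := EE_nonneg _ _ hf0 r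
  set κ := (β + ((m:ℝ)+1) / H0) ^ (NCs C z).card with hκ
  have hκ0 : 0 ≤ κ := by have : 0 < H0 := by linarith
                         positivity
  set pr := ∏ i ∈ Cᶜ, 1/(z i:ℝ) with hpr'
  have hpr0 : 0 ≤ pr := prod_nonneg fun i _ => hz1' i
  have hpr1 : pr ≤ 1 := prod_le_one (fun i _ => hz1' i) (fun i _ => hz1 i)
  set W := ((m+1) * L) ^ J / (J.factorial:ℝ) with hW
  have hW0 : 0 ≤ W := hec0.trans hec2
  have hb1 : 2 * 2 ^ m * (S.prod:ℝ) * (1 + 2 * Hn * l.length : ℝ) ^ J ≤ 2 * 2 ^ m * (2 * (Hn:ℝ)^m) * (1 + 2 * Hn * P.card : ℝ) ^ J := by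
    gcongr
  have hb2 : 2 ^ J * ((2 * N + (S.prod:ℝ) * (Hn:ℝ) ^ J) * F * ec (fun p : ℕ => ((m:ℝ)+1)/(p:ℝ)) l J) ≤
      2 ^ J * (2 * N + 2 * (Hn:ℝ)^m * (Hn:ℝ)^J) * W * F := by
    calc _ ≤ 2 ^ J * ((2 * N + (2 * (Hn:ℝ)^m) * (Hn:ℝ) ^ J) * F * W) := by gcongr
      _ = _ := by ring
  have hmain : |∑ n ∈ Ico a0 (a0 + N), Gw P C z ε a θ (cst n)| ≤
      (N * κ + 2 ^ J * (2 * N + 2 * (Hn:ℝ)^m * (Hn:ℝ)^J) * W) * F + 2 * 2 ^ m * (2 * (Hn:ℝ)^m) * (1 + 2 * Hn * P.card : ℝ) ^ J := by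
    have h1 : |∑ n ∈ Ico a0 (a0 + N), Gw P C z ε a θ (cst n)| ≤
      |∑ n ∈ Ico a0 (a0 + N), Gw P C z ε a θ (cst n) - N * EE (S ++ l) (Gw P C z ε a θ) r| + |N * EE (S ++ l) (Gw P C z ε a θ) r| := by
      have := abs_add_le (∑ n ∈ Ico a0 (a0 + N), Gw P C z ε a θ (cst n) - N * EE (S ++ l) (Gw P C z ε a θ) r) (N * EE (S ++ l) (Gw P C z ε a θ) r)
      rwa [sub_add_cancel] at this
    have h2 : |(N:ℝ) * EE (S ++ l) (Gw P C z ε a θ) r| ≤ N * (κ * F) := by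
      rw [abs_mul, Nat.abs_cast]
      exact mul_le_mul_of_nonneg_left E1 (by positivity)
    linarith
  set R := 2 * 2 ^ m * (2 * (Hn:ℝ)^m) * (1 + 2 * Hn * P.card : ℝ) ^ J with hR
  have hR0 : 0 ≤ R := by positivity
  have hco : 0 ≤ N * κ + 2 ^ J * (2 * N + 2 * (Hn:ℝ)^m * (Hn:ℝ)^J) * W := by positivity
  calc _ ≤ ((N * κ + 2 ^ J * (2 * N + 2 * (Hn:ℝ)^m * (Hn:ℝ)^J) * W) * F + R) * pr := mul_le_mul_of_nonneg_right hmain hpr0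
    _ = (N * κ + 2 ^ J * (2 * N + 2 * (Hn:ℝ)^m * (Hn:ℝ)^J) * W) * (F * pr) + R * pr := by ring
    _ ≤ _ := add_le_add (mul_le_mul_of_nonneg_left hPB hco) (mul_le_of_le_one_right hR0 hpr1)

noncomputable def th (M b : ℕ) (x : ℝ) : ℝ := ((Ico M (M+b)).filter (fun t : ℕ => x ≤ t)).card / (b:ℝ)

lemma th_Dth (M b : ℕ) (hb : 1 ≤ b) (k : ℕ) (hk : k ≤ 2) (x : ℝ) : |Dth (th M b) k x| ≤ (Real.sqrt (2/b)) ^ k := by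
  have hb0 : (0:ℝ) < b := by exact_mod_cast hb
  have h0 : ∀ x, |th M b x| ≤ 1 := by
    intro x
    unfold th
    rw [abs_of_nonneg (by positivity), div_le_one hb0]
    have : ((Ico M (M+b)).filter (fun t : ℕ => x ≤ t)).card ≤ (Ico M (M+b)).card := card_filter_le _ _
    rw [Nat.card_Ico] at this
    exact_mod_cast this.trans (by omega)
  have h1 : ∀ x, |th M b (x+1) - th M b x| ≤ 1 / b := by
    intro x
    unfold th
    have hsub : (Ico M (M+b)).filter (fun t : ℕ => x + 1 ≤ t) ⊆ (Ico M (M+b)).filter (fun t : ℕ => x ≤ t) := by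
      intro t ht
      rw [mem_filter] at ht ⊢
      exact ⟨ht.1, by linarith [ht.2]⟩
    have hd := card_sdiff_add_card_eq_card hsub
    have h2 : ((Ico M (M+b)).filter (fun t : ℕ => x ≤ t) \ (Ico M (M+b)).filter (fun t : ℕ => x + 1 ≤ t)).card ≤ 1 := by
      rw [card_le_one]
      intro s hs t ht
      simp only [mem_sdiff, mem_filter, not_and, not_le] at hs ht
      have a1 := hs.2 hs.1.1
      have a2 := ht.2 ht.1.1
      have a3 : (s:ℝ) < t + 1 := by linarith [ht.1.2]
      have a4 : (t:ℝ) < s + 1 := by linarith [hs.1.2]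
      have : s < t + 1 := by exact_mod_cast a3
      have : t < s + 1 := by exact_mod_cast a4
      omega
    rw [← sub_div, abs_div, abs_of_pos hb0]
    gcongr
    have e : (((Ico M (M+b)).filter (fun t : ℕ => x ≤ t)).card : ℝ) = ((Ico M (M+b)).filter (fun t : ℕ => x ≤ t) \ (Ico M (M+b)).filter (fun t : ℕ => x + 1 ≤ t)).card + ((Ico M (M+b)).filter (fun t : ℕ => x + 1 ≤ t)).card := by
      exact_mod_cast hd.symm
    have h2' : (((Ico M (M+b)).filter (fun t : ℕ => x ≤ t) \ (Ico M (M+b)).filter (fun t : ℕ => x + 1 ≤ t)).card : ℝ) ≤ 1 := by exact_mod_cast h2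
    have h3' : (0:ℝ) ≤ (((Ico M (M+b)).filter (fun t : ℕ => x ≤ t) \ (Ico M (M+b)).filter (fun t : ℕ => x + 1 ≤ t)).card : ℝ) := by positivity
    rw [e, abs_le]
    constructor <;> linarith
  interval_cases k
  · simpa [Dth] using h0 x
  · simp only [Dth, pow_one]
    refine (h1 x).trans ?_
    apply Real.le_sqrt_of_sq_le
    rw [div_pow, one_pow, div_le_div_iff₀ (by positivity) hb0]
    have : (1:ℝ) ≤ b := by exact_mod_cast hb
    nlinarith
  · simp only [Dth]
    rw [Real.sq_sqrt (by positivity)]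
    calc _ ≤ |th M b (x+1+1) - th M b (x+1)| + |th M b (x+1) - th M b x| := abs_sub _ _
      _ ≤ 1/b + 1/b := add_le_add (h1 _) (h1 _)
      _ = 2 / b := by ring

lemma pow_div_fact_le (x : ℝ) (hx : 0 ≤ x) (J : ℕ) (h : 8 * x ≤ J) : x ^ J / J.factorial ≤ Real.exp (-J) := by
  rcases Nat.eq_zero_or_pos J with h0 | hJ
  · subst h0; simp
  have hJ0 : (0:ℝ) < J := by exact_mod_cast hJ
  have h1 : (J:ℝ)^J / J.factorial ≤ Real.exp J := Real.pow_div_factorial_le_exp (J:ℝ) (by positivity) J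
  have e2 : Real.exp 2 ≤ 8 := by
    have := Real.exp_one_lt_d9
    have h3 : Real.exp 2 = Real.exp 1 * Real.exp 1 := by rw [← Real.exp_add]; norm_num
    rw [h3]; nlinarith [Real.exp_pos 1]
  have h4 : x ≤ J * Real.exp (-2) := by
    rw [Real.exp_neg, ← div_eq_mul_inv, le_div_iff₀ (Real.exp_pos _)]
    nlinarith
  calc x ^ J / J.factorial ≤ (J * Real.exp (-2)) ^ J / J.factorial := by gcongr
    _ = ((J:ℝ)^J / J.factorial) * Real.exp (-2) ^ J := by rw [mul_pow]; ring
    _ ≤ Real.exp J * Real.exp (-2) ^ J := by gcongr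
    _ = Real.exp (-J) := by
      rw [← Real.exp_nat_mul, ← Real.exp_add]; congr 1; ring

lemma tiny_aux (m J : ℕ) (h : ℝ) (c : ℝ) (hc0 : 0 ≤ c) (hh : 16 ≤ h) (hc : c ≤ h) (hJ1 : 1 ≤ J) :
    2 * 2 ^ m * (2 * h^m) * (1 + 2 * h * c : ℝ) ^ J ≤ h^(3*(m+J)) := by
  have h0 : 0 < h := by linarith
  have h2 : 2 ≤ h ^ 2 := by nlinarith
  have h5 : (1 + 2 * h * c : ℝ) ≤ (1/4) * h^3 := by
    have h1 : 2 * h * c ≤ 2 * h * h := by gcongr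
    have h3 : 16 * (h * h) ≤ h * (h * h) := by gcongr
    nlinarith
  have h6 : 2 * h ≤ h ^ 3 := by nlinarith
  have h7 : (1 + 2 * h * c) ^ J ≤ ((1/4) * h^3)^J := pow_le_pow_left₀ (by positivity) h5 J
  have h8 : (2 * h)^m ≤ (h^3)^m := pow_le_pow_left₀ (by positivity) h6 m
  have h9 : (1/4:ℝ)^J ≤ (1/4)^1 := pow_le_pow_of_le_one (by norm_num) (by norm_num) hJ1
  have e : h^(3*(m+J)) = (h^3)^m * (h^3)^J := by rw [← pow_mul, ← pow_mul, ← pow_add]; congr 1; ring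
  have h10 : 2 * 2 ^ m * (2 * h^m) = 4 * (2*h)^m := by rw [mul_pow]; ring
  rw [e, h10]
  calc 4 * (2*h)^m * (1 + 2 * h * c : ℝ) ^ J ≤ 4 * (h^3)^m * (((1/4) * h^3)^J) := by gcongr
    _ = (4 * (1/4)^J) * ((h^3)^m * (h^3)^J) := by rw [mul_pow]; ring
    _ ≤ 1 * ((h^3)^m * (h^3)^J) := by gcongr; linarith
    _ = _ := by ring

lemma perword {m : ℕ} (P : Finset ℕ) (H0 : ℝ) (hH0 : 2 < H0) (hP : ∀ p ∈ P, Nat.Prime p ∧ H0 ≤ p) (Hn : ℕ) (hHn : 16 ≤ Hn)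
    (hPH : ∀ p ∈ P, p ≤ Hn) (L : ℝ) (hL : L = ∑ p ∈ P, (1:ℝ) / p) (C : Finset (Fin m)) (z : Fin m → ℕ)
    (hz : ∀ i, z i ∈ P) (ε a : ℤ) (hε : ε * ε = 1) (M b J : ℕ) (hb : 1 ≤ b) (hLM : L ≤ M) (hbM : (b:ℝ) ≤ M)
    (hJ : J = 16 * ((m+1) * M)) (hmb : ((m:ℝ)+1) * Real.sqrt b ≤ H0)
    (a0 : ℤ) (N : ℕ) (hN : (Hn:ℝ)^(m+J) ≤ N) :
    |∑ n ∈ Ico a0 (a0 + N), Gw P C z ε a (th M b) (cst n)| * ∏ i ∈ Cᶜ, 1/(z i:ℝ) ≤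
      5 * N * 6 ^ m * ∑ E ∈ C.powerset.filter (fun E => goodE C E z ∧ cong (C \ E) z), dTerm C (Real.sqrt b) z E
      + (Hn:ℝ)^(3*(m+J)) := by
  have hb0 : (0:ℝ) < b := by exact_mod_cast hb
  have hb1 : (1:ℝ) ≤ b := by exact_mod_cast hb
  have hL0 : 0 ≤ L := by rw [hL]; exact sum_nonneg fun _ _ => by positivity
  have hM1 : 1 ≤ M := by have : (1:ℝ) ≤ M := hb1.trans hbM
                         exact_mod_cast this
  have hHn1 : (1:ℝ) ≤ Hn := by exact_mod_cast (by omega : 1 ≤ Hn)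
  have hHn16 : (16:ℝ) ≤ Hn := by exact_mod_cast hHn
  set bs := Real.sqrt b with hbs
  have hbs1 : 1 ≤ bs := Real.one_le_sqrt.2 hb1
  have hbs0 : 0 < bs := by linarith
  have H := perword0 P H0 hH0 hP Hn (by omega) hPH L hL C z hz ε a hε (th M b) (Real.sqrt (2/b)) (Real.sqrt_nonneg _)
    (fun k hk x => th_Dth M b hb k hk x) J a0 N
  set k := (NCs C z).card with hk
  have hkm : k ≤ m := (card_le_univ _).trans (by simp)
  set SE := ∑ E ∈ C.powerset.filter (fun E => goodE C E z ∧ cong (C \ E) z), ptE C z E with hSE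
  have hSE0 : 0 ≤ SE := sum_nonneg fun E _ => prod_nonneg fun i _ => by positivity
  have hdT : ∑ E ∈ C.powerset.filter (fun E => goodE C E z ∧ cong (C \ E) z), dTerm C bs z E = SE * (1/bs)^k := by
    rw [hSE, sum_mul]; rfl
  rw [hdT]
  have hκ : Real.sqrt (2/b) + ((m:ℝ)+1)/H0 ≤ 3 / bs := by
    have h1 : Real.sqrt (2/b) ≤ 2 / bs := by
      rw [Real.sqrt_div (by norm_num)]
      gcongr
      exact Real.sqrt_le_iff.2 ⟨by norm_num, by norm_num⟩
    have h2 : ((m:ℝ)+1)/H0 ≤ 1/bs := by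
      rw [div_le_div_iff₀ (by linarith) hbs0]; linarith
    have : (3:ℝ)/bs = 2/bs + 1/bs := by ring
    linarith
  have hκ0 : 0 ≤ Real.sqrt (2/b) + ((m:ℝ)+1)/H0 := by
    have : 0 < H0 := by linarith
    positivity
  have hκk : (Real.sqrt (2/b) + ((m:ℝ)+1)/H0)^k ≤ 3^m * (1/bs)^k := by
    calc _ ≤ (3/bs)^k := pow_le_pow_left₀ hκ0 hκ k
      _ = 3^k * (1/bs)^k := by rw [← mul_pow]; congr 1; ring
      _ ≤ 3^m * (1/bs)^k := by
        gcongr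
        · norm_num
  have hW : 2 ^ J * (((m:ℝ)+1) * L) ^ J / J.factorial ≤ (1/bs)^k := by
    have h1 : 2 ^ J * (((m:ℝ)+1) * L) ^ J / J.factorial ≤ Real.exp (-J) := by
      rw [← mul_pow]
      apply pow_div_fact_le
      · positivity
      · rw [hJ]; push_cast
        have : ((m:ℝ)+1) * L ≤ (m+1) * M := by gcongr
        linarith
    have h2 : Real.exp (-(J:ℝ)) ≤ (1/bs)^m := by
      rw [one_div, inv_pow, Real.exp_neg]
      apply inv_anti₀ (by positivity)
      have h3 : bs ≤ Real.exp M := by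
        have : bs ≤ b := by rw [hbs]; exact Real.sqrt_le_iff.2 ⟨by positivity, by nlinarith⟩
        linarith [Real.add_one_le_exp (M:ℝ)]
      calc bs^m ≤ (Real.exp M)^m := by gcongr
        _ = Real.exp (m * M) := by rw [← Real.exp_nat_mul]
        _ ≤ Real.exp J := by
          apply Real.exp_le_exp.2
          rw [hJ]
          have : (m * M : ℕ) ≤ 16 * ((m+1) * M) := by nlinarith
          exact_mod_cast this
    have h3 : (1/bs)^m ≤ (1/bs)^k := pow_le_pow_of_le_one (by positivity) (by rw [div_le_one hbs0]; exact hbs1) hkm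
    linarith
  have hW0 : 0 ≤ 2 ^ J * (((m:ℝ)+1) * L) ^ J / J.factorial := by positivity
  have hco : N * (Real.sqrt (2/b) + ((m:ℝ)+1)/H0)^k + 2 ^ J * (2 * N + 2 * (Hn:ℝ)^m * (Hn:ℝ)^J) * ((((m:ℝ)+1) * L) ^ J / J.factorial)
      ≤ 5 * N * 3 ^ m * (1/bs)^k := by
    have h1 : 2 ^ J * (2 * N + 2 * (Hn:ℝ)^m * (Hn:ℝ)^J) * ((((m:ℝ)+1) * L) ^ J / J.factorial) ≤ 4 * N * (1/bs)^k := by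
      calc _ = (2 * N + 2 * (Hn:ℝ)^(m+J)) * (2 ^ J * (((m:ℝ)+1) * L) ^ J / J.factorial) := by rw [pow_add]; ring
        _ ≤ (2 * N + 2 * N) * (1/bs)^k := by gcongr
        _ = _ := by ring
    have h2 : N * (Real.sqrt (2/b) + ((m:ℝ)+1)/H0)^k ≤ N * (3^m * (1/bs)^k) := by gcongr
    have h3 : (1:ℝ) ≤ 3^m := one_le_pow₀ (by norm_num)
    have h4 : (4:ℝ) * N * (1/bs)^k * 1 ≤ 4 * N * (1/bs)^k * 3^m := by gcongr
    linarith
  have hR : 2 * 2 ^ m * (2 * (Hn:ℝ)^m) * (1 + 2 * Hn * P.card : ℝ) ^ J ≤ (Hn:ℝ)^(3*(m+J)) := by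
    have hPc : (P.card:ℝ) ≤ Hn := by
      have : P ⊆ Icc 1 Hn := fun p hp => mem_Icc.2 ⟨(hP p hp).1.pos, hPH p hp⟩
      have := card_le_card this
      rw [Nat.card_Icc] at this
      exact_mod_cast this.trans (by omega)
    have hJ1 : 1 ≤ J := by rw [hJ]; nlinarith
    exact tiny_aux m J Hn P.card (by positivity) hHn16 hPc hJ1
  have h6 : (6:ℝ)^m = 3^m * 2^m := by rw [← mul_pow]; norm_num
  have h2S : 0 ≤ 2 ^ m * SE := by positivity
  have hfin := H.trans (add_le_add (mul_le_mul_of_nonneg_right hco h2S) hR)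
  have e : 5 * N * 3 ^ m * (1/bs)^k * (2 ^ m * SE) = 5 * N * 6 ^ m * (SE * (1/bs)^k) := by rw [h6]; ring
  rwa [e] at hfin

lemma wordsum {m : ℕ} (hm : 0 < m) (nb l d : ℕ) (hmn : m = nb * l) (P : Finset ℕ) 
    (H0 : ℝ) (hH0 : 2 < H0) (hP0 : ∀ p ∈ P, Nat.Prime p ∧ H0 ≤ p) (Hn : ℕ) (hHn : 16 ≤ Hn) (hPH : ∀ p ∈ P, p ≤ Hn) 
    (r : ℕ) (hP : ∀ x ∈ P, (x:ℝ) < H0 * 2 ^ r) (L : ℝ) (hL : L = ∑ p ∈ P, (1:ℝ) / p)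
    (hL1 : 1 ≤ L) (Q : ℕ) (hQB : m * Hn < 2 ^ Q)
    (hQ : ((m:ℝ)+1) * Q ≤ H0)
    (D : ℝ) (hD1 : 1 ≤ D) (hD : ∀ k ≤ d, (k.factorial : ℝ) * (m:ℝ) ^ k ≤ D)
    (hbig : (m:ℝ) ^ m * (L ^ m * (r * (10 * m * (d + 1) ^ 2 * D / H0)) ^ d) ≤ 1) (C : Finset (Fin m))
    (ε a : ℤ) (hε : ε * ε = 1) (M b J : ℕ) (hLb : L ≤ b) (hbM : (b:ℝ) ≤ M)
    (hJ : J = 16 * ((m+1) * M)) (hmb : ((m:ℝ)+1) * Real.sqrt b ≤ H0)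
    (a0 : ℤ) (N : ℕ) (hN : (Hn:ℝ)^(4*(m+J)) ≤ N) :
    ∑ z ∈ (Fintype.piFinset (fun _ : Fin m => P)).filter (fun z => zBInj l z),
      |∑ n ∈ Ico a0 (a0 + N), Gw P C z ε a (th M b) (cst n)| * ∏ i ∈ Cᶜ, 1/(z i:ℝ) ≤
      N * 12000 ^ m * (m:ℝ) ^ (2 * (nb * (4 * (5 * d + 2 * nb) + 1 + 2 * nb))) * Real.sqrt L ^ (2 * Cᶜ.card + C.card) := by
  have hb1 : (1:ℝ) ≤ b := hL1.trans hLb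
  have hb : 1 ≤ b := by exact_mod_cast hb1
  have hHn1 : (1:ℝ) ≤ Hn := by exact_mod_cast (by omega : 1 ≤ Hn)
  have hbs1 : 1 ≤ Real.sqrt b := Real.one_le_sqrt.2 hb1
  have hm1 : (1:ℝ) ≤ m := by exact_mod_cast hm
  have hmH : (m:ℝ) ≤ H0 := by nlinarith
  have hN2 : (Hn:ℝ)^(m+J) ≤ N := le_trans (pow_le_pow_right₀ hHn1 (by omega)) hN
  have hs1 : 1 ≤ Real.sqrt L := Real.one_le_sqrt.2 hL1
  have SD := stepD hm nb l d hmn P (fun p hp => (hP0 p hp).1) H0 (by linarith) r (fun x hx => ⟨(hP0 x hx).2, hP x hx⟩) L hL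
    (Real.sqrt L) hs1 (Real.sq_sqrt (by linarith)) (Real.sqrt b) (Real.sqrt_le_sqrt hLb) Q Hn hPH hQB hQ hmH D hD1 hD hbig C
  set Z := (Fintype.piFinset (fun _ : Fin m => P)).filter (fun z => zBInj l z) with hZ
  set T := (m:ℝ) ^ (2 * (nb * (4 * (5 * d + 2 * nb) + 1 + 2 * nb))) * Real.sqrt L ^ (2 * Cᶜ.card + C.card) with hT
  have hT1 : 1 ≤ T := by
    have h1 : 1 ≤ (m:ℝ) ^ (2 * (nb * (4 * (5 * d + 2 * nb) + 1 + 2 * nb))) := one_le_pow₀ hm1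
    have h2 : 1 ≤ Real.sqrt L ^ (2 * Cᶜ.card + C.card) := one_le_pow₀ hs1
    exact one_le_mul_of_one_le_of_one_le h1 h2
  have hZc : (Z.card : ℝ) ≤ (Hn:ℝ)^m := by
    have hPc : P.card ≤ Hn := by
      have : P ⊆ Icc 1 Hn := fun p hp => mem_Icc.2 ⟨(hP0 p hp).1.pos, hPH p hp⟩
      have := card_le_card this
      rw [Nat.card_Icc] at this
      omega
    have : Z.card ≤ Hn ^ m := by
      calc Z.card ≤ (Fintype.piFinset (fun _ : Fin m => P)).card := card_filter_le _ _
        _ = P.card ^ m := by simp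
        _ ≤ Hn ^ m := Nat.pow_le_pow_left hPc m
    exact_mod_cast this
  have h1 : ∑ z ∈ Z, |∑ n ∈ Ico a0 (a0 + N), Gw P C z ε a (th M b) (cst n)| * ∏ i ∈ Cᶜ, 1/(z i:ℝ) ≤
      ∑ z ∈ Z, (5 * N * 6 ^ m * ∑ E ∈ C.powerset.filter (fun E => goodE C E z ∧ cong (C \ E) z), dTerm C (Real.sqrt b) z E
      + (Hn:ℝ)^(3*(m+J))) := by
    apply sum_le_sum
    intro z hz
    rw [hZ, mem_filter, Fintype.mem_piFinset] at hz
    exact perword P H0 hH0 hP0 Hn hHn hPH L hL C z hz.1 ε a hε M b J hb (hLb.trans hbM) hbM hJ hmb a0 N hN2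
  have h2 : (Z.card:ℝ) * (Hn:ℝ)^(3*(m+J)) ≤ N := by
    calc (Z.card:ℝ) * (Hn:ℝ)^(3*(m+J)) ≤ (Hn:ℝ)^m * (Hn:ℝ)^(3*(m+J)) := by gcongr
      _ = (Hn:ℝ)^(m + 3*(m+J)) := by rw [pow_add]
      _ ≤ (Hn:ℝ)^(4*(m+J)) := pow_le_pow_right₀ hHn1 (by omega)
      _ ≤ N := hN
  rw [sum_add_distrib, ← mul_sum, sum_const, nsmul_eq_mul] at h1
  have h3 : (5:ℝ) * N * 6 ^ m * ∑ z ∈ Z, ∑ E ∈ C.powerset.filter (fun E => goodE C E z ∧ cong (C \ E) z), dTerm C (Real.sqrt b) z E ≤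
      5 * N * 6 ^ m * (16 ^ m * (2 * (2^m * T))) := by
    gcongr
    refine SD.trans ?_
    gcongr
    have h5 : (1:ℝ) ≤ 2^m := one_le_pow₀ (by norm_num)
    have h6 : (1:ℝ) ≤ 2^m * T := one_le_mul_of_one_le_of_one_le h5 hT1
    rw [mul_assoc]
    linarith
  have hNT : (N:ℝ) ≤ N * 192 ^ m * T := by
    have : (1:ℝ) ≤ 192^m := one_le_pow₀ (by norm_num)
    have h6 : (1:ℝ) ≤ 192^m * T := one_le_mul_of_one_le_of_one_le this hT1
    have : (N:ℝ) * 1 ≤ N * (192^m * T) := by gcongr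
    linarith
  have h7_unused : (11:ℝ) * 192^m ≤ 600 * 600^m * (11/600) := by
    have : (192:ℝ)^m ≤ 600^m := pow_le_pow_left₀ (by norm_num) (by norm_num) m
    linarith
  have h192 : (5:ℝ) * N * 6 ^ m * (16 ^ m * (2 * (2^m * T))) = 10 * (N * 192^m * T) := by
    have : (192:ℝ)^m = 6^m * 16^m * 2^m := by rw [← mul_pow, ← mul_pow]; norm_num
    rw [this]; ring
  calc _ ≤ _ := h1
    _ ≤ 10 * (N * 192^m * T) + N * 192^m * T := by linarith
    _ = N * T * (11 * 192^m) := by ring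
    _ ≤ N * T * (11 * 192 ^ m) := le_refl _
    _ ≤ N * T * (12000 ^ m) := by
      gcongr
      obtain ⟨k, rfl⟩ : ∃ k, m = k + 1 := ⟨m-1, by omega⟩
      have : (192:ℝ)^k ≤ 12000^k := pow_le_pow_left₀ (by norm_num) (by norm_num) k
      have h8 : (0:ℝ) < 12000^k := by positivity
      rw [pow_succ, pow_succ]; linarith
    _ = _ := by rw [hT]; ring

lemma spec_basis {ι : Type*} [Fintype ι] [DecidableEq ι] (A : ι → ι → ℝ) (hA : ∀ i j, A i j = A j i) (K : ℝ) (hK : ∀ i, ∑ j, |A i j| ≤ K) :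
    ∃ (U : ι → ι → ℝ) (lam : ι → ℝ), (∀ f g : ι → ℝ, ∑ j, (∑ i, U j i * f i) * (∑ i, U j i * g i) = ∑ i, f i * g i) ∧
      (∀ (f : ι → ℝ) j, ∑ i, U j i * (∑ k, A i k * f k) = lam j * ∑ i, U j i * f i) ∧ ∀ j, |lam j| ≤ K := by
  have hH : (Matrix.of A).IsHermitian := by
    ext i j; simp [Matrix.conjTranspose, hA i j]
  set b := hH.eigenvectorBasis with hb
  have hev : ∀ j i, ∑ k, A i k * (b j).ofLp k = hH.eigenvalues j * (b j).ofLp i := by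
    intro j i
    have := congrFun (hH.mulVec_eigenvectorBasis j) i
    simpa [Matrix.mulVec, dotProduct] using this
  refine ⟨fun j i => (b j).ofLp i, hH.eigenvalues, ?_, ?_, ?_⟩
  · intro f g
    have h := b.sum_inner_mul_inner (WithLp.toLp 2 f) (WithLp.toLp 2 g)
    simp only [EuclideanSpace.inner_eq_star_dotProduct, dotProduct, Pi.star_apply, star_trivial] at h
    rw [show ∑ i, f i * g i = ∑ i, g i * f i from sum_congr rfl fun i _ => mul_comm _ _, ← h]
    apply sum_congr rfl
    intro j _
    congr 1
    exact sum_congr rfl fun i _ => mul_comm _ _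
  · intro f j
    calc ∑ i, (b j).ofLp i * ∑ k, A i k * f k = ∑ i, ∑ k, (b j).ofLp i * (A i k * f k) := sum_congr rfl fun i _ => mul_sum _ _ _
      _ = ∑ k, ∑ i, (b j).ofLp i * (A i k * f k) := sum_comm
      _ = ∑ k, (∑ i, A k i * (b j).ofLp i) * f k := by
        apply sum_congr rfl; intro k _
        rw [sum_mul]
        apply sum_congr rfl; intro i _
        rw [hA k i]; ring
      _ = ∑ k, hH.eigenvalues j * ((b j).ofLp k * f k) := by
        apply sum_congr rfl; intro k _
        rw [hev]; ring
      _ = _ := by rw [mul_sum]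
  · intro j
    have hne : b j ≠ 0 := b.orthonormal.ne_zero j
    obtain ⟨i, -, hi⟩ := exists_max_image univ (fun i => |(b j).ofLp i|) ⟨j, mem_univ _⟩
    have hpos : 0 < |(b j).ofLp i| := by
      by_contra h0
      apply hne
      ext k
      have h1 := hi k (mem_univ _)
      have h2 : |(b j).ofLp k| = 0 := le_antisymm (h1.trans (not_lt.1 h0)) (abs_nonneg _)
      simpa using h2
    have h3 : |hH.eigenvalues j| * |(b j).ofLp i| ≤ K * |(b j).ofLp i| := by
      rw [← abs_mul, ← hev]
      calc |∑ k, A i k * (b j).ofLp k| ≤ ∑ k, |A i k * (b j).ofLp k| := abs_sum_le_sum_abs _ _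
        _ ≤ ∑ k, |A i k| * |(b j).ofLp i| := sum_le_sum fun k _ => by
            rw [abs_mul]; exact mul_le_mul_of_nonneg_left (hi k (mem_univ _)) (abs_nonneg _)
        _ = (∑ k, |A i k|) * |(b j).ofLp i| := by rw [sum_mul]
        _ ≤ _ := mul_le_mul_of_nonneg_right (hK i) hpos.le
    exact le_of_mul_le_mul_right h3 hpos

noncomputable def chb (q x : ℝ) : ℕ → ℝ
  | 0 => 1
  | 1 => x
  | k+2 => x * chb q x (k+1) - q * chb q x k

lemma chb_neg (q x : ℝ) (k : ℕ) : chb q (-x) k = (-1)^k * chb q x k ∧ chb q (-x) (k+1) = (-1)^(k+1) * chb q x (k+1) := by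
  induction k with
  | zero => simp [chb]
  | succ k ih =>
    refine ⟨ih.2, ?_⟩
    simp only [chb]
    rw [ih.1, ih.2]; ring

lemma chb_big (q x : ℝ) (hq : 0 ≤ q) (hx : 0 < x) (hxq : 4 * q ≤ x^2) (k : ℕ) : (x/2)^k ≤ chb q x k ∧ (x/2) * chb q x k ≤ chb q x (k+1) := by
  induction k with
  | zero => simp [chb]; linarith
  | succ k ih =>
    have h0 : 0 ≤ chb q x k := le_trans (by positivity) ih.1
    refine ⟨?_, ?_⟩
    · rw [pow_succ]
      calc (x/2)^k * (x/2) ≤ chb q x k * (x/2) := by gcongr; exact ih.1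
        _ = (x/2) * chb q x k := mul_comm _ _
        _ ≤ _ := ih.2
    · simp only [chb]
      have h1 : q * chb q x k ≤ (x/2) * chb q x (k+1) := by
        calc q * chb q x k ≤ (x/2)*(x/2) * chb q x k := by gcongr; nlinarith
          _ = (x/2) * ((x/2) * chb q x k) := by ring
          _ ≤ _ := by gcongr; exact ih.2
      linarith

lemma chb_small (q x s : ℝ) (hs : 0 ≤ s) (hsq : s^2 = q) (hx : |x| ≤ 3 * s) (k : ℕ) : |chb q x k| ≤ (4*s)^k ∧ |chb q x (k+1)| ≤ (4*s)^(k+1) := by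
  induction k with
  | zero => simp [chb]; linarith
  | succ k ih =>
    refine ⟨ih.2, ?_⟩
    simp only [chb]
    calc |x * chb q x (k+1) - q * chb q x k| ≤ |x * chb q x (k+1)| + |q * chb q x k| := abs_sub _ _
      _ = |x| * |chb q x (k+1)| + s^2 * |chb q x k| := by rw [abs_mul, abs_mul, ← hsq, abs_of_nonneg (sq_nonneg s)]
      _ ≤ (3*s) * (4*s)^(k+1) + s^2 * (4*s)^k := by gcongr; exact ih.2; exact ih.1
      _ = (4*s)^k * (13 * s^2) := by ring
      _ ≤ (4*s)^k * (16 * s^2) := by gcongr; norm_num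
      _ = _ := by ring

lemma chb_crude (q x B : ℝ) (hq : 0 ≤ q) (hB : |x| + q ≤ B) (hB1 : 1 ≤ B) (k : ℕ) : |chb q x k| ≤ B^k ∧ |chb q x (k+1)| ≤ B^(k+1) := by
  induction k with
  | zero => simp [chb]; linarith
  | succ k ih =>
    refine ⟨ih.2, ?_⟩
    simp only [chb]
    calc |x * chb q x (k+1) - q * chb q x k| ≤ |x * chb q x (k+1)| + |q * chb q x k| := abs_sub _ _
      _ = |x| * |chb q x (k+1)| + q * |chb q x k| := by rw [abs_mul, abs_mul, abs_of_nonneg hq]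
      _ ≤ |x| * B^(k+1) + q * B^(k+1) := by
        gcongr
        · exact ih.2
        · exact ih.1.trans (pow_le_pow_right₀ hB1 (by omega))
      _ = (|x| + q) * B^(k+1) := by ring
      _ ≤ B * B^(k+1) := by gcongr
      _ = _ := by ring

lemma chb_lower (q x s : ℝ) (hs : 0 < s) (hsq : s^2 = q) (l : ℕ) (hl : Even l) : (x/2)^l - 2 * (4*s)^l ≤ chb q x l := by
  have hq : 0 ≤ q := by rw [← hsq]; positivity
  have key : ∀ x : ℝ, 0 ≤ x → (x/2)^l - 2 * (4*s)^l ≤ chb q x l := by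
    intro x hx
    rcases le_or_gt x (3*s) with h | h
    · have h1 := (abs_le.1 (chb_small q x s hs.le hsq (by rwa [abs_of_nonneg hx]) l).1).1
      have h2 : (x/2)^l ≤ (4*s)^l := pow_le_pow_left₀ (by positivity) (by linarith) l
      linarith
    · have h1 := (chb_big q x hq (by nlinarith) (by rw [← hsq]; nlinarith) l).1
      have : 0 ≤ 2 * (4*s)^l := by positivity
      linarith
  rcases le_or_gt 0 x with h | h
  · exact key x h
  · have h1 := key (-x) (by linarith)
    rw [(chb_neg q x l).1, hl.neg_one_pow, one_mul] at h1
    have : (-x/2)^l = (x/2)^l := by rw [neg_div, hl.neg_pow]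
    linarith

lemma chb_rec (q x : ℝ) (n : ℕ) (u e : ℕ → ℝ) (h0 : x * u 0 = u 1 + e 0) (hs : ∀ h, h + 1 < n → x * u (h+1) = u (h+2) + q * u h + e (h+1)) :
    ∀ k ≤ n, u k = chb q x k * u 0 - ∑ h ∈ range k, chb q x (k-1-h) * e h := by
  intro k
  induction k using Nat.strong_induction_on with
  | _ k ih =>
    intro hk
    rcases k with _ | _ | k
    · simp [chb]
    · simp [chb]; linarith
    · have h1 := ih k (by omega) (by omega)
      have h2 := ih (k+1) (by omega) (by omega)
      have h3 := hs k (by omega)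
      have h4 : u (k+2) = x * u (k+1) - q * u k - e (k+1) := by linarith
      rw [h4, h1, h2]
      have h5 : ∑ h ∈ range (k+2), chb q x (k+2-1-h) * e h = x * (∑ h ∈ range (k+1), chb q x (k+1-1-h) * e h)
          - q * (∑ h ∈ range k, chb q x (k-1-h) * e h) + e (k+1) := by
        rw [sum_range_succ, sum_range_succ, sum_range_succ]
        have e1 : k + 2 - 1 - (k+1) = 0 := by omega
        have e2 : k + 2 - 1 - k = 1 := by omega
        have e3 : k + 1 - 1 - k = 0 := by omega
        rw [e1, e2, e3, mul_add, mul_sum, mul_sum]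
        have : ∑ h ∈ range k, chb q x (k+2-1-h) * e h = ∑ h ∈ range k, x * (chb q x (k+1-1-h) * e h) - ∑ h ∈ range k, q * (chb q x (k-1-h) * e h) := by
          rw [← sum_sub_distrib]
          apply sum_congr rfl
          intro h hh
          rw [mem_range] at hh
          obtain ⟨t, rfl⟩ : ∃ t, k = h + 1 + t := ⟨k - (h+1), by omega⟩
          have e4 : h + 1 + t + 2 - 1 - h = t + 2 := by omega
          have e5 : h + 1 + t + 1 - 1 - h = t + 1 := by omega
          have e6 : h + 1 + t - 1 - h = t := by omega
          rw [e4, e5, e6]; simp only [chb]; ring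
        rw [this]; simp only [chb]; ring
      rw [h5]; simp only [chb]; ring

/-- symmetric version with constant coefficient -/
lemma cheb_form {ι : Type*} [Fintype ι] [DecidableEq ι] (A : ι → ι → ℝ) (hA : ∀ i j, A i j = A j i) (K q B η : ℝ) (hK : ∀ i, ∑ j, |A i j| ≤ K)
    (hq : 0 < q) (hB : K + q ≤ B) (hB1 : 1 ≤ B) (l : ℕ) (hl : Even l) (y e : ℕ → ι → ℝ) (hη : 0 ≤ η)
    (h0 : ∀ i, ∑ j, A i j * y 0 j = y 1 i + e 0 i)
    (hs : ∀ h, h + 1 < l → ∀ i, ∑ j, A i j * y (h+1) j = y (h+2) i + q * y h i + e (h+1) i)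
    (he : ∀ h < l, ∑ i, e h i ^ 2 ≤ η ^ 2) (hy : ∑ i, y 0 i ^ 2 = 1) :
    ((∑ i, y 0 i * ∑ j, A i j * y 0 j) / 2) ^ l ≤ ∑ i, y 0 i * y l i + 2 * (4 * Real.sqrt q) ^ l + l * B ^ l * η := by
  obtain ⟨U, lam, hU, hlam, hlK⟩ := spec_basis A hA K hK
  set hat : (ι → ℝ) → ι → ℝ := fun f j => ∑ i, U j i * f i with hhat
  have hadd : ∀ f g j, hat (fun i => f i + g i) j = hat f j + hat g j := by
    intro f g j; simp only [hhat, mul_add, sum_add_distrib]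
  have hsm : ∀ (c:ℝ) f j, hat (fun i => c * f i) j = c * hat f j := by
    intro c f j; simp only [hhat, mul_sum]; exact sum_congr rfl fun i _ => by ring
  have r0 : ∀ j, lam j * hat (y 0) j = hat (y 1) j + hat (e 0) j := by
    intro j
    rw [← hadd, ← hlam]
    simp only [h0]; rfl
  have rs : ∀ j h, h + 1 < l → lam j * hat (y (h+1)) j = hat (y (h+2)) j + q * hat (y h) j + hat (e (h+1)) j := by
    intro j h hh
    rw [← hsm q, ← hadd, ← hadd, ← hlam]
    simp only [hs h hh]; rfl
  have hsol : ∀ j, hat (y l) j = chb q (lam j) l * hat (y 0) j - ∑ h ∈ range l, chb q (lam j) (l-1-h) * hat (e h) j :=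
    fun j => chb_rec q (lam j) l (fun h => hat (y h) j) (fun h => hat (e h) j) (r0 j) (rs j) l le_rfl
  set c := hat (y 0) with hc
  have hc1 : ∑ j, c j ^ 2 = 1 := by
    rw [← hy]
    have := hU (y 0) (y 0)
    simp only [← sq] at this; exact this
  have hcA : ∑ j, c j ^ 2 * (lam j / 2) = (∑ i, y 0 i * ∑ j, A i j * y 0 j) / 2 := by
    have := hU (y 0) (fun i => ∑ j, A i j * y 0 j)
    rw [← this, sum_div]
    apply sum_congr rfl
    intro j _
    rw [hlam]; simp only [hc, hhat]; ring
  have hJ := Real.pow_arith_mean_le_arith_mean_pow_of_even univ (fun j => c j ^ 2) (fun j => lam j / 2) (fun _ _ => sq_nonneg _) hc1 hl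
  rw [hcA] at hJ
  have hsq := Real.sqrt_pos.2 hq
  have h1 : ∑ j, c j ^ 2 * (lam j / 2)^l ≤ ∑ j, c j^2 * chb q (lam j) l + 2 * (4 * Real.sqrt q) ^ l := by
    have : ∀ j ∈ univ, c j ^ 2 * (lam j / 2)^l ≤ c j^2 * chb q (lam j) l + c j ^ 2 * (2 * (4 * Real.sqrt q) ^ l) := by
      intro j _
      rw [← mul_add]
      apply mul_le_mul_of_nonneg_left _ (sq_nonneg _)
      linarith [chb_lower q (lam j) (Real.sqrt q) hsq (Real.sq_sqrt hq.le) l hl]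
    have h2 := sum_le_sum this
    rw [sum_add_distrib, ← sum_mul, hc1, one_mul] at h2
    exact h2
  have h2 : ∑ j, c j^2 * chb q (lam j) l = ∑ i, y 0 i * y l i + ∑ h ∈ range l, ∑ j, c j * (chb q (lam j) (l-1-h) * hat (e h) j) := by
    rw [← hU (y 0) (y l), sum_comm, ← sum_add_distrib]
    apply sum_congr rfl
    intro j _
    have h3 := hsol j
    have h4 : (∑ i, U j i * y l i) = hat (y l) j := rfl
    have h5 : (∑ i, U j i * y 0 i) = c j := rfl
    rw [h4, h5, h3, ← mul_sum]; ring
  have h3 : ∀ h ∈ range l, ∑ j, c j * (chb q (lam j) (l-1-h) * hat (e h) j) ≤ B ^ l * η := by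
    intro h hh
    rw [mem_range] at hh
    have hK0 : ∀ j, |chb q (lam j) (l-1-h)| ≤ B^l := fun j =>
      ((chb_crude q (lam j) B hq.le (by linarith [hlK j]) hB1 (l-1-h)).1).trans (pow_le_pow_right₀ hB1 (by omega))
    have hCS := sum_mul_sq_le_sq_mul_sq univ c (fun j => chb q (lam j) (l-1-h) * hat (e h) j)
    have h6 : ∑ j, (chb q (lam j) (l-1-h) * hat (e h) j)^2 ≤ (B^l * η)^2 := by
      calc _ ≤ ∑ j, (B^l)^2 * (hat (e h) j)^2 := sum_le_sum fun j _ => by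
            rw [mul_pow]
            apply mul_le_mul_of_nonneg_right _ (sq_nonneg _)
            rw [sq_le_sq, abs_of_nonneg (by positivity : 0 ≤ B^l)]; exact hK0 j
        _ = (B^l)^2 * ∑ j, hat (e h) j * hat (e h) j := by rw [mul_sum]; exact sum_congr rfl fun j _ => by ring
        _ = (B^l)^2 * ∑ i, e h i ^ 2 := by rw [hU]; simp only [sq]
        _ ≤ (B^l)^2 * η^2 := by gcongr; exact he h hh
        _ = _ := by ring
    rw [hc1, one_mul] at hCS
    exact abs_le_of_sq_le_sq' (hCS.trans h6) (by positivity) |>.2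
  have h4 := sum_le_sum h3
  rw [sum_const, card_range, nsmul_eq_mul] at h4
  have h5 : ∑ j, c j^2 * (lam j/2)^l = ∑ j, c j^2 * (lam j/2)^l := rfl
  linarith

noncomputable def gst {ι : Type*} (q : ℝ) (D : ι → ℝ) (i : ι) (b : ℕ) : ℝ := if b = 0 then Real.sqrt (q - D i) else Real.sqrt q
noncomputable def gco {ι : Type*} (q : ℝ) (D : ι → ℝ) (i : ι) : ℕ → ℝ
  | 0 => 1
  | b+1 => gco q D i b * gst q D i b
noncomputable def gy {ι : Type*} (q : ℝ) (D : ι → ℝ) (y : ℕ → ι → ℝ) (h : ℕ) (i : ι) (b : ℕ) : ℝ :=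
  if b ≤ h then gco q D i b * y (h-b) i else 0

lemma ghost {ι : Type*} [Fintype ι] [DecidableEq ι] (A : ι → ι → ℝ) (hA : ∀ i j, A i j = A j i) (K q B η : ℝ) (hK : ∀ i, ∑ j, |A i j| ≤ K)
    (hq : 1 ≤ q) (D : ι → ℝ) (hD : ∀ i, -1 ≤ D i ∧ D i ≤ q)
    (hB : K + 5 * q ≤ B) (hB1 : 1 ≤ B) (l : ℕ) (hl : Even l) (y e : ℕ → ι → ℝ) (hη : 0 ≤ η)
    (h0 : ∀ i, ∑ j, A i j * y 0 j = y 1 i + e 0 i)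
    (hs : ∀ h, h + 1 < l → ∀ i, ∑ j, A i j * y (h+1) j = y (h+2) i + D i * y h i + e (h+1) i)
    (he : ∀ h < l, ∑ i, e h i ^ 2 ≤ η ^ 2) (hy : ∑ i, y 0 i ^ 2 = 1) :
    ((∑ i, y 0 i * ∑ j, A i j * y 0 j) / 2) ^ l ≤ ∑ i, y 0 i * y l i + 2 * (4 * Real.sqrt q) ^ l + l * B ^ l * η := by
  set M : ι × Fin (l+1) → ι × Fin (l+1) → ℝ := fun x x' =>
    (if x.2.1 = 0 ∧ x'.2.1 = 0 then A x.1 x'.1 else 0) +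
    ((if x.1 = x'.1 ∧ x.2.1 + 1 = x'.2.1 then gst q D x.1 x.2.1 else 0) +
     (if x.1 = x'.1 ∧ x'.2.1 + 1 = x.2.1 then gst q D x.1 x'.2.1 else 0)) with hM
  have hMs : ∀ x x', M x x' = M x' x := by
    intro x x'
    simp only [hM]
    rw [add_comm (if x.1 = x'.1 ∧ x.2.1 + 1 = x'.2.1 then _ else _)]
    congr 1
    · simp only [and_comm, hA x.1 x'.1]
    · congr 1
      · by_cases h : x.1 = x'.1 <;> simp [h, eq_comm]
      · by_cases h : x.1 = x'.1 <;> simp [h, eq_comm]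
  have hMsum : ∀ (i : ι) (b : Fin (l+1)) (g : ι → ℕ → ℝ) (G : (ι → ℝ) → ℝ), True := fun _ _ _ _ => trivial
  have hsum : ∀ (i : ι) (b : Fin (l+1)) (g : ι → ℕ → ℝ), ∑ x' : ι × Fin (l+1), M (i,b) x' * g x'.1 x'.2.1 =
      (if b.1 = 0 then ∑ j, A i j * g j 0 else 0) + ((if b.1 < l then gst q D i b.1 * g i (b.1+1) else 0) +
        (if b.1 = 0 then 0 else gst q D i (b.1-1) * g i (b.1-1))) := by
    intro i b g
    rw [Fintype.sum_prod_type]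
    simp only [hM, add_mul, sum_add_distrib]
    congr 1
    · by_cases hb : b.1 = 0
      · rw [if_pos hb]
        apply sum_congr rfl
        intro j _
        rw [sum_eq_single (0 : Fin (l+1))]
        · simp [hb]
        · intro c _ hc
          rw [if_neg, zero_mul]
          rintro ⟨_, h⟩; exact hc (Fin.ext h)
        · simp
      · rw [if_neg hb]
        apply sum_eq_zero; intro j _
        apply sum_eq_zero; intro c _
        rw [if_neg (fun h => hb h.1), zero_mul]
    · congr 1
      · rw [sum_eq_single i]
        · by_cases hb : b.1 < l
          · rw [if_pos hb, sum_eq_single (⟨b.1+1, by omega⟩ : Fin (l+1))]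
            · simp
            · intro c _ hc
              rw [if_neg, zero_mul]
              rintro ⟨_, h⟩; exact hc (Fin.ext h.symm)
            · simp
          · rw [if_neg hb]
            apply sum_eq_zero; intro c _
            rw [if_neg, zero_mul]
            rintro ⟨_, h⟩
            have := c.2; omega
        · intro j _ hj
          apply sum_eq_zero; intro c _
          rw [if_neg, zero_mul]
          rintro ⟨h, _⟩; exact hj h.symm
        · simp
      · rw [sum_eq_single i]
        · by_cases hb : b.1 = 0
          · rw [if_pos hb]
            apply sum_eq_zero; intro c _
            rw [if_neg, zero_mul]
            rintro ⟨_, h⟩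
            omega
          · rw [if_neg hb, sum_eq_single (⟨b.1-1, by omega⟩ : Fin (l+1))]
            · rw [if_pos ⟨rfl, by simp only; omega⟩]
            · intro c _ hc
              rw [if_neg, zero_mul]
              rintro ⟨_, h⟩
              apply hc; ext; simp only; omega
            · simp
        · intro j _ hj
          apply sum_eq_zero; intro c _
          rw [if_neg, zero_mul]
          rintro ⟨h, _⟩; exact hj h.symm
        · simp
  have hg0 : ∀ i b, 0 ≤ gst q D i b := fun i b => by unfold gst; split_ifs <;> exact Real.sqrt_nonneg _
  have hg2 : ∀ i b, gst q D i b ≤ 2 * q := by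
    intro i b
    unfold gst
    split_ifs
    · apply Real.sqrt_le_iff.2 ⟨by linarith, by nlinarith [(hD i).1]⟩
    · apply Real.sqrt_le_iff.2 ⟨by linarith, by nlinarith⟩
  have hgsq0 : ∀ i, gst q D i 0 * gst q D i 0 = q - D i := fun i => by
    unfold gst; rw [if_pos rfl, Real.mul_self_sqrt]; linarith [(hD i).2]
  have hgsq : ∀ i b, gst q D i (b+1) * gst q D i (b+1) = q := fun i b => by
    unfold gst; rw [if_neg (by omega), Real.mul_self_sqrt]; linarith
  have hMabs : ∀ x, ∑ x', |M x x'| ≤ K + 4 * q := by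
    rintro ⟨i, b⟩
    have h1 : ∀ x', |M (i,b) x'| ≤ (if b.1 = 0 ∧ x'.2.1 = 0 then |A i x'.1| else 0) +
      ((if i = x'.1 ∧ b.1 + 1 = x'.2.1 then gst q D i b.1 else 0) + (if i = x'.1 ∧ x'.2.1 + 1 = b.1 then gst q D i x'.2.1 else 0)) := by
      intro x'
      simp only [hM]
      refine (abs_add_le _ _).trans (add_le_add ?_ ((abs_add_le _ _).trans (add_le_add ?_ ?_)))
      · split_ifs <;> simp
      · split_ifs
        · rw [abs_of_nonneg (hg0 _ _)]
        · simp
      · split_ifs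
        · rw [abs_of_nonneg (hg0 _ _)]
        · simp
    refine (sum_le_sum fun x' _ => h1 x').trans ?_
    rw [sum_add_distrib, sum_add_distrib]
    have a1 : ∑ x' : ι × Fin (l+1), (if b.1 = 0 ∧ x'.2.1 = 0 then |A i x'.1| else 0) ≤ K := by
      rw [Fintype.sum_prod_type]
      refine le_trans (sum_le_sum (g := fun j => |A i j|) fun j _ => ?_) (hK i)
      rw [sum_eq_single (0 : Fin (l+1))]
      · split_ifs <;> simp
      · intro c _ hc
        rw [if_neg]
        rintro ⟨_, h⟩; exact hc (Fin.ext h)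
      · simp
    have a2 : ∑ x' : ι × Fin (l+1), (if i = x'.1 ∧ b.1 + 1 = x'.2.1 then gst q D i b.1 else 0) ≤ 2 * q := by
      by_cases hb : b.1 < l
      · rw [sum_eq_single (i, (⟨b.1+1, by omega⟩ : Fin (l+1)))]
        · split_ifs
          · exact hg2 _ _
          · linarith
        · rintro ⟨j, c⟩ _ hc
          rw [if_neg]
          rintro ⟨h, h'⟩
          apply hc
          simp only at h h'
          subst h; congr; ext; simp only; omega
        · simp
      · rw [sum_eq_zero]
        · linarith
        · rintro ⟨j, c⟩ _
          rw [if_neg]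
          rintro ⟨_, h⟩
          have := c.2; simp only at h; omega
    have a3 : ∑ x' : ι × Fin (l+1), (if i = x'.1 ∧ x'.2.1 + 1 = b.1 then gst q D i x'.2.1 else 0) ≤ 2 * q := by
      rw [sum_eq_single (i, (⟨b.1-1, by omega⟩ : Fin (l+1)))]
      · split_ifs
        · exact hg2 _ _
        · linarith
      · rintro ⟨j, c⟩ _ hc
        rw [if_neg]
        rintro ⟨h, h'⟩
        apply hc
        simp only at h h'
        subst h; congr; ext; simp only; omega
      · simp
    linarith
  have hz : ∀ (F : ι → ℝ), ∑ x : ι × Fin (l+1), (if x.2.1 = 0 then F x.1 else 0) = ∑ i, F i := by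
    intro F
    rw [Fintype.sum_prod_type]
    apply sum_congr rfl
    intro i _
    rw [sum_eq_single (0 : Fin (l+1))]
    · simp
    · intro c _ hc
      rw [if_neg]
      intro h; exact hc (Fin.ext h)
    · simp
  have H := cheb_form M hMs (K + 4*q) q B η hMabs (by linarith) (by linarith) hB1 l hl
    (fun h x => gy q D y h x.1 x.2.1) (fun h x => if x.2.1 = 0 then e h x.1 else 0) hη ?_ ?_ ?_ ?_
  · have e1 : ∑ x : ι × Fin (l+1), gy q D y 0 x.1 x.2.1 * gy q D y l x.1 x.2.1 = ∑ i, y 0 i * y l i := by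
      rw [← hz]
      apply sum_congr rfl
      rintro ⟨i, b⟩ _
      simp only [gy]
      by_cases hb : b.1 = 0
      · simp [hb, gco]
      · rw [if_neg (by omega), if_neg hb, zero_mul]
    have e2 : ∑ x : ι × Fin (l+1), gy q D y 0 x.1 x.2.1 * ∑ x', M x x' * gy q D y 0 x'.1 x'.2.1 = ∑ i, y 0 i * ∑ j, A i j * y 0 j := by
      rw [← hz]
      apply sum_congr rfl
      rintro ⟨i, b⟩ _
      rw [hsum i b (gy q D y 0)]
      by_cases hb : b.1 = 0
      · simp [hb, gco, gy]
      · simp only [gy]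
        rw [if_neg (by omega), zero_mul]; simp [hb]
    rw [e1, e2] at H
    exact H
  · rintro ⟨i, b⟩
    rw [hsum i b (gy q D y 0)]
    obtain ⟨b, hb⟩ := b
    rcases b with _ | _ | b
    · simp [gy, gco, h0]
    · simp [gy, gco]
    · simp [gy, gco]
  · rintro h hh ⟨i, b⟩
    rw [hsum i b (gy q D y (h+1))]
    obtain ⟨b, hb⟩ := b
    simp only
    have key : (if b < l then gst q D i b * gy q D y (h+1) i (b+1) else 0) = gst q D i b * gy q D y (h+1) i (b+1) := by
      split_ifs with h1
      · rfl
      · unfold gy; rw [if_neg (by omega), mul_zero]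
    rw [key]
    rcases b with _ | b
    · simp only [if_true, gy, Nat.zero_le, gco, Nat.sub_zero, one_mul, add_zero, zero_add]
      rw [if_pos (by omega), hs h hh]
      have : h + 1 - 1 = h := by omega
      rw [this]
      have := hgsq0 i
      linear_combination y h i * this
    · have e0 : (b + 1 = 0) = False := by simp
      simp only [e0, if_false, Nat.add_sub_cancel, gy, zero_add, add_zero]
      have hrel : gco q D i (b+1+1) * gst q D i (b+1) = q * gco q D i (b+1) := by
        simp only [gco]; linear_combination gco q D i b * gst q D i b * hgsq i b
      have t1 : (if b + 1 + 1 ≤ h + 1 then gco q D i (b+1+1) * y (h+1-(b+1+1)) i else 0) = if b + 1 ≤ h then gco q D i (b+1+1) * y (h-(b+1)) i else 0 := by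
        by_cases hc : b + 1 ≤ h
        · rw [if_pos (by omega), if_pos hc]; congr 2; omega
        · rw [if_neg (by omega), if_neg hc]
      have t2 : (if b + 1 ≤ h + 2 then gco q D i (b+1) * y (h+2-(b+1)) i else 0) = if b ≤ h + 1 then gco q D i (b+1) * y (h+1-b) i else 0 := by
        by_cases hc : b ≤ h + 1
        · rw [if_pos (by omega), if_pos hc]; congr 2; omega
        · rw [if_neg (by omega), if_neg hc]
      rw [t1, t2]
      by_cases c1 : b + 1 ≤ h <;> by_cases c2 : b ≤ h + 1
      · simp only [if_pos c1, if_pos c2]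
        have : gco q D i (b+1) = gco q D i b * gst q D i b := rfl
        linear_combination y (h-(b+1)) i * hrel - y (h+1-b) i * this
      · omega
      · simp only [if_neg c1, if_pos c2]
        have : gco q D i (b+1) = gco q D i b * gst q D i b := rfl
        linear_combination - y (h+1-b) i * this
      · simp only [if_neg c1, if_neg c2]; ring
  · intro h hh
    refine le_of_eq_of_le ?_ (he h hh)
    rw [← hz (fun i => e h i ^ 2)]
    apply sum_congr rfl
    intro x _
    split_ifs <;> simp
  · rw [← hy, ← hz (fun i => y 0 i ^ 2)]
    apply sum_congr rfl
    rintro ⟨i, b⟩ _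
    simp only [gy]
    by_cases hb : b.1 = 0
    · simp [hb, gco]
    · rw [if_neg (by omega), if_neg hb]; simp

noncomputable def WL (P : Finset ℕ) : ℕ → Finset (List ℕ)
  | 0 => {[]}
  | n+1 => (P ×ˢ WL P n).image (fun a => a.1 :: a.2)

def okw (Av : Finset ℕ) (z : List ℕ) : Prop := z.Nodup ∧ ∀ q ∈ z, q ∉ Av

lemma WL_succ {M : Type*} [AddCommMonoid M] (P : Finset ℕ) (n : ℕ) (F : List ℕ → M) :
    ∑ z ∈ WL P (n+1), F z = ∑ p ∈ P, ∑ z ∈ WL P n, F (p :: z) := by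
  rw [WL, sum_image, sum_product]
  rintro ⟨a, b⟩ _ ⟨c, d⟩ _ h
  simp only [List.cons.injEq] at h
  simp [h.1, h.2]

lemma WL_rec {M : Type*} [AddCommMonoid M] (P : Finset ℕ) (n : ℕ) (Av : Finset ℕ) (F : List ℕ → M) :
    ∑ z ∈ WL P (n+1), (if okw Av z then F z else 0) =
      ∑ p ∈ P \ Av, ∑ z ∈ WL P n, if okw (insert p Av) z then F (p :: z) else 0 := by
  rw [WL_succ, sdiff_eq_filter, sum_filter]
  apply sum_congr rfl
  intro p _
  by_cases hp : p ∈ Av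
  · rw [if_neg (by simpa using hp)]
    apply sum_eq_zero
    intro z _
    rw [if_neg]
    intro h
    exact h.2 p (by simp) hp
  · rw [if_pos hp]
    apply sum_congr rfl
    intro z _
    have : okw Av (p :: z) ↔ okw (insert p Av) z := by
      unfold okw
      simp only [List.nodup_cons, List.mem_cons, forall_eq_or_imp, mem_insert, not_or]
      constructor
      · rintro ⟨⟨h1, h2⟩, h3, h4⟩
        exact ⟨h2, fun q hq => ⟨by rintro rfl; exact h1 hq, h4 q hq⟩⟩
      · rintro ⟨h1, h2⟩
        exact ⟨⟨fun h => (h2 p h).1 rfl, h1⟩, hp, fun q hq => (h2 q hq).2⟩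
    by_cases h : okw Av (p :: z)
    · rw [if_pos h, if_pos (this.1 h)]
    · rw [if_neg h, if_neg (fun hh => h (this.2 hh))]

lemma WL_mem (P : Finset ℕ) (n : ℕ) (z : List ℕ) : z ∈ WL P n ↔ z.length = n ∧ ∀ q ∈ z, q ∈ P := by
  induction n generalizing z with
  | zero => 
    simp only [WL, mem_singleton, List.length_eq_zero_iff]
    constructor
    · rintro rfl; simp
    · exact fun h => h.1
  | succ n ih =>
    simp only [WL, mem_image, mem_product, Prod.exists]
    constructor
    · rintro ⟨a, b, ⟨h1, h2⟩, rfl⟩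
      rw [ih] at h2
      simp [h2.1, h1]; exact h2.2
    · rintro ⟨h1, h2⟩
      cases z with
      | nil => simp at h1
      | cons a b =>
        refine ⟨a, b, ⟨h2 a (by simp), ?_⟩, rfl⟩
        rw [ih]
        exact ⟨by simpa using h1, fun q hq => h2 q (by simp [hq])⟩

lemma WL_prod (P : Finset ℕ) (n : ℕ) (f : ℕ → ℝ) :
    ∑ z ∈ WL P n, (z.map f).prod = (∑ p ∈ P, f p) ^ n := by
  induction n with
  | zero => simp [WL]
  | succ n ih =>
    rw [WL_succ, pow_succ', sum_mul]
    apply sum_congr rfl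
    intro p _
    simp only [List.map_cons, List.prod_cons]
    rw [← mul_sum, ih]

/-- the involution -/
def nu (a : ℤ) (p : ℕ) (n : ℤ) : ℤ := if (2:ℤ) ∣ n + a then n + p else n - p

noncomputable def ub (p : ℕ) (n : ℤ) : ℝ := (if (p:ℤ) ∣ n then 1 else 0) + 1/(p:ℝ)

lemma ub_nonneg (p n) : 0 ≤ ub p n := by unfold ub; positivity

noncomputable def muL (a : ℤ) : List ℕ → ℤ → ℝ
  | [], _ => 1
  | p :: z, v => ub p v * muL a z (nu a p v)

lemma muL_nonneg (a z v) : 0 ≤ muL a z v := by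
  induction z generalizing v with
  | nil => simp [muL]
  | cons p z ih => exact mul_nonneg (ub_nonneg _ _) (ih _)

def prL : ℤ → ℤ → List ℕ → List (ℕ × ℤ)
  | _, _, [] => []
  | ε, x, q :: z => (q, x) :: prL (-ε) (x + ε * q) z

def offL : ℤ → ℤ → List ℕ → ℤ
  | _, x, [] => x
  | ε, x, q :: z => offL (-ε) (x + ε * q) z

lemma prL_append (ε x z1 p z2) : ∃ l, prL ε x (z1 ++ p :: z2) = prL ε x z1 ++ (p, offL ε x z1) :: l := by
  induction z1 generalizing ε x with
  | nil => exact ⟨_, rfl⟩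
  | cons q z ih =>
    obtain ⟨l, hl⟩ := ih (-ε) (x + ε * q)
    exact ⟨l, by simp [prL, offL, hl]⟩

lemma prL_fst (ε x z) : (prL ε x z).map Prod.fst = z := by
  induction z generalizing ε x with
  | nil => rfl
  | cons q z ih => simp [prL, ih]

lemma offL_shift (ε x z) : offL ε x z = x + offL ε 0 z := by
  induction z generalizing ε x with
  | nil => simp [offL]
  | cons q z ih => 
    simp only [offL]
    rw [ih, ih (-ε) (0 + _)]; ring

/-- weight of a list of pairs -/
noncomputable def wp (l : List (ℕ × ℤ)) (r : RR) : ℝ := (l.map (fun a => hit r a.1 a.2 + 1/(a.1:ℝ))).prod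

lemma wp_nonneg (l r) : 0 ≤ wp l r := by
  apply List.prod_nonneg
  intro x hx
  simp only [List.mem_map] at hx
  obtain ⟨a, _, rfl⟩ := hx
  have := hit_nonneg r a.1 a.2
  positivity

lemma muL_eq (a : ℤ) (z : List ℕ) (hz : ∀ p ∈ z, Odd p) (v x : ℤ) (ε : ℤ) (hε : ε = if (2:ℤ) ∣ v + x + a then 1 else -1) :
    muL a z (v + x) = wp (prL ε x z) (cst v) := by
  induction z generalizing x ε with
  | nil => simp [muL, prL, wp]
  | cons p z ih =>
    have hp := hz p (by simp)
    have hn : nu a p (v + x) = v + (x + ε * p) := by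
      unfold nu; rw [hε]; split_ifs <;> ring
    simp only [muL, prL, wp, List.map_cons, List.prod_cons]
    rw [hn, ih (fun q hq => hz q (by simp [hq])) (x + ε * p) (-ε)]
    · rw [hit_cst]; rfl
    · rw [hε]
      have hp2 : (p:ℤ) % 2 = 1 := by exact_mod_cast Nat.odd_iff.1 hp
      split_ifs with h1 h2 h2 <;> omega

lemma muL_le (a : ℤ) (z : List ℕ) (hz : ∀ p ∈ z, Odd p) (v : ℤ) :
    muL a z v ≤ wp (prL 1 0 z) (cst v) + wp (prL (-1) 0 z) (cst v) := by
  have h1 := wp_nonneg (prL 1 0 z) (cst v)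
  have h2 := wp_nonneg (prL (-1) 0 z) (cst v)
  have := muL_eq a z hz v 0 _ rfl
  rw [add_zero] at this
  rw [this]
  split_ifs <;> linarith

lemma wp_avg (l : List (ℕ × ℤ)) (hnd : (l.map Prod.fst).Nodup) (hl : ∀ a ∈ l, Nat.Prime a.1) (a0 : ℤ) (N : ℕ)
    (hN : (l.map Prod.fst).prod ≤ N) :
    ∑ n ∈ Ico a0 (a0 + N), wp l (cst n) ≤ 2 * N * (l.map (fun a => 2/(a.1:ℝ))).prod := by
  have hnd' : l.Nodup := List.Nodup.of_map _ hnd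
  have hl' : ∀ p ∈ l.map Prod.fst, Nat.Prime p := by
    intro p hp
    simp only [List.mem_map] at hp
    obtain ⟨a, ha, rfl⟩ := hp
    exact hl a ha
  have h1 : ∀ r, wp l r = (∏ a ∈ l.toFinset, (hit r a.1 a.2 + 1/(a.1:ℝ))) * 1 := by
    intro r
    rw [mul_one, List.prod_toFinset _ hnd']; rfl
  have h2 := per_pos (l.map Prod.fst) hl' hnd (wp l) (by
      intro r r' h
      unfold wp
      congr 1
      apply List.map_congr_left
      intro a ha
      rw [hit_oeq r r' a.1 a.2 (h a.1 (List.mem_map_of_mem ha))]) (wp_nonneg l) (cst 0) a0 N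
  have h3 := EE_pullout (fun a : ℕ × ℤ => a.1) (fun a => a.2) (fun a => 1/(a.1:ℝ)) l.toFinset (by
      intro a ha b hb hab
      simp only [List.coe_toFinset, Set.mem_setOf_eq] at ha hb
      exact List.inj_on_of_nodup_map hnd ha hb hab) (l.map Prod.fst) hnd (fun p hp => (hl' p hp).pos)
      (fun i hi => List.mem_map_of_mem (List.mem_toFinset.1 hi)) (fun _ => 1) (fun _ _ _ _ => rfl) (cst 0)
  rw [EE_const _ (fun p hp => (hl' p hp).pos), mul_one] at h3
  have h4 : EE (l.map Prod.fst) (wp l) (cst 0) = (l.map (fun a => 2/(a.1:ℝ))).prod := by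
    have : wp l = fun r => (∏ a ∈ l.toFinset, (hit r a.1 a.2 + 1/(a.1:ℝ))) * 1 := funext h1
    rw [this, h3, List.prod_toFinset _ hnd']
    congr 1
    apply List.map_congr_left
    intro a _
    ring
  rw [h4] at h2
  refine h2.trans ?_
  apply mul_le_mul_of_nonneg_right
  · have : ((l.map Prod.fst).prod : ℝ) ≤ N := by exact_mod_cast hN
    push_cast at this ⊢
    linarith
  · apply List.prod_nonneg
    intro x hx
    simp only [List.mem_map] at hx
    obtain ⟨a, _, rfl⟩ := hx
    positivity

lemma wp_avg2 (l1 l2 : List (ℕ × ℤ)) (p : ℕ) (x x0 : ℤ) (hnd : ((l1 ++ (p,x) :: l2).map Prod.fst).Nodup)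
    (hl : ∀ a ∈ l1 ++ (p,x) :: l2, Nat.Prime a.1) (a0 : ℤ) (N : ℕ)
    (hN : ((l1 ++ (p,x) :: l2).map Prod.fst).prod ≤ N) :
    ∑ n ∈ Ico a0 (a0 + N), (hit (cst n) p x0 + 1/(p:ℝ)) * wp (l1 ++ (p,x) :: l2) (cst n) ≤
      2 * N * (((if (p:ℤ) ∣ x - x0 then 1 else 0) + 2/(p:ℝ)) * ((l1 ++ (p,x) :: l2).map (fun a => 2/(a.1:ℝ))).prod) := by
  have A1 := wp_avg (l1 ++ (p,x) :: l2) hnd hl a0 N hN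
  have A2 := wp_avg (l1 ++ (p,x0) :: l2) (by simpa using hnd) (by
    intro a ha
    simp only [List.mem_append, List.mem_cons] at ha
    rcases ha with h | rfl | h
    · exact hl a (by simp [h])
    · exact hl (p,x) (by simp)
    · exact hl a (by simp [h])) a0 N (by simpa using hN)
  have e : ((l1 ++ (p,x0) :: l2).map (fun a => 2/(a.1:ℝ))).prod = ((l1 ++ (p,x) :: l2).map (fun a => 2/(a.1:ℝ))).prod := by simp
  rw [e] at A2
  set Q := ((l1 ++ (p,x) :: l2).map (fun a => 2/(a.1:ℝ))).prod
  set κ : ℝ := if (p:ℤ) ∣ x - x0 then 1 else 0 with hκ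
  have hκ0 : 0 ≤ κ := by rw [hκ]; split_ifs <;> norm_num
  have hpt : ∀ n, (hit (cst n) p x0 + 1/(p:ℝ)) * wp (l1 ++ (p,x) :: l2) (cst n) ≤
      (κ + 1/(p:ℝ)) * wp (l1 ++ (p,x) :: l2) (cst n) + 1/(p:ℝ) * wp (l1 ++ (p,x0) :: l2) (cst n) := by
    intro n
    have r0 : 0 ≤ wp l1 (cst n) * wp l2 (cst n) := mul_nonneg (wp_nonneg _ _) (wp_nonneg _ _)
    have ew : ∀ y, wp (l1 ++ (p,y) :: l2) (cst n) = (hit (cst n) p y + 1/(p:ℝ)) * (wp l1 (cst n) * wp l2 (cst n)) := by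
      intro y
      simp only [wp, List.map_append, List.map_cons, List.prod_append, List.prod_cons]
      ring
    rw [ew, ew]
    have c0 : (0:ℝ) ≤ 1/p := by positivity
    have key : (hit (cst n) p x0 + 1/(p:ℝ)) * (hit (cst n) p x + 1/(p:ℝ)) ≤ (κ + 1/p) * (hit (cst n) p x + 1/p) + 1/p * (hit (cst n) p x0 + 1/p) := by
      have h1 := hit_nonneg (cst n) p x
      have h2 := hit_nonneg (cst n) p x0
      have h3 : hit (cst n) p x0 * hit (cst n) p x ≤ κ * hit (cst n) p x := by
        rw [hit_cst, hit_cst, hκ]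
        split_ifs with a1 a2 a3 a3 <;> try norm_num
        exfalso; apply a3
        have := dvd_sub a2 a1
        rwa [show n + x - (n + x0) = x - x0 by ring] at this
      nlinarith [mul_nonneg hκ0 c0, mul_nonneg c0 c0]
    nlinarith [mul_le_mul_of_nonneg_right key r0]
  calc _ ≤ ∑ n ∈ Ico a0 (a0 + N), ((κ + 1/(p:ℝ)) * wp (l1 ++ (p,x) :: l2) (cst n) + 1/(p:ℝ) * wp (l1 ++ (p,x0) :: l2) (cst n)) := sum_le_sum fun n _ => hpt n
    _ ≤ (κ + 1/(p:ℝ)) * (2 * N * Q) + 1/(p:ℝ) * (2 * N * Q) := by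
      rw [sum_add_distrib, ← mul_sum, ← mul_sum]
      gcongr
    _ = _ := by ring

lemma ap_sum (P : Finset ℕ) (H0 : ℝ) (hH0 : 0 < H0) (Hn : ℕ) (hP : ∀ p ∈ P, H0 ≤ (p:ℝ) ∧ p ≤ Hn) (q : ℕ) (hq : H0 ≤ (q:ℝ)) (c : ℤ) :
    ∑ p ∈ P, (if (q:ℤ) ∣ (p:ℤ) + c then (1:ℝ)/p else 0) ≤ (2 + Real.log Hn) / H0 := by
  have hq0 : 0 < q := by
    have : (0:ℝ) < q := by linarith
    exact_mod_cast this
  set F : Finset ℕ := P.filter (fun p : ℕ => (q:ℤ) ∣ (p:ℤ) + c) with hF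
  have hinj : Set.InjOn (fun p : ℕ => p / q) F := by
    intro x hx y hy hxy
    simp only [hF, coe_filter, Set.mem_setOf_eq] at hx hy
    have h1 : (q:ℤ) ∣ (x:ℤ) - y := by
      have := dvd_sub hx.2 hy.2
      rwa [show (x:ℤ) + c - (y + c) = x - y by ring] at this
    have h2 : x % q = y % q := by
      have h3 := Int.emod_eq_emod_iff_emod_sub_eq_zero.2 (Int.emod_eq_zero_of_dvd h1)
      exact_mod_cast h3
    have h3 : x / q = y / q := by simpa using hxy
    rw [← Nat.div_add_mod x q, ← Nat.div_add_mod y q, h2, h3]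
  have e1 : ∑ p ∈ P, (if (q:ℤ) ∣ (p:ℤ) + c then (1:ℝ)/p else 0) = ∑ p ∈ F, (1:ℝ)/p := by
    rw [hF, sum_filter]
  rw [e1]
  set g : ℕ → ℝ := fun k => if k = 0 then 1 else 1/(k:ℝ) with hg
  have hg0 : ∀ k, 0 ≤ g k := by intro k; simp only [hg]; split_ifs <;> positivity
  have h1 : ∀ p ∈ F, (1:ℝ)/p ≤ g (p/q) / H0 := by
    intro p hp
    have hp' := hP p (mem_filter.1 hp).1
    have hp0 : (0:ℝ) < p := by linarith
    simp only [hg]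
    split_ifs with h
    · exact one_div_le_one_div_of_le hH0 hp'.1
    · have hk : (0:ℝ) < (p/q : ℕ) := by exact_mod_cast Nat.pos_of_ne_zero h
      rw [div_div]
      apply one_div_le_one_div_of_le (by positivity)
      calc ((p/q:ℕ):ℝ) * H0 ≤ ((p/q:ℕ):ℝ) * q := by gcongr
        _ = ((p/q*q : ℕ):ℝ) := by push_cast; ring
        _ ≤ p := by exact_mod_cast Nat.div_mul_le_self p q
  calc _ ≤ ∑ p ∈ F, g (p/q) / H0 := sum_le_sum h1
    _ = (∑ k ∈ F.image (fun p => p / q), g k) / H0 := by rw [sum_image hinj, sum_div]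
    _ ≤ (∑ k ∈ range (Hn+1), g k) / H0 := by
      gcongr
      · intro k hk
        simp only [mem_image] at hk
        obtain ⟨p, hp, rfl⟩ := hk
        have := (hP p (mem_filter.1 hp).1).2
        exact mem_range.2 (Nat.lt_succ_of_le ((Nat.div_le_self _ _).trans this))
    _ ≤ _ := by
      gcongr
      rw [sum_range_succ']
      have h2 := harmonic_le_one_add_log Hn
      rw [harmonic] at h2
      push_cast at h2
      have h3 : ∑ k ∈ range Hn, g (k+1) = ∑ i ∈ range Hn, ((i:ℝ)+1)⁻¹ := by
        apply sum_congr rfl; intro i _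
        simp [hg]
      rw [h3]
      have : g 0 = 1 := by simp [hg]
      linarith

lemma muL_avg (P : Finset ℕ) (hP : ∀ p ∈ P, Nat.Prime p ∧ Odd p) (Hn : ℕ) (hPH : ∀ p ∈ P, p ≤ Hn) (a a0 : ℤ) (N n : ℕ) (hN : Hn ^ n ≤ N)
    (L : ℝ) (hL : L = ∑ p ∈ P, (1:ℝ)/p) :
    ∑ v ∈ Ico a0 (a0 + N), ∑ z ∈ WL P n, (if okw ∅ z then muL a z v else 0) ≤ 4 * N * (2 * L) ^ n := by
  rw [sum_comm]
  have e : (2 * L) ^ n = ∑ z ∈ WL P n, (z.map (fun p : ℕ => 2/(p:ℝ))).prod := by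
    rw [WL_prod, hL, mul_sum]
    congr 1; apply sum_congr rfl; intro p _; ring
  rw [e, mul_sum]
  apply sum_le_sum
  intro z hz
  rw [WL_mem] at hz
  by_cases hok : okw ∅ z
  · simp only [if_pos hok]
    have hp : z.prod ≤ N := by
      refine le_trans ?_ hN
      rw [← hz.1]
      exact List.prod_le_pow_card _ _ fun x hx => hPH x (hz.2 x hx)
    have key : ∀ ε, ∑ v ∈ Ico a0 (a0 + N), wp (prL ε 0 z) (cst v) ≤ 2 * N * (z.map (fun p : ℕ => 2/(p:ℝ))).prod := by
      intro ε
      have := wp_avg (prL ε 0 z) (by rw [prL_fst]; exact hok.1) (fun b hb => (hP b.1 (hz.2 _ (by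
        rw [← prL_fst ε 0 z]; exact List.mem_map_of_mem hb))).1) a0 N (by rw [prL_fst]; exact hp)
      have e : (prL ε 0 z).map (fun a => 2/(a.1:ℝ)) = z.map (fun p : ℕ => 2/(p:ℝ)) := by
        conv_rhs => rw [← prL_fst ε 0 z, List.map_map]
        rfl
      rwa [e] at this
    calc _ ≤ ∑ v ∈ Ico a0 (a0 + N), (wp (prL 1 0 z) (cst v) + wp (prL (-1) 0 z) (cst v)) :=
          sum_le_sum fun v _ => muL_le a z (fun p hp => (hP p (hz.2 p hp)).2) v
      _ ≤ _ := by
        rw [sum_add_distrib]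
        linarith [key 1, key (-1)]
  · simp only [if_neg hok, sum_const_zero]
    have : 0 ≤ (z.map (fun p : ℕ => 2/(p:ℝ))).prod := by
      apply List.prod_nonneg
      intro x hx
      simp only [List.mem_map] at hx
      obtain ⟨a, _, rfl⟩ := hx
      positivity
    positivity

/-- repeated-prime average -/
lemma rep_avg (P : Finset ℕ) (H0 : ℝ) (hH0 : 1 ≤ H0) (hP : ∀ p ∈ P, Nat.Prime p ∧ Odd p) (Hn : ℕ) (hPH : ∀ p ∈ P, H0 ≤ (p:ℝ) ∧ p ≤ Hn) (a a0 : ℤ) (N n : ℕ) (hN : Hn ^ (n+1) ≤ N)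
    (L : ℝ) (hL : L = ∑ p ∈ P, (1:ℝ)/p) :
    ∑ v ∈ Ico a0 (a0 + N), ∑ p ∈ P, ub p v * ∑ p' ∈ P, ∑ z ∈ WL P n, (if okw ∅ (p' :: z) ∧ p ∈ z then muL a (p' :: z) v else 0) ≤
      N * (2 * L) ^ n * (n * (8 * (2 + Real.log Hn + 2 * L) / H0)) := by
  have hL0 : 0 ≤ L := by rw [hL]; exact sum_nonneg fun _ _ => by positivity
  have hlog : 0 ≤ Real.log Hn := Real.log_natCast_nonneg _
  set K : ℝ := 8 * (2 + Real.log Hn + 2 * L) / H0 with hK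
  have hK0 : 0 ≤ K := by positivity
  have e : (2 * L) ^ n = ∑ z ∈ WL P n, (z.map (fun p : ℕ => 2/(p:ℝ))).prod := by
    rw [WL_prod, hL, mul_sum]
    congr 1; apply sum_congr rfl; intro p _; ring
  have hpos : ∀ z : List ℕ, 0 ≤ (z.map (fun p : ℕ => 2/(p:ℝ))).prod := by
    intro z
    apply List.prod_nonneg
    intro x hx
    simp only [List.mem_map] at hx
    obtain ⟨a, _, rfl⟩ := hx
    positivity
  have sw : ∑ v ∈ Ico a0 (a0 + N), ∑ p ∈ P, ub p v * ∑ p' ∈ P, ∑ z ∈ WL P n, (if okw ∅ (p' :: z) ∧ p ∈ z then muL a (p' :: z) v else 0)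
      = ∑ z ∈ WL P n, ∑ p ∈ P, ∑ p' ∈ P, ∑ v ∈ Ico a0 (a0 + N), ub p v * (if okw ∅ (p' :: z) ∧ p ∈ z then muL a (p' :: z) v else 0) := by
    simp_rw [mul_sum]
    rw [sum_comm, sum_comm' (s := WL P n) (t := fun _ => P) (t' := P) (s' := fun _ => WL P n) (by tauto)]
    apply sum_congr rfl; intro p _
    rw [sum_comm, sum_comm' (s := WL P n) (t := fun _ => P) (t' := P) (s' := fun _ => WL P n) (by tauto)]
    apply sum_congr rfl; intro p' _
    rw [sum_comm]
  rw [sw, e, mul_sum, sum_mul]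
  apply sum_le_sum
  intro z hz
  have hz' := hz
  rw [WL_mem] at hz
  have main : ∀ p ∈ P, p ∈ z → ∑ p' ∈ P, ∑ v ∈ Ico a0 (a0 + N), ub p v * (if okw ∅ (p' :: z) ∧ p ∈ z then muL a (p' :: z) v else 0)
      ≤ N * (z.map (fun p : ℕ => 2/(p:ℝ))).prod * K := by
    intro p hpP hpz
    have hpH := (hPH p hpP).1
    have hp0 : (0:ℝ) < p := by linarith
    obtain ⟨z1, z2, hzz⟩ := List.append_of_mem hpz
    set Q := (z.map (fun p : ℕ => 2/(p:ℝ))).prod with hQ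
    have hQ0 : 0 ≤ Q := hpos z
    set c : ℤ → ℤ := fun ε => ε * offL (-ε) 0 z1 with hc
    set ci : ℤ → ℕ → ℝ := fun ε p' => if (p:ℤ) ∣ (p':ℤ) + c ε then (1:ℝ)/p' else 0 with hci
    have one : ∀ ε : ℤ, ε * ε = 1 → ∀ p' ∈ P, okw ∅ (p' :: z) → 
        ∑ v ∈ Ico a0 (a0 + N), ub p v * wp (prL ε 0 (p' :: z)) (cst v) ≤ 2 * N * Q * (2 * ci ε p' + 4 / H0 * (1/(p':ℝ))) := by
      intro ε hε p' hp' hok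
      obtain ⟨l, hl⟩ := prL_append ε 0 (p' :: z1) p z2
      have hz3 : (p' :: z1) ++ p :: z2 = p' :: z := by rw [hzz]; rfl
      rw [hz3] at hl
      have hfst := prL_fst ε 0 (p' :: z)
      have hprod : (p' :: z).prod ≤ N := by
        refine le_trans ?_ hN
        rw [← hz.1]
        refine List.prod_le_pow_card (p' :: z) Hn fun x hx => ?_
        rw [List.mem_cons] at hx
        rcases hx with rfl | hx
        · exact (hPH _ hp').2
        · exact (hPH x (hz.2 x hx)).2
      rw [hl] at hfst
      have := wp_avg2 (prL ε 0 (p' :: z1)) l p (offL ε 0 (p' :: z1)) 0 (by rw [hfst]; exact hok.1) (fun b hb => (hP b.1 (by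
        have hb' : b.1 ∈ p' :: z := by rw [← hfst]; exact List.mem_map_of_mem hb
        rw [List.mem_cons] at hb'
        rcases hb' with h | h
        · rw [h]; exact hp'
        · exact hz.2 _ h)).1) a0 N (by rw [hfst]; exact hprod)
      have e2 : (prL ε 0 (p' :: z1) ++ (p, offL ε 0 (p' :: z1)) :: l).map (fun a => 2/(a.1:ℝ)) = (p' :: z).map (fun p : ℕ => 2/(p:ℝ)) := by
        conv_rhs => rw [← hfst, List.map_map]
        rfl
      rw [e2, List.map_cons, List.prod_cons, ← hQ] at this
      have e3 : ∀ v, ub p v = hit (cst v) p 0 + 1/(p:ℝ) := by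
        intro v; rw [hit_cst, add_zero]; rfl
      simp_rw [e3, hl]
      refine this.trans ?_
      have e4 : ((p:ℤ) ∣ offL ε 0 (p' :: z1) - 0) ↔ (p:ℤ) ∣ (p':ℤ) + c ε := by
        simp only [offL]
        rw [offL_shift, hc]
        have : 0 + ε * (p':ℤ) + offL (-ε) 0 z1 - 0 = ε * ((p':ℤ) + ε * offL (-ε) 0 z1) := by
          linear_combination (-offL (-ε) 0 z1) * hε
        rw [this]
        constructor
        · intro h
          have := Dvd.dvd.mul_left h ε
          rwa [← mul_assoc, hε, one_mul] at this
        · intro h; exact Dvd.dvd.mul_left h ε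
      have hp'0 : (0:ℝ) ≤ 1/(p':ℝ) := by positivity
      have h2p : 2/(p:ℝ) ≤ 2/H0 := by gcongr
      have e5 : ((if (p:ℤ) ∣ offL ε 0 (p' :: z1) - 0 then (1:ℝ) else 0) + 2/(p:ℝ)) * (2/(p':ℝ)) ≤ 2 * ci ε p' + 4/H0 * (1/(p':ℝ)) := by
        have : ci ε p' = (if (p:ℤ) ∣ offL ε 0 (p' :: z1) - 0 then (1:ℝ) else 0) * (1/(p':ℝ)) := by
          simp only [hci]
          by_cases h : (p:ℤ) ∣ (p':ℤ) + c ε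
          · rw [if_pos h, if_pos (e4.2 h), one_mul]
          · rw [if_neg h, if_neg (fun hh => h (e4.1 hh)), zero_mul]
        rw [this]
        have e6 : (2/(p':ℝ)) = 2 * (1/(p':ℝ)) := by ring
        rw [e6]
        have := mul_le_mul_of_nonneg_right h2p hp'0
        have e7 : 4/H0 = 2*(2/H0) := by ring
        rw [e7]
        nlinarith
      calc _ = 2 * N * Q * (((if (p:ℤ) ∣ offL ε 0 (p' :: z1) - 0 then (1:ℝ) else 0) + 2/(p:ℝ)) * (2/(p':ℝ))) := by ring
        _ ≤ _ := by gcongr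
    have hci0 : ∀ ε p', 0 ≤ ci ε p' := by intro ε p'; simp only [hci]; split_ifs <;> positivity
    have two : ∀ p' ∈ P, ∑ v ∈ Ico a0 (a0 + N), ub p v * (if okw ∅ (p' :: z) ∧ p ∈ z then muL a (p' :: z) v else 0) ≤
        2 * N * Q * (2 * ci 1 p' + 4 / H0 * (1/(p':ℝ))) + 2 * N * Q * (2 * ci (-1) p' + 4 / H0 * (1/(p':ℝ))) := by
      intro p' hp'
      by_cases hok : okw ∅ (p' :: z)
      · have hh : okw ∅ (p' :: z) ∧ p ∈ z := ⟨hok, hpz⟩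
        simp only [if_pos hh]
        refine le_trans ?_ (add_le_add (one 1 (by norm_num) p' hp' hok) (one (-1) (by norm_num) p' hp' hok))
        rw [← sum_add_distrib]
        apply sum_le_sum
        intro v _
        rw [← mul_add]
        apply mul_le_mul_of_nonneg_left _ (ub_nonneg _ _)
        apply muL_le
        intro x hx
        rw [List.mem_cons] at hx
        rcases hx with rfl | hx
        · exact (hP _ hp').2
        · exact (hP x (hz.2 x hx)).2
      · have hh : ¬ (okw ∅ (p' :: z) ∧ p ∈ z) := fun h => hok h.1
        simp only [if_neg hh, mul_zero, sum_const_zero]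
        have := hci0 1 p'
        have := hci0 (-1) p'
        positivity
    refine (sum_le_sum two).trans ?_
    rw [sum_add_distrib, ← mul_sum, ← mul_sum, sum_add_distrib, sum_add_distrib, ← mul_sum, ← mul_sum, ← mul_sum, ← hL]
    have h1 := ap_sum P H0 (by linarith) Hn hPH p hpH (c 1)
    have h2 := ap_sum P H0 (by linarith) Hn hPH p hpH (c (-1))
    have hNQ : 0 ≤ 2 * N * Q := by positivity
    have h3 : 2 * (∑ p' ∈ P, ci 1 p') + 4 / H0 * L + (2 * (∑ p' ∈ P, ci (-1) p') + 4 / H0 * L) ≤ K / 2 := by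
      have : K / 2 = 4 * ((2 + Real.log Hn) / H0) + 8 / H0 * L := by rw [hK]; ring
      rw [this]
      have e8 : 8/H0*L = 2*(4/H0*L) := by ring
      rw [e8]
      linarith
    calc _ = 2 * N * Q * (2 * (∑ p' ∈ P, ci 1 p') + 4 / H0 * L + (2 * (∑ p' ∈ P, ci (-1) p') + 4 / H0 * L)) := by ring
      _ ≤ 2 * N * Q * (K/2) := by gcongr
      _ = _ := by ring
  calc _ ≤ ∑ p ∈ P, if p ∈ z then N * (z.map (fun p : ℕ => 2/(p:ℝ))).prod * K else 0 := by
        apply sum_le_sum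
        intro p hp
        split_ifs with h
        · exact main p hp h
        · simp [h]
    _ = ((P.filter (fun p => p ∈ z)).card : ℝ) * (N * (z.map (fun p : ℕ => 2/(p:ℝ))).prod * K) := by
        rw [← sum_filter, sum_const, nsmul_eq_mul]
    _ ≤ n * (N * (z.map (fun p : ℕ => 2/(p:ℝ))).prod * K) := by
        have := hpos z
        gcongr
        calc (P.filter (fun p => p ∈ z)).card ≤ z.toFinset.card := card_le_card (fun x hx => by simpa using (mem_filter.1 hx).2)
          _ ≤ z.length := List.toFinset_card_le z
          _ = n := hz.1
    _ = _ := by ring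

abbrev WM (W : Finset ℤ) := Matrix {x // x ∈ W} {x // x ∈ W} ℝ

noncomputable def wtb (b : Bool) (p : ℕ) (n : ℤ) : ℝ := (if b = true then 0 else if (p:ℤ) ∣ n then 1 else 0) - 1/(p:ℝ)

noncomputable def Cm (W : Finset ℤ) (a : ℤ) (κ : ℤ → ℝ) (p : ℕ) : WM W := fun v x => if (x:ℤ) = nu a p v then κ v else 0

noncomputable def Sm (W : Finset ℤ) (a : ℤ) (b : Bool) (p : ℕ) : WM W := Cm W a (wtb b p) p

noncomputable def pw (W : Finset ℤ) (a : ℤ) (s : List Bool) (z : List ℕ) : WM W := (List.zipWith (Sm W a) s z).prod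

noncomputable def TT (W : Finset ℤ) (a : ℤ) (P : Finset ℕ) (s : List Bool) (Av : Finset ℕ) : WM W :=
  ∑ z ∈ WL P s.length, if okw Av z then pw W a s z else 0

def Dom {W : Finset ℤ} (M : WM W) (g : ℤ → ℝ) : Prop := ∀ v, ∑ x, |M v x| ≤ g v

lemma Dom_zero {W : Finset ℤ} (g : ℤ → ℝ) (hg : ∀ v, 0 ≤ g v) : Dom (0 : WM W) g := by
  intro v; simpa using hg v

lemma Dom_add {W : Finset ℤ} {M M' : WM W} {g g' : ℤ → ℝ} (h : Dom M g) (h' : Dom M' g') : Dom (M + M') (fun v => g v + g' v) := by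
  intro v
  refine le_trans ?_ (add_le_add (h v) (h' v))
  rw [← sum_add_distrib]
  exact sum_le_sum fun x _ => abs_add_le _ _

lemma Dom_neg {W : Finset ℤ} {M : WM W} {g : ℤ → ℝ} (h : Dom M g) : Dom (-M) g := by
  intro v; simpa using h v

lemma Dom_sub {W : Finset ℤ} {M M' : WM W} {g g' : ℤ → ℝ} (h : Dom M g) (h' : Dom M' g') : Dom (M - M') (fun v => g v + g' v) := by
  rw [sub_eq_add_neg]; exact Dom_add h (Dom_neg h')

lemma Dom_sum {W : Finset ℤ} {ι : Type*} (s : Finset ι) (M : ι → WM W) (g : ι → ℤ → ℝ) (h : ∀ i ∈ s, Dom (M i) (g i)) :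
    Dom (∑ i ∈ s, M i) (fun v => ∑ i ∈ s, g i v) := by
  induction s using Finset.induction_on with
  | empty => exact Dom_zero _ (by simp)
  | @insert i s hi ih =>
    simp only [sum_insert hi]
    exact Dom_add (h i (mem_insert_self _ _)) (ih fun j hj => h j (mem_insert_of_mem hj))

lemma Dom_mono {W : Finset ℤ} {M : WM W} {g g' : ℤ → ℝ} (h : Dom M g) (hg : ∀ v ∈ W, g v ≤ g' v) : Dom M g' :=
  fun v => (h v).trans (hg v v.2)

lemma Dom_ite {W : Finset ℤ} {M : WM W} {g : ℤ → ℝ} (c : Prop) [Decidable c] (h : c → Dom M g) : Dom (if c then M else 0) (fun v => if c then g v else 0) := by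
  by_cases hc : c
  · simp only [if_pos hc]; exact h hc
  · simp only [if_neg hc]; exact Dom_zero _ (by simp)

lemma Cm_mul_apply {W : Finset ℤ} (a : ℤ) (κ : ℤ → ℝ) (p : ℕ) (M : WM W) (v x : {x // x ∈ W}) :
    (Cm W a κ p * M) v x = if h : nu a p v ∈ W then κ v * M ⟨nu a p v, h⟩ x else 0 := by
  rw [Matrix.mul_apply]
  split_ifs with h
  · rw [sum_eq_single ⟨nu a p v, h⟩]
    · simp [Cm]
    · intro y _ hy
      have : ¬ (y:ℤ) = nu a p v := fun hh => hy (Subtype.ext hh)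
      simp [Cm, this]
    · simp
  · apply sum_eq_zero
    intro y _
    have : ¬ (y:ℤ) = nu a p v := fun hh => h (hh ▸ y.2)
    simp [Cm, this]

lemma Dom_Cm {W : Finset ℤ} (a : ℤ) (κ β : ℤ → ℝ) (p : ℕ) (hκ : ∀ v, |κ v| ≤ β v) {M : WM W} {g : ℤ → ℝ} (hM : Dom M g) (hg : ∀ v, 0 ≤ g v) :
    Dom (Cm W a κ p * M) (fun v => β v * g (nu a p v)) := by
  intro v
  have hb : 0 ≤ β v := (abs_nonneg _).trans (hκ v)
  simp_rw [Cm_mul_apply]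
  by_cases h : nu a p v ∈ W
  · simp only [dif_pos h, abs_mul]
    rw [← mul_sum]
    exact mul_le_mul (hκ v) (hM _) (sum_nonneg fun _ _ => abs_nonneg _) hb
  · simp only [dif_neg h, abs_zero, sum_const_zero]
    exact mul_nonneg hb (hg _)

lemma wtb_le (b p n) : |wtb b p n| ≤ ub p n := by
  unfold wtb ub
  have : (0:ℝ) ≤ 1/p := by positivity
  rw [abs_le]
  split_ifs <;> constructor <;> linarith

lemma wtb_le_one (b p n) : |wtb b p n| ≤ 1 := by
  unfold wtb
  have : (0:ℝ) ≤ 1/p := by positivity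
  have : (1:ℝ)/p ≤ 1 := by
    rcases Nat.eq_zero_or_pos p with rfl | h
    · simp
    · rw [div_le_one (by positivity)]; exact_mod_cast h
  rw [abs_le]
  split_ifs <;> constructor <;> linarith

lemma Dom_one {W : Finset ℤ} : Dom (1 : WM W) (fun _ => 1) := by
  intro v
  rw [sum_eq_single v]
  · simp
  · intro x _ hx; simp [Matrix.one_apply, Ne.symm hx]
  · simp

lemma pw_dom (W : Finset ℤ) (a : ℤ) (s : List Bool) (z : List ℕ) (h : z.length = s.length) : Dom (pw W a s z) (muL a z) := by
  induction s generalizing z with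
  | nil =>
    rw [List.length_eq_zero_iff.1 h]
    exact Dom_one
  | cons b s ih =>
    cases z with
    | nil => simp at h
    | cons p z =>
      have := ih z (by simpa using h)
      have h2 := Dom_Cm a (wtb b p) (ub p) p (wtb_le b p) this (muL_nonneg a z)
      exact h2

noncomputable def gT (a : ℤ) (P : Finset ℕ) (n : ℕ) (Av : Finset ℕ) (v : ℤ) : ℝ := ∑ z ∈ WL P n, if okw Av z then muL a z v else 0

noncomputable def gR (a : ℤ) (P : Finset ℕ) (n : ℕ) (p : ℕ) (v : ℤ) : ℝ := 
  ∑ p' ∈ P, ∑ z ∈ WL P n, (if okw ∅ (p' :: z) ∧ p ∈ z then muL a (p' :: z) v else 0)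

lemma gT_nonneg (a P n Av v) : 0 ≤ gT a P n Av v := sum_nonneg fun z _ => by
  split_ifs; exacts [muL_nonneg _ _ _, le_refl _]
lemma gR_nonneg (a P n p v) : 0 ≤ gR a P n p v := sum_nonneg fun z _ => sum_nonneg fun z _ => by
  split_ifs; exacts [muL_nonneg _ _ _, le_refl _]

lemma TT_dom (W : Finset ℤ) (a : ℤ) (P : Finset ℕ) (s : List Bool) (Av : Finset ℕ) : Dom (TT W a P s Av) (gT a P s.length Av) := by
  apply Dom_sum
  intro z hz
  exact Dom_ite _ fun _ => pw_dom W a s z ((WL_mem _ _ _).1 hz).1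

lemma TT_cons (W : Finset ℤ) (a : ℤ) (P : Finset ℕ) (b : Bool) (s : List Bool) (Av : Finset ℕ) : 
    TT W a P (b :: s) Av = ∑ p ∈ P \ Av, Sm W a b p * TT W a P s (insert p Av) := by
  unfold TT
  rw [List.length_cons, WL_rec]
  apply sum_congr rfl
  intro p _
  rw [mul_sum]
  apply sum_congr rfl
  intro z _
  rw [mul_ite, mul_zero]
  rfl

lemma TT_nil (W : Finset ℤ) (a : ℤ) (P : Finset ℕ) (Av : Finset ℕ) : TT W a P [] Av = 1 := by
  simp [TT, WL, okw, pw]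

noncomputable def Rm (W : Finset ℤ) (a : ℤ) (P : Finset ℕ) (b : Bool) (s : List Bool) (p : ℕ) : WM W :=
  ∑ p' ∈ P, ∑ z ∈ WL P s.length, (if okw ∅ (p' :: z) ∧ p ∈ z then pw W a (b :: s) (p' :: z) else 0)

lemma Rm_dom (W : Finset ℤ) (a : ℤ) (P : Finset ℕ) (b : Bool) (s : List Bool) (p : ℕ) : Dom (Rm W a P b s p) (gR a P s.length p) := by
  apply Dom_sum
  intro p' hp'
  apply Dom_sum
  intro z hz
  exact Dom_ite _ fun _ => pw_dom W a (b :: s) (p' :: z) (by simp [((WL_mem _ _ _).1 hz).1])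

lemma TT_dif (W : Finset ℤ) (a : ℤ) (P : Finset ℕ) (b : Bool) (s : List Bool) (p : ℕ) (hp : p ∈ P) :
    TT W a P (b :: s) ∅ = TT W a P (b :: s) {p} + Sm W a b p * TT W a P s {p} + Rm W a P b s p := by
  have h1 : TT W a P (b :: s) ∅ = ∑ p' ∈ P, ∑ z ∈ WL P s.length, if okw ∅ (p' :: z) then pw W a (b :: s) (p' :: z) else 0 := by
    unfold TT; rw [List.length_cons, WL_succ]
  have h2 : TT W a P (b :: s) {p} = ∑ p' ∈ P, ∑ z ∈ WL P s.length, if okw ∅ (p' :: z) ∧ p ≠ p' ∧ p ∉ z then pw W a (b :: s) (p' :: z) else 0 := by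
    unfold TT; rw [List.length_cons, WL_succ]
    apply sum_congr rfl; intro p' _; apply sum_congr rfl; intro z _
    apply if_congr _ rfl rfl
    unfold okw
    simp only [mem_singleton, notMem_empty, not_false_eq_true, implies_true, and_true, List.mem_cons]
    constructor
    · rintro ⟨h1, h2⟩
      exact ⟨h1, fun h => h2 p (Or.inl h) rfl, fun h => h2 p (Or.inr h) rfl⟩
    · rintro ⟨h1, h2, h3⟩
      refine ⟨h1, fun q hq hqp => ?_⟩
      subst hqp
      tauto
  have h3 : Sm W a b p * TT W a P s {p} = ∑ p' ∈ P, ∑ z ∈ WL P s.length, if okw ∅ (p' :: z) ∧ p = p' then pw W a (b :: s) (p' :: z) else 0 := by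
    rw [sum_eq_single_of_mem p hp]
    · unfold TT
      rw [mul_sum]
      apply sum_congr rfl; intro z _
      rw [mul_ite, mul_zero]
      apply if_congr _ rfl rfl
      unfold okw
      simp only [mem_singleton, notMem_empty, not_false_eq_true, implies_true, and_true, List.nodup_cons]
      constructor
      · rintro ⟨h1, h2⟩
        exact ⟨fun h => h2 p h rfl, h1⟩
      · rintro ⟨h1, h2⟩
        exact ⟨h2, fun q hq hqp => h1 (hqp ▸ hq)⟩
    · intro p' _ hpp
      apply sum_eq_zero; intro z _
      rw [if_neg (fun h => hpp h.2.symm)]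
  rw [h1, h2, h3, Rm, ← sum_add_distrib, ← sum_add_distrib]
  apply sum_congr rfl; intro p' _
  rw [← sum_add_distrib, ← sum_add_distrib]
  apply sum_congr rfl; intro z _
  by_cases h : okw ∅ (p' :: z)
  · by_cases h4 : p = p'
    · have : p ∉ z := by rw [h4]; exact (List.nodup_cons.1 h.1).1
      simp [h, this, h4]
      intro h5; exact absurd (h4 ▸ h5) this
    · by_cases h5 : p ∈ z <;> simp [h, h4, h5]
  · simp [h]

noncomputable def Am (W : Finset ℤ) (a : ℤ) (P : Finset ℕ) : WM W := ∑ p ∈ P, Sm W a false p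
noncomputable def Dg (W : Finset ℤ) (a : ℤ) (P : Finset ℕ) : WM W := ∑ p ∈ P, Sm W a false p * Sm W a false p

def mark : List Bool → List Bool
  | [] => []
  | _ :: l => true :: l

noncomputable def Tg (W : Finset ℤ) (a : ℤ) (P : Finset ℕ) : List Bool → WM W
  | [] => TT W a P [false] ∅
  | true :: s => TT W a P (false :: true :: s) ∅
  | false :: s => TT W a P (false :: false :: s) ∅ + (Dg W a P - 1) * TT W a P s ∅ + TT W a P (mark s) ∅

noncomputable def Er (W : Finset ℤ) (a : ℤ) (P : Finset ℕ) (s : List Bool) : WM W := Am W a P * TT W a P s ∅ - Tg W a P s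

lemma Am_mul (W : Finset ℤ) (a : ℤ) (P : Finset ℕ) (b : Bool) (s : List Bool) :
    Am W a P * TT W a P (b :: s) ∅ = TT W a P (false :: b :: s) ∅ + ∑ p ∈ P, Sm W a false p * (Sm W a b p * TT W a P s {p}) + 
      ∑ p ∈ P, Sm W a false p * Rm W a P b s p := by
  rw [Am, sum_mul, TT_cons W a P false, sdiff_empty, ← sum_add_distrib, ← sum_add_distrib]
  apply sum_congr rfl; intro p hp
  rw [TT_dif W a P b s p hp]
  simp only [insert_empty_eq]
  rw [mul_add, mul_add]

lemma Er_nil (W : Finset ℤ) (a : ℤ) (P : Finset ℕ) : Er W a P [] = 0 := by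
  simp [Er, Tg, TT_cons, TT_nil, Am]

lemma Er_true (W : Finset ℤ) (a : ℤ) (P : Finset ℕ) (s : List Bool) : Er W a P (true :: s) =
    ∑ p ∈ P, Sm W a false p * (Sm W a true p * TT W a P s {p}) + ∑ p ∈ P, Sm W a false p * Rm W a P true s p := by
  rw [Er, Am_mul, Tg]; abel

lemma Er_false_nil (W : Finset ℤ) (a : ℤ) (P : Finset ℕ) : Er W a P [false] = 0 := by
  rw [Er, Am_mul, Tg]
  simp [TT_nil, Rm, mark, WL, Dg]
  abel

lemma Er_false (W : Finset ℤ) (a : ℤ) (P : Finset ℕ) (c : Bool) (s : List Bool) : Er W a P (false :: c :: s) =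
    ∑ p ∈ P, (Sm W a c p - Sm W a true p - Sm W a false p * (Sm W a false p * Sm W a c p)) * TT W a P s {p}
    - ∑ p ∈ P, Sm W a false p * (Sm W a false p * Rm W a P c s p) + ∑ p ∈ P, Sm W a false p * Rm W a P false (c :: s) p := by
  rw [Er, Am_mul, Tg]
  have h1 : ∑ p ∈ P, Sm W a false p * (Sm W a false p * TT W a P (c :: s) {p}) = Dg W a P * TT W a P (c :: s) ∅ -
     ∑ p ∈ P, Sm W a false p * (Sm W a false p * Sm W a c p) * TT W a P s {p} - ∑ p ∈ P, Sm W a false p * (Sm W a false p * Rm W a P c s p) := by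
    rw [Dg, sum_mul, ← sum_sub_distrib, ← sum_sub_distrib]
    apply sum_congr rfl; intro p hp
    rw [TT_dif W a P c s p hp]
    noncomm_ring
  have h2 : ∀ b, TT W a P (b :: s) ∅ = ∑ p ∈ P, Sm W a b p * TT W a P s {p} := by
    intro b; rw [TT_cons, sdiff_empty]; simp
  have h3 : ∑ p ∈ P, (Sm W a c p - Sm W a true p - Sm W a false p * (Sm W a false p * Sm W a c p)) * TT W a P s {p} =
     TT W a P (c :: s) ∅ - TT W a P (true :: s) ∅ - ∑ p ∈ P, Sm W a false p * (Sm W a false p * Sm W a c p) * TT W a P s {p} := by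
    rw [h2, h2, ← sum_sub_distrib, ← sum_sub_distrib]
    apply sum_congr rfl; intro p hp
    rw [sub_mul, sub_mul]
  rw [h1, h3, sub_mul, one_mul, mark]
  abel

lemma nu_nu (a : ℤ) (p : ℕ) (hp : Odd p) (v : ℤ) : nu a p (nu a p v) = v := by
  have hp2 : (p:ℤ) % 2 = 1 := by exact_mod_cast Nat.odd_iff.1 hp
  unfold nu
  split_ifs with h1 h2 h2 <;> omega

lemma dvd_nu (a : ℤ) (p : ℕ) (v : ℤ) : (p:ℤ) ∣ nu a p v ↔ (p:ℤ) ∣ v := by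
  unfold nu
  split_ifs
  · exact dvd_add_self_right
  · exact dvd_sub_self_right

lemma ub_nu (a : ℤ) (p : ℕ) (v : ℤ) : ub p (nu a p v) = ub p v := by
  unfold ub
  congr 1
  exact if_congr (dvd_nu a p v) rfl rfl

lemma wtb_nu (a : ℤ) (b : Bool) (p : ℕ) (v : ℤ) : wtb b p (nu a p v) = wtb b p v := by
  unfold wtb
  congr 1
  exact if_congr Iff.rfl rfl (if_congr (dvd_nu a p v) rfl rfl)

lemma Sm_symm (W : Finset ℤ) (a : ℤ) (b : Bool) (p : ℕ) (hp : Odd p) (v x : {x // x ∈ W}) : Sm W a b p v x = Sm W a b p x v := by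
  unfold Sm Cm
  by_cases h : (x:ℤ) = nu a p v
  · have h2 : (v:ℤ) = nu a p x := by rw [h, nu_nu a p hp]
    rw [if_pos h, if_pos h2, h, wtb_nu]
  · have h2 : ¬ (v:ℤ) = nu a p x := fun hh => h (by rw [hh, nu_nu a p hp])
    rw [if_neg h, if_neg h2]

lemma Sm_sq (W : Finset ℤ) (a : ℤ) (p : ℕ) (hp : Odd p) (κ : ℤ → ℝ) (v x : {x // x ∈ W}) :
    (Sm W a false p * Cm W a κ p) v x = if v = x then (if nu a p v ∈ W then wtb false p v * κ (nu a p v) else 0) else 0 := by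
  rw [Sm, Cm_mul_apply]
  by_cases h : nu a p v ∈ W
  · rw [dif_pos h, if_pos h]
    simp only [Cm, nu_nu a p hp]
    by_cases hx : v = x
    · rw [if_pos hx, if_pos (by rw [hx])]
    · rw [if_neg hx, if_neg (fun hh => hx (Subtype.ext hh.symm)), mul_zero]
  · rw [dif_neg h, if_neg h]; simp

lemma Dg_apply (W : Finset ℤ) (a : ℤ) (P : Finset ℕ) (hP : ∀ p ∈ P, Odd p) (v x : {x // x ∈ W}) : 
    Dg W a P v x = if v = x then ∑ p ∈ P, (if nu a p v ∈ W then (wtb false p v)^2 else 0) else 0 := by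
  rw [Dg, Matrix.sum_apply]
  have : ∀ p ∈ P, (Sm W a false p * Sm W a false p) v x = if v = x then (if nu a p v ∈ W then (wtb false p v)^2 else 0) else 0 := by
    intro p hp
    conv_lhs => rw [show Sm W a false p * Sm W a false p = Sm W a false p * Cm W a (wtb false p) p from rfl]
    rw [Sm_sq W a p (hP p hp)]
    rw [wtb_nu, sq]
  rw [sum_congr rfl this]
  split_ifs <;> simp

lemma coefm (W : Finset ℤ) (a : ℤ) (p : ℕ) (hp : Odd p) (c : Bool) :
    Sm W a c p - Sm W a true p - Sm W a false p * (Sm W a false p * Sm W a c p) =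
      Cm W a (fun v => wtb c p v - wtb true p v - (wtb false p v)^2 * wtb c p v) p := by
  ext v x
  rw [Matrix.sub_apply, Matrix.sub_apply]
  have e : (Sm W a false p * (Sm W a false p * Sm W a c p)) v x = if (x:ℤ) = nu a p v then (wtb false p v)^2 * wtb c p v else 0 := by
    conv_lhs => rw [Sm, Cm_mul_apply]
    by_cases h : nu a p v ∈ W
    · rw [dif_pos h]
      have := Sm_sq W a p hp (wtb c p) ⟨nu a p v, h⟩ x
      rw [show Sm W a c p = Cm W a (wtb c p) p from rfl]
      rw [Sm] at this
      rw [this]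
      by_cases hx : (x:ℤ) = nu a p v
      · rw [if_pos hx, if_pos (Subtype.ext hx.symm)]
        simp only [nu_nu a p hp]
        rw [if_pos v.2, wtb_nu]; ring
      · rw [if_neg hx, if_neg (fun hh => hx (by rw [← hh])), mul_zero]
    · have hx : ¬ (x:ℤ) = nu a p v := fun hh => h (by rw [← hh]; exact x.2)
      rw [dif_neg h, if_neg hx]
  rw [e]
  simp only [Sm, Cm]
  split_ifs <;> simp

lemma coef_le (c : Bool) (p : ℕ) (H0 : ℝ) (hH0 : 1 ≤ H0) (hp : H0 ≤ p) (v : ℤ) :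
    |wtb c p v - wtb true p v - (wtb false p v)^2 * wtb c p v| ≤ 4 / H0 * ub p v := by
  have hp0 : (0:ℝ) < p := by linarith
  set t : ℝ := 1/p with ht
  have ht0 : 0 < t := by positivity
  have htH : t ≤ 1/H0 := by rw [ht]; gcongr
  have hH1 : 1/H0 ≤ 1 := by rw [div_le_one (by linarith)]; exact hH0
  have ht1 : t ≤ 1 := htH.trans hH1
  have e4 : 4/H0 = 4 * (1/H0) := by ring
  rw [e4]
  unfold wtb ub
  rw [← ht]
  have key1 : t * 4 ≤ 4 * (1/H0) := by linarith
  cases c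
  · by_cases h : (p:ℤ) ∣ v
    · simp only [h, if_true, Bool.false_eq_true, if_false]
      have e : (1 - t - (0 - t) - (1-t)^2*(1-t)) = t * (3 - 3*t + t^2) := by ring
      rw [e, abs_le]
      constructor
      · have : 0 ≤ t * (3 - 3*t + t^2) := mul_nonneg ht0.le (by nlinarith)
        have : 0 ≤ 4 * (1/H0) * (1+t) := by positivity
        linarith
      · have : t * (3 - 3*t + t^2) ≤ t * 4 := mul_le_mul_of_nonneg_left (by nlinarith) ht0.le
        nlinarith
    · simp only [h, Bool.false_eq_true, if_false, ite_true, ite_self]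
      have e : (0 - t - (0 - t) - (0-t)^2*(0-t)) = t * t^2 := by ring
      rw [e, abs_of_nonneg (by positivity)]
      have : t * t ≤ 1/H0 * 1 := mul_le_mul htH ht1 ht0.le (by linarith)
      nlinarith
  · simp only [if_true]
    by_cases h : (p:ℤ) ∣ v
    · simp only [h, if_true, Bool.false_eq_true, if_false]
      have e : (0 - t - (0 - t) - (1-t)^2*(0-t)) = t * (1-t)^2 := by ring
      rw [e, abs_of_nonneg (by positivity)]
      have : t * (1-t)^2 ≤ t * 1 := mul_le_mul_of_nonneg_left (by nlinarith) ht0.le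
      nlinarith
    · simp only [h, Bool.false_eq_true, if_false, ite_true, ite_self]
      have e : (0 - t - (0 - t) - (0-t)^2*(0-t)) = t * t^2 := by ring
      rw [e, abs_of_nonneg (by positivity)]
      have : t * t ≤ 1/H0 * 1 := mul_le_mul htH ht1 ht0.le (by linarith)
      nlinarith

noncomputable def gE (a : ℤ) (P : Finset ℕ) (H0 : ℝ) (n : ℕ) (v : ℤ) : ℝ :=
  4 / H0 * ∑ p ∈ P, ub p v * (gT a P n {p} v + gT a P n {p} (nu a p v)) +
  ∑ p ∈ P, ub p v * (gR a P n p v + gR a P n p (nu a p v) + gR a P (n+1) p (nu a p v))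

lemma wtb_true_le (p : ℕ) (H0 : ℝ) (hH0 : 1 ≤ H0) (hp : H0 ≤ p) (v : ℤ) : |wtb true p v| ≤ 4/H0 := by
  have hp0 : (0:ℝ) < p := by linarith
  simp only [wtb, if_true, zero_sub, abs_neg]
  rw [abs_of_nonneg (by positivity)]
  calc 1/(p:ℝ) ≤ 1/H0 := by gcongr
    _ ≤ 4/H0 := by gcongr; norm_num

lemma Er_dom (W : Finset ℤ) (a : ℤ) (P : Finset ℕ) (H0 : ℝ) (hH0 : 1 ≤ H0) (hP : ∀ p ∈ P, Odd p ∧ H0 ≤ (p:ℝ)) (s : List Bool) :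
    Er W a P s = 0 ∨ ∃ n, n + 1 ≤ s.length ∧ Dom (Er W a P s) (gE a P H0 n) := by
  match s with
  | [] => left; exact Er_nil W a P
  | [false] => left; exact Er_false_nil W a P
  | true :: s =>
    right
    refine ⟨s.length, by simp, ?_⟩
    rw [Er_true]
    have h1 := Dom_sum P (fun p => Sm W a false p * (Sm W a true p * TT W a P s {p})) (fun p v => ub p v * (4/H0 * gT a P s.length {p} v)) (by
      intro p hp
      have h1 := Dom_Cm a (wtb true p) (fun _ => 4/H0) p (wtb_true_le p H0 hH0 (hP p hp).2) (TT_dom W a P s {p}) (gT_nonneg a P _ _)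
      have h2 := Dom_Cm a (wtb false p) (ub p) p (wtb_le false p) h1 (fun v => mul_nonneg (by positivity) (gT_nonneg a P _ _ _))
      simp only [nu_nu a p (hP p hp).1] at h2
      exact h2)
    have h2 := Dom_sum P (fun p => Sm W a false p * Rm W a P true s p) (fun p v => ub p v * gR a P s.length p (nu a p v)) (by
      intro p hp
      exact Dom_Cm a (wtb false p) (ub p) p (wtb_le false p) (Rm_dom W a P true s p) (gR_nonneg a P _ _))
    refine Dom_mono (Dom_add h1 h2) ?_
    intro v _
    unfold gE
    rw [mul_sum]
    apply add_le_add <;> apply sum_le_sum <;> intro p _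
    · have := gT_nonneg a P s.length {p} (nu a p v)
      have := ub_nonneg p v
      have h5 : 0 ≤ 4/H0 * (ub p v * gT a P s.length {p} (nu a p v)) := by positivity
      linarith
    · have := gR_nonneg a P s.length p v
      have := gR_nonneg a P (s.length+1) p (nu a p v)
      exact mul_le_mul_of_nonneg_left (by linarith) (ub_nonneg p v)
  | false :: c :: s =>
    right
    refine ⟨s.length, by simp, ?_⟩
    rw [Er_false]
    have h1 := Dom_sum P (fun p => (Sm W a c p - Sm W a true p - Sm W a false p * (Sm W a false p * Sm W a c p)) * TT W a P s {p}) (fun p v => (4/H0 * ub p v) * gT a P s.length {p} (nu a p v)) (by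
      intro p hp
      rw [coefm W a p (hP p hp).1]
      exact Dom_Cm a _ (fun v => 4/H0 * ub p v) p (coef_le c p H0 hH0 (hP p hp).2) (TT_dom W a P s {p}) (gT_nonneg a P _ _))
    have h2 := Dom_sum P (fun p => Sm W a false p * (Sm W a false p * Rm W a P c s p)) (fun p v => ub p v * (1 * gR a P s.length p v)) (by
      intro p hp
      have h1 := Dom_Cm a (wtb false p) (fun _ => 1) p (wtb_le_one false p) (Rm_dom W a P c s p) (gR_nonneg a P _ _)
      have h2 := Dom_Cm a (wtb false p) (ub p) p (wtb_le false p) h1 (fun v => mul_nonneg (by positivity) (gR_nonneg a P _ _ _))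
      simp only [nu_nu a p (hP p hp).1] at h2
      exact h2)
    have h3 := Dom_sum P (fun p => Sm W a false p * Rm W a P false (c :: s) p) (fun p v => ub p v * gR a P (s.length+1) p (nu a p v)) (by
      intro p hp
      exact Dom_Cm a (wtb false p) (ub p) p (wtb_le false p) (Rm_dom W a P false (c :: s) p) (gR_nonneg a P _ _))
    refine Dom_mono (Dom_add (Dom_sub h1 h2) h3) ?_
    intro v _
    unfold gE
    rw [mul_sum, add_assoc, ← sum_add_distrib]
    apply add_le_add <;> apply sum_le_sum <;> intro p _
    · have := gT_nonneg a P s.length {p} v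
      have := ub_nonneg p v
      have h5 : 0 ≤ 4/H0 * (ub p v * gT a P s.length {p} v) := by positivity
      linarith
    · have := gR_nonneg a P s.length p (nu a p v)
      rw [one_mul, ← mul_add]
      exact mul_le_mul_of_nonneg_left (by linarith) (ub_nonneg p v)

lemma nu_box (a : ℤ) (p : ℕ) (N : ℕ) (hpN : p ≤ N) (hN : 1 ≤ N) (v : ℤ) (hv : v ∈ Icc (-(4*N:ℤ)) (4*N)) : 
    v ∈ Ico (-(5*N:ℤ)) (-(5*N:ℤ) + (11*N:ℕ)) ∧ nu a p v ∈ Ico (-(5*N:ℤ)) (-(5*N:ℤ) + (11*N:ℕ)) := by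
  simp only [mem_Icc, mem_Ico, nu] at *
  push_cast
  split_ifs <;> omega

lemma nu_shift (a : ℤ) (p : ℕ) (hp : Odd p) (N : ℕ) (hpN : p ≤ N) (hN : 1 ≤ N) (W : Finset ℤ) (hW : W ⊆ Icc (-(4*N:ℤ)) (4*N)) (F : ℤ → ℝ) (hF : ∀ v, 0 ≤ F v) :
    ∑ v ∈ W, F (nu a p v) ≤ ∑ v ∈ Ico (-(5*N:ℤ)) (-(5*N:ℤ) + (11*N:ℕ)), F v := by
  have hinj : Set.InjOn (nu a p) W := by
    intro x _ y _ h
    rw [← nu_nu a p hp x, h, nu_nu a p hp]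
  rw [← sum_image (f := F) hinj]
  apply sum_le_sum_of_subset_of_nonneg
  · intro u hu
    simp only [mem_image] at hu
    obtain ⟨v, hv, rfl⟩ := hu
    exact (nu_box a p N hpN hN v (hW hv)).2
  · intros; exact hF _

lemma gE_mass (W : Finset ℤ) (a : ℤ) (P : Finset ℕ) (H0 : ℝ) (hH0 : 1 ≤ H0) (Hn : ℕ) (hHn : 1 ≤ Hn) (hP : ∀ p ∈ P, Nat.Prime p ∧ Odd p ∧ H0 ≤ (p:ℝ) ∧ p ≤ Hn)
    (N : ℕ) (hN : 1 ≤ N) (hW : W ⊆ Icc (-(4*N:ℤ)) (4*N)) (n l : ℕ) (hnl : n + 1 ≤ l) (hHN : Hn ^ (l+1) ≤ N) (L : ℝ) (hL : L = ∑ p ∈ P, (1:ℝ)/p) (hL1 : 1 ≤ L) :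
    ∑ v ∈ W, gE a P H0 n v ≤ 900 * N * ((2 * L) ^ l * (l * ((2 + Real.log Hn + 2 * L) / H0))) := by
  have hNn : Hn ≤ N := le_trans (by calc Hn = Hn^1 := (pow_one _).symm
                                      _ ≤ Hn^(l+1) := Nat.pow_le_pow_right hHn (by omega)) hHN
  have hpN : ∀ p ∈ P, p ≤ N := fun p hp => (hP p hp).2.2.2.trans hNn
  have hlog : 0 ≤ Real.log Hn := Real.log_natCast_nonneg _
  set B := Ico (-(5*N:ℤ)) (-(5*N:ℤ) + (11*N:ℕ)) with hB
  have hsub : W ⊆ B := fun v hv => (nu_box a 0 N (by omega) hN v (hW hv)).1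
  -- T part
  have gTe : ∀ u, ∑ p ∈ P, ub p u * gT a P n {p} (nu a p u) = gT a P (n+1) ∅ u := by
    intro u
    rw [gT, WL_rec, sdiff_empty]
    apply sum_congr rfl; intro p _
    rw [gT, mul_sum]
    apply sum_congr rfl; intro z _
    simp only [insert_empty_eq, mul_ite, mul_zero]
    rfl
  have hT : ∑ v ∈ B, gT a P (n+1) ∅ v ≤ 4 * (11*N:ℕ) * (2*L)^(n+1) := by
    have := muL_avg P (fun p hp => ⟨(hP p hp).1, (hP p hp).2.1⟩) Hn (fun p hp => (hP p hp).2.2.2) a (-(5*N:ℤ)) (11*N) (n+1) (by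
      calc Hn^(n+1) ≤ Hn^(l+1) := Nat.pow_le_pow_right hHn (by omega)
        _ ≤ 11*N := by omega) L hL
    exact this
  have t1 : ∑ v ∈ W, ∑ p ∈ P, ub p v * gT a P n {p} v ≤ ∑ v ∈ B, gT a P (n+1) ∅ v := by
    rw [sum_comm]
    simp_rw [← gTe]
    rw [sum_comm (s := B)]
    apply sum_le_sum; intro p hp
    have := nu_shift a p (hP p hp).2.1 N (hpN p hp) hN W hW (fun u => ub p u * gT a P n {p} (nu a p u)) (fun u => mul_nonneg (ub_nonneg _ _) (gT_nonneg _ _ _ _ _))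
    simpa only [ub_nu, nu_nu a p (hP p hp).2.1] using this
  have t2 : ∑ v ∈ W, ∑ p ∈ P, ub p v * gT a P n {p} (nu a p v) ≤ ∑ v ∈ B, gT a P (n+1) ∅ v := by
    simp_rw [gTe]
    exact sum_le_sum_of_subset_of_nonneg hsub fun _ _ _ => gT_nonneg _ _ _ _ _
  have hR : ∀ k ≤ n+1, ∑ v ∈ B, ∑ p ∈ P, ub p v * gR a P k p v ≤ (11*N:ℕ) * (2*L)^k * (k * (8 * (2 + Real.log Hn + 2*L)/H0)) := by
    intro k hk
    exact rep_avg P H0 hH0 (fun p hp => ⟨(hP p hp).1, (hP p hp).2.1⟩) Hn (fun p hp => (hP p hp).2.2) a (-(5*N:ℤ)) (11*N) k (by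
      calc Hn^(k+1) ≤ Hn^(l+1) := Nat.pow_le_pow_right hHn (by omega)
        _ ≤ 11*N := by omega) L hL
  have r1 : ∀ k, ∑ v ∈ W, ∑ p ∈ P, ub p v * gR a P k p v ≤ ∑ v ∈ B, ∑ p ∈ P, ub p v * gR a P k p v := fun k =>
    sum_le_sum_of_subset_of_nonneg hsub fun _ _ _ => sum_nonneg fun _ _ => mul_nonneg (ub_nonneg _ _) (gR_nonneg _ _ _ _ _)
  have r2 : ∀ k, ∑ v ∈ W, ∑ p ∈ P, ub p v * gR a P k p (nu a p v) ≤ ∑ v ∈ B, ∑ p ∈ P, ub p v * gR a P k p v := by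
    intro k
    rw [sum_comm, sum_comm (s := B)]
    apply sum_le_sum; intro p hp
    have := nu_shift a p (hP p hp).2.1 N (hpN p hp) hN W hW (fun u => ub p u * gR a P k p u) (fun u => mul_nonneg (ub_nonneg _ _) (gR_nonneg _ _ _ _ _))
    simpa only [ub_nu] using this
  unfold gE
  rw [sum_add_distrib, ← mul_sum]
  simp_rw [mul_add, sum_add_distrib]
  set X := (2 + Real.log Hn + 2*L)/H0 with hX
  have hX0 : 0 ≤ X := by positivity
  have h8 : 8 * (2 + Real.log Hn + 2*L)/H0 = 8 * X := by rw [hX]; ring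
  rw [h8] at hR
  have hpl : ∀ k ≤ n+1, (2*L)^k ≤ (2*L)^l := fun k hk => pow_le_pow_right₀ (by linarith) (by omega)
  have hRl : ∀ k ≤ n+1, ∑ v ∈ B, ∑ p ∈ P, ub p v * gR a P k p v ≤ (11*N) * (2*L)^l * (l * (8 * X)) := by
    intro k hk
    refine (hR k hk).trans ?_
    push_cast
    have := hpl k hk
    have : (k:ℝ) ≤ l := by exact_mod_cast (by omega : k ≤ l)
    gcongr
  have hTl : ∑ v ∈ B, gT a P (n+1) ∅ v ≤ 44 * N * (2*L)^l := by
    refine hT.trans ?_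
    push_cast
    have := hpl (n+1) le_rfl
    have hh : (0:ℝ) ≤ 4 * (11 * N) := by positivity
    nlinarith
  have h4X : 4/H0 ≤ l * X * 2 := by
    have h1 : (1:ℝ) ≤ l := by exact_mod_cast (by omega : 1 ≤ l)
    have h2 : 2/H0 ≤ X := by rw [hX]; gcongr; linarith
    have h3 : 4/H0 = 2/H0*2 := by ring
    rw [h3]; nlinarith
  have hA : 4/H0 * (∑ v ∈ W, ∑ p ∈ P, ub p v * gT a P n {p} v + ∑ v ∈ W, ∑ p ∈ P, ub p v * gT a P n {p} (nu a p v)) ≤ (l*X*2) * (88 * N * (2*L)^l) := by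
    apply mul_le_mul h4X (by linarith) _ (by positivity)
    apply add_nonneg <;> exact sum_nonneg fun _ _ => sum_nonneg fun _ _ => mul_nonneg (ub_nonneg _ _) (gT_nonneg _ _ _ _ _)
  have hb1 := (r1 n).trans (hRl n (by omega))
  have hb2 := (r2 n).trans (hRl n (by omega))
  have hb3 := (r2 (n+1)).trans (hRl (n+1) (by omega))
  have hY : 0 ≤ (N:ℝ) * ((2*L)^l * (l*X)) := by positivity
  rw [mul_add] at hA
  linarith

def Sh : ℕ → List (List Bool)
  | 0 => [[]]
  | 1 => [[false]]
  | h+2 => (Sh (h+1)).map (List.cons false) ++ (Sh h).map mark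

lemma mark_len (s : List Bool) : (mark s).length = s.length ∧ (mark s).count true ≤ s.count true + 1 := by
  cases s with
  | nil => simp [mark]
  | cons b s => cases b <;> simp [mark]

lemma Sh_len (h : ℕ) : ∀ s ∈ Sh h, s.length + 2 * s.count true ≤ h := by
  induction h using Nat.strong_induction_on with
  | _ h ih =>
    match h with
    | 0 => simp [Sh]
    | 1 => simp [Sh]
    | h+2 =>
      intro s hs
      simp only [Sh, List.mem_append, List.mem_map] at hs
      rcases hs with ⟨t, ht, rfl⟩ | ⟨t, ht, rfl⟩
      · have := ih (h+1) (by omega) t ht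
        simp; omega
      · have := ih h (by omega) t ht
        have := mark_len t
        omega

lemma Sh_card (h : ℕ) : (Sh h).length ≤ 2^h := by
  induction h using Nat.strong_induction_on with
  | _ h ih =>
    match h with
    | 0 => simp [Sh]
    | 1 => simp [Sh]
    | h+2 =>
      have h1 := ih (h+1) (by omega)
      have h2 := ih h (by omega)
      simp only [Sh, List.length_append, List.length_map]
      rw [pow_succ] at *
      have : 2^h ≤ 2^h*2 := by omega
      omega

noncomputable def Yh (W : Finset ℤ) (a : ℤ) (P : Finset ℕ) (h : ℕ) : WM W := ((Sh h).map fun s => TT W a P s ∅).sum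
noncomputable def Eh (W : Finset ℤ) (a : ℤ) (P : Finset ℕ) (h : ℕ) : WM W := ((Sh h).map fun s => Er W a P s).sum

lemma Tg_mark (W : Finset ℤ) (a : ℤ) (P : Finset ℕ) (s : List Bool) : Tg W a P (mark s) = TT W a P (false :: mark s) ∅ := by
  cases s <;> rfl

lemma Tg_false_sum (W : Finset ℤ) (a : ℤ) (P : Finset ℕ) (S : List (List Bool)) : ((S.map (List.cons false)).map (Tg W a P)).sum =
    ((S.map (List.cons false)).map fun s => TT W a P (false :: s) ∅).sum + (Dg W a P - 1) * (S.map fun s => TT W a P s ∅).sum + ((S.map mark).map fun s => TT W a P s ∅).sum := by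
  induction S with
  | nil => simp
  | cons s S ih =>
    simp only [List.map_cons, List.sum_cons, ih, mul_add, Tg]
    abel

lemma Tg_sum (W : Finset ℤ) (a : ℤ) (P : Finset ℕ) (h : ℕ) : ((Sh (h+1)).map (Tg W a P)).sum = Yh W a P (h+2) + (Dg W a P - 1) * Yh W a P h := by
  have e2 : Yh W a P (h+2) = ((Sh (h+1)).map fun s => TT W a P (false :: s) ∅).sum + (((Sh h).map mark).map fun s => TT W a P s ∅).sum := by
    rw [Yh, Sh, List.map_append, List.sum_append, List.map_map]; rfl
  rw [e2]
  cases h with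
  | zero => simp [Sh, Yh, Tg, mark]; abel
  | succ h =>
    have e3 : Sh (h+2) = (Sh (h+1)).map (List.cons false) ++ (Sh h).map mark := rfl
    rw [show h+1+1 = h+2 from rfl, e3, List.map_append, List.sum_append, Tg_false_sum, List.map_append, List.sum_append]
    have e4 : ((Sh h).map mark).map (Tg W a P) = ((Sh h).map mark).map fun s => TT W a P (false :: s) ∅ := by
      rw [List.map_map, List.map_map]
      exact List.map_congr_left fun s _ => Tg_mark W a P s
    rw [e4, Yh]; abel

lemma Er_sum (W : Finset ℤ) (a : ℤ) (P : Finset ℕ) (S : List (List Bool)) :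
    Am W a P * (S.map fun s => TT W a P s ∅).sum = (S.map (Tg W a P)).sum + (S.map (Er W a P)).sum := by
  induction S with
  | nil => simp
  | cons s S ih => simp only [List.map_cons, List.sum_cons, mul_add, ih, Er]; abel

lemma Dom_Sm {W : Finset ℤ} {a : ℤ} {P : Finset ℕ} {Qr : ℝ} (hQ : ∀ v ∈ W, ∑ p ∈ P, ub p v ≤ Qr) (b : Bool) {P' : Finset ℕ} (hP' : P' ⊆ P) (M : ℕ → WM W) {c : ℝ} (hc : 0 ≤ c)
    (hM : ∀ p, Dom (M p) fun _ => c) : Dom (∑ p ∈ P', Sm W a b p * M p) fun _ => Qr * c := by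
  refine Dom_mono (Dom_sum P' _ (fun p v => ub p v * c) fun p _ => Dom_Cm a (wtb b p) (ub p) p (wtb_le b p) (hM p) fun _ => hc) ?_
  intro v hv
  rw [← sum_mul]
  exact mul_le_mul_of_nonneg_right ((sum_le_sum_of_subset_of_nonneg hP' fun p _ _ => ub_nonneg p v).trans (hQ v hv)) hc

lemma TT_domQ {W : Finset ℤ} {a : ℤ} {P : Finset ℕ} {Qr : ℝ} (h1 : 1 ≤ Qr) (hQ : ∀ v ∈ W, ∑ p ∈ P, ub p v ≤ Qr) (s : List Bool) (Av : Finset ℕ) :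
    Dom (TT W a P s Av) fun _ => Qr^s.length := by
  induction s generalizing Av with
  | nil => rw [TT_nil]; simpa using Dom_one
  | cons b s ih =>
    rw [TT_cons, List.length_cons, pow_succ']
    exact Dom_Sm hQ b sdiff_subset _ (by positivity) fun p => ih _

lemma Dom_Am {W : Finset ℤ} {a : ℤ} {P : Finset ℕ} {Qr : ℝ} (hQ : ∀ v ∈ W, ∑ p ∈ P, ub p v ≤ Qr) (M : WM W) {c : ℝ} (hc : 0 ≤ c)
    (hM : Dom M fun _ => c) : Dom (Am W a P * M) fun _ => Qr * c := by
  rw [Am, sum_mul]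
  exact Dom_Sm hQ false (Subset.refl _) _ hc fun _ => hM

lemma Dom_Dg {W : Finset ℤ} {a : ℤ} {P : Finset ℕ} {Qr : ℝ} (hQ : ∀ v ∈ W, ∑ p ∈ P, ub p v ≤ Qr) (M : WM W) {c : ℝ} (hc : 0 ≤ c)
    (hM : Dom M fun _ => c) : Dom (Dg W a P * M) fun _ => Qr * c := by
  rw [Dg, sum_mul]
  simp_rw [mul_assoc]
  refine Dom_Sm hQ false (Subset.refl _) _ hc fun p => ?_
  simpa [Sm] using Dom_Cm a (wtb false p) (fun _ => 1) p (wtb_le_one false p) hM fun _ => hc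

lemma Er_domQ {W : Finset ℤ} {a : ℤ} {P : Finset ℕ} {Qr : ℝ} (h1 : 1 ≤ Qr) (hQ : ∀ v ∈ W, ∑ p ∈ P, ub p v ≤ Qr) (s : List Bool) :
    Dom (Er W a P s) fun _ => 5 * Qr^(s.length+1) := by
  have hA := Dom_Am (a := a) hQ _ (by positivity) (TT_domQ (a := a) h1 hQ s ∅)
  have hT : Dom (Tg W a P s) fun _ => 4 * Qr^(s.length+1) := by
    match s with
    | [] => exact Dom_mono (TT_domQ h1 hQ [false] ∅) fun v _ => by simp; linarith
    | true :: s =>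
      refine Dom_mono (TT_domQ h1 hQ (false :: true :: s) ∅) fun v _ => ?_
      simp only [List.length_cons]; have : 0 ≤ Qr^(s.length+1+1) := by positivity
      linarith
    | false :: s =>
      have h5 := TT_domQ (a := a) h1 hQ s ∅
      have h3 := Dom_sub (Dom_Dg (a := a) hQ _ (by positivity) h5) h5
      have h4 := TT_domQ (a := a) h1 hQ (mark s) ∅
      rw [(mark_len s).1] at h4
      rw [Tg, sub_mul, one_mul]
      refine Dom_mono (Dom_add (Dom_add (TT_domQ h1 hQ (false :: false :: s) ∅) h3) h4) fun v _ => ?_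
      simp only [List.length_cons]
      have h6 : 0 ≤ Qr^s.length := by positivity
      have h7 : Qr^s.length ≤ Qr^(s.length+1+1) := pow_le_pow_right₀ h1 (by omega)
      have h8 : Qr * Qr^s.length ≤ Qr^(s.length+1+1) := by rw [← pow_succ']; exact pow_le_pow_right₀ h1 (by omega)
      linarith
  refine Dom_mono (Dom_sub hA hT) fun v _ => ?_
  rw [← pow_succ']; linarith

lemma Dom_list {W : Finset ℤ} {α : Type*} (S : List α) (M : α → WM W) (g : ℤ → ℝ) (h : ∀ s ∈ S, Dom (M s) g) : Dom (S.map M).sum fun v => S.length * g v := by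
  induction S with
  | nil => simpa using Dom_zero (W := W) (fun _ => 0) (by simp)
  | cons s S ih =>
    simp only [List.map_cons, List.sum_cons]
    refine Dom_mono (Dom_add (h s (by simp)) (ih fun t ht => h t (by simp [ht]))) fun v _ => ?_
    simp; linarith

lemma Eh_domQ {W : Finset ℤ} {a : ℤ} {P : Finset ℕ} {Qr : ℝ} (h1 : 1 ≤ Qr) (hQ : ∀ v ∈ W, ∑ p ∈ P, ub p v ≤ Qr) (l h : ℕ) (hl : h ≤ l) :
    Dom (Eh W a P h) fun _ => 2^l * (5 * Qr^(l+1)) := by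
  refine Dom_mono (Dom_list (Sh h) (Er W a P) (fun _ => 5 * Qr^(l+1)) fun s hs => Dom_mono (Er_domQ h1 hQ s) fun v _ => ?_) fun v _ => ?_
  · have := Sh_len h s hs
    exact mul_le_mul_of_nonneg_left (pow_le_pow_right₀ h1 (by omega)) (by norm_num)
  · refine mul_le_mul_of_nonneg_right ?_ (by positivity)
    calc ((Sh h).length:ℝ) ≤ ((2^h:ℕ):ℝ) := by exact_mod_cast Sh_card h
      _ = 2^h := by push_cast; rfl
      _ ≤ 2^l := pow_le_pow_right₀ (by norm_num) hl

lemma schur_col {W : Finset ℤ} (M : WM W) (R δ : ℝ) (hM : Dom M fun _ => R) (hR : 0 ≤ R) (f : {x // x ∈ W} → ℝ) (hf : ∑ i, f i^2 = 1) (hc : ∀ x, f x ≠ 0 → ∑ v, |M v x| ≤ δ) :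
    ∑ v, (∑ x, M v x * f x)^2 ≤ R * δ := by
  have h1 : ∀ v, (∑ x, M v x * f x)^2 ≤ R * ∑ x, |M v x| * f x^2 := by
    intro v
    calc (∑ x, M v x * f x)^2 ≤ (∑ x, |M v x|) * ∑ x, |M v x| * f x^2 := by
          apply sum_sq_le_sum_mul_sum_of_sq_le_mul
          · intro x _; positivity
          · intro x _; positivity
          · intro x _; rw [mul_pow, ← sq_abs (M v x)]; apply le_of_eq; ring
      _ ≤ _ := mul_le_mul_of_nonneg_right (hM v) (sum_nonneg fun x _ => by positivity)
  calc _ ≤ ∑ v, R * ∑ x, |M v x| * f x^2 := sum_le_sum fun v _ => h1 v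
    _ = R * ∑ x, (∑ v, |M v x|) * f x^2 := by rw [← mul_sum, sum_comm]; simp_rw [sum_mul]
    _ ≤ R * ∑ x, δ * f x^2 := by
        refine mul_le_mul_of_nonneg_left (sum_le_sum fun x _ => ?_) hR
        by_cases hx : f x = 0
        · simp [hx]
        · exact mul_le_mul_of_nonneg_right (hc x hx) (sq_nonneg _)
    _ = R * δ := by rw [← mul_sum, hf, mul_one]

lemma stepA (W : Finset ℤ) (a : ℤ) (P : Finset ℕ) (hP : ∀ p ∈ P, Odd p) (Qr : ℝ) (h1 : 1 ≤ Qr) (hQ : ∀ v ∈ W, ∑ p ∈ P, ub p v ≤ Qr) (l : ℕ) (hl : Even l) (δ : ℝ) (hδ : 0 ≤ δ)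
    (f : {x // x ∈ W} → ℝ) (hf : ∑ i, f i^2 = 1) (hc : ∀ x, f x ≠ 0 → ∀ h < l, ∑ v, |Eh W a P h v x| ≤ δ) :
    ((∑ i, f i * ∑ j, Am W a P i j * f j)/2)^l ≤ ∑ i, f i * ∑ j, Yh W a P l i j * f j + 2*(4*√Qr)^l + l * (6*Qr)^l * √(2^l * (5 * Qr^(l+1)) * δ) := by
  have hAm : Dom (Am W a P) fun _ => Qr := by simpa using Dom_Am (a := a) hQ 1 zero_le_one Dom_one
  have hy0 : ∀ i, ∑ j, Yh W a P 0 i j * f j = f i := by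
    intro i
    have : Yh W a P 0 = 1 := by simp [Yh, Sh, TT_nil]
    rw [this]
    exact congrFun (Matrix.one_mulVec f) i
  have mv : ∀ (M M' : WM W) i, ∑ j, M i j * ∑ k, M' j k * f k = ∑ k, (M * M') i k * f k := by
    intro M M' i
    have := congrFun (Matrix.mulVec_mulVec f M M') i
    simpa only [Matrix.mulVec, dotProduct] using this
  have ad : ∀ (M M' : WM W) i, ∑ k, (M + M') i k * f k = ∑ k, M i k * f k + ∑ k, M' i k * f k := by
    intro M M' i
    rw [← sum_add_distrib]; exact sum_congr rfl fun k _ => by rw [Matrix.add_apply]; ring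
  have hD : ∀ (M : WM W) i, ∑ k, ((Dg W a P - 1) * M) i k * f k = (Dg W a P i i - 1) * ∑ k, M i k * f k := by
    intro M i
    rw [← mv, sum_eq_single i]
    · rw [Matrix.sub_apply, Matrix.one_apply_eq]
    · intro j _ hj
      rw [Matrix.sub_apply, Dg_apply W a P hP, if_neg hj.symm, Matrix.one_apply_ne hj.symm]; simp
    · simp
  have key := ghost (Am W a P) (by
      intro i j
      simp only [Am, Matrix.sum_apply]
      exact sum_congr rfl fun p hp => Sm_symm W a false p (hP p hp) i j) Qr Qr (6*Qr) (√(2^l * (5 * Qr^(l+1)) * δ)) hAm h1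
    (fun v => Dg W a P v v - 1) (by
      intro v
      rw [Dg_apply W a P hP, if_pos rfl]
      have h0 : 0 ≤ ∑ p ∈ P, (if nu a p v ∈ W then (wtb false p v)^2 else 0) := sum_nonneg fun p _ => by positivity
      have h2 : ∑ p ∈ P, (if nu a p v ∈ W then (wtb false p v)^2 else 0) ≤ Qr := by
        refine le_trans (sum_le_sum fun p _ => ?_) (hQ v v.2)
        have h4 := wtb_le false p v
        have h5 := wtb_le_one false p v
        split_ifs
        · rw [← sq_abs]; nlinarith [abs_nonneg (wtb false p v)]
        · exact ub_nonneg p v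
      constructor <;> linarith) (by linarith) (by linarith) l hl (fun h i => ∑ j, Yh W a P h i j * f j) (fun h i => ∑ j, Eh W a P h i j * f j) (Real.sqrt_nonneg _)
    (by
      intro i
      rw [mv, ← ad]
      have : Am W a P * Yh W a P 0 = Yh W a P 1 + Eh W a P 0 := by
        rw [Yh, Er_sum]; simp [Sh, Tg, Yh, Eh]
      rw [this])
    (by
      intro h _ i
      rw [mv, ← hD, ← ad, ← ad, ← Tg_sum]
      have : Am W a P * Yh W a P (h+1) = ((Sh (h+1)).map (Tg W a P)).sum + Eh W a P (h+1) := Er_sum _ _ _ _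
      rw [this])
    (by
      intro h hh
      rw [Real.sq_sqrt (by positivity)]
      exact schur_col _ _ _ (Eh_domQ h1 hQ l h hh.le) (by positivity) f hf fun x hx => hc x hx h hh)
    (by simp only [hy0]; exact hf)
  simp only [hy0] at key
  exact key

def toF (m : ℕ) (z : List ℕ) : Fin m → ℕ := fun i => z.getD i.1 0

lemma sg_toF (m : ℕ) (p : ℕ) (z : List ℕ) (i : ℕ) : sg (toF (m+1) (p :: z)) (i+1) = p - sg (toF m z) i := by
  unfold sg toF
  rw [Fin.sum_univ_succ, sub_eq_add_neg, ← sum_neg_distrib]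
  simp only [Fin.val_zero, Nat.zero_lt_succ, if_true, pow_zero, one_mul, List.getD_cons_zero, Fin.val_succ, List.getD_cons_succ, add_lt_add_iff_right, pow_succ]
  congr 1
  apply sum_congr rfl; intro u _
  split_ifs <;> simp

lemma sg_zero' {m : ℕ} (z : Fin m → ℕ) : sg z 0 = 0 := by simp [sg]

lemma pw_entry (W : Finset ℤ) (a : ℤ) (m : ℕ) (s : List Bool) (z : List ℕ) (hs : s.length = m) (hz : z.length = m) (ho : ∀ p ∈ z, Odd p) (v x : {x // x ∈ W}) (ε : ℤ)
    (hε : ε = if (2:ℤ) ∣ v + a then 1 else -1) : pw W a s z v x =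
      if (∀ i ≤ m, (v:ℤ) + ε * sg (toF m z) i ∈ W) ∧ (x:ℤ) = v + ε * sg (toF m z) m then
        ∏ i : Fin m, wtb (s.getD i.1 false) (toF m z i) (v + ε * sg (toF m z) i.1) else 0 := by
  induction m generalizing s z v ε with
  | zero =>
    rw [List.length_eq_zero_iff] at hs hz
    subst hs hz
    simp only [pw, List.zipWith_nil_left, List.prod_nil, Matrix.one_apply]
    apply if_congr _ (by simp) rfl
    simp only [nonpos_iff_eq_zero, forall_eq, sg_zero', mul_zero, add_zero, Subtype.coe_prop, true_and]
    exact ⟨fun h => ⟨v.2, by rw [h]⟩, fun h => Subtype.ext h.2.symm⟩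
  | succ m ih =>
    match s, z, hs, hz with
    | b :: s, p :: z, hs, hz =>
    simp only [List.length_cons, add_left_inj] at hs hz
    have hp : (p:ℤ) % 2 = 1 := by exact_mod_cast Nat.odd_iff.1 (ho p (by simp))
    have hnu : nu a p v = v + ε * p := by rw [hε, nu]; split_ifs <;> ring
    have hpos : ∀ i, nu a p v + (-ε) * sg (toF m z) i = v + ε * sg (toF (m+1) (p :: z)) (i+1) := by
      intro i; rw [hnu, sg_toF]; ring
    have e1 : pw W a (b :: s) (p :: z) v x = if h : nu a p v ∈ W then wtb b p v * pw W a s z ⟨nu a p v, h⟩ x else 0 := Cm_mul_apply a _ p _ v x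
    have hall : (∀ i ≤ m+1, (v:ℤ) + ε * sg (toF (m+1) (p :: z)) i ∈ W) ↔ ∀ i ≤ m, nu a p v + (-ε) * sg (toF m z) i ∈ W := by
      simp only [hpos]
      constructor
      · intro h i hi; exact h (i+1) (by omega)
      · intro h i hi
        rcases i with _ | i
        · rw [sg_zero', mul_zero, add_zero]; exact v.2
        · exact h i (by omega)
    rw [e1]
    by_cases h : nu a p v ∈ W
    · rw [dif_pos h, ih s z hs hz (fun q hq => ho q (by simp [hq])) ⟨nu a p v, h⟩ (-ε) (by
        rw [hε]; simp only [nu]; split_ifs <;> omega)]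
      rw [mul_ite, mul_zero]
      apply if_congr (by rw [hall, ← hpos m]) _ rfl
      rw [Fin.prod_univ_succ]
      simp only [hpos]
      congr 1
      simp [toF, sg_zero']
    · rw [dif_neg h, if_neg]
      rintro ⟨h1, -⟩
      apply h
      have := hall.1 h1 0 (by omega)
      rwa [sg_zero', mul_zero, add_zero] at this

noncomputable def LB (P : Finset ℕ) (l : ℕ) : ℕ → Finset (List ℕ)
  | 0 => {[]}
  | k+1 => ((((WL P l).filter (okw ∅)) ×ˢ LB P l k)).image fun x => x.1 ++ x.2

lemma LB_succ {M : Type*} [AddCommMonoid M] (P : Finset ℕ) (l k : ℕ) (F : List ℕ → M) :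
    ∑ z ∈ LB P l (k+1), F z = ∑ x ∈ (WL P l).filter (okw ∅), ∑ y ∈ LB P l k, F (x ++ y) := by
  rw [LB, sum_image, sum_product]
  rintro ⟨x, y⟩ hx ⟨x', y'⟩ hx' h
  simp only [mem_coe, mem_product, mem_filter, WL_mem] at hx hx'
  obtain ⟨h1, h2⟩ := List.append_inj h (by rw [hx.1.1.1, hx'.1.1.1])
  simp only at h1 h2
  rw [h1, h2]

lemma LB_mem (P : Finset ℕ) (l k : ℕ) (z : List ℕ) (hz : z ∈ LB P l k) : z.length = k * l ∧ (∀ p ∈ z, p ∈ P) ∧ zBInj l (toF (k*l) z) := by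
  induction k generalizing z with
  | zero =>
    simp only [LB, mem_singleton] at hz; subst hz
    exact ⟨by simp, by simp, fun t => absurd t.2 (by simp)⟩
  | succ k ih =>
    simp only [LB, mem_image, mem_product, mem_filter, WL_mem] at hz
    obtain ⟨⟨x, y⟩, ⟨⟨⟨hx1, hx2⟩, hx3⟩, hy⟩, rfl⟩ := hz
    simp only at *
    obtain ⟨h1, h2, h3⟩ := ih y hy
    refine ⟨by rw [List.length_append, h1, hx1]; ring, ?_, ?_⟩
    · intro p hp
      rcases List.mem_append.1 hp with hp | hp
      exacts [hx2 p hp, h2 p hp]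
    · intro t t' htt hz
      have hl : 0 < l := by
        rcases Nat.eq_zero_or_pos l with h | h
        · have := t.2; simp [h] at this
        · exact h
      simp only [toF] at hz
      have ht : t.1 < k*l+l := by have := t.2; linarith
      have ht' : t'.1 < k*l+l := by have := t'.2; linarith
      by_cases hc : t.1 < l
      · have hc' : t'.1 < l := by rw [Nat.div_eq_of_lt hc] at htt; exact (Nat.div_eq_zero_iff_lt hl).1 htt.symm
        rw [List.getD_append _ _ _ _ (by omega), List.getD_append _ _ _ _ (by omega), List.getD_eq_getElem _ _ (by omega), List.getD_eq_getElem _ _ (by omega)] at hz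
        exact Fin.ext ((List.Nodup.getElem_inj_iff hx3.1).1 hz)
      · have hc' : ¬ t'.1 < l := fun h => hc (by rw [Nat.div_eq_of_lt h] at htt; exact (Nat.div_eq_zero_iff_lt hl).1 htt)
        rw [List.getD_append_right _ _ _ _ (by omega), List.getD_append_right _ _ _ _ (by omega), hx1] at hz
        have := h3 ⟨t.1 - l, by omega⟩ ⟨t'.1 - l, by omega⟩ (by
          have h5 := Nat.div_eq_sub_div hl (not_lt.1 hc)
          have h6 := Nat.div_eq_sub_div hl (not_lt.1 hc')
          simp only; omega) hz
        simp only [Fin.mk.injEq] at this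
        apply Fin.ext; omega

lemma TT_prod (W : Finset ℤ) (a : ℤ) (P : Finset ℕ) (l : ℕ) (S : List (List Bool)) (hS : ∀ s ∈ S, s.length = l) :
    (S.map fun s => TT W a P s ∅).prod = ∑ z ∈ LB P l S.length, pw W a S.flatten z := by
  induction S with
  | nil => simp [LB, pw]
  | cons s S ih =>
    rw [List.map_cons, List.prod_cons, ih fun t ht => hS t (by simp [ht]), List.length_cons, LB_succ, TT, hS s (by simp), ← sum_filter, sum_mul]
    apply sum_congr rfl; intro x hx
    rw [mul_sum]
    apply sum_congr rfl; intro y hy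
    rw [List.flatten_cons, pw, pw, pw, List.zipWith_append, List.prod_append]
    rw [hS s (by simp), ((WL_mem _ _ _).1 (mem_filter.1 hx).1).1]

lemma TT_transpose (W : Finset ℤ) (a : ℤ) (P : Finset ℕ) (hP : ∀ p ∈ P, Odd p) (s : List Bool) : (TT W a P s ∅).transpose = TT W a P s.reverse ∅ := by
  unfold TT
  rw [Matrix.transpose_sum, List.length_reverse]
  have key : ∀ z ∈ WL P s.length, ((if okw ∅ z then pw W a s z else 0 : WM W)).transpose = if okw ∅ z.reverse then pw W a s.reverse z.reverse else 0 := by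
    intro z hz
    rw [WL_mem] at hz
    have h1 : okw ∅ z.reverse ↔ okw ∅ z := by simp [okw]
    rw [h1]
    split_ifs
    · rw [pw, pw, Matrix.transpose_list_prod, ← List.map_reverse]
      rw [← List.reverse_zipWith hz.1.symm, List.map_reverse]
      congr 2
      rw [List.map_zipWith]
      apply List.ext_getElem
      · simp
      · intro i h2 h3
        simp only [List.getElem_zipWith]
        ext v x
        rw [Matrix.transpose_apply]
        exact Sm_symm W a _ _ (hP _ (hz.2 _ (List.getElem_mem _))) x v
    · simp
  rw [sum_congr rfl key]
  refine sum_nbij' List.reverse List.reverse ?_ ?_ ?_ ?_ ?_ <;> simp [WL_mem]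

noncomputable def om (P : Finset ℕ) (n : ℤ) : ℝ := ∑ p ∈ P, if (p:ℤ) ∣ n then 1 else 0

noncomputable abbrev Box (N : ℕ) : Finset ℤ := Icc (-(4*N:ℤ)) (4*N)

noncomputable def Wt (P : Finset ℕ) (M b N : ℕ) (τ : {x // x ∈ Box N} → Fin b) : Finset ℤ :=
  (univ.filter fun x : {x // x ∈ Box N} => om P x ≤ ((M + τ x : ℕ):ℝ)).image Subtype.val

lemma Wt_mem (P : Finset ℕ) (M b N : ℕ) (τ : {x // x ∈ Box N} → Fin b) (x : ℤ) : x ∈ Wt P M b N τ ↔ ∃ h : x ∈ Box N, om P x ≤ ((M + τ ⟨x, h⟩ : ℕ):ℝ) := by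
  simp only [Wt, mem_image, mem_filter, mem_univ, true_and, Subtype.exists, exists_and_right, exists_eq_right]

lemma avgW (P : Finset ℕ) (M b N : ℕ) (hb : 1 ≤ b) (D : Finset ℤ) (hD : D ⊆ Box N) :
    ∑ τ : {x // x ∈ Box N} → Fin b, (if ∀ x ∈ D, x ∈ Wt P M b N τ then (1:ℝ) else 0) = (b:ℝ)^(Box N).card * ∏ x ∈ D, th M b (om P x) := by
  have hb0 : (b:ℝ) ≠ 0 := by positivity
  have h1 : ∀ τ : {x // x ∈ Box N} → Fin b, (if ∀ x ∈ D, x ∈ Wt P M b N τ then (1:ℝ) else 0) =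
      ∏ x : {x // x ∈ Box N}, (if (x:ℤ) ∈ D then (if om P x ≤ ((M + τ x : ℕ):ℝ) then (1:ℝ) else 0) else 1) := by
    intro τ
    split_ifs with h
    · symm; apply prod_eq_one; intro x _
      split_ifs with h1 h2
      · rfl
      · exact absurd ((Wt_mem _ _ _ _ _ _).1 (h x h1)).2 h2
      · rfl
    · push Not at h
      obtain ⟨x, hx, hxW⟩ := h
      symm; apply prod_eq_zero (mem_univ ⟨x, hD hx⟩)
      rw [if_pos hx, if_neg]
      exact fun hh => hxW ((Wt_mem _ _ _ _ _ _).2 ⟨hD hx, hh⟩)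
  have h2 : ∀ y : ℝ, ∑ t : Fin b, (if y ≤ ((M + t : ℕ):ℝ) then (1:ℝ) else 0) = b * th M b y := by
    intro y
    rw [th, mul_div_cancel₀ _ hb0, card_filter, Nat.cast_sum, sum_Ico_eq_sum_range, Nat.add_sub_cancel_left,
      Fin.sum_univ_eq_sum_range (fun t => if y ≤ ((M + t : ℕ):ℝ) then (1:ℝ) else 0)]
    apply sum_congr rfl; intro t _
    split_ifs <;> simp
  rw [sum_congr rfl fun τ _ => h1 τ]
  have h3 := Finset.prod_univ_sum (fun _ : {x // x ∈ Box N} => (univ : Finset (Fin b))) (fun x t => (if (x:ℤ) ∈ D then (if om P x ≤ ((M + t : ℕ):ℝ) then (1:ℝ) else 0) else 1))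
  rw [Fintype.piFinset_univ] at h3
  rw [← h3]
  have h4 : ∀ x : {x // x ∈ Box N}, ∑ t : Fin b, (if (x:ℤ) ∈ D then (if om P x ≤ ((M + t : ℕ):ℝ) then (1:ℝ) else 0) else 1) = b * (if (x:ℤ) ∈ D then th M b (om P x) else 1) := by
    intro x
    by_cases h : (x:ℤ) ∈ D
    · simp only [if_pos h]; exact h2 _
    · simp [if_neg h]
  rw [prod_congr rfl fun x _ => h4 x, prod_mul_distrib, prod_const, card_univ, Fintype.card_coe]
  congr 1
  rw [prod_coe_sort (Box N) (fun x => if x ∈ D then th M b (om P x) else 1), ← prod_filter]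
  congr 1
  ext x; simp only [mem_filter]; exact ⟨fun h => h.2, fun h => ⟨hD h, h⟩⟩

noncomputable def dgn {W : Finset ℤ} (M : WM W) (n : ℤ) : ℝ := if h : n ∈ W then M ⟨n,h⟩ ⟨n,h⟩ else 0

noncomputable def Cf (m : ℕ) (s : List Bool) : Finset (Fin m) := univ.filter fun i => s.getD i.1 false = false

lemma pw_avg (P : Finset ℕ) (M b N : ℕ) (hb : 1 ≤ b) (a : ℤ) (m : ℕ) (s : List Bool) (z : List ℕ) (hs : s.length = m) (hz : z.length = m) (ho : ∀ p ∈ z, Odd p)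
    (Hn : ℕ) (hH : ∀ i, toF m z i ≤ Hn) (hHN : m * Hn ≤ N) (n : ℤ) (hn : n ∈ Ioc (N:ℤ) (2*N)) :
    ∑ τ : {x // x ∈ Box N} → Fin b, dgn (pw (Wt P M b N τ) a s z) n = (b:ℝ)^(Box N).card *
      ((if sg (toF m z) m = 0 then ∏ i ∈ (Cf m s)ᶜ, (-(1/(toF m z i:ℝ))) else 0) *
        (Gw P (Cf m s) (toF m z) 1 a (th M b) (cst n) + Gw P (Cf m s) (toF m z) (-1) (a+1) (th M b) (cst n))) := by
  set ζ := toF m z with hζ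
  set ε : ℤ := if (2:ℤ) ∣ n + a then 1 else -1 with hε
  have hε1 : |ε| = 1 ∧ ε ≠ 0 := by rw [hε]; split_ifs <;> simp
  have hbox : ∀ i, n + ε * sg ζ i ∈ Box N := by
    intro i
    have h1 := sg_abs ζ 0 i (by omega) Hn hH
    rw [sg_zero', sub_zero] at h1
    have h2 : |ε * sg ζ i| ≤ N := by rw [abs_mul, hε1.1, one_mul]; exact h1.trans (by exact_mod_cast hHN)
    rw [abs_le] at h2
    rw [mem_Ioc] at hn
    rw [mem_Icc]; constructor <;> linarith
  have h1 : ∀ τ : {x // x ∈ Box N} → Fin b, dgn (pw (Wt P M b N τ) a s z) n = (if ∀ x ∈ (Dz ε ζ).image (n + ·), x ∈ Wt P M b N τ then (1:ℝ) else 0) *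
      (if sg ζ m = 0 then ∏ i : Fin m, wtb (s.getD i.1 false) (ζ i) (n + ε * sg ζ i.1) else 0) := by
    intro τ
    have hiff : (∀ x ∈ (Dz ε ζ).image (n + ·), x ∈ Wt P M b N τ) ↔ ∀ i ≤ m, n + ε * sg ζ i ∈ Wt P M b N τ := by
      simp only [Dz, image_image, forall_mem_image, mem_range, Nat.lt_succ_iff]; rfl
    rw [dgn]
    by_cases hW : n ∈ Wt P M b N τ
    · rw [dif_pos hW, pw_entry _ a m s z hs hz ho ⟨n, hW⟩ ⟨n, hW⟩ ε hε]
      simp only [left_eq_add, mul_eq_zero, hε1.2, false_or]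
      by_cases h2 : ∀ i ≤ m, n + ε * sg ζ i ∈ Wt P M b N τ
      · rw [if_pos (hiff.2 h2), one_mul]
        apply if_congr _ rfl rfl
        exact ⟨fun h => h.2, fun h => ⟨h2, h⟩⟩
      · rw [if_neg (fun h => h2 h.1), if_neg (fun h => h2 (hiff.1 h)), zero_mul]
    · rw [dif_neg hW, if_neg, zero_mul]
      intro h
      have := hiff.1 h 0 (by omega)
      rw [sg_zero', mul_zero, add_zero] at this
      exact hW this
  rw [sum_congr rfl fun τ _ => h1 τ, ← sum_mul, avgW P M b N hb _ (by
    intro x hx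
    simp only [Dz, mem_image, exists_exists_and_eq_and] at hx
    obtain ⟨i, -, rfl⟩ := hx
    exact hbox i)]
  rw [prod_image (by intro x _ y _ h; simpa using h), mul_assoc]
  congr 1
  have hG : Gw P (Cf m s) ζ 1 a (th M b) (cst n) + Gw P (Cf m s) ζ (-1) (a+1) (th M b) (cst n) =
      (∏ i ∈ Cf m s, (hit (cst n) (ζ i) (ε * sg ζ i.1) - 1/(ζ i:ℝ))) * ∏ x ∈ Dz ε ζ, th M b (∑ p ∈ P, hit (cst n) p x) := by
    unfold Gw
    rw [hit_cst, hit_cst]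
    by_cases h : (2:ℤ) ∣ n + a
    · have h' : ¬ (2:ℤ) ∣ n + (a+1) := by omega
      rw [hε, if_pos h]
      simp [h, h']
    · have h' : (2:ℤ) ∣ n + (a+1) := by omega
      rw [hε, if_neg h]
      simp [h, h']
  rw [hG]
  have hp : ∏ i : Fin m, wtb (s.getD i.1 false) (ζ i) (n + ε * sg ζ i.1) = (∏ i ∈ Cf m s, (hit (cst n) (ζ i) (ε * sg ζ i.1) - 1/(ζ i:ℝ))) * ∏ i ∈ (Cf m s)ᶜ, (-(1/(ζ i:ℝ))) := by
    rw [← prod_mul_prod_compl (Cf m s)]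
    congr 1
    · apply prod_congr rfl; intro i hi
      have hi := (mem_filter.1 hi).2
      rw [hit_cst, wtb, hi]; simp
    · apply prod_congr rfl; intro i hi
      have hi : s.getD i.1 false = true := by simpa [Cf] using hi
      rw [wtb, hi]; simp
  have hth : ∏ x ∈ Dz ε ζ, th M b (om P (n + x)) = ∏ x ∈ Dz ε ζ, th M b (∑ p ∈ P, hit (cst n) p x) := by
    apply prod_congr rfl; intro x _
    rw [om, sum_congr rfl fun p _ => hit_cst n p x]
  rw [hth, hp]
  split_ifs <;> ring

lemma dgn_sum {W : Finset ℤ} {ι : Type*} (S : Finset ι) (M : ι → WM W) (n : ℤ) : dgn (∑ z ∈ S, M z) n = ∑ z ∈ S, dgn (M z) n := by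
  unfold dgn
  split_ifs with h
  · rw [Matrix.sum_apply]
  · simp

noncomputable def Bt (W : Finset ℤ) (a : ℤ) (P : Finset ℕ) (s : List Bool) : WM W := TT W a P s ∅ * (TT W a P s ∅).transpose

def fl (s : List Bool) (J : ℕ) : List (List Bool) := (List.replicate J [s, s.reverse]).flatten

lemma Bt_pow (W : Finset ℤ) (a : ℤ) (P : Finset ℕ) (hP : ∀ p ∈ P, Odd p) (s : List Bool) (J : ℕ) :
    (Bt W a P s)^J = ((fl s J).map fun s => TT W a P s ∅).prod := by
  rw [Bt, TT_transpose W a P hP, fl]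
  induction J with
  | zero => simp
  | succ J ih =>
    rw [List.replicate_succ, List.flatten_cons, List.map_append, List.prod_append, pow_succ', ih, List.map_cons, List.map_cons, List.prod_cons, List.prod_cons, List.map_nil,
      List.prod_nil, mul_one]

lemma fl_len (s : List Bool) (J : ℕ) : (fl s J).length = 2*J ∧ (∀ t ∈ fl s J, t.length = s.length) ∧ (fl s J).flatten.length = 2*J*s.length ∧ (fl s J).flatten.count true = 2*J*s.count true := by
  unfold fl
  induction J with
  | zero => simp
  | succ J ih =>
    obtain ⟨h1, h2, h3, h4⟩ := ih
    simp only [List.replicate_succ, List.flatten_cons, List.cons_append, List.nil_append, List.length_cons, List.length_append, List.length_reverse, List.count_append,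
      List.count_reverse, h1, h3, h4, List.mem_cons, forall_eq_or_imp, true_and]
    refine ⟨by ring, h2, by ring, by ring⟩

lemma Cf_card (m : ℕ) (s : List Bool) (hs : s.length = m) : ((Cf m s)ᶜ).card = s.count true := by
  have h : ((Cf m s)ᶜ).card = ∑ i : Fin m, if s.getD i.1 false = true then 1 else 0 := by
    rw [← card_filter]; congr 1; ext i; simp [Cf]
  rw [h]
  clear h
  induction s generalizing m with
  | nil => subst hs; simp
  | cons b s ih =>
    subst hs
    rw [List.length_cons, Fin.sum_univ_succ]
    simp only [Fin.val_zero, List.getD_cons_zero, Fin.val_succ, List.getD_cons_succ]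
    rw [ih s.length rfl]
    cases b <;> simp [add_comm]

lemma trace_avg (P : Finset ℕ) (hP : ∀ p ∈ P, Odd p) (M b N : ℕ) (hb : 1 ≤ b) (a : ℤ) (s : List Bool) (J m : ℕ) (hm : m = 2*J*s.length)
    (Hn : ℕ) (hH : ∀ p ∈ P, p ≤ Hn) (hHN : m * Hn ≤ N) (Bd : ℝ) (hws : ∀ ε a' : ℤ, ε * ε = 1 →
      ∑ z ∈ (Fintype.piFinset (fun _ : Fin m => P)).filter (fun z => zBInj s.length z),
      |∑ n ∈ Ico ((N:ℤ)+1) ((N:ℤ)+1+N), Gw P (Cf m (fl s J).flatten) z ε a' (th M b) (cst n)| * ∏ i ∈ (Cf m (fl s J).flatten)ᶜ, 1/(z i:ℝ) ≤ Bd) :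
    ∑ τ : {x // x ∈ Box N} → Fin b, ∑ n ∈ Ioc (N:ℤ) (2*N), dgn ((Bt (Wt P M b N τ) a P s)^J) n ≤ (b:ℝ)^(Box N).card * (2 * Bd) := by
  obtain ⟨h1, h2, h3, h4⟩ := fl_len s J
  rw [← hm] at h3
  set F := (fl s J).flatten with hF
  have hlb : ∀ z ∈ LB P s.length (2*J), z.length = m ∧ (∀ p ∈ z, p ∈ P) ∧ zBInj s.length (toF m z) := by
    intro z hz; rw [hm]; exact LB_mem P _ _ z hz
  have htm : ∀ z ∈ LB P s.length (2*J), ∀ i, toF m z i ∈ P := by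
    intro z hz i
    rw [toF, List.getD_eq_getElem _ _ (by rw [(hlb z hz).1]; exact i.2)]
    exact (hlb z hz).2.1 _ (List.getElem_mem _)
  have e1 : ∑ τ : {x // x ∈ Box N} → Fin b, ∑ n ∈ Ioc (N:ℤ) (2*N), dgn ((Bt (Wt P M b N τ) a P s)^J) n =
      ∑ z ∈ LB P s.length (2*J), ∑ n ∈ Ioc (N:ℤ) (2*N), ∑ τ : {x // x ∈ Box N} → Fin b, dgn (pw (Wt P M b N τ) a F z) n := by
    have e2 : ∀ τ : {x // x ∈ Box N} → Fin b, ∀ n, dgn ((Bt (Wt P M b N τ) a P s)^J) n = ∑ z ∈ LB P s.length (2*J), dgn (pw (Wt P M b N τ) a F z) n := by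
      intro τ n
      rw [Bt_pow _ a P hP, TT_prod _ a P s.length _ h2, h1, dgn_sum]
    simp_rw [e2]
    rw [sum_comm]
    rw [sum_comm (s := LB P s.length (2*J))]
    exact sum_congr rfl fun n _ => sum_comm
  set G : ℤ → ℤ → (Fin m → ℕ) → ℝ := fun ε a' z => |∑ n ∈ Ico ((N:ℤ)+1) ((N:ℤ)+1+N), Gw P (Cf m F) z ε a' (th M b) (cst n)| * ∏ i ∈ (Cf m F)ᶜ, 1/(z i:ℝ) with hG
  have hIoc : Ico ((N:ℤ)+1) ((N:ℤ)+1+N) = Ioc (N:ℤ) (2*N) := by ext x; simp only [mem_Ico, mem_Ioc]; omega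
  have hz : ∀ z ∈ LB P s.length (2*J), ∑ n ∈ Ioc (N:ℤ) (2*N), ∑ τ : {x // x ∈ Box N} → Fin b, dgn (pw (Wt P M b N τ) a F z) n ≤
      (b:ℝ)^(Box N).card * (G 1 a (toF m z) + G (-1) (a+1) (toF m z)) := by
    intro z hz
    obtain ⟨hz1, hz2, hz3⟩ := hlb z hz
    rw [sum_congr rfl fun n hn => pw_avg P M b N hb a m F z h3 hz1 (fun p hp => hP p (hz2 p hp)) Hn (fun i => hH _ (htm z hz i)) hHN n hn]
    rw [← mul_sum, ← mul_sum, sum_add_distrib]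
    refine mul_le_mul_of_nonneg_left ?_ (by positivity)
    simp only [hG, hIoc]
    set A1 := ∑ n ∈ Ioc (N:ℤ) (2*N), Gw P (Cf m F) (toF m z) 1 a (th M b) (cst n)
    set A2 := ∑ n ∈ Ioc (N:ℤ) (2*N), Gw P (Cf m F) (toF m z) (-1) (a+1) (th M b) (cst n)
    have hpi : |if sg (toF m z) m = 0 then ∏ i ∈ (Cf m F)ᶜ, (-(1/(toF m z i:ℝ))) else 0| ≤ ∏ i ∈ (Cf m F)ᶜ, 1/(toF m z i:ℝ) := by
      split_ifs
      · rw [abs_prod]; apply le_of_eq; apply prod_congr rfl; intro i _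
        rw [abs_neg, abs_of_nonneg (by positivity)]
      · rw [abs_zero]; exact prod_nonneg fun i _ => by positivity
    rw [← add_mul, mul_comm]
    refine (le_abs_self _).trans ?_
    rw [abs_mul]
    exact mul_le_mul (abs_add_le _ _) hpi (abs_nonneg _) (by positivity)
  rw [e1]
  refine (sum_le_sum hz).trans ?_
  rw [← mul_sum]
  refine mul_le_mul_of_nonneg_left ?_ (by positivity)
  have hGn : ∀ ε a' z, 0 ≤ G ε a' z := fun ε a' z => mul_nonneg (abs_nonneg _) (prod_nonneg fun i _ => by positivity)
  have hsum : ∀ ε a' : ℤ, ε * ε = 1 → ∑ z ∈ LB P s.length (2*J), G ε a' (toF m z) ≤ Bd := by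
    intro ε a' hε
    refine le_trans ?_ (hws ε a' hε)
    have hinj : Set.InjOn (toF m) (LB P s.length (2*J) : Set (List ℕ)) := by
      intro z hz z' hz' h
      have l1 := (hlb z hz).1
      have l2 := (hlb z' hz').1
      apply List.ext_getElem (by rw [l1, l2])
      intro i hi hi'
      have := congrFun h ⟨i, by omega⟩
      simp only [toF] at this
      rwa [List.getD_eq_getElem _ _ hi, List.getD_eq_getElem _ _ hi'] at this
    rw [← sum_image (f := fun z => G ε a' z) hinj]
    apply sum_le_sum_of_subset_of_nonneg
    · intro ζ hζ
      obtain ⟨z, hz, rfl⟩ := mem_image.1 hζ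
      rw [mem_filter, Fintype.mem_piFinset]
      exact ⟨htm z hz, (hlb z hz).2.2⟩
    · intro z _ _; exact hGn _ _ _
  rw [sum_add_distrib]
  linarith [hsum 1 a (by norm_num), hsum (-1) (a+1) (by norm_num)]

section
variable {ι : Type*} [Fintype ι]

noncomputable def qf (A : Matrix ι ι ℝ) (f : ι → ℝ) : ℝ := ∑ i, f i * ∑ j, A i j * f j

lemma qf_smul (A : Matrix ι ι ℝ) (f : ι → ℝ) (c : ℝ) : qf A (fun i => c * f i) = c^2 * qf A f := by
  simp only [qf, mul_sum]
  exact sum_congr rfl fun i _ => sum_congr rfl fun j _ => by ring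

lemma qf_mmt (M : Matrix ι ι ℝ) (f : ι → ℝ) : qf (M * M.transpose) f = ∑ i, (∑ j, M j i * f j)^2 := by
  have : ∀ i, (∑ j, M j i * f j)^2 = ∑ j, ∑ k, f j * (M j i * M k i * f k) := by
    intro i; rw [sq, sum_mul_sum]; exact sum_congr rfl fun j _ => sum_congr rfl fun k _ => by ring
  simp_rw [this, qf, Matrix.mul_apply, Matrix.transpose_apply, sum_mul, mul_sum]
  rw [sum_comm]
  conv_rhs => rw [sum_comm]
  rw [sum_comm]
  exact sum_congr rfl fun i _ => sum_comm

lemma qf_sq (M : Matrix ι ι ℝ) (f : ι → ℝ) (hf : ∑ i, f i^2 = 1) : (qf M f)^2 ≤ qf (M * M.transpose) f := by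
  have e : qf M f = ∑ i, (∑ j, M j i * f j) * f i := by
    simp only [qf, mul_sum, sum_mul]; rw [sum_comm]
    exact sum_congr rfl fun i _ => sum_congr rfl fun j _ => by ring
  rw [e, qf_mmt]
  have := sum_mul_sq_le_sq_mul_sq univ (fun i => ∑ j, M j i * f j) f
  rwa [hf, mul_one] at this

lemma qf_diag (M : Matrix ι ι ℝ) (f : ι → ℝ) (hf : ∑ i, f i^2 = 1) (S : Finset ι) (hS : ∀ i, f i ≠ 0 → i ∈ S) : qf (M * M.transpose) f ≤ ∑ i ∈ S, (M * M.transpose) i i := by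
  rw [qf_mmt]
  have h1 : ∀ i, (∑ j, M j i * f j)^2 ≤ ∑ j ∈ S, M j i^2 := by
    intro i
    have : ∑ j, M j i * f j = ∑ j ∈ S, M j i * f j := by
      symm; apply sum_subset (subset_univ _); intro j _ hj
      rw [not_not.1 fun h => hj (hS j h), mul_zero]
    rw [this]
    refine (sum_mul_sq_le_sq_mul_sq S _ f).trans ?_
    refine mul_le_of_le_one_right (sum_nonneg fun j _ => sq_nonneg _) ?_
    rw [← hf]; exact sum_le_sum_of_subset_of_nonneg (subset_univ _) fun i _ _ => sq_nonneg _
  refine (sum_le_sum fun i _ => h1 i).trans (le_of_eq ?_)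
  rw [sum_comm]
  exact sum_congr rfl fun j _ => by simp only [Matrix.mul_apply, Matrix.transpose_apply, sq]

variable [DecidableEq ι]

lemma pow_mmt (R : Matrix ι ι ℝ) (k : ℕ) : ∃ M : Matrix ι ι ℝ, (R * R.transpose)^(2^k) = M * M.transpose := by
  cases k with
  | zero => exact ⟨R, by simp⟩
  | succ k =>
    refine ⟨(R * R.transpose)^(2^k), ?_⟩
    rw [Matrix.transpose_pow, Matrix.transpose_mul, Matrix.transpose_transpose, pow_succ, pow_mul, sq]

lemma trace_ineq (R : Matrix ι ι ℝ) (f : ι → ℝ) (hf : ∑ i, f i^2 = 1) (S : Finset ι) (hS : ∀ i, f i ≠ 0 → i ∈ S) (k : ℕ) :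
    (qf R f)^(2 * 2^k) ≤ ∑ i ∈ S, ((R * R.transpose)^(2^k)) i i := by
  have h1 : (qf R f)^(2 * 2^k) ≤ qf ((R * R.transpose)^(2^k)) f := by
    induction k with
    | zero => rw [pow_zero, mul_one, pow_one]; exact qf_sq R f hf
    | succ k ih =>
      have h2 := qf_sq ((R * R.transpose)^(2^k)) f hf
      rw [Matrix.transpose_pow, Matrix.transpose_mul, Matrix.transpose_transpose, ← pow_add, ← two_mul, ← pow_succ'] at h2
      refine le_trans ?_ h2
      rw [pow_succ, ← mul_assoc, pow_mul]
      exact pow_le_pow_left₀ (by rw [pow_mul]; positivity) ih 2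
  obtain ⟨M, hM⟩ := pow_mmt R k
  rw [hM] at h1 ⊢
  exact h1.trans (qf_diag M f hf S hS)

lemma window (A : Matrix ι ι ℝ) (c : ι → ℤ) (hA : ∀ i j, A i j ≠ 0 → |c i - c j| ≤ 1) (Γ : ℝ) (hΓ : 0 ≤ Γ) (X : ι → Prop)
    (h : ∀ (k : ℤ) (f : ι → ℝ), (∀ i, f i ≠ 0 → X i ∧ (c i = k ∨ c i = k + 1)) → ∑ i, f i^2 = 1 → |qf A f| ≤ Γ) (f : ι → ℝ) (hX : ∀ i, f i ≠ 0 → X i) :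
    |qf A f| ≤ 3 * Γ * ∑ i, f i^2 := by
  have h' : ∀ (k : ℤ) (f : ι → ℝ), (∀ i, f i ≠ 0 → X i ∧ (c i = k ∨ c i = k + 1)) → |qf A f| ≤ Γ * ∑ i, f i^2 := by
    intro k f hf
    set t := ∑ i, f i^2 with ht
    have ht0 : 0 ≤ t := sum_nonneg fun i _ => sq_nonneg _
    rcases ht0.eq_or_lt with h0 | h0
    · have hz : ∀ i, f i = 0 := fun i => by
        have := (sum_eq_zero_iff_of_nonneg fun i _ => sq_nonneg (f i)).1 (ht.symm.trans h0.symm) i (mem_univ i)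
        exact pow_eq_zero_iff (two_ne_zero) |>.1 this
      rw [← h0]; simp [qf, hz]
    · have h2 := h k (fun i => (√t)⁻¹ * f i) (fun i hi => hf i (right_ne_zero_of_mul hi)) (by
        simp_rw [mul_pow]; rw [← mul_sum, ← ht, inv_pow, Real.sq_sqrt ht0, inv_mul_cancel₀ h0.ne'])
      rw [qf_smul, inv_pow, Real.sq_sqrt ht0, abs_mul, abs_of_nonneg (by positivity : 0 ≤ t⁻¹)] at h2
      rwa [inv_mul_le_iff₀ h0, mul_comm] at h2
  set T : Finset ℤ := univ.image c ∪ univ.image (fun i => c i - 1) with hT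
  set g1 : ℤ → ι → ℝ := fun k i => if c i = k then f i else 0
  set g2 : ℤ → ι → ℝ := fun k i => if c i = k ∨ c i = k + 1 then f i else 0
  have id1 : ∀ i j, ∑ k ∈ T, g2 k i * (A i j * g2 k j) - ∑ k ∈ T, g1 k i * (A i j * g1 k j) = f i * (A i j * f j) := by
    intro i j
    by_cases hij : A i j = 0
    · simp [hij]
    · have hc := abs_le.1 (hA i j hij)
      have m1 : ∀ i, c i ∈ T := fun i => by simp [hT]
      have m2 : ∀ i, c i - 1 ∈ T := fun i => by simp [hT]
      have e2 : ∀ (k : ℤ), g2 k i * (A i j * g2 k j) - g1 k i * (A i j * g1 k j) = if k = min (c i) (c j) - (if c i = c j then 1 else 0) then f i * (A i j * f j) else 0 := by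
        intro k
        simp only [g1, g2]
        grind
      rw [← sum_sub_distrib, sum_congr rfl fun k _ => e2 k, sum_ite_eq', if_pos]
      split_ifs with h5
      · rw [h5, min_self]; exact m2 j
      · rw [sub_zero]; rcases min_choice (c i) (c j) with h | h <;> rw [h] <;> exact m1 _
  have id2 : qf A f = ∑ k ∈ T, qf A (g2 k) - ∑ k ∈ T, qf A (g1 k) := by
    have e : ∀ g : ℤ → ι → ℝ, ∑ k ∈ T, qf A (g k) = ∑ i, ∑ j, ∑ k ∈ T, g k i * (A i j * g k j) := by
      intro g; simp only [qf, mul_sum]; rw [sum_comm]; exact sum_congr rfl fun i _ => sum_comm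
    rw [e, e]; simp only [qf, mul_sum, ← sum_sub_distrib]
    exact sum_congr rfl fun i _ => sum_congr rfl fun j _ => by rw [← id1 i j, sum_sub_distrib]
  have b1 : ∑ k ∈ T, ∑ i, g1 k i^2 ≤ ∑ i, f i^2 := by
    rw [sum_comm]; apply sum_le_sum; intro i _
    have : ∀ k, g1 k i^2 = if k = c i then f i^2 else 0 := by
      intro k; simp only [g1]; grind
    rw [sum_congr rfl fun k _ => this k, sum_ite_eq']; split_ifs; exacts [le_refl _, sq_nonneg _]
  have b2 : ∑ k ∈ T, ∑ i, g2 k i^2 ≤ 2 * ∑ i, f i^2 := by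
    rw [sum_comm, mul_sum]; apply sum_le_sum; intro i _
    have : ∀ k, g2 k i^2 = (if k = c i then f i^2 else 0) + if k = c i - 1 then f i^2 else 0 := by
      intro k; simp only [g2]
      grind
    rw [sum_congr rfl fun k _ => this k, sum_add_distrib, sum_ite_eq', sum_ite_eq']
    have := sq_nonneg (f i)
    split_ifs <;> linarith
  have hg : ∀ k, |qf A (g2 k)| ≤ Γ * ∑ i, g2 k i^2 ∧ |qf A (g1 k)| ≤ Γ * ∑ i, g1 k i^2 := by
    intro k
    constructor <;> apply h' k <;> intro i hi
    · by_cases hc : c i = k ∨ c i = k+1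
      · simp only [g2, if_pos hc] at hi; exact ⟨hX i hi, hc⟩
      · simp [g2, if_neg hc] at hi
    · by_cases hc : c i = k
      · simp only [g1, if_pos hc] at hi; exact ⟨hX i hi, Or.inl hc⟩
      · simp [g1, if_neg hc] at hi
  rw [id2]
  calc _ ≤ |∑ k ∈ T, qf A (g2 k)| + |∑ k ∈ T, qf A (g1 k)| := abs_sub _ _
    _ ≤ ∑ k ∈ T, Γ * ∑ i, g2 k i^2 + ∑ k ∈ T, Γ * ∑ i, g1 k i^2 := add_le_add
        ((abs_sum_le_sum_abs _ _).trans (sum_le_sum fun k _ => (hg k).1)) ((abs_sum_le_sum_abs _ _).trans (sum_le_sum fun k _ => (hg k).2))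
    _ ≤ _ := by rw [← mul_sum, ← mul_sum]; nlinarith
end

lemma qf_list {ι α : Type*} [Fintype ι] (S : List α) (M : α → Matrix ι ι ℝ) (f : ι → ℝ) (t : ℝ) (h : ∀ s ∈ S, qf (M s) f ≤ t) : qf (S.map M).sum f ≤ S.length * t := by
  induction S with
  | nil => simp [qf]
  | cons s S ih =>
    have e : qf ((s :: S).map M).sum f = qf (M s) f + qf (S.map M).sum f := by
      simp only [qf, List.map_cons, List.sum_cons, Matrix.add_apply, add_mul, sum_add_distrib, mul_add]
    rw [e, List.length_cons]; push_cast
    linarith [h s (by simp), ih fun s hs => h s (by simp [hs])]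

lemma Am_near (W : Finset ℤ) (a : ℤ) (P : Finset ℕ) (Hn : ℕ) (h0 : 0 < Hn) (hP : ∀ p ∈ P, p ≤ Hn) (i j : {x // x ∈ W}) (h : Am W a P i j ≠ 0) :
    |(i:ℤ) / Hn - (j:ℤ) / Hn| ≤ 1 := by
  rw [Am, Matrix.sum_apply] at h
  obtain ⟨p, hp, h⟩ := exists_ne_zero_of_sum_ne_zero h
  simp only [Sm, Cm] at h
  have hj : (j:ℤ) = nu a p i := by by_contra hh; exact h (if_neg hh)
  have hp := hP p hp
  have hH : (0:ℤ) < Hn := by exact_mod_cast h0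
  have hb : (i:ℤ) ≤ j + Hn ∧ (j:ℤ) ≤ i + Hn := by
    rw [hj, nu]; split_ifs <;> constructor <;> omega
  have h1 := Int.ediv_le_ediv hH hb.1
  have h2 := Int.ediv_le_ediv hH hb.2
  rw [Int.add_ediv_of_dvd_right (dvd_refl _), Int.ediv_self hH.ne'] at h1 h2
  rw [abs_le]; constructor <;> linarith

lemma core (W : Finset ℤ) (a : ℤ) (P : Finset ℕ) (hP : ∀ p ∈ P, Odd p) (Hn : ℕ) (h0 : 0 < Hn) (hPH : ∀ p ∈ P, p ≤ Hn) (Qr : ℝ) (h1 : 1 ≤ Qr) (hQ : ∀ v ∈ W, ∑ p ∈ P, ub p v ≤ Qr)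
    (l : ℕ) (hl : Even l) (hl0 : l ≠ 0) (δ : ℝ) (hδ : 0 ≤ δ) (X NN : Finset ℤ) (hXN : X ⊆ NN) (Γ : ℝ) (hΓ : 0 ≤ Γ) (k : ℕ) (T : ℝ) (hT : 0 ≤ T)
    (hc : ∀ x : {x // x ∈ W}, (x:ℤ) ∈ X → ∀ h < l, ∑ v, |Eh W a P h v x| ≤ δ)
    (htr : ∀ x ∈ X, ∀ q : ℤ, x / Hn = q ∨ x / Hn = q + 1 → ∀ s ∈ Sh l, ∑ n ∈ NN with n / Hn = q ∨ n / Hn = q + 1, dgn ((Bt W a P s)^(2^k)) n ≤ T^(2*2^k))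
    (hfin : 2^l * T + 2*(4*√Qr)^l + l * (6*Qr)^l * √(2^l * (5 * Qr^(l+1)) * δ) ≤ (Γ/2)^l) (f : {x // x ∈ W} → ℝ) (hf : ∀ x, f x ≠ 0 → (x:ℤ) ∈ X) :
    |qf (Am W a P) f| ≤ 3 * Γ * ∑ i, f i^2 := by
  refine window (Am W a P) (fun x => (x:ℤ) / Hn) (Am_near W a P Hn h0 hPH) Γ hΓ (fun x => (x:ℤ) ∈ X) ?_ f hf
  clear hf f
  intro q f hf hf1
  have hA := stepA W a P hP Qr h1 hQ l hl δ hδ f hf1 fun x hx => hc x (hf x hx).1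
  have hT1 : ∀ s ∈ Sh l, qf (TT W a P s ∅) f ≤ T := by
    intro s hs
    obtain ⟨x, hx⟩ : ∃ x, f x ≠ 0 := by
      by_contra hh; push Not at hh; simp [hh] at hf1
    have h2 := htr x (hf x hx).1 q (hf x hx).2 s hs
    have h3 := trace_ineq (TT W a P s ∅) f hf1 (univ.filter fun x => (x:ℤ) ∈ NN ∧ ((x:ℤ) / Hn = q ∨ (x:ℤ) / Hn = q + 1)) (fun i hi => by
      simp only [mem_filter, mem_univ, true_and]; exact ⟨hXN (hf i hi).1, (hf i hi).2⟩) k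
    have h4 : ∑ i ∈ univ.filter (fun x : {x // x ∈ W} => (x:ℤ) ∈ NN ∧ ((x:ℤ) / Hn = q ∨ (x:ℤ) / Hn = q + 1)), ((Bt W a P s)^(2^k)) i i = ∑ n ∈ NN with n / Hn = q ∨ n / Hn = q + 1, dgn ((Bt W a P s)^(2^k)) n := by
      rw [← sum_filter_add_sum_filter_not (NN.filter _) (fun n => n ∈ W)]
      rw [sum_eq_zero (s := filter (fun n => ¬ n ∈ W) _) (fun n hn => by rw [dgn, dif_neg (mem_filter.1 hn).2]), add_zero]
      refine sum_bij (fun i _ => (i:ℤ)) ?_ (fun _ _ _ _ h => Subtype.ext h) ?_ ?_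
      · intro i hi; simp only [mem_filter, mem_univ, true_and] at hi ⊢; exact ⟨hi, i.2⟩
      · intro n hn; simp only [mem_filter] at hn; exact ⟨⟨n, hn.2⟩, by simpa using hn.1, rfl⟩
      · intro i _; rw [dgn, dif_pos i.2]
    rw [Bt] at h2 h4
    rw [h4] at h3
    have h5 := h3.trans h2
    refine (le_abs_self _).trans (abs_le_of_sq_le_sq' ?_ hT |> abs_le.2)
    rw [pow_mul, pow_mul] at h5
    exact (pow_le_pow_iff_left₀ (sq_nonneg _) (sq_nonneg _) (by positivity)).1 h5
  have hY : qf (Yh W a P l) f ≤ 2^l * T := by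
    refine (qf_list (Sh l) _ f T hT1).trans (mul_le_mul_of_nonneg_right (by exact_mod_cast Sh_card l) hT)
  have h6 : (qf (Am W a P) f/2)^l ≤ (Γ/2)^l := by
    refine hA.trans (le_trans ?_ hfin)
    change qf (Yh W a P l) f + _ + _ ≤ _
    linarith
  rw [← hl.pow_abs, pow_le_pow_iff_left₀ (abs_nonneg _) (by positivity) hl0, abs_div, abs_two] at h6
  linarith

noncomputable def Qa (NN : Finset ℤ) (a : ℤ) (P : Finset ℕ) (g : ℤ → ℝ) : ℝ := ∑ n ∈ NN, g n * ∑ p ∈ P, wtb false p n * g (nu a p n)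

lemma sum_supp (W NN : Finset ℤ) (F : ℤ → ℝ) (h : ∀ n, F n ≠ 0 → n ∈ W ∧ n ∈ NN) : ∑ x : {x // x ∈ W}, F x = ∑ n ∈ NN, F n := by
  rw [sum_coe_sort W F, ← sum_filter_ne_zero, ← sum_filter_ne_zero (s := NN)]
  congr 1; ext n; simp only [mem_filter]
  exact ⟨fun hn => ⟨(h n hn.2).2, hn.2⟩, fun hn => ⟨(h n hn.2).1, hn.2⟩⟩

lemma qf_Am (W NN : Finset ℤ) (a : ℤ) (P : Finset ℕ) (g : ℤ → ℝ) (h : ∀ n, g n ≠ 0 → n ∈ W ∧ n ∈ NN) : qf (Am W a P) (fun x => g x) = Qa NN a P g := by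
  rw [qf, Qa, ← sum_supp W NN _ fun n hn => h n (left_ne_zero_of_mul hn)]
  apply sum_congr rfl; intro i _
  congr 1
  simp only [Am, Matrix.sum_apply, sum_mul]
  rw [sum_comm]
  apply sum_congr rfl; intro p _
  simp only [Sm, Cm, ite_mul, zero_mul]
  rw [sum_coe_sort W (fun x => if x = nu a p i then wtb false p i * g x else 0), sum_ite_eq']
  split_ifs with hh
  · rfl
  · rw [not_not.1 fun h' => hh (h _ h').1, mul_zero]

lemma list_mass {W : Finset ℤ} {α : Type*} (S : List α) (M : α → WM W) (B : ℝ) (h : ∀ s ∈ S, ∑ v, ∑ x, |M s v x| ≤ B) : ∑ v, ∑ x, |(S.map M).sum v x| ≤ S.length * B := by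
  induction S with
  | nil => simp
  | cons s S ih =>
    rw [List.map_cons, List.sum_cons, List.length_cons]; push_cast
    calc _ ≤ ∑ v, ∑ x, (|M s v x| + |(S.map M).sum v x|) := sum_le_sum fun v _ => sum_le_sum fun x _ => by rw [Matrix.add_apply]; exact abs_add_le _ _
      _ = ∑ v, ∑ x, |M s v x| + ∑ v, ∑ x, |(S.map M).sum v x| := by simp only [sum_add_distrib]
      _ ≤ _ := by linarith [h s (by simp), ih fun s hs => h s (by simp [hs])]

lemma Eh_mass (W : Finset ℤ) (a : ℤ) (P : Finset ℕ) (H0 : ℝ) (hH0 : 1 ≤ H0) (Hn : ℕ) (hHn : 1 ≤ Hn) (hP : ∀ p ∈ P, Nat.Prime p ∧ Odd p ∧ H0 ≤ (p:ℝ) ∧ p ≤ Hn)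
    (N : ℕ) (hN : 1 ≤ N) (hW : W ⊆ Icc (-(4*N:ℤ)) (4*N)) (l : ℕ) (hl : Hn^(l+1) ≤ N) (L : ℝ) (hL : L = ∑ p ∈ P, 1/(p:ℝ)) (hL1 : 1 ≤ L) (h : ℕ) (hh : h < l) :
    ∑ x, ∑ v, |Eh W a P h v x| ≤ 2^l * (900 * N * ((2*L)^l * (l * ((2 + Real.log Hn + 2*L)/H0)))) := by
  have hlog : 0 ≤ Real.log Hn := Real.log_nonneg (by exact_mod_cast hHn)
  have hB : 0 ≤ 900 * (N:ℝ) * ((2*L)^l * (l * ((2 + Real.log Hn + 2*L)/H0))) := by positivity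
  rw [sum_comm, Eh]
  refine (list_mass _ _ (900 * N * ((2*L)^l * (l * ((2 + Real.log Hn + 2*L)/H0)))) ?_).trans (mul_le_mul_of_nonneg_right ?_ hB)
  · intro s hs
    rcases Er_dom W a P H0 hH0 (fun p hp => ⟨(hP p hp).2.1, (hP p hp).2.2.1⟩) s with h0 | ⟨n, hn, hd⟩
    · rw [h0]; simpa using hB
    · have := Sh_len h s hs
      refine (sum_le_sum fun v _ => hd v).trans ?_
      rw [sum_coe_sort W (gE a P H0 n)]
      exact gE_mass W a P H0 hH0 Hn hHn hP N hN hW n l (by omega) hl L hL hL1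
  · have h1 := Sh_card h
    exact_mod_cast h1.trans (Nat.pow_le_pow_right (by norm_num) hh.le)

lemma dgn_nonneg (W : Finset ℤ) (a : ℤ) (P : Finset ℕ) (s : List Bool) (k : ℕ) (n : ℤ) : 0 ≤ dgn ((Bt W a P s)^(2^k)) n := by
  rw [dgn]; split_ifs with h
  · obtain ⟨M, hM⟩ := pow_mmt (TT W a P s ∅) k
    rw [Bt, hM, Matrix.mul_apply]
    exact sum_nonneg fun j _ => by rw [Matrix.transpose_apply]; exact mul_self_nonneg _
  · exact le_refl _

lemma win_card (Hn : ℕ) (h0 : 0 < Hn) (NN : Finset ℤ) (q : ℤ) : ((NN.filter fun x : ℤ => |x / Hn - q| ≤ 1).card : ℝ) ≤ 3 * Hn := by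
  have hH : (0:ℤ) < Hn := by exact_mod_cast h0
  have : (NN.filter fun x : ℤ => |x / Hn - q| ≤ 1) ⊆ Ico (Hn * (q-1)) (Hn * (q+2)) := by
    intro x hx
    have hx := abs_le.1 (mem_filter.1 hx).2
    have e := Int.mul_ediv_add_emod x Hn
    have e1 := Int.emod_nonneg x hH.ne'
    have e2 := Int.emod_lt_of_pos x hH
    rw [mem_Ico]; constructor <;> nlinarith
  have h2 := card_le_card this
  rw [Int.card_Ico] at h2
  have : ((Hn:ℤ) * (q+2) - Hn * (q-1)).toNat = 3 * Hn := by
    rw [show (Hn:ℤ) * (q+2) - Hn * (q-1) = ((3 * Hn : ℕ):ℤ) by push_cast; ring]; rfl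
  rw [this] at h2; exact_mod_cast h2

lemma half (P : Finset ℕ) (a : ℤ) (H0 : ℝ) (hH0 : 1 ≤ H0) (Hn : ℕ) (hHn : 1 ≤ Hn) (hP : ∀ p ∈ P, Nat.Prime p ∧ Odd p ∧ H0 ≤ (p:ℝ) ∧ p ≤ Hn) (N : ℕ) (hN : 1 ≤ N) (M b : ℕ) (hb : 1 ≤ b)
    (l : ℕ) (hl : Even l) (hl0 : l ≠ 0) (hHN : Hn^(l+1) ≤ N) (L : ℝ) (hL : L = ∑ p ∈ P, 1/(p:ℝ)) (hL1 : 1 ≤ L) (k : ℕ) (Bd : ℝ) (hBd : 0 ≤ Bd)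
    (hav : ∀ s ∈ Sh l, ∑ τ : {x // x ∈ Box N} → Fin b, ∑ n ∈ Ioc (N:ℤ) (2*N), dgn ((Bt (Wt P M b N τ) a P s)^(2^k)) n ≤ (b:ℝ)^(Box N).card * (2 * Bd))
    (T δ Γ B1 B2 : ℝ) (hT : 0 < T) (hδ : 0 < δ) (hΓ : 0 ≤ Γ)
    (hB1 : 3 * Hn * (2^l * (2 * Bd)) ≤ B1 * T^(2*2^k)) (hB2 : l * (2^l * (900 * N * ((2*L)^l * (l * ((2 + Real.log Hn + 2*L)/H0))))) ≤ B2 * δ)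
    (hfin : 2^l * T + 2*(4*√(M+b+L))^l + l * (6*(M+b+L))^l * √(2^l * (5 * (M+b+L)^(l+1)) * δ) ≤ (Γ/2)^l) :
    ∃ Z ⊆ Ioc (N:ℤ) (2*N), (Z.card:ℝ) ≤ B1 + B2 ∧ ∀ g : ℤ → ℝ, (∀ n, g n ≠ 0 → n ∈ Ioc (N:ℤ) (2*N) ∧ om P n ≤ M ∧ n ∉ Z) →
      |Qa (Ioc (N:ℤ) (2*N)) a P g| ≤ 3 * Γ * ∑ n ∈ Ioc (N:ℤ) (2*N), g n^2 := by
  set NN := Ioc (N:ℤ) (2*N) with hNN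
  have hMb : (1:ℝ) ≤ M + b + L := by
    have : (0:ℝ) ≤ M := Nat.cast_nonneg _
    have : (0:ℝ) ≤ b := Nat.cast_nonneg _
    linarith
  obtain ⟨τ, hτ⟩ : ∃ τ : {x // x ∈ Box N} → Fin b, ∑ n ∈ NN, ∑ s ∈ (Sh l).toFinset, dgn ((Bt (Wt P M b N τ) a P s)^(2^k)) n ≤ (Sh l).toFinset.card * (2 * Bd) := by
    have : NeZero b := ⟨by omega⟩
    by_contra hh
    push Not at hh
    have h1 := sum_lt_sum_of_nonempty (univ_nonempty (α := {x // x ∈ Box N} → Fin b)) fun τ _ => hh τ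
    rw [sum_const, card_univ, Fintype.card_fun, Fintype.card_fin, Fintype.card_coe, nsmul_eq_mul] at h1
    have h2 : ∑ τ : {x // x ∈ Box N} → Fin b, ∑ n ∈ NN, ∑ s ∈ (Sh l).toFinset, dgn ((Bt (Wt P M b N τ) a P s)^(2^k)) n ≤ ∑ s ∈ (Sh l).toFinset, (b:ℝ)^(Box N).card * (2 * Bd) := by
      rw [sum_congr rfl fun τ _ => sum_comm, sum_comm]
      exact sum_le_sum fun s hs => hav s (List.mem_toFinset.1 hs)
    rw [sum_const, nsmul_eq_mul] at h2
    push_cast at h1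
    nlinarith
  set W := Wt P M b N τ with hW
  have hWm : ∀ n, n ∈ W → n ∈ Box N ∧ om P n ≤ M + b := by
    intro n hn
    obtain ⟨h1, h2⟩ := (Wt_mem _ _ _ _ _ _).1 hn
    refine ⟨h1, h2.trans ?_⟩
    exact_mod_cast Nat.add_le_add_left (τ ⟨n, h1⟩).2.le M
  have hWg : ∀ n, n ∈ NN → om P n ≤ M → n ∈ W := by
    intro n hn ho
    have hB : n ∈ Box N := by
      rw [hNN, mem_Ioc] at hn; rw [mem_Icc]; constructor <;> omega
    refine (Wt_mem _ _ _ _ _ _).2 ⟨hB, ho.trans ?_⟩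
    push_cast; linarith [Nat.cast_nonneg (α := ℝ) (τ ⟨n, hB⟩ : ℕ)]
  have hQ : ∀ v ∈ W, ∑ p ∈ P, ub p v ≤ M + b + L := by
    intro v hv
    have := (hWm v hv).2
    simp only [ub, sum_add_distrib, ← hL]
    rw [om] at this; linarith
  set D : ℤ → ℝ := fun n => ∑ s ∈ (Sh l).toFinset, dgn ((Bt W a P s)^(2^k)) n with hD
  have hD0 : ∀ n, 0 ≤ D n := fun n => sum_nonneg fun s _ => dgn_nonneg _ _ _ _ _ _
  set Z1 := NN.filter fun x : ℤ => T^(2*2^k) < ∑ n ∈ NN with |x / (Hn:ℤ) - n / Hn| ≤ 1, D n with hZ1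
  have c1 : (Z1.card:ℝ) ≤ B1 := by
    have h1 : (Z1.card:ℝ) * T^(2*2^k) ≤ ∑ x ∈ NN, ∑ n ∈ NN with |x / (Hn:ℤ) - n / Hn| ≤ 1, D n := by
      rw [← nsmul_eq_mul]
      refine (card_nsmul_le_sum Z1 _ _ fun x hx => (mem_filter.1 hx).2.le).trans ?_
      exact sum_le_sum_of_subset_of_nonneg (filter_subset _ _) fun i _ _ => sum_nonneg fun n _ => hD0 n
    have h2 : ∑ x ∈ NN, ∑ n ∈ NN with |x / (Hn:ℤ) - n / Hn| ≤ 1, D n ≤ 3 * Hn * ∑ n ∈ NN, D n := by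
      simp only [sum_filter]
      rw [sum_comm, mul_sum]
      apply sum_le_sum; intro n _
      rw [← sum_filter, sum_const, nsmul_eq_mul]
      exact mul_le_mul_of_nonneg_right (win_card Hn hHn NN _) (hD0 n)
    have h3 : ((Sh l).toFinset.card : ℝ) ≤ 2^l := by
      exact_mod_cast (List.toFinset_card_le _).trans (Sh_card l)
    have h4 : (Sh l).toFinset.card * (2*Bd) ≤ 2^l * (2*Bd) := mul_le_mul_of_nonneg_right h3 (by positivity)
    have h5 : (Z1.card:ℝ) * T^(2*2^k) ≤ B1 * T^(2*2^k) := by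
      refine h1.trans (h2.trans (le_trans ?_ hB1))
      exact mul_le_mul_of_nonneg_left (hτ.trans h4) (by positivity)
    exact le_of_mul_le_mul_right h5 (by positivity)
  set Z2 := NN.filter fun x => ∃ h : x ∈ W, δ < ∑ j ∈ range l, ∑ v, |Eh W a P j v ⟨x, h⟩| with hZ2
  have c2 : (Z2.card:ℝ) ≤ B2 := by
    set F : ℤ → ℝ := fun x => if h : x ∈ W then ∑ j ∈ range l, ∑ v, |Eh W a P j v ⟨x, h⟩| else 0 with hF
    have hF0 : ∀ x, 0 ≤ F x := by
      intro x; simp only [hF]; split_ifs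
      · exact sum_nonneg fun _ _ => sum_nonneg fun _ _ => abs_nonneg _
      · exact le_refl _
    have h1 : (Z2.card:ℝ) * δ ≤ ∑ x ∈ W, F x := by
      rw [← nsmul_eq_mul]
      refine (card_nsmul_le_sum Z2 F _ fun x hx => ?_).trans ?_
      · obtain ⟨h, h'⟩ := (mem_filter.1 hx).2
        simp only [hF, dif_pos h]; exact h'.le
      · exact sum_le_sum_of_subset_of_nonneg (fun x hx => (mem_filter.1 hx).2.1) fun i _ _ => hF0 i
    rw [← sum_coe_sort W F] at h1
    have h2 : ∑ x : {x // x ∈ W}, F x = ∑ j ∈ range l, ∑ x, ∑ v, |Eh W a P j v x| := by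
      rw [sum_comm]; apply sum_congr rfl; intro x _; simp only [hF, dif_pos x.2]
    rw [h2] at h1
    have h3 := sum_le_sum fun j hj => Eh_mass W a P H0 hH0 Hn hHn hP N hN (fun n hn => (hWm n hn).1) l hHN L hL hL1 j (mem_range.1 hj)
    rw [sum_const, card_range, nsmul_eq_mul] at h3
    exact le_of_mul_le_mul_right (h1.trans (h3.trans hB2)) hδ
  refine ⟨Z1 ∪ Z2, union_subset (filter_subset _ _) (filter_subset _ _), ?_, ?_⟩
  · have := card_union_le Z1 Z2
    have : ((Z1 ∪ Z2).card:ℝ) ≤ Z1.card + Z2.card := by exact_mod_cast this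
    linarith
  intro g hg
  have hgW : ∀ n, g n ≠ 0 → n ∈ W ∧ n ∈ NN := fun n hn => ⟨hWg n (hg n hn).1 (hg n hn).2.1, (hg n hn).1⟩
  rw [← qf_Am W NN a P g hgW, ← sum_supp W NN (fun n => g n^2) fun n hn => hgW n (by intro h; simp [h] at hn)]
  refine core W a P (fun p hp => (hP p hp).2.1) Hn hHn (fun p hp => (hP p hp).2.2.2) _ hMb hQ l hl hl0 δ hδ.le ((NN.filter fun n => om P n ≤ M) \ (Z1 ∪ Z2)) NN
    (sdiff_subset.trans (filter_subset _ _)) Γ hΓ k T hT.le ?_ ?_ hfin _ ?_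
  · intro x hx j hj
    simp only [mem_sdiff, mem_union, mem_filter, not_or, hZ2] at hx
    by_contra hh
    refine hx.2.2 ⟨hx.1.1, x.2, (not_le.1 hh).trans_le ?_⟩
    exact single_le_sum (f := fun j => ∑ v, |Eh W a P j v x|) (fun _ _ => sum_nonneg fun _ _ => abs_nonneg _) (mem_range.2 hj)
  · intro x hx q hq s hs
    simp only [mem_sdiff, mem_union, mem_filter, not_or, hZ1, not_and, not_lt] at hx
    refine le_trans ?_ (hx.2.1 hx.1.1)
    refine (sum_le_sum fun n _ => single_le_sum (f := fun s => dgn ((Bt W a P s)^(2^k)) n) (fun s _ => dgn_nonneg _ _ _ _ _ _) (List.mem_toFinset.2 hs)).trans ?_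
    refine sum_le_sum_of_subset_of_nonneg ?_ fun i _ _ => hD0 i
    intro n hn
    simp only [mem_filter] at hn ⊢
    refine ⟨hn.1, ?_⟩
    rw [abs_le]; omega
  · intro x hx
    have := hg x hx
    simp only [mem_sdiff, mem_filter]
    exact ⟨⟨this.1, this.2.1⟩, this.2.2⟩

lemma havg (P : Finset ℕ) (H0 : ℝ) (hH0 : 2 < H0) (Hn : ℕ) (hHn : 16 ≤ Hn) (hP : ∀ p ∈ P, Nat.Prime p ∧ Odd p ∧ H0 ≤ (p:ℝ) ∧ p ≤ Hn) (r : ℕ) (hr : (Hn:ℝ) < H0 * 2^r)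
    (L : ℝ) (hL : L = ∑ p ∈ P, (1:ℝ)/p) (hL1 : 1 ≤ L) (l k d mm : ℕ) (hm1 : 1 ≤ mm) (hmm : mm = 2*2^k*l) (Q : ℕ) (hQB : mm * Hn < 2^Q) (hQ : ((mm:ℝ)+1) * Q ≤ H0)
    (hbig : (mm:ℝ)^mm * (L^mm * (r * (10 * mm * (d+1)^2 * (d.factorial * (mm:ℝ)^d) / H0))^d) ≤ 1) (M : ℕ) (hLM : L ≤ M) (hmb : ((mm:ℝ)+1) * √M ≤ H0)
    (N : ℕ) (hN : (Hn:ℝ)^(4*(mm + 16*((mm+1)*M))) ≤ N) (a : ℤ) (s : List Bool) (hs : s ∈ Sh l) :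
    ∑ τ : {x // x ∈ Box N} → Fin M, ∑ n ∈ Ioc (N:ℤ) (2*N), dgn ((Bt (Wt P M M N τ) a P s)^(2^k)) n ≤
      (M:ℝ)^(Box N).card * (2 * (N * 12000^mm * (mm:ℝ)^(2*(2*2^k*(4*(5*d+2*(2*2^k))+1+2*(2*2^k)))) * √L^mm)) := by
  set e := 2*(2*2^k*(4*(5*d+2*(2*2^k))+1+2*(2*2^k)))
  have hsl : 1 ≤ √L := Real.one_le_sqrt.2 hL1
  have hm1' : (1:ℝ) ≤ mm := by exact_mod_cast hm1
  have hM1 : 1 ≤ M := by exact_mod_cast hL1.trans hLM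
  have hlen := Sh_len l s hs
  have hHn1 : (1:ℝ) ≤ Hn := by exact_mod_cast (by omega : 1 ≤ Hn)
  have hH00 : (0:ℝ) < H0 := by linarith
  by_cases h0 : s = []
  · have e1 : ∀ τ : {x // x ∈ Box N} → Fin M, ∀ n, dgn ((Bt (Wt P M M N τ) a P s)^(2^k)) n ≤ 1 := by
      intro τ n
      rw [h0, Bt, TT_nil, Matrix.transpose_one, mul_one, one_pow, dgn]
      split_ifs <;> simp
    refine (sum_le_sum fun τ _ => sum_le_sum fun n _ => e1 τ n).trans ?_
    simp only [sum_const, card_univ, Fintype.card_fun, Fintype.card_fin, Fintype.card_coe, nsmul_eq_mul, mul_one, Int.card_Ioc]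
    rw [show ((2 * (N:ℤ) - N).toNat) = N by omega]; push_cast
    refine mul_le_mul_of_nonneg_left ?_ (by positivity)
    have h1 : (1:ℝ) ≤ 12000^mm * (mm:ℝ)^e * √L^mm :=
      one_le_mul_of_one_le_of_one_le (one_le_mul_of_one_le_of_one_le (one_le_pow₀ (by norm_num)) (one_le_pow₀ hm1')) (one_le_pow₀ hsl)
    have hN0 : (0:ℝ) ≤ N := Nat.cast_nonneg _
    nlinarith
  have hs1 : 1 ≤ s.length := List.length_pos_iff.2 h0
  set m := 2*2^k*s.length with hm
  have hmle : m ≤ mm := by rw [hmm, hm]; exact Nat.mul_le_mul_left _ (by omega)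
  have hmpos : 0 < m := by positivity
  have hmle' : (m:ℝ) ≤ mm := by exact_mod_cast hmle
  have hm1r : (1:ℝ) ≤ m := by exact_mod_cast hmpos
  obtain ⟨f1, f2, f3, f4⟩ := fl_len s (2^k)
  refine trace_avg P (fun p hp => (hP p hp).2.1) M M N hM1 a s (2^k) m hm Hn (fun p hp => (hP p hp).2.2.2) ?_ _ ?_
  · have h1 : m * Hn ≤ Hn^(4*(mm + 16*((mm+1)*M))) := calc
      m * Hn ≤ Hn^mm * Hn := Nat.mul_le_mul_right _ (hmle.trans ((Nat.lt_two_pow_self).le.trans (Nat.pow_le_pow_left (by omega) _)))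
      _ = Hn^(mm+1) := (pow_succ _ _).symm
      _ ≤ _ := Nat.pow_le_pow_right (by omega) (by omega)
    exact h1.trans (by exact_mod_cast hN)
  intro ε a' hε
  have hD : ∀ j ≤ d, (j.factorial : ℝ) * (m:ℝ)^j ≤ d.factorial * (mm:ℝ)^d := by
    intro j hj
    have h1 : (j.factorial:ℝ) ≤ d.factorial := by exact_mod_cast Nat.factorial_le hj
    have h2 : (m:ℝ)^j ≤ (mm:ℝ)^d := (pow_le_pow_left₀ (by positivity) hmle' _).trans (pow_le_pow_right₀ hm1' hj)
    exact mul_le_mul h1 h2 (by positivity) (by positivity)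
  have hmm2 : (m:ℝ)^m ≤ (mm:ℝ)^mm := (pow_le_pow_left₀ (by positivity) hmle' _).trans (pow_le_pow_right₀ hm1' hmle)
  have hw := wordsum hmpos (2*2^k) s.length d hm P H0 hH0 (fun p hp => ⟨(hP p hp).1, (hP p hp).2.2.1⟩) Hn hHn (fun p hp => (hP p hp).2.2.2) r
    (fun p hp => lt_of_le_of_lt (by exact_mod_cast (hP p hp).2.2.2) hr) L hL hL1 Q (lt_of_le_of_lt (Nat.mul_le_mul_right _ hmle) hQB)
    (le_trans (by gcongr) hQ) (d.factorial * (mm:ℝ)^d) (by simpa using hD 0 (Nat.zero_le _)) hD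
    (le_trans (by gcongr) hbig) (Cf m (fl s (2^k)).flatten) ε a' hε M M _ hLM le_rfl rfl (le_trans (by gcongr) hmb) ((N:ℤ)+1) N
    (le_trans (pow_le_pow_right₀ hHn1 (by gcongr)) hN)
  refine hw.trans ?_
  have hcc := Cf_card m (fl s (2^k)).flatten f3
  have hca := card_compl_add_card (Cf m (fl s (2^k)).flatten)
  rw [Fintype.card_fin] at hca
  gcongr
  · norm_num
  · have h2 : s.length + s.count true ≤ l := by omega
    have := Nat.mul_le_mul_left (2*2^k) h2
    rw [mul_add, ← hmm, ← f4, ← hm] at this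
    omega

lemma eig0 (NN X : Finset ℤ) (hX : X ⊆ NN) (P : Finset ℕ) (A : ({n : ℤ // n ∈ NN} → ℂ) →ₗ[ℂ] ({n : ℤ // n ∈ NN} → ℂ))
    (hA : ∀ (f : {n : ℤ // n ∈ NN} → ℂ) (n : {n : ℤ // n ∈ NN}), A f n = ∑ p ∈ P, ((if (p : ℤ) ∣ (n : ℤ) then (1 : ℂ) else 0) - 1 / (p : ℂ)) *
      ((if h : (n : ℤ) + (p : ℤ) ∈ NN then f ⟨(n : ℤ) + (p : ℤ), h⟩ else 0) + (if h : (n : ℤ) - (p : ℤ) ∈ NN then f ⟨(n : ℤ) - (p : ℤ), h⟩ else 0)))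
    (γ : ℝ) (hγ : γ ≠ 0) (f : {n : ℤ // n ∈ NN} → ℂ) (hf : f ≠ 0)
    (he : (fun n : {n : ℤ // n ∈ NN} => if (n : ℤ) ∈ X then A (fun m : {n : ℤ // n ∈ NN} => if (m : ℤ) ∈ X then f m else 0) n else 0) = (γ : ℂ) • f) :
    ∃ g : ℤ → ℝ, (∃ n, g n ≠ 0) ∧ (∀ n, g n ≠ 0 → n ∈ X) ∧ ∀ n ∈ X, γ * g n = ∑ p ∈ P, wtb false p n * (g (n+p) + g (n-p)) := by
  have hγ' : (γ:ℂ) ≠ 0 := by exact_mod_cast hγ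
  have h0 : ∀ n : {n : ℤ // n ∈ NN}, (n:ℤ) ∉ X → f n = 0 := by
    intro n hn
    have := congrFun he n
    simp only [if_neg hn, Pi.smul_apply, smul_eq_mul] at this
    exact (mul_eq_zero.1 this.symm).resolve_left hγ'
  have h1 : (fun m : {n : ℤ // n ∈ NN} => if (m : ℤ) ∈ X then f m else 0) = f := by
    funext m; split_ifs with h
    · rfl
    · exact (h0 m h).symm
  rw [h1] at he
  set F : ℤ → ℂ := fun n => if h : n ∈ NN then f ⟨n, h⟩ else 0 with hF
  have hFX : ∀ n, n ∉ X → F n = 0 := by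
    intro n hn; simp only [hF]; split_ifs with h
    · exact h0 ⟨n, h⟩ hn
    · rfl
  have hFe : ∀ n ∈ X, (γ:ℂ) * F n = ∑ p ∈ P, ((wtb false p n : ℝ):ℂ) * (F (n+p) + F (n-p)) := by
    intro n hn
    have := congrFun he ⟨n, hX hn⟩
    simp only [if_pos hn, Pi.smul_apply, smul_eq_mul, hA] at this
    rw [show F n = f ⟨n, hX hn⟩ from dif_pos (hX hn), ← this]
    apply sum_congr rfl; intro p _
    congr 1
    simp only [wtb]; push_cast; split_ifs <;> simp_all
  have key : ∀ φ : ℂ →ₗ[ℝ] ℝ, (∃ n, φ (F n) ≠ 0) → ∃ g : ℤ → ℝ, (∃ n, g n ≠ 0) ∧ (∀ n, g n ≠ 0 → n ∈ X) ∧ ∀ n ∈ X, γ * g n = ∑ p ∈ P, wtb false p n * (g (n+p) + g (n-p)) := by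
    intro φ hφ
    refine ⟨fun n => φ (F n), hφ, fun n hn => ?_, fun n hn => ?_⟩
    · by_contra h; exact hn (by simp [hFX n h])
    · have h2 := congrArg φ (hFe n hn)
      simp only [← Complex.real_smul] at h2
      rw [map_smul, map_sum, smul_eq_mul] at h2
      rw [h2]; exact sum_congr rfl fun p _ => by rw [map_smul, map_add, smul_eq_mul]
  obtain ⟨n, hn⟩ : ∃ n, f n ≠ 0 := by
    by_contra hh; push Not at hh; exact hf (funext hh)
  have hFn : F n ≠ 0 := by simpa only [hF, dif_pos n.2] using hn
  by_cases hr : (F n).re = 0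
  · exact key Complex.imLm ⟨n, fun h => hFn (Complex.ext hr h)⟩
  · exact key Complex.reLm ⟨n, hr⟩

lemma eig_row (X : Finset ℤ) (P : Finset ℕ) (γ : ℝ) (g : ℤ → ℝ) (hg : ∃ n, g n ≠ 0) (hX : ∀ n, g n ≠ 0 → n ∈ X)
    (he : ∀ n ∈ X, γ * g n = ∑ p ∈ P, wtb false p n * (g (n+p) + g (n-p))) (R : ℝ) (hR : ∀ n ∈ X, ∑ p ∈ P, ub p n ≤ R) : |γ| ≤ 2 * R := by
  obtain ⟨n0, hn0⟩ := hg
  obtain ⟨n, hn, hmax⟩ := exists_max_image X (fun n => |g n|) ⟨n0, hX n0 hn0⟩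
  have hm : ∀ x, |g x| ≤ |g n| := by
    intro x; by_cases h : g x = 0
    · rw [h, abs_zero]; exact abs_nonneg _
    · exact hmax x (hX x h)
  have hpos : 0 < |g n| := (abs_pos.2 hn0).trans_le (hm n0)
  have h1 : |γ| * |g n| ≤ 2 * R * |g n| := by
    rw [← abs_mul, he n hn]
    calc _ ≤ ∑ p ∈ P, ub p n * (2 * |g n|) := (abs_sum_le_sum_abs _ _).trans (sum_le_sum fun p _ => by
          rw [abs_mul]
          refine mul_le_mul (wtb_le _ _ _) ?_ (abs_nonneg _) ((abs_nonneg _).trans (wtb_le false p n))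
          linarith [abs_add_le (g (n+p)) (g (n-p)), hm (n+p), hm (n-p)])
      _ ≤ _ := by rw [← sum_mul]; nlinarith [hR n hn]
  exact le_of_mul_le_mul_right h1 hpos

lemma eig_qf (NN X : Finset ℤ) (hXN : X ⊆ NN) (P : Finset ℕ) (γ : ℝ) (g : ℤ → ℝ) (hg : ∃ n, g n ≠ 0) (hX : ∀ n, g n ≠ 0 → n ∈ X)
    (he : ∀ n ∈ X, γ * g n = ∑ p ∈ P, wtb false p n * (g (n+p) + g (n-p))) (R : ℝ) (h0 : |Qa NN 0 P g| ≤ R * ∑ n ∈ NN, g n^2) (h1 : |Qa NN 1 P g| ≤ R * ∑ n ∈ NN, g n^2) : |γ| ≤ 2 * R := by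
  obtain ⟨n0, hn0⟩ := hg
  have hpos : 0 < ∑ n ∈ NN, g n^2 := sum_pos' (fun n _ => sq_nonneg _) ⟨n0, hXN (hX n0 hn0), by positivity⟩
  have e : γ * ∑ n ∈ NN, g n^2 = Qa NN 0 P g + Qa NN 1 P g := by
    rw [Qa, Qa, mul_sum, ← sum_add_distrib]
    apply sum_congr rfl; intro n _
    by_cases h : g n = 0
    · simp [h]
    · rw [sq, ← mul_assoc, he n (hX n h), ← mul_add, ← sum_add_distrib, mul_comm]
      congr 1; apply sum_congr rfl; intro p _
      rw [← mul_add]; congr 1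
      simp only [nu]
      by_cases h2 : (2:ℤ) ∣ n
      · rw [if_pos (by simpa using h2), if_neg (by omega)]
      · rw [if_neg (by simpa using h2), if_pos (by omega), add_comm]
  have h3 : |γ| * ∑ n ∈ NN, g n^2 ≤ 2 * R * ∑ n ∈ NN, g n^2 := by
    rw [← abs_of_pos hpos, ← abs_mul, abs_of_pos hpos, e]
    linarith [abs_add_le (Qa NN 0 P g) (Qa NN 1 P g)]
  exact le_of_mul_le_mul_right h3 hpos

lemma es_ge (h : ℕ → RR → ℝ) (r : RR) (hh : ∀ p, h p r = 0 ∨ h p r = 1) (l : List ℕ) (j : ℕ) : 0 ≤ es h l j r ∧ ((j:ℝ) ≤ (l.map fun p => h p r).sum → 1 ≤ es h l j r) := by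
  induction l generalizing j with
  | nil => cases j with
    | zero => simp [es]
    | succ j => simp only [es, List.map_nil, List.sum_nil, le_refl, true_and]; push_cast; intro h; linarith [Nat.cast_nonneg (α := ℝ) j]
  | cons p l ih => cases j with
    | zero => simp [es]
    | succ j =>
      simp only [es, List.map_cons, List.sum_cons]
      obtain ⟨a1, a2⟩ := ih (j+1)
      obtain ⟨b1, b2⟩ := ih j
      rcases hh p with h0 | h0 <;> rw [h0]
      · simpa using ih (j+1)
      · rw [one_mul]; refine ⟨by linarith, fun hj => ?_⟩
        push_cast at hj
        linarith [b2 (by linarith)]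

lemma tail (P : Finset ℕ) (Hn : ℕ) (hHn : 1 ≤ Hn) (hP : ∀ p ∈ P, Nat.Prime p ∧ p ≤ Hn) (L : ℝ) (hL : L = ∑ p ∈ P, (1:ℝ)/p) (N M : ℕ) (hN : (Hn:ℝ)^M ≤ N) :
    (((Ioc (N:ℤ) (2*N)).filter fun n => ¬ om P n ≤ M).card : ℝ) ≤ 2 * N * (L^M / M.factorial) := by
  set h : ℕ → RR → ℝ := fun p r => hit r p 0 with hh
  have h1 := es_real Hn h (fun p r => hit_nonneg r p 0) (fun p r r' hr => hit_oeq r r' _ _ (hr p (by simp))) (fun p => 1/(p:ℝ)) P.toList [] 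
    (fun p hp => (hP p (by simpa using hp)).1) (by simpa using P.nodup_toList) (fun p hp => (hP p (by simpa using hp)).2) hHn
    (fun p hp r => (Av_hit p (hP p (by simpa using hp)).1.pos 0 r).le) (fun p _ => by positivity) M (fun _ => 1) (fun _ _ _ => rfl) (fun _ => zero_le_one) (fun _ => none) ((N:ℤ)+1) N
  have h2 := ec_le (fun p => 1/(p:ℝ)) P.toList (fun p _ => by positivity) M
  rw [toList_sum_map, ← hL] at h2
  have h01 : ∀ n p, h p (cst n) = if (p:ℤ) ∣ n then 1 else 0 := by intro n p; rw [hh]; simp only [hit_cst, add_zero]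
  have hs := fun n => es_ge h (cst n) (fun p => by rw [h01]; split_ifs <;> simp) P.toList M
  have e : Ioc (N:ℤ) (2*N) = Ico ((N:ℤ)+1) ((N:ℤ)+1+N) := by ext x; simp only [mem_Ioc, mem_Ico]; omega
  have h3 : (((Ioc (N:ℤ) (2*N)).filter fun n => ¬ om P n ≤ M).card : ℝ) ≤ ∑ n ∈ Ico ((N:ℤ)+1) ((N:ℤ)+1+N), 1 * es h P.toList M (cst n) := by
    rw [e, ← nsmul_one, ]
    refine (card_nsmul_le_sum _ (fun n => 1 * es h P.toList M (cst n)) 1 ?_).trans (sum_le_sum_of_subset_of_nonneg (filter_subset _ _) fun n _ _ => by rw [one_mul]; exact (hs n).1)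
    intro n hn
    rw [one_mul]; refine (hs n).2 ?_
    rw [toList_sum_map, sum_congr rfl fun p _ => h01 n p]
    exact (not_le.1 (mem_filter.1 hn).2).le
  have hL0 : 0 ≤ L := by rw [hL]; exact sum_nonneg fun _ _ => by positivity
  refine h3.trans (h1.trans ?_)
  simp only [EE, List.prod_nil, Nat.cast_one, one_mul, mul_one]
  exact mul_le_mul (by linarith) h2 (ec_nonneg _ _ (fun p _ => by positivity) _) (by positivity)

lemma tailK (L K : ℝ) (hL : 0 < L) (hK : 1 ≤ K) (M : ℕ) (hM : 8 * (K * L) ≤ M) : L^M / M.factorial ≤ Real.exp (-(K*L) * Real.log K) := by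
  have h1 := pow_div_fact_le (K*L) (by positivity) M (by linarith)
  have hK0 : 0 < K := by linarith
  rw [mul_pow, mul_div_assoc] at h1
  have h2 : Real.exp (-(M:ℝ)) ≤ 1 := Real.exp_le_one_iff.2 (by linarith [Nat.cast_nonneg (α := ℝ) M])
  have h3 : L^M / M.factorial ≤ (K^M)⁻¹ := by
    rw [← one_div, le_div_iff₀' (by positivity)]; exact h1.trans h2
  refine h3.trans ?_
  rw [← Real.rpow_natCast, ← Real.rpow_neg hK0.le, Real.rpow_def_of_pos hK0]
  refine Real.exp_le_exp.2 ?_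
  have := Real.log_nonneg hK
  nlinarith [mul_pos hK0 hL]

lemma L_le (P : Finset ℕ) (Hn : ℕ) (hP : ∀ p ∈ P, Nat.Prime p ∧ p ≤ Hn) : ∑ p ∈ P, (1:ℝ)/p ≤ 1 + Real.log Hn := by
  have h1 := harmonic_le_one_add_log Hn
  rw [harmonic_eq_sum_Icc] at h1
  push_cast at h1
  refine le_trans ?_ h1
  simp only [one_div]
  exact sum_le_sum_of_subset_of_nonneg (fun p hp => mem_Icc.2 ⟨(hP p hp).1.pos, (hP p hp).2⟩) fun _ _ _ => by positivity

lemma row_eq (P : Finset ℕ) (L : ℝ) (hL : L = ∑ p ∈ P, (1:ℝ)/p) (n : ℤ) : ∑ p ∈ P, ub p n = om P n + L := by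
  simp only [ub, om, hL, sum_add_distrib]

lemma om_card (P : Finset ℕ) (n : ℤ) : om P n ≤ P.card := by
  rw [om, ← nsmul_one]
  exact sum_le_card_nsmul _ _ _ fun p _ => by split_ifs <;> norm_num

lemma logN_ge (N : ℕ) (l L K : ℝ) (hl : 0 < l) (hL : 0 < L) (hK : K ≤ Real.log N / (L * l^2)) : K * L * l^2 ≤ Real.log N := by
  rw [le_div_iff₀ (by positivity)] at hK; linarith

lemma pow_le_N (N : ℕ) (hN : 1 ≤ N) (Hn M : ℕ) (H : ℝ) (h1 : 1 ≤ Hn) (h : (Hn:ℝ) ≤ H) (h2 : M * Real.log H ≤ Real.log N) : (Hn:ℝ)^M ≤ N := by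
  have : (0:ℝ) < Hn := by exact_mod_cast h1
  refine (pow_le_pow_left₀ this.le h M).trans ?_
  have hH : 0 < H := by linarith
  rw [← Real.log_le_log_iff (by positivity) (by exact_mod_cast hN), Real.log_pow]; exact h2

lemma case_b (N : ℕ) (hN : 1 ≤ N) (H0 H : ℝ) (hH0 : 1 ≤ H0) (hH : H0 ≤ H) (hH3 : 3 ≤ H) (P : Finset ℕ) (hP : ∀ p ∈ P, Nat.Prime p ∧ H0 ≤ (p : ℝ) ∧ (p : ℝ) ≤ H)
    (L : ℝ) (hL : L = ∑ p ∈ P, (1 : ℝ) / p) (hLe : 1 ≤ L) (K : ℝ) (hK : 1 ≤ K) (hKN : K * L * (Real.log H)^2 ≤ Real.log N) (hc : 30 ≤ Real.log H) (hb : (Real.log H)^2 ≤ K * L) :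
    ∃ X ⊆ Ioc (N:ℤ) (2*N), (((Ioc (N:ℤ) (2*N)) \ X).card : ℝ) ≤ 2 * ((N:ℝ) / √H0) ∧ ∀ n ∈ X, ∑ p ∈ P, ub p n ≤ 24 * √(K*L) := by
  set lam := Real.log H with hlam
  set M := ⌈20*lam⌉₊ with hM
  have hM1 : 20 * lam ≤ M := Nat.le_ceil _
  have hM2 : (M:ℝ) < 20 * lam + 1 := Nat.ceil_lt_add_one (by linarith)
  have hP' : ∀ p ∈ P, Nat.Prime p ∧ p ≤ ⌊H⌋₊ := fun p hp => ⟨(hP p hp).1, Nat.le_floor (hP p hp).2.2⟩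
  have hHn1 : 1 ≤ ⌊H⌋₊ := Nat.le_floor (by push_cast; linarith)
  have hHn : (⌊H⌋₊:ℝ) ≤ H := Nat.floor_le (by linarith)
  have hL2 : L ≤ 1 + lam := by
    rw [hL]; refine (L_le P _ hP').trans ?_
    have := Real.log_le_log (by exact_mod_cast hHn1) hHn
    linarith
  have ht := tail P ⌊H⌋₊ hHn1 hP' L hL N M (pow_le_N N hN _ M H hHn1 hHn (by nlinarith [mul_le_mul_of_nonneg_right hb (sq_nonneg lam), pow_pos (by linarith : 0 < lam) 2, pow_pos (by linarith : 0 < lam) 3]))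
  have hs : lam ≤ √(K*L) := Real.le_sqrt_of_sq_le hb
  refine ⟨(Ioc (N:ℤ) (2*N)).filter fun n => om P n ≤ M, filter_subset _ _, ?_, fun n hn => ?_⟩
  · rw [← filter_not]
    refine ht.trans ?_
    rw [mul_assoc, mul_div_assoc', ← mul_div_assoc, mul_div_assoc]
    refine mul_le_mul_of_nonneg_left ?_ zero_le_two
    rw [mul_div_assoc]
    rw [div_eq_mul_inv (N:ℝ)]
    refine mul_le_mul_of_nonneg_left ?_ (Nat.cast_nonneg N)
    refine (pow_div_fact_le L (by linarith) M (by linarith)).trans ?_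
    rw [Real.exp_neg]
    refine inv_anti₀ (by positivity) ?_
    refine (Real.sqrt_le_sqrt hH).trans ?_
    have h1 : √H ≤ H := by rw [Real.sqrt_le_left (by linarith)]; nlinarith
    refine h1.trans ?_
    calc H = Real.exp lam := (Real.exp_log (by linarith)).symm
      _ ≤ _ := Real.exp_le_exp.2 (by linarith)
  · rw [row_eq P L hL]
    have := (mem_filter.1 hn).2
    linarith

set_option maxHeartbeats 1000000 in
lemma par (y lam lam0 : ℝ) (hy : 10^8 ≤ y) (hlam : lam = Real.exp y) (h0 : √lam * y^2 ≤ lam0) (h1 : lam0 ≤ lam) : y^10 ≤ lam ∧ y^7 ≤ lam0 ∧ ∃ l k d : ℕ,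
    Even l ∧ 2 ≤ l ∧ l * y ≤ lam0/500 ∧ (2*2^k*l:ℝ) ≤ lam/1200 ∧ lam/2400 ≤ (2*2^k*l:ℝ) ∧ (2*(2*2^k*(4*(5*d+2*(2*2^k))+1+2*(2*2^k))):ℝ) * y ≤ lam ∧ 1 ≤ d ∧ (d:ℝ) ≤ lam ∧
    (2*d+5)*y ≤ lam0/2 ∧ lam*y ≤ d*lam0 := by
  have hy0 : 0 < y := by linarith
  have hl0 : 0 < lam := by rw [hlam]; positivity
  have hA : y^10 ≤ lam := by
    have := Real.pow_div_factorial_le_exp y hy0.le 11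
    rw [← hlam, div_le_iff₀ (by positivity)] at this
    have e : ((Nat.factorial 11 : ℕ):ℝ) = 39916800 := by norm_num [Nat.factorial]
    rw [e] at this
    have : 39916800 * y^10 ≤ 39916800 * lam := by
      refine le_trans ?_ (this.trans (by linarith))
      rw [pow_succ' y 10]
      exact mul_le_mul_of_nonneg_right (by linarith) (by positivity)
    linarith
  have hB : y^7 ≤ lam0 := by
    refine le_trans ?_ h0
    have : y^5 ≤ √lam := Real.le_sqrt_of_sq_le (by rw [← pow_mul]; exact hA)
    calc y^7 = y^5*y^2 := by ring
      _ ≤ _ := mul_le_mul_of_nonneg_right this (by positivity)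
  have hC : lam * y^4 ≤ lam0^2 := by
    calc lam * y^4 = (√lam*y^2)^2 := by rw [mul_pow, Real.sq_sqrt hl0.le]; ring
      _ ≤ _ := pow_le_pow_left₀ (by positivity) h0 2
  have h00 : 0 < lam0 := lt_of_lt_of_le (by positivity) hB
  have hB1 : 10^40 * y ≤ lam0 := by
    refine le_trans ?_ hB
    calc 10^40 * y = (10^8)^5*y := by norm_num
      _ ≤ y^5 * y := by gcongr
      _ = y^6 * 1 := by ring
      _ ≤ y^6 * y := mul_le_mul_of_nonneg_left (by linarith) (by positivity)
      _ = y^7 := by ring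
  refine ⟨hA, hB, ?_⟩
  set q := ⌊lam0/(1000*y)⌋₊ with hq
  set x := lam0/(1000*y) with hx
  have hx1 : 10^10 ≤ x := by rw [hx, le_div_iff₀ (by positivity)]; linarith
  have hxe : x * (1000 * y) = lam0 := by rw [hx]; field_simp
  have hq1 : (q:ℝ) ≤ x := Nat.floor_le (by linarith)
  have hq2 : x < q + 1 := Nat.lt_floor_add_one x
  have hql : x/2 ≤ q := by linarith
  have hq0 : (1:ℝ) ≤ q := by linarith
  have hz : (1:ℝ) ≤ lam / (4800 * q) := by
    rw [one_le_div (by positivity)]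
    nlinarith
  obtain ⟨k, hk1, hk2⟩ := exists_nat_pow_near hz (one_lt_two)
  rw [le_div_iff₀ (by positivity)] at hk1
  rw [div_lt_iff₀ (by positivity), pow_succ] at hk2
  set u := lam*y/lam0 with hu
  have hu0 : 0 < u := by positivity
  have hue : u * lam0 = lam * y := by rw [hu]; field_simp
  have huy : y ≤ u := by rw [hu, le_div_iff₀ h00]; nlinarith
  have hd1 : u ≤ ⌈u⌉₊ := Nat.le_ceil _
  have hd2 : (⌈u⌉₊:ℝ) < u + 1 := Nat.ceil_lt_add_one (by linarith)
  have hu2 : u * y^3 ≤ lam0 := by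
    have : u * y^3 * lam0 ≤ lam0 * lam0 := by
      calc u * y^3 * lam0 = lam * y^4 := by rw [mul_right_comm, hue]; ring
        _ ≤ _ := by rw [← sq]; exact hC
    exact le_of_mul_le_mul_right this h00
  have hu3 : u^2*y ≤ lam / y := by
    rw [le_div_iff₀ hy0]
    have : u^2*y*y*lam0^2 ≤ lam * lam0^2 := by
      calc u^2*y*y*lam0^2 = lam * (lam * y^4) := by rw [show u^2*y*y*lam0^2 = (u*lam0)^2*y^2 by ring, hue]; ring
        _ ≤ _ := mul_le_mul_of_nonneg_left hC hl0.le
    exact le_of_mul_le_mul_right this (by positivity)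
  have hnb : (2*2^k:ℝ) ≤ u := by
    rw [hu, le_div_iff₀ h00, ← hxe]
    have h2 : (2:ℝ)^k * x ≤ 2^k * (2*q) := mul_le_mul_of_nonneg_left (by linarith) (by positivity)
    have : (2:ℝ)^k * x * 2400 ≤ lam := by linarith
    nlinarith
  refine ⟨2*q, k, ⌈u⌉₊, even_two_mul q, ?_, ?_, ?_, ?_, ?_, ?_, ?_, ?_, ?_⟩
  · have : 1 ≤ q := by exact_mod_cast hq0
    omega
  · push_cast; nlinarith
  · push_cast; linarith
  · push_cast; linarith
  · have h3 : (2*(2*2^k*(4*(5*⌈u⌉₊+2*(2*2^k))+1+2*(2*2^k))):ℝ) ≤ 2*(u*(4*(5*(2*u)+2*u)+u+2*u)) := by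
      have : (⌈u⌉₊:ℝ) ≤ 2*u := by linarith
      gcongr; linarith
    have h4 : lam/y ≤ lam/102 := by gcongr; linarith
    nlinarith
  · exact Nat.one_le_iff_ne_zero.2 (Nat.ceil_pos.2 (by linarith)).ne'
  · have : u * y^3 ≤ lam := hu2.trans h1
    linarith [mul_le_mul_of_nonneg_left (show (2:ℝ) ≤ y^3 from le_trans (by norm_num) (pow_le_pow_left₀ (by norm_num) hy 3)) (by linarith : 0 ≤ u)]
  · have h5 : (2*(⌈u⌉₊:ℝ)+5)*y ≤ 9*u*y := mul_le_mul_of_nonneg_right (by linarith) hy0.le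
    have h6 : u*y*18 ≤ u*y*y^2 := mul_le_mul_of_nonneg_left (by nlinarith only [hy]) (by positivity)
    linarith [show u*y*y^2 = u*y^3 by ring]
  · rw [← hue]; exact mul_le_mul_of_nonneg_right hd1 h00.le

lemma p_big (y lam lam0 L : ℝ) (hy : 10^8 ≤ y) (hlam : lam = Real.exp y) (hly : y ≤ lam) (mm d : ℕ) (r : ℝ) (hr0 : 0 ≤ r) (hr : r ≤ 3*lam) (hmm : (mm:ℝ) ≤ lam/1200) (hL0 : 0 ≤ L) (hL : L ≤ 2*lam) (hd1 : 1 ≤ d) (hd : (d:ℝ) ≤ lam)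
    (hdy : (2*d+5)*y ≤ lam0/2) (hdl : lam*y ≤ d*lam0) : (mm:ℝ)^mm * (L^mm * (r * (10 * mm * (d+1)^2 * (d.factorial * (mm:ℝ)^d) / Real.exp lam0))^d) ≤ 1 := by
  have hp : ∀ n : ℕ, lam^n = Real.exp (n*y) := fun n => by rw [hlam, ← Real.exp_nat_mul]
  have hl0 : 0 < lam := by linarith
  have hd1' : (1:ℝ) ≤ d := by exact_mod_cast hd1
  have h1 : r * (10 * mm * (d+1)^2 * (d.factorial * (mm:ℝ)^d) / Real.exp lam0) ≤ Real.exp (-lam0/2) := by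
    have hf : (d.factorial:ℝ) ≤ lam^d := by
      refine le_trans (by exact_mod_cast Nat.factorial_le_pow d) (pow_le_pow_left₀ (by positivity) hd d)
    have hm : (mm:ℝ)^d ≤ lam^d := pow_le_pow_left₀ (by positivity) (by linarith) d
    have hmm' : (mm:ℝ) ≤ lam := by linarith
    have e1 : r * (10 * mm * (d+1)^2 * (d.factorial * (mm:ℝ)^d)) ≤ (3*lam)*(10*lam*(2*lam)^2*(lam^d*lam^d)) := by
      have : (d:ℝ)+1 ≤ 2*lam := by linarith
      gcongr
    have e2 : (3*lam)*(10*lam*(2*lam)^2*(lam^d*lam^d)) ≤ lam^(2*d+5) := by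
      calc (3*lam)*(10*lam*(2*lam)^2*(lam^d*lam^d)) = 120 * lam^(2*d+4) := by ring
        _ ≤ lam * lam^(2*d+4) := by gcongr; linarith
        _ = _ := by ring
    rw [← mul_div_assoc, div_le_iff₀ (Real.exp_pos _), ← Real.exp_add]
    refine (e1.trans e2).trans ?_
    rw [hp]; refine Real.exp_le_exp.2 ?_
    push_cast; linarith
  have h2 := pow_le_pow_left₀ (by positivity) h1 d
  have h3 : (mm:ℝ)^mm ≤ lam^mm := pow_le_pow_left₀ (by positivity) (by linarith) mm
  have h4 : L^mm ≤ (lam^2)^mm := pow_le_pow_left₀ (by positivity) (by nlinarith) mm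
  calc _ ≤ lam^mm * ((lam^2)^mm * Real.exp (-lam0/2)^d) := by gcongr
    _ = lam^(3*mm) * Real.exp (-lam0/2)^d := by ring
    _ = Real.exp (3*mm*y + d*(-lam0/2)) := by rw [hp, ← Real.exp_nat_mul, ← Real.exp_add]; push_cast; rfl
    _ ≤ 1 := Real.exp_le_one_iff.2 (by nlinarith)

lemma p_B1 (lam lam0 L N Hn C : ℝ) (hC : C = Real.exp 12000) (hlam : 10 ≤ lam) (h0 : lam0 ≤ lam) (hN : 0 ≤ N) (hH0 : 0 ≤ Hn) (hH : Hn ≤ Real.exp lam) (l nb mm e : ℕ) (hl : (l:ℝ) ≤ lam) (hmm : mm = nb*l) (hm : lam/2400 ≤ (mm:ℝ))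
    (hm2 : (mm:ℝ)^e ≤ Real.exp lam) :
    3 * Hn * (2^l * (2 * (N * 12000^mm * (mm:ℝ)^e * √L^mm))) ≤ N/√(Real.exp lam0) * ((12000*C*√L)^l)^nb := by
  rw [← pow_mul, mul_comm l nb, ← hmm, mul_pow, mul_pow]
  have h2 : (2:ℝ)^l ≤ Real.exp lam := by
    calc (2:ℝ)^l ≤ (Real.exp 1)^l := pow_le_pow_left₀ (by norm_num) (by linarith [Real.add_one_le_exp (1:ℝ)]) l
      _ = Real.exp l := by rw [← Real.exp_nat_mul, mul_one]
      _ ≤ _ := Real.exp_le_exp.2 hl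
  have h3 : √(Real.exp lam0) ≤ Real.exp lam := by
    rw [Real.sqrt_le_left (by positivity), sq, ← Real.exp_add]; exact Real.exp_le_exp.2 (by linarith)
  have h6 : (6:ℝ) ≤ Real.exp lam := by linarith [Real.add_one_le_exp lam]
  have h5 : Real.exp (5*lam) ≤ C^mm := by
    rw [hC, ← Real.exp_nat_mul]; exact Real.exp_le_exp.2 (by linarith)
  rw [div_mul_eq_mul_div, le_div_iff₀ (by positivity)]
  calc _ = 6 * Hn * 2^l * (mm:ℝ)^e * √(Real.exp lam0) * (N*12000^mm*√L^mm) := by ring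
    _ ≤ Real.exp lam * Real.exp lam * Real.exp lam * Real.exp lam * Real.exp lam * (N*12000^mm*√L^mm) := by gcongr
    _ = Real.exp (5*lam) * (N*12000^mm*√L^mm) := by rw [← Real.exp_add, ← Real.exp_add, ← Real.exp_add, ← Real.exp_add]; ring_nf
    _ ≤ C^mm * (N*12000^mm*√L^mm) := by gcongr
    _ = _ := by ring

lemma p_B2 (y lam lam0 L N g : ℝ) (hy : 10^8 ≤ y) (hlam : lam = Real.exp y) (hly : y ≤ lam) (h0 : 10^4*y ≤ lam0) (hN : 0 ≤ N) (hg0 : 0 ≤ g) (hg : g ≤ lam) (l : ℕ) (hl : (l:ℝ) ≤ lam) (hly2 : l * y ≤ lam0/500) (hL1 : 1 ≤ L) (hL : L ≤ 2*lam) :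
    l * (2^l * (900 * N * ((2*L)^l * (l * ((2 + g + 2*L)/Real.exp lam0))))) ≤ N/√(Real.exp lam0) * Real.exp (-lam0/4) := by
  have hp : ∀ n : ℕ, lam^n = Real.exp (n*y) := fun n => by rw [hlam, ← Real.exp_nat_mul]
  have e : √(Real.exp lam0) = Real.exp (lam0/2) := by
    rw [Real.sqrt_eq_iff_mul_self_eq (by positivity) (by positivity), ← Real.exp_add]; ring_nf
  have hl0 : 0 < lam := by linarith
  rw [e, div_mul_eq_mul_div, le_div_iff₀ (by positivity)]
  have h1 : (4*L)^l ≤ (lam^2)^l := pow_le_pow_left₀ (by positivity) (by nlinarith) l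
  have h2 : 900*((l:ℝ)*l*(2+g+2*L)) ≤ lam^4 := by
    calc 900*((l:ℝ)*l*(2+g+2*L)) ≤ 900*(lam*lam*(6*lam)) := by
          have : 2+g+2*L ≤ 6*lam := by linarith
          gcongr
      _ = 5400 * lam^3 := by ring
      _ ≤ lam * lam^3 := by gcongr; linarith
      _ = _ := by ring
  have h3 : (4*L)^l * (900*((l:ℝ)*l*(2+g+2*L))) ≤ Real.exp (lam0/4) := by
    calc _ ≤ (lam^2)^l * lam^4 := by
          refine mul_le_mul_of_nonneg h1 h2 (by positivity) (by positivity)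
      _ = lam^(2*l+4) := by ring
      _ ≤ _ := by rw [hp]; refine Real.exp_le_exp.2 ?_; push_cast; linarith
  calc _ = N * ((4*L)^l * (900*((l:ℝ)*l*(2+g+2*L)))) * (Real.exp (lam0/2) / Real.exp lam0) := by rw [show (4*L)^l = 2^l*(2*L)^l by rw [← mul_pow]; ring_nf]; ring
    _ ≤ N * Real.exp (lam0/4) * (Real.exp (lam0/2) / Real.exp lam0) := by gcongr
    _ = _ := by rw [← Real.exp_sub, mul_assoc, ← Real.exp_add]; ring_nf

lemma p_fin (y lam lam0 L S C : ℝ) (hC : 8 ≤ C) (hy : 10^8 ≤ y) (hlam : lam = Real.exp y) (hly : y ≤ lam) (h0 : 10^4*y ≤ lam0) (l : ℕ) (hl2 : 2 ≤ l) (hl : (l:ℝ) ≤ lam) (hly2 : l * y ≤ lam0/500) (hL1 : 1 ≤ L) (hLS : L ≤ S) (hS : S ≤ 40*lam^2) :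
    2^l * (C*√L)^l + 2*(4*√S)^l + l * (6*S)^l * √(2^l * (5 * S^(l+1)) * Real.exp (-lam0/4)) ≤ (8*C*√S/2)^l := by
  have hp : ∀ n : ℕ, lam^n = Real.exp (n*y) := fun n => by rw [hlam, ← Real.exp_nat_mul]
  have hl0 : 0 < lam := by linarith
  have hS0 : 0 ≤ S := by linarith
  have hS1 : 1 ≤ √S := Real.one_le_sqrt.2 (by linarith)
  set R := (2*C*√S)^l with hR
  have hR1 : 1 ≤ R := one_le_pow₀ (by nlinarith)
  have e1 : 4 * R ≤ (8*C*√S/2)^l := by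
    rw [show 8*C*√S/2 = 2*(2*C*√S) by ring, mul_pow 2]
    refine mul_le_mul_of_nonneg_right ?_ (by linarith)
    calc (4:ℝ) = 2^2 := by norm_num
      _ ≤ 2^l := pow_le_pow_right₀ (by norm_num) hl2
  have e2 : 2^l * (C*√L)^l ≤ R := by
    rw [← mul_pow]; refine pow_le_pow_left₀ (by positivity) ?_ l
    rw [mul_assoc]; gcongr
  have e3 : (4*√S)^l ≤ R := pow_le_pow_left₀ (by positivity) (by nlinarith) l
  have hS3 : 6*S ≤ lam^3 := by nlinarith [pow_pos hl0 2]
  have e4 : l * (6*S)^l * √(2^l * (5 * S^(l+1)) * Real.exp (-lam0/4)) ≤ 1 := by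
    have h1 : l * (6*S)^l ≤ lam^(3*l+1) := by
      calc l * (6*S)^l ≤ lam * (lam^3)^l := by gcongr
        _ = _ := by ring
    have h2 : (2:ℝ)^l * (5 * S^(l+1)) ≤ lam^(3*l+3) := by
      calc (2:ℝ)^l * (5 * S^(l+1)) = (2*S)^l * (5*S) := by ring
        _ ≤ (lam^3)^l * lam^3 := by gcongr <;> linarith
        _ = _ := by ring
    have h3 : √(2^l * (5 * S^(l+1)) * Real.exp (-lam0/4)) ≤ Real.exp (-((3*l+1)*y)) := by
      rw [Real.sqrt_le_left (by positivity), ← Real.exp_nat_mul]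
      refine (mul_le_mul_of_nonneg_right h2 (by positivity)).trans ?_
      rw [hp, ← Real.exp_add]; refine Real.exp_le_exp.2 ?_; push_cast; linarith
    calc _ ≤ lam^(3*l+1) * Real.exp (-((3*l+1)*y)) := by gcongr
      _ = 1 := by rw [hp, ← Real.exp_add, Real.exp_eq_one_iff]; push_cast; ring
  linarith

set_option maxHeartbeats 2000000 in
lemma main_c (N : ℕ) (hN : 1 ≤ N) (H0 H : ℝ) (hH0 : 1 ≤ H0) (hH : H0 ≤ H) (hH3 : 3 ≤ H) (hll : √(Real.log H) * (Real.log (Real.log H))^2 ≤ Real.log H0)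
    (P : Finset ℕ) (hP : ∀ p ∈ P, Nat.Prime p ∧ H0 ≤ (p : ℝ) ∧ (p : ℝ) ≤ H)
    (L : ℝ) (hL : L = ∑ p ∈ P, (1 : ℝ) / p) (hLe : 1 ≤ L) (K : ℝ) (hK : 1 ≤ K) (hKN : K * L * (Real.log H)^2 ≤ Real.log N) (hc : 10^8 ≤ Real.log (Real.log H)) (hb : K * L < (Real.log H)^2) (C : ℝ) (hC : C = Real.exp 12000) (a : ℤ) :
    ∃ Z ⊆ Ioc (N:ℤ) (2*N), (Z.card:ℝ) ≤ 2*(N/√H0) ∧ ∀ g : ℤ → ℝ, (∀ n, g n ≠ 0 → n ∈ Ioc (N:ℤ) (2*N) ∧ om P n ≤ ⌈8*(K*L)⌉₊ ∧ n ∉ Z) →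
      |Qa (Ioc (N:ℤ) (2*N)) a P g| ≤ (1440000 * C * √(K*L)) * ∑ n ∈ Ioc (N:ℤ) (2*N), g n^2 := by
  have hl0 : 0 < Real.log H := Real.log_pos (by linarith)
  set lam := Real.log H with hlam
  set y := Real.log lam with hy
  have hlamy : lam = Real.exp y := (Real.exp_log hl0).symm
  set lam0 := Real.log H0 with hlam0
  have hH0e : H0 = Real.exp lam0 := (Real.exp_log (by linarith)).symm
  have hHe : H = Real.exp lam := (Real.exp_log (by linarith)).symm
  have h01 : lam0 ≤ lam := Real.log_le_log (by linarith) hH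
  obtain ⟨hA, hB, l, k, d, hev, hl2, hly2, hm1, hm2, hey, hd1, hdl, hdy, hdd⟩ := par y lam lam0 hc hlamy hll h01
  have hly : y ≤ lam := by linarith [Real.add_one_le_exp y]
  have h0y : 10^4*y ≤ lam0 := by
    refine le_trans ?_ hB
    calc 10^4*y ≤ (10^8)^6*y := mul_le_mul_of_nonneg_right (by norm_num) (by linarith)
      _ ≤ y^6*y := by gcongr
      _ = _ := by ring
  set M := ⌈8*(K*L)⌉₊ with hM
  have hKL : 1 ≤ K*L := by nlinarith only [hK, hLe]
  have hMl : 8*(K*L) ≤ M := Nat.le_ceil _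
  have hMu : (M:ℝ) ≤ 9*(K*L) := by linarith [Nat.ceil_lt_add_one (by linarith : 0 ≤ 8*(K*L))]
  have hP' : ∀ p ∈ P, Nat.Prime p ∧ p ≤ ⌊H⌋₊ := fun p hp => ⟨(hP p hp).1, Nat.le_floor (hP p hp).2.2⟩
  have hH0b : 10^8 ≤ H0 := by linarith [Real.add_one_le_exp lam0]
  have hP2 : ∀ p ∈ P, Nat.Prime p ∧ Odd p ∧ H0 ≤ (p:ℝ) ∧ p ≤ ⌊H⌋₊ := fun p hp => ⟨(hP p hp).1, (hP p hp).1.odd_of_ne_two (by rintro rfl; have := (hP 2 hp).2.1; norm_num at this; linarith), (hP p hp).2.1, (hP' p hp).2⟩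
  have hHn16 : 16 ≤ ⌊H⌋₊ := Nat.le_floor (by push_cast; linarith)
  have hHn : (⌊H⌋₊:ℝ) ≤ H := Nat.floor_le (by linarith)
  set Hn := ⌊H⌋₊
  have hHn0 : (0:ℝ) < Hn := by exact_mod_cast (by omega : 0 < Hn)
  have hlHn : Real.log Hn ≤ lam := Real.log_le_log hHn0 hHn
  have hL2 : L ≤ 2*lam := by
    have := L_le P _ hP'
    rw [← hL] at this; linarith
  have hl0' : (l:ℝ) ≤ lam - 1 := by nlinarith only [hly2, hc, h01, hly, Nat.cast_nonneg (α := ℝ) l]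
  set mm := 2*2^k*l with hmm
  have hmc : (mm:ℝ) = 2*2^k*l := by rw [hmm]; push_cast; ring
  rw [← hmc] at hm1 hm2
  have hmm1 : 1 ≤ mm := by
    have : (0:ℝ) < mm := by linarith
    exact_mod_cast this
  have hmm1' : (1:ℝ) ≤ mm := by exact_mod_cast hmm1
  have h3 : 3*y ≤ lam0 := by linarith
  have hcube : lam^3 ≤ H0 := by
    rw [hlamy, ← Real.exp_nat_mul, hH0e]; exact Real.exp_le_exp.2 (by push_cast; exact h3)
  have hpow2 : ∀ x : ℝ, 0 ≤ x → Real.exp x ≤ 2^⌈2*x⌉₊ := by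
    intro x hx
    have h := Nat.le_ceil (2*x)
    calc Real.exp x ≤ Real.exp (⌈2*x⌉₊ * Real.log 2) := Real.exp_le_exp.2 (by nlinarith only [h, hx, Real.log_two_gt_d9])
      _ = _ := by rw [Real.exp_nat_mul, Real.exp_log two_pos]
  have hexp : lam < Real.exp lam := by linarith [Real.add_one_le_exp lam]
  have hr3 : ((⌈2*lam⌉₊:ℕ):ℝ) ≤ 3*lam := by linarith [Nat.ceil_lt_add_one (by linarith : 0 ≤ 2*lam)]
  have hQ5 : ((⌈2*(2*lam)⌉₊:ℕ):ℝ) ≤ 5*lam := by linarith [Nat.ceil_lt_add_one (by linarith : 0 ≤ 2*(2*lam))]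
  have hsM : √M ≤ 3*lam := by
    rw [Real.sqrt_le_left (by positivity)]; nlinarith only [hMu, hb]
  have hbig := p_big y lam lam0 L hc hlamy hly mm d (⌈2*lam⌉₊:ℕ) (Nat.cast_nonneg _) hr3 hm1 (by linarith) hL2 hd1 hdl hdy hdd
  rw [← hH0e] at hbig
  have hNb : (Hn:ℝ)^(4*(mm + 16*((mm+1)*M))) ≤ N := by
    refine pow_le_N N hN Hn _ H (by omega) hHn (le_trans ?_ hKN)
    rw [sq, ← mul_assoc (K*L)]
    refine mul_le_mul_of_nonneg_right ?_ hl0.le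
    push_cast
    calc 4*((mm:ℝ) + 16*((mm+1)*M)) ≤ 4*((mm:ℝ)*(K*L) + 16*((mm+mm)*(9*(K*L)))) := by gcongr; exact le_mul_of_one_le_right (by linarith) hKL
      _ = 1156*(K*L)*mm := by ring
      _ ≤ 1156*(K*L)*(lam/1200) := by gcongr
      _ ≤ _ := by nlinarith only [hKL, hl0]
  have hav := havg P H0 (by linarith) Hn hHn16 hP2 ⌈2*lam⌉₊ (by
      calc (Hn:ℝ) ≤ Real.exp lam := by rw [← hHe]; exact hHn
        _ ≤ 2^⌈2*lam⌉₊ := hpow2 lam hl0.le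
        _ < H0 * 2^⌈2*lam⌉₊ := lt_mul_of_one_lt_left (by positivity) (by linarith))
    L hL hLe l k d mm hmm1 hmm ⌈2*(2*lam)⌉₊ (by
      have : (mm:ℝ)*Hn < 2^⌈2*(2*lam)⌉₊ := by
        refine lt_of_lt_of_le ?_ (hpow2 (2*lam) (by linarith))
        rw [two_mul, Real.exp_add]
        exact mul_lt_mul (by linarith) (by rw [← hHe]; exact hHn) hHn0 (by positivity)
      exact_mod_cast this) (by
      refine le_trans ?_ hcube
      calc ((mm:ℝ)+1)*(⌈2*(2*lam)⌉₊:ℕ) ≤ lam*(5*lam) := by gcongr; linarith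
        _ = 5 * lam^2 := by ring
        _ ≤ lam*lam^2 := by gcongr; linarith
        _ = _ := by ring) hbig M (by nlinarith only [hMl, hK, hLe]) (by
      refine le_trans ?_ hcube
      calc ((mm:ℝ)+1)*√M ≤ lam*(3*lam) := by gcongr; linarith
        _ = 3 * lam^2 := by ring
        _ ≤ lam*lam^2 := by gcongr; linarith
        _ = _ := by ring) N hNb a
  set e := 2*(2*2^k*(4*(5*d+2*(2*2^k))+1+2*(2*2^k))) with he
  have hme : (mm:ℝ)^e ≤ Real.exp lam := by
    calc (mm:ℝ)^e ≤ lam^e := pow_le_pow_left₀ (by positivity) (by linarith) e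
      _ = Real.exp (e*y) := by rw [hlamy, ← Real.exp_nat_mul]
      _ ≤ _ := Real.exp_le_exp.2 (by rw [he]; push_cast; exact hey)
  have hC1 : 1 ≤ C := by rw [hC]; exact Real.one_le_exp (by norm_num)
  have hS : (M:ℝ)+M+L ≤ 19*(K*L) + (K*L) := by nlinarith only [hMu, hK, hLe]
  have hM1 : 1 ≤ M := by
    have : (1:ℝ) ≤ M := by linarith
    exact_mod_cast this
  have hlr : (l:ℝ) ≤ lam := by linarith
  obtain ⟨Z, hZ1, hZ2, hZ3⟩ := half P a H0 hH0 Hn (by omega) hP2 N hN M M hM1 l hev (by omega) (by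
      have : (Hn:ℝ)^(l+1) ≤ N := by
        refine pow_le_N N hN Hn _ H (by omega) hHn (le_trans ?_ hKN)
        push_cast; nlinarith only [hl0', hl0, hKL, mul_pos hl0 hl0]
      exact_mod_cast this) L hL hLe k _ (by positivity) hav ((12000*C*√L)^l) (Real.exp (-lam0/4)) (8*(12000*C)*√((M:ℝ)+M+L)) (N/√H0) (N/√H0)
      (by positivity) (by positivity) (by positivity)
      (by rw [hH0e]; exact p_B1 lam lam0 L N Hn C hC (by linarith) h01 (by positivity) hHn0.le (by rw [← hHe]; exact hHn) l (2*2^k) mm e hlr hmm hm2 hme)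
      (by rw [hH0e]; exact p_B2 y lam lam0 L N (Real.log Hn) hc hlamy hly h0y (by positivity) (Real.log_natCast_nonneg _) hlHn l hlr hly2 hLe hL2)
      (p_fin y lam lam0 L _ (12000*C) (by linarith) hc hlamy hly h0y l hl2 hlr hly2 hLe (by linarith) (by linarith))
  refine ⟨Z, hZ1, by linarith, fun g hg => (hZ3 g hg).trans ?_⟩
  refine mul_le_mul_of_nonneg_right ?_ (sum_nonneg fun _ _ => sq_nonneg _)
  have h5 : √((M:ℝ)+M+L) ≤ 5*√(K*L) := by
    rw [Real.sqrt_le_left (by positivity), mul_pow, Real.sq_sqrt (by linarith)]; linarith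
  calc 3*(8*(12000*C)*√((M:ℝ)+M+L)) ≤ 3*(8*(12000*C)*(5*√(K*L))) := by gcongr
    _ = _ := by ring

theorem main_theorem_local_expansion :
    ∃ C : ℝ, 0 < C ∧
      ∀ (N : ℕ) (H0 H : ℝ), 1 ≤ N → 1 ≤ H0 → H0 ≤ H → 3 ≤ H →
        Real.sqrt (Real.log H) * (Real.log (Real.log H)) ^ 2 ≤ Real.log H0 →
        ∀ NN : Finset ℤ, NN = Finset.Ioc (N : ℤ) (2 * N) →
        ∀ P : Finset ℕ, (∀ p ∈ P, Nat.Prime p ∧ H0 ≤ (p : ℝ) ∧ (p : ℝ) ≤ H) →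
        ∀ L : ℝ, L = ∑ p ∈ P, (1 : ℝ) / p →
        Real.exp 1 ≤ L →
        Real.log H ≤ Real.sqrt (Real.log N / L) →
        ∀ A : ({n : ℤ // n ∈ NN} → ℂ) →ₗ[ℂ] ({n : ℤ // n ∈ NN} → ℂ),
        (∀ (f : {n : ℤ // n ∈ NN} → ℂ) (n : {n : ℤ // n ∈ NN}),
          A f n = ∑ p ∈ P,
            ((if (p : ℤ) ∣ (n : ℤ) then (1 : ℂ) else 0) - 1 / (p : ℂ)) *
              ((if h : (n : ℤ) + (p : ℤ) ∈ NN then f ⟨(n : ℤ) + (p : ℤ), h⟩ else 0) +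
               (if h : (n : ℤ) - (p : ℤ) ∈ NN then f ⟨(n : ℤ) - (p : ℤ), h⟩ else 0))) →
        ∀ K : ℝ, 1 ≤ K → K ≤ Real.log N / (L * (Real.log H) ^ 2) →
        ∃ X ⊆ NN,
          ((NN \ X).card : ℝ) ≤
            C * ((N : ℝ) * Real.exp (-(K * L) * Real.log K) + (N : ℝ) / Real.sqrt H0) ∧
          ∀ γ : ℝ, ∀ f : {n : ℤ // n ∈ NN} → ℂ, f ≠ 0 →
            (fun n : {n : ℤ // n ∈ NN} =>
                if (n : ℤ) ∈ X then
                  A (fun m : {n : ℤ // n ∈ NN} => if (m : ℤ) ∈ X then f m else 0) n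
                else 0) = (γ : ℂ) • f →
            |γ| ≤ C * Real.sqrt (K * L) := by
  obtain ⟨D, hD⟩ : ∃ D : ℝ, D = Real.exp 12000 := ⟨_, rfl⟩
  obtain ⟨E, hE⟩ : ∃ E : ℝ, E = Real.exp (Real.exp (10^8)) := ⟨_, rfl⟩
  have hD1 : 1 ≤ D := by rw [hD]; exact Real.one_le_exp (by norm_num)
  have hE1 : 1 ≤ E := by rw [hE]; exact Real.one_le_exp (by positivity)
  refine ⟨2880000*D + 8*E, by positivity, ?_⟩
  intro N H0 H hN hH0 hH hH3 hll NN hNN P hP L hL hLe _ A hA K hK hKN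
  have hl0 : 0 < Real.log H := Real.log_pos (by linarith)
  have hL1 : 1 ≤ L := by linarith [Real.add_one_le_exp (1:ℝ)]
  have hKN' := logN_ge N (Real.log H) L K hl0 (by linarith) hKN
  have hKL : 1 ≤ K*L := by nlinarith only [hK, hL1]
  have hs1 : 1 ≤ √(K*L) := Real.one_le_sqrt.2 hKL
  set e1 := (N:ℝ) * Real.exp (-(K * L) * Real.log K) with he1
  set e2 := (N:ℝ) / √H0 with he2
  have p1 : 0 ≤ e1 := by positivity
  have p2 : 0 ≤ e2 := by positivity
  have q1 : 0 ≤ D * e1 := by positivity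
  have q2 : 0 ≤ E * e2 := by positivity
  have q3 : 0 ≤ D * √(K*L) := by positivity
  have q4 : 0 ≤ E * √(K*L) := by positivity
  have r1 : e1 ≤ D * e1 := le_mul_of_one_le_left p1 hD1
  have r2 : e2 ≤ D * e2 := le_mul_of_one_le_left p2 hD1
  have r3 : 0 ≤ E * e1 := by positivity
  have r4 : √(K*L) ≤ D * √(K*L) := le_mul_of_one_le_left (by linarith) hD1
  have red : ∀ X ⊆ NN, (∀ γ : ℝ, ∀ g : ℤ → ℝ, (∃ n, g n ≠ 0) → (∀ n, g n ≠ 0 → n ∈ X) → (∀ n ∈ X, γ * g n = ∑ p ∈ P, wtb false p n * (g (n+p) + g (n-p))) → |γ| ≤ (2880000*D + 8*E) * √(K*L)) →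
      ∀ γ : ℝ, ∀ f : {n : ℤ // n ∈ NN} → ℂ, f ≠ 0 →
            (fun n : {n : ℤ // n ∈ NN} =>
                if (n : ℤ) ∈ X then
                  A (fun m : {n : ℤ // n ∈ NN} => if (m : ℤ) ∈ X then f m else 0) n
                else 0) = (γ : ℂ) • f →
            |γ| ≤ (2880000*D + 8*E) * √(K*L) := by
    intro X hX h γ f hf he
    by_cases hγ : γ = 0
    · rw [hγ, abs_zero]; positivity
    · obtain ⟨g, h1, h2, h3⟩ := eig0 NN X hX P A hA γ hγ f hf he
      exact h γ g h1 h2 h3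
  by_cases c1 : 10^8 ≤ Real.log (Real.log H)
  · have hlam : 10^8 ≤ Real.log H := by
      have := Real.add_one_le_exp (Real.log (Real.log H))
      rw [Real.exp_log hl0] at this; linarith
    by_cases c2 : (Real.log H)^2 ≤ K*L
    · obtain ⟨X, hX, hX1, hX2⟩ := case_b N hN H0 H hH0 hH hH3 P hP L hL hL1 K hK hKN' (by linarith) c2
      rw [← hNN] at hX hX1
      refine ⟨X, hX, by linarith, red X hX fun γ g h1 h2 h3 => ?_⟩
      linarith [eig_row X P γ g h1 h2 h3 _ hX2]
    · have hm := main_c N hN H0 H hH0 hH hH3 hll P hP L hL hL1 K hK hKN' c1 (not_le.1 c2) D hD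
      obtain ⟨Z0, hZ0, hc0, hg0⟩ := hm 0
      obtain ⟨Z1, hZ1, hc1, hg1⟩ := hm 1
      rw [← hNN] at hZ0 hg0 hZ1 hg1
      set M := ⌈8*(K*L)⌉₊ with hM
      have hMl : 8*(K*L) ≤ M := Nat.le_ceil _
      have hMu : (M:ℝ) ≤ 9*(K*L) := by linarith [Nat.ceil_lt_add_one (by linarith : 0 ≤ 8*(K*L))]
      have hHn1 : 1 ≤ ⌊H⌋₊ := Nat.le_floor (by push_cast; linarith)
      have ht := tail P ⌊H⌋₊ hHn1 (fun p hp => ⟨(hP p hp).1, Nat.le_floor (hP p hp).2.2⟩) L hL N M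
        (pow_le_N N hN _ M H hHn1 (Nat.floor_le (by linarith)) (le_trans (by
          rw [sq, ← mul_assoc (K*L)]
          refine mul_le_mul_of_nonneg_right ?_ hl0.le
          nlinarith only [hMu, hKL, hlam]) hKN'))
      rw [← hNN] at ht
      have ht2 : (2 * N * (L^M / M.factorial):ℝ) ≤ 2*e1 := by
        rw [he1, mul_assoc]; gcongr; exact tailK L K (by linarith) hK M hMl
      have hX : (NN.filter fun n => om P n ≤ M) \ (Z0 ∪ Z1) ⊆ NN := sdiff_subset.trans (filter_subset _ _)
      refine ⟨(NN.filter fun n => om P n ≤ M) \ (Z0 ∪ Z1), hX, ?_, red _ hX fun γ g h1 h2 h3 => ?_⟩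
      · have : ((NN \ ((NN.filter fun n => om P n ≤ M) \ (Z0 ∪ Z1))).card) ≤ (NN.filter fun n => ¬ om P n ≤ M).card + (Z0.card + Z1.card) := by
          refine (card_le_card ?_).trans ((card_union_le _ _).trans (Nat.add_le_add_left (card_union_le Z0 Z1) _))
          intro n hn
          simp only [mem_sdiff, mem_filter, mem_union] at hn ⊢
          tauto
        have : ((NN \ ((NN.filter fun n => om P n ≤ M) \ (Z0 ∪ Z1))).card : ℝ) ≤ (NN.filter fun n => ¬ om P n ≤ M).card + (Z0.card + Z1.card) := by exact_mod_cast this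
        linarith
      · have hh := fun n hn => mem_sdiff.1 (h2 n hn)
        have := eig_qf NN _ hX P γ g h1 h2 h3 _
          (hg0 g fun n hn => ⟨(mem_filter.1 (hh n hn).1).1, (mem_filter.1 (hh n hn).1).2, fun h => (hh n hn).2 (mem_union_left _ h)⟩)
          (hg1 g fun n hn => ⟨(mem_filter.1 (hh n hn).1).1, (mem_filter.1 (hh n hn).1).2, fun h => (hh n hn).2 (mem_union_right _ h)⟩)
        linarith
  · refine ⟨NN, Subset.rfl, ?_, red NN Subset.rfl fun γ g h1 h2 h3 => ?_⟩
    · rw [Finset.sdiff_self, card_empty, Nat.cast_zero]; positivity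
    · have hHE : H ≤ E := by
        have h1 := (Real.log_lt_iff_lt_exp hl0).1 (not_le.1 c1)
        rw [hE]; exact ((Real.log_lt_iff_lt_exp (by linarith)).1 h1).le
      have hc : (P.card:ℝ) ≤ E := by
        have h1 : P ⊆ Icc 1 ⌊H⌋₊ := fun p hp => mem_Icc.2 ⟨(hP p hp).1.pos, Nat.le_floor (hP p hp).2.2⟩
        have h2 := card_le_card h1
        rw [Nat.card_Icc, Nat.add_sub_cancel] at h2
        have h3 : (P.card:ℝ) ≤ ⌊H⌋₊ := by exact_mod_cast h2
        exact h3.trans ((Nat.floor_le (by linarith)).trans hHE)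
      have hLc : L ≤ P.card := by
        rw [hL, ← nsmul_one]
        refine sum_le_card_nsmul _ _ _ fun p hp => ?_
        rw [div_le_one (by exact_mod_cast (hP p hp).1.pos)]; exact_mod_cast (hP p hp).1.pos
      have h4 := eig_row NN P γ g h1 h2 h3 (2*E) (fun n _ => by rw [row_eq P L hL]; linarith [om_card P n])
      nlinarith only [h4, mul_le_mul_of_nonneg_left hs1 (by linarith : 0 ≤ E), q3, q4]
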